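/- Let C be a smooth plane quartic curve defined over the real numbers (or any real closed field) whose set of real points in the projective plane consists of exactly 2 connected components (ovals). Then the following are equivalent: (1) C has exactly 4 real bitangent lines; (2) C is dividing, i.e., the real point set C(ℝ) disconnects the complex point set C(ℂ) into two connected components; (3) the two ovals are nested, i.e., one oval is contained in the disk bounded by the other. -/

import Mathlib

noncomputable section

open MvPolynomial

/-- The real projective plane `ℝP²`, as the projectivization of `ℝ³`. -/
abbrev RP2 : Type := Projectivization ℝ (Fin 3 → ℝ)

/-- The complex projective plane `ℂP²`, as the projectivization of `ℂ³`. -/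
abbrev CP2 : Type := Projectivization ℂ (Fin 3 → ℂ)

/-- The quotient topology on `ℝP²`. -/
instance : TopologicalSpace (Projectivization ℝ (Fin 3 → ℝ)) := by
  unfold Projectivization; infer_instance

/-- The quotient topology on `ℂP²`. -/
instance : TopologicalSpace (Projectivization ℂ (Fin 3 → ℂ)) := by
  unfold Projectivization; infer_instance

/-- The set of real points `C(ℝ) ⊆ ℝP²` of the plane curve defined by a homogeneous
polynomial `f ∈ ℝ[x₀,x₁,x₂]`. -/
def realLocus (f : MvPolynomial (Fin 3) ℝ) : Set RP2 :=
  {x | eval x.rep f = 0}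

/-- The set of complex points `C(ℂ) ⊆ ℂP²` of the plane curve defined by a homogeneous
polynomial `f ∈ ℝ[x₀,x₁,x₂]`. -/
def complexLocus (f : MvPolynomial (Fin 3) ℝ) : Set CP2 :=
  {x | eval x.rep (f.map (algebraMap ℝ ℂ)) = 0}

/-- The set of real points of the curve, viewed inside its complex point set in `ℂP²`:
the complex points admitting a representative vector with real coordinates. -/
def realPointsInCP2 (f : MvPolynomial (Fin 3) ℝ) : Set CP2 :=
  {x | x ∈ complexLocus f ∧
    ∃ (v : Fin 3 → ℝ) (hv : (fun i => (v i : ℂ)) ≠ 0), x = Projectivization.mk ℂ _ hv}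

/-- `f` defines a smooth plane quartic: `f` is homogeneous of degree 4 and its zero locus
is nonsingular, i.e. the complex gradient does not vanish at any nonzero complex zero
of `f`. -/
def IsSmoothQuartic (f : MvPolynomial (Fin 3) ℝ) : Prop :=
  f.IsHomogeneous 4 ∧
  ∀ z : Fin 3 → ℂ, z ≠ 0 → eval z (f.map (algebraMap ℝ ℂ)) = 0 →
    ∃ i : Fin 3, eval z (pderiv i (f.map (algebraMap ℝ ℂ))) ≠ 0

/-- The restriction of `f` to the line parametrized by the linear map `φ : ℝ² → ℝ³`:
the polynomial `f ∘ φ ∈ ℝ[y₀,y₁]`, obtained by substituting the coordinates of `φ` into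
`f`. -/
def restrictToLine (f : MvPolynomial (Fin 3) ℝ) (φ : (Fin 2 → ℝ) →ₗ[ℝ] (Fin 3 → ℝ)) :
    MvPolynomial (Fin 2) ℝ :=
  aeval (fun i : Fin 3 => ∑ j : Fin 2, C (φ (Pi.single j 1) i) * X j) f

/-- The (real) projective line corresponding to a 2-dimensional subspace `W ⊆ ℝ³` is a
*bitangent* of the curve `C = V(f)`: the restriction of `f` to the line is proportional to
the square of a (nonzero) quadratic form.  (Equivalently, the line is tangent to `C` at
two points, or at one point with intersection multiplicity 4.) -/
def IsRealBitangent (f : MvPolynomial (Fin 3) ℝ) (W : Submodule ℝ (Fin 3 → ℝ)) : Prop :=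
  Module.finrank ℝ W = 2 ∧
  ∃ φ : (Fin 2 → ℝ) →ₗ[ℝ] (Fin 3 → ℝ), LinearMap.range φ = W ∧
    ∃ (q : MvPolynomial (Fin 2) ℝ) (c : ℝ),
      q.IsHomogeneous 2 ∧ q ≠ 0 ∧ c ≠ 0 ∧ restrictToLine f φ = c • q ^ 2

/-- The oval (connected component of the real point set `C(ℝ) ⊆ ℝP²`) through a point
`x ∈ C(ℝ)`. -/
def ovalThrough (f : MvPolynomial (Fin 3) ℝ) (x : RP2) : Set RP2 :=
  connectedComponentIn (realLocus f) x

/-- `D` is the (open) disk bounded by the oval `O`: `D` is a connected component of the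
complement `ℝP² \ O` which is homeomorphic to an open disk. -/
def IsDiskBoundedBy (O D : Set RP2) : Prop :=
  (∃ y ∉ O, D = connectedComponentIn Oᶜ y) ∧
  Nonempty (↥D ≃ₜ ↥(Metric.ball (0 : EuclideanSpace ℝ (Fin 2)) 1))

/-- The oval `O₁` is nested inside the oval `O₂`: `O₁` is contained in the disk bounded
by `O₂`. -/
def NestedOvals (O₁ O₂ : Set RP2) : Prop :=
  ∃ D : Set RP2, IsDiskBoundedBy O₂ D ∧ O₁ ⊆ D

section
open Filter Topology
set_option linter.all false
local notation "ℛ" => Fin 3 → ℝ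
local notation "𝒞" => Fin 3 → ℂ
local notation "𝒫" => MvPolynomial (Fin 3) ℝ
theorem two_iff (S : Type*) [TopologicalSpace S] : Nat.card (ConnectedComponents S) = 2 ↔
    ∃ χ : S → Bool, Continuous χ ∧ Function.Surjective χ ∧
      ∀ φ : S → Bool, Continuous φ → ∀ x y, χ x = χ y → φ x = φ y := by
  constructor
  · intro h
    have : Finite (ConnectedComponents S) := Nat.finite_of_card_ne_zero (by omega)
    let e : ConnectedComponents S ≃ Bool := (Finite.card_eq.1 (by simp [h])).some
    refine ⟨fun x => e x, (continuous_of_discreteTopology ).comp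
      ConnectedComponents.continuous_coe,
      e.surjective.comp ConnectedComponents.surjective_coe, fun φ hφ x y hxy => ?_⟩
    have := e.injective hxy
    rw [← hφ.connectedComponentsLift_apply_coe, ← hφ.connectedComponentsLift_apply_coe, this]
  · rintro ⟨χ, hχ, hs, H⟩
    have hb : Function.Bijective hχ.connectedComponentsLift := by
      constructor
      · intro x y hxy
        obtain ⟨x, rfl⟩ := ConnectedComponents.surjective_coe x
        obtain ⟨y, rfl⟩ := ConnectedComponents.surjective_coe y
        simp at hxy
        have hc : IsPreconnected (χ ⁻¹' {χ x}) := by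
          rw [isPreconnected_iff_preconnectedSpace]
          refine preconnectedSpace_of_forall_constant fun g hg a b => ?_
          have hcl : IsClopen (χ ⁻¹' {χ x}) := (isClopen_discrete _).preimage hχ
          classical
          let φ := fun s => if h : s ∈ χ ⁻¹' {χ x} then g ⟨s, h⟩ else false
          have hφ : Continuous φ := by
            rw [continuous_iff_continuousAt]
            intro s
            by_cases h : s ∈ χ ⁻¹' {χ x}
            · have : ContinuousOn φ (χ ⁻¹' {χ x}) := by
                rw [continuousOn_iff_continuous_domRestrict]
                convert hg using 1
                ext1 t; exact dif_pos t.2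
              exact this.continuousAt (hcl.isOpen.mem_nhds h)
            · refine continuousAt_const (y := false) |>.congr ?_
              filter_upwards [hcl.compl.isOpen.mem_nhds h] with t ht
              simp only [φ]; rw [dif_neg ht]
          grind
        exact (ConnectedComponents.coe_eq_coe').2
          (hc.subset_connectedComponent (by simp [hxy]) (by simp))
      · intro b
        obtain ⟨x, rfl⟩ := hs b
        exact ⟨x, by simp⟩
    rw [Nat.card_eq_of_bijective _ hb]; simp
def InvOn {K : Type*} [NontriviallyNormedField K] (A : Set (Fin 3 → K)) (φ : (Fin 3 → K) → Bool) : Prop :=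
  ContinuousOn φ A ∧ ∀ t : K, t ≠ 0 → ∀ v, φ (t • v) = φ v
def TwoC {K : Type*} [NontriviallyNormedField K] (A : Set (Fin 3 → K)) : Prop :=
  ∃ χ, InvOn A χ ∧ (∀ b, ∃ a ∈ A, χ a = b) ∧
    ∀ φ, InvOn A φ → ∀ a ∈ A, ∀ b ∈ A, χ a = χ b → φ a = φ b
section
variable {K : Type*} [NontriviallyNormedField K]
abbrev prj (v : {v : Fin 3 → K // v ≠ 0}) : Projectivization K (Fin 3 → K) :=
  Projectivization.mk K v.1 v.2
theorem prj_open [TopologicalSpace (Projectivization K (Fin 3 → K))]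
    (hq : IsQuotientMap (prj (K := K))) : IsOpenQuotientMap (prj (K := K)) := by
  refine ⟨hq.surjective, hq.continuous, fun U hU => ?_⟩
  rw [← hq.isOpen_preimage]
  have : prj ⁻¹' (prj '' U) = ⋃ t : Kˣ, (fun v : {v : Fin 3 → K // v ≠ 0} =>
      (⟨t • v.1, by simpa [smul_eq_zero_iff_eq] using v.2⟩)) ⁻¹' U := by
    ext v
    simp only [Set.mem_preimage, Set.mem_image, Set.mem_iUnion, Projectivization.mk_eq_mk_iff]
    constructor
    · rintro ⟨u, hu, t, ht⟩
      exact ⟨t, by convert hu⟩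
    · rintro ⟨t, ht⟩
      exact ⟨_, ht, t, rfl⟩
  rw [this]
  refine isOpen_iUnion fun t => hU.preimage ?_
  fun_prop
theorem contOn_of_map {X Y Z : Type*} [TopologicalSpace X] [TopologicalSpace Y] [TopologicalSpace Z]
    {g : X → Y} {S : Set Y} {φ : Y → Z} (hS : S ⊆ Set.range g)
    (h : ∀ x, g x ∈ S → map g (𝓝[g ⁻¹' S] x) = 𝓝[S] (g x)) :
    ContinuousOn φ S ↔ ContinuousOn (φ ∘ g) (g ⁻¹' S) := by
  constructor
  · intro H x hx
    have := H (g x) hx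
    rw [ContinuousWithinAt, ← h x hx, tendsto_map'_iff] at this
    exact this
  · intro H y hy
    obtain ⟨x, rfl⟩ := hS hy
    rw [ContinuousWithinAt, ← h x hy, tendsto_map'_iff]
    exact H x hy
variable [TopologicalSpace (Projectivization K (Fin 3 → K))]
theorem contOn_prj (hq : IsQuotientMap (prj (K := K))) {Z : Type*} [TopologicalSpace Z]
    (S : Set (Projectivization K (Fin 3 → K))) (φ : Projectivization K (Fin 3 → K) → Z)
    (ψ : (Fin 3 → K) → Z) (h : ∀ v, (hv : v ≠ 0) → prj ⟨v, hv⟩ ∈ S → ψ v = φ (prj ⟨v, hv⟩)) :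
    ContinuousOn φ S ↔ ContinuousOn ψ {v | ∃ hv : v ≠ 0, prj ⟨v, hv⟩ ∈ S} := by
  rw [contOn_of_map (g := prj) (fun x _ => hq.surjective x), contOn_of_map (φ := ψ) (g := Subtype.val)]
  · have : (Subtype.val ⁻¹' {v | ∃ hv : v ≠ 0, prj ⟨v, hv⟩ ∈ S}) = (prj (K := K)) ⁻¹' S := by
      ext v; simp [v.2]
    rw [this]
    exact continuousOn_congr fun v hv => (h v.1 v.2 hv).symm
  · simp_all
  · intro x hx
    exact IsOpenEmbedding.map_nhdsWithin_preimage_eq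
      (isOpen_ne.isOpenEmbedding_subtypeVal) _ _
  · intro x hx
    rw [nhdsWithin, map_inf_principal_preimage, (prj_open hq).map_nhds_eq]; rfl
theorem prj_smul {t : K} (ht : t ≠ 0) {v : Fin 3 → K} (h : t • v ≠ 0) (hv : v ≠ 0) :
    prj ⟨t • v, h⟩ = prj ⟨v, hv⟩ := by
  simp only [Projectivization.mk_eq_mk_iff']
  exact ⟨t, rfl⟩
theorem two_prj (hq : IsQuotientMap (prj (K := K))) (S : Set (Projectivization K (Fin 3 → K))) :
    Nat.card (ConnectedComponents S) = 2 ↔ TwoC {v | ∃ hv : v ≠ 0, prj ⟨v, hv⟩ ∈ S} := by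
  classical
  rw [two_iff]
  let up : (S → Bool) → (Fin 3 → K) → Bool := fun φ v =>
    if h : ∃ hv : v ≠ 0, prj ⟨v, hv⟩ ∈ S then φ ⟨_, h.2⟩ else false
  let dn : ((Fin 3 → K) → Bool) → S → Bool := fun ψ s => ψ s.1.rep
  have hup1 : ∀ φ v, (hv : v ≠ 0) → (h : prj ⟨v, hv⟩ ∈ S) → up φ v = φ ⟨_, h⟩ :=
    fun φ v hv h => dif_pos ⟨hv, h⟩
  have hup : ∀ φ, Continuous φ → InvOn {v | ∃ hv : v ≠ 0, prj ⟨v, hv⟩ ∈ S} (up φ) := by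
    intro φ hφ
    constructor
    · refine (contOn_prj hq S (fun x => if h : x ∈ S then φ ⟨x, h⟩ else false) _ ?_).1 ?_
      · simp_all
      · rw [continuousOn_iff_continuous_domRestrict]
        simp_all
    · intro t ht v
      by_cases hv : v = 0
      · simp [hv]
      · have e := prj_smul ht (smul_ne_zero ht hv) hv
        by_cases h : prj ⟨v, hv⟩ ∈ S
        · simp_all
        · simp only [up]
          simp_all
  have hdn1 : ∀ ψ, InvOn {v | ∃ hv : v ≠ 0, prj ⟨v, hv⟩ ∈ S} ψ → ∀ v, (hv : v ≠ 0) →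
      (h : prj ⟨v, hv⟩ ∈ S) → dn ψ ⟨_, h⟩ = ψ v := by
    intro ψ hψ v hv h
    have : prj ⟨v, hv⟩ = prj ⟨_, (prj ⟨v, hv⟩).rep_nonzero⟩ := (Projectivization.mk_rep _).symm
    simp only [prj, Projectivization.mk_eq_mk_iff] at this
    obtain ⟨t, ht⟩ := this
    conv_rhs => rw [← ht]
    exact (hψ.2 t t.ne_zero _).symm
  have hdn : ∀ ψ, InvOn {v | ∃ hv : v ≠ 0, prj ⟨v, hv⟩ ∈ S} ψ → Continuous (dn ψ) := by
    intro ψ hψ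
    have := (contOn_prj hq S (fun x => ψ x.rep) ψ
      (fun v hv h => (hdn1 ψ hψ v hv h).symm)).2 hψ.1
    exact continuousOn_iff_continuous_domRestrict.1 this
  have hr : ∀ s : S, ∃ v, ∃ hv : v ≠ 0, ∃ h : prj ⟨v, hv⟩ ∈ S, s = ⟨prj ⟨v, hv⟩, h⟩ := by
    intro s
    have : prj ⟨_, s.1.rep_nonzero⟩ = s.1 := Projectivization.mk_rep _
    exact ⟨_, s.1.rep_nonzero, by rw [this]; exact s.2, by ext1; exact this.symm⟩
  constructor
  · rintro ⟨χ, hχ, hs, H⟩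
    refine ⟨up χ, hup χ hχ, fun b => ?_, fun φ hφ a ha b hb hab => ?_⟩
    · obtain ⟨s, rfl⟩ := hs b
      obtain ⟨v, hv, h, rfl⟩ := hr s
      exact ⟨v, ⟨hv, h⟩, hup1 χ v hv h⟩
    · have := H (dn φ) (hdn φ hφ) ⟨_, ha.2⟩ ⟨_, hb.2⟩ (by
        rwa [hup1 χ a ha.1 ha.2, hup1 χ b hb.1 hb.2] at hab)
      rwa [hdn1 φ hφ, hdn1 φ hφ] at this
  · rintro ⟨χ, hχ, hs, H⟩
    refine ⟨dn χ, hdn χ hχ, fun b => ?_, fun φ hφ s t hst => ?_⟩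
    · obtain ⟨v, ⟨hv, h⟩, rfl⟩ := hs b
      exact ⟨⟨_, h⟩, hdn1 χ hχ v hv h⟩
    · obtain ⟨v, hv, h, rfl⟩ := hr s
      obtain ⟨w, hw, h', rfl⟩ := hr t
      rw [hdn1 χ hχ, hdn1 χ hχ] at hst
      have := H (up φ) (hup φ hφ) v ⟨hv, h⟩ w ⟨hw, h'⟩ hst
      rwa [hup1 φ v hv h, hup1 φ w hw h'] at this
end
theorem qR : IsQuotientMap (prj (K := ℝ)) := isQuotientMap_quotient_mk'
theorem qC : IsQuotientMap (prj (K := ℂ)) := isQuotientMap_quotient_mk'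
abbrev ev (f : 𝒫) (z : 𝒞) : ℂ := eval z (f.map (algebraMap ℝ ℂ))
def rl (v : ℛ) : 𝒞 := fun i => (v i : ℂ)
section
variable {f : 𝒫}
theorem ev_rl (v : ℛ) : ev f (rl v) = ((eval v f : ℝ) : ℂ) := by
  simp
  exact (eval₂_comp_left (algebraMap ℝ ℂ) (RingHom.id ℝ) v f).symm
theorem ev_star (z : 𝒞) : ev f (star z) = star (ev f z) := by
  simp
  have := eval₂_comp_left (starRingEnd ℂ) (algebraMap ℝ ℂ) z f
  rw [show (starRingEnd ℂ).comp (algebraMap ℝ ℂ) = algebraMap ℝ ℂ by ext; simp] at this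
  exact this.symm
theorem hom_smul {R : Type*} [CommRing R] {n : ℕ} {p : MvPolynomial (Fin 3) R} (hp : p.IsHomogeneous n)
    (t : R) (z : Fin 3 → R) : eval (t • z) p = t ^ n * eval z p := by
  rw [eval_eq', eval_eq', Finset.mul_sum]
  refine Finset.sum_congr rfl fun d hd => ?_
  have hd4 : ∑ i, d i = n := by
    have := hp (mem_support_iff.1 hd)
    rw [← this, Finsupp.weight_apply, Finsupp.sum_fintype] <;> simp
  simp  [Pi.smul_apply, mul_pow, Finset.prod_mul_distrib, Finset.prod_pow_eq_pow_sum, hd4]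
  ring
theorem ev_smul (hf : f.IsHomogeneous 4) (t : ℂ) (z : 𝒞) : ev f (t • z) = t ^ 4 * ev f z :=
  hom_smul (hf.map _) t z
theorem eval_smul4 (hf : f.IsHomogeneous 4) (t : ℝ) (z : ℛ) :
    eval (t • z) f = t ^ 4 * eval z f := hom_smul hf t z
theorem eval_cont : Continuous (fun v => eval v f) := MvPolynomial.continuous_eval _
def lpo (f : 𝒫) (v m : 𝒞) : Polynomial ℂ :=
  aeval (fun i => Polynomial.C (v i) + Polynomial.C (m i) * Polynomial.X) f
theorem lpo_eval (v m : 𝒞) (t : ℂ) : (lpo f v m).eval t = ev f (v + t • m) := by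
  simp only [lpo, ev]
  induction f using MvPolynomial.induction_on with
  | C a => simp
  | add p q hp hq => simp [hp, hq]
  | mul_X p i hp => simp [hp]; left; ring
theorem lpo_coeff_cont (k : ℕ) :
    Continuous fun p : 𝒞 × 𝒞 => (lpo f p.1 p.2).coeff k := by
  simp  [lpo]
  induction f using MvPolynomial.induction_on generalizing k with
  | C a => simp; fun_prop
  | add p q hp hq => simp; exact (hp k).add (hq k)
  | mul_X p i hp =>
    simp  [map_mul, mul_add, ← mul_assoc]
    refine ((hp k).mul (by fun_prop)).add ?_
    cases k with
    | zero => simp; fun_prop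
    | succ k => simp; exact (hp k).mul (by fun_prop)
theorem lpo_deg (hf : f.IsHomogeneous 4) (v m : 𝒞) :
    (lpo f v m).natDegree ≤ 4 ∧ (lpo f v m).coeff 4 = ev f m := by
  have key : ∀ d ∈ f.support,
      (∏ i : Fin 3, (Polynomial.C (v i) + Polynomial.C (m i) * Polynomial.X) ^ d i).natDegree ≤ 4 ∧
      (∏ i : Fin 3, (Polynomial.C (v i) + Polynomial.C (m i) * Polynomial.X) ^ d i).coeff 4 =
        ∏ i, m i ^ d i := by
    intro d hd
    have hd4 : ∑ i, d i = 4 := by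
      have := hf (mem_support_iff.1 hd)
      rw [← this, Finsupp.weight_apply, Finsupp.sum_fintype] <;> simp
    have h1 : ∀ i, (Polynomial.C (v i) + Polynomial.C (m i) * Polynomial.X).natDegree ≤ 1 := by
      intro i; compute_degree
    have h2 : ∀ i (n : ℕ), ((Polynomial.C (v i) + Polynomial.C (m i) * Polynomial.X) ^ n).natDegree ≤ n ∧
        ((Polynomial.C (v i) + Polynomial.C (m i) * Polynomial.X) ^ n).coeff n = m i ^ n := by
      intro i n
      refine ⟨by simpa using Polynomial.natDegree_pow_le_of_le n (h1 i), ?_⟩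
      have := Polynomial.coeff_pow_of_natDegree_le (m := n) (h1 i)
      simpa using this
    rw [Fin.sum_univ_three] at hd4
    rw [Fin.prod_univ_three, Fin.prod_univ_three]
    have h3 := Polynomial.natDegree_mul_le_of_le (h2 0 (d 0)).1 (h2 1 (d 1)).1
    refine ⟨by simpa [hd4] using Polynomial.natDegree_mul_le_of_le h3 (h2 2 (d 2)).1, ?_⟩
    rw [← hd4, Polynomial.coeff_mul_add_eq_of_natDegree_le h3 (h2 2 (d 2)).1,
      Polynomial.coeff_mul_add_eq_of_natDegree_le (h2 0 (d 0)).1 (h2 1 (d 1)).1, (h2 0 _).2, (h2 1 _).2,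
      (h2 2 _).2]
  rw [lpo, aeval_def, eval₂_eq']
  constructor
  · refine Polynomial.natDegree_sum_le_of_forall_le _ _ fun d hd => ?_
    refine Polynomial.natDegree_C_mul_le _ _ |>.trans (key d hd).1
  · rw [Polynomial.finset_sum_coeff, ev, eval_map, eval₂_eq']
    refine Finset.sum_congr rfl fun d hd => ?_
    simp_all
attribute [irreducible] lpo
theorem quartic_roots (P : Polynomial ℂ) (hd : P.natDegree ≤ 4) (h : P.coeff 4 ≠ 0) :
    ∃ w : Fin 4 → ℂ, ∀ t, P.eval t = P.coeff 4 * ∏ i, (t - w i) := by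
  have hn := le_antisymm hd (Polynomial.le_natDegree_of_ne_zero h)
  have hs := IsAlgClosed.splits P
  have hc : P.roots.card = 4 := by rw [← hn]; exact hs.natDegree_eq_card_roots.symm
  have he := hs.eq_prod_roots
  obtain ⟨l, hl⟩ := Quot.exists_rep P.roots
  have hlen : l.length = 4 := by rw [← hc, ← hl]; simp
  refine ⟨fun i => l.get (i.cast hlen.symm), fun t => ?_⟩
  conv_lhs => rw [he]
  rw [Polynomial.leadingCoeff, hn, Polynomial.eval_C_mul, ← hl]
  match l, hlen with
  | [a, b, c, d], _ => simp [Fin.prod_univ_four, mul_assoc]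
theorem roots_perm {w w' : Fin 4 → ℂ} (h : ∀ t : ℂ, ∏ i, (t - w i) = ∏ i, (t - w' i)) :
    (Finset.univ.val.map w) = Finset.univ.val.map w' := by
  have : (Multiset.map (fun a => Polynomial.X - Polynomial.C a) (Finset.univ.val.map w)).prod =
      (Multiset.map (fun a => Polynomial.X - Polynomial.C a) (Finset.univ.val.map w')).prod := by
    refine Polynomial.funext fun t => ?_
    have := h t
    simp only [Multiset.map_map]
    change Polynomial.eval t (∏ i, _) = Polynomial.eval t (∏ i, _)
    simpa [Polynomial.eval_prod] using this
  rw [← Polynomial.roots_multiset_prod_X_sub_C (Finset.univ.val.map w), this,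
    Polynomial.roots_multiset_prod_X_sub_C]
theorem roots_count {w w' : Fin 4 → ℂ} (h : ∀ t : ℂ, ∏ i, (t - w i) = ∏ i, (t - w' i)) (p : ℂ → Bool) :
    (Finset.univ.filter (fun i => p (w i))).card = (Finset.univ.filter (fun i => p (w' i))).card := by
  have := congrArg (Multiset.countP (fun z => p z = true)) (roots_perm h)
  simp only [Multiset.countP_map] at this; exact this
theorem root_lim {T : Type*} (U : Ultrafilter T) (P : T → Polynomial ℂ) (P0 : Polynomial ℂ)
    (hd : ∀ t, (P t).natDegree ≤ 4) (hd0 : P0.natDegree ≤ 4)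
    (hk : ∀ k, Tendsto (fun t => (P t).coeff k) U (𝓝 (P0.coeff k))) (h0 : P0.coeff 4 ≠ 0)
    (w : T → Fin 4 → ℂ) (hw : ∀ t s, (P t).eval s = (P t).coeff 4 * ∏ i, (s - w t i)) :
    ∃ w0, Tendsto w U (𝓝 w0) ∧ ∀ s, P0.eval s = P0.coeff 4 * ∏ i, (s - w0 i) := by
  set B : Polynomial ℂ → ℝ := fun p => 1 + (‖p.coeff 0‖ + ‖p.coeff 1‖ + ‖p.coeff 2‖ + ‖p.coeff 3‖) / ‖p.coeff 4‖
  have hB : Tendsto (fun t => B (P t)) U (𝓝 (B P0)) := by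
    have := fun k => (hk k).norm
    exact (((((this 0).add (this 1)).add (this 2)).add (this 3)).div (this 4) (by simpa using h0)).const_add 1
  have hne := (hk 4).eventually_ne h0
  have hbd : ∀ᶠ t in U, w t ∈ Metric.closedBall 0 (B P0 + 1) := by
    filter_upwards [hne, hB.eventually_le_const (lt_add_one _)] with t ht hb
    rw [mem_closedBall_zero_iff, pi_norm_le_iff_of_nonneg]
    swap
    · have : 0 ≤ B P0 := by positivity
      linarith
    intro i
    by_contra! hlt
    have hB1 : 1 ≤ B (P t) := by linarith [show 0 ≤ (‖(P t).coeff 0‖ + ‖(P t).coeff 1‖ + ‖(P t).coeff 2‖ + ‖(P t).coeff 3‖) / ‖(P t).coeff 4‖ by positivity]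
    set s := w t i
    have hz : (P t).eval s = 0 := by
      rw [hw, Finset.prod_eq_zero (Finset.mem_univ i) (sub_self _), mul_zero]
    rw [Polynomial.eval_eq_sum_range' (Nat.lt_succ_of_le (hd t))] at hz
    simp only [Finset.sum_range_succ] at hz
    have h1 : 1 ≤ ‖s‖ := by linarith
    have e : (P t).coeff 4 * s ^ 4 = -((P t).coeff 0 * s ^ 0 + (P t).coeff 1 * s ^ 1 + (P t).coeff 2 * s ^ 2 + (P t).coeff 3 * s ^ 3) := by
      linear_combination hz
    have e2 := congrArg norm e
    rw [norm_neg, norm_mul, norm_pow] at e2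
    have e3 : ‖(P t).coeff 4‖ * ‖s‖ ^ 4 ≤ (‖(P t).coeff 0‖ + ‖(P t).coeff 1‖ + ‖(P t).coeff 2‖ + ‖(P t).coeff 3‖) * ‖s‖ ^ 3 := by
      rw [e2]
      refine (norm_add_le _ _).trans ?_
      refine (add_le_add ((norm_add_le _ _).trans (add_le_add (norm_add_le _ _) le_rfl)) le_rfl).trans ?_
      simp only [norm_mul, norm_pow, add_mul]
      gcongr <;> omega
    have hp : 0 < ‖(P t).coeff 4‖ := norm_pos_iff.2 ht
    have e4 : ‖(P t).coeff 4‖ * ‖s‖ ≤ (‖(P t).coeff 0‖ + ‖(P t).coeff 1‖ + ‖(P t).coeff 2‖ + ‖(P t).coeff 3‖) := by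
      have : 0 < ‖s‖ ^ 3 := by positivity
      nlinarith
    have : ‖s‖ ≤ (‖(P t).coeff 0‖ + ‖(P t).coeff 1‖ + ‖(P t).coeff 2‖ + ‖(P t).coeff 3‖) / ‖(P t).coeff 4‖ := by
      rw [le_div_iff₀ hp]; linarith
    linarith
  obtain ⟨w0, -, h⟩ := (isCompact_closedBall (0) (B P0 + 1)).ultrafilter_le_nhds (U.map w)
    (by rw [le_principal_iff]; exact hbd)
  have hw0 : Tendsto w U (𝓝 w0) := h
  refine ⟨w0, hw0, fun s => ?_⟩
  have h1 : Tendsto (fun t => (P t).eval s) U (𝓝 (P0.eval s)) := by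
    simp_rw [Polynomial.eval_eq_sum_range' (Nat.lt_succ_of_le (hd _)),
      Polynomial.eval_eq_sum_range' (Nat.lt_succ_of_le hd0)]
    exact tendsto_finsetSum _ fun k _ => (hk k).mul tendsto_const_nhds
  simp_rw [hw] at h1
  refine tendsto_nhds_unique h1 ((hk 4).mul ?_)
  exact tendsto_finsetProd _ fun i _ => tendsto_const_nhds.sub ((continuous_apply i).continuousAt.tendsto.comp hw0)
section
variable {f : 𝒫}
def IsRV (f : 𝒫) (v m : 𝒞) (w : Fin 4 → ℂ) : Prop :=
  ∀ t : ℂ, ev f (v + t • m) = ev f m * ∏ i, (t - w i)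
theorem exists_rv (hf : f.IsHomogeneous 4) (v : 𝒞) {m : 𝒞} (hm : ev f m ≠ 0) :
    ∃ w, IsRV f v m w := by
  have h := lpo_deg hf v m
  obtain ⟨w, hw⟩ := quartic_roots _ h.1 (by rwa [h.2])
  exact ⟨w, fun t => by rw [← lpo_eval, hw, h.2]⟩
theorem rv_zero {v m : 𝒞} {w} (h : IsRV f v m w) (i : Fin 4) : ev f (v + w i • m) = 0 := by
  rw [h, Finset.prod_eq_zero (Finset.mem_univ i) (sub_self _), mul_zero]
theorem rv_lim (hf : f.IsHomogeneous 4) {T : Type*} (U : Ultrafilter T) {v m : T → 𝒞} {v0 m0 : 𝒞}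
    (hv : Tendsto v U (𝓝 v0)) (hm : Tendsto m U (𝓝 m0)) (h0 : ev f m0 ≠ 0) {w : T → Fin 4 → ℂ}
    (hw : ∀ t, IsRV f (v t) (m t) (w t)) : ∃ w0, Tendsto w U (𝓝 w0) ∧ IsRV f v0 m0 w0 := by
  have hk : ∀ k, Tendsto (fun t => (lpo f (v t) (m t)).coeff k) U (𝓝 ((lpo f v0 m0).coeff k)) := fun k =>
    Tendsto.comp
       ((lpo_coeff_cont (f := f) k).tendsto (v0, m0)) (hv.prodMk_nhds hm)
  obtain ⟨w0, h1, h2⟩ := root_lim U (fun t => lpo f (v t) (m t)) (lpo f v0 m0) (fun t => (lpo_deg hf _ _).1)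
    (lpo_deg hf _ _).1 hk
    (by rwa [(lpo_deg hf _ _).2]) w (fun t s => by rw [lpo_eval, (lpo_deg hf _ _).2, hw t])
  exact ⟨w0, h1, fun s => by rw [← lpo_eval, h2, (lpo_deg hf _ _).2]⟩
theorem rv_perm {v m : 𝒞} {w w'} (hm : ev f m ≠ 0) (h : IsRV f v m w) (h' : IsRV f v m w') (t : ℂ) :
    ∏ i, (t - w i) = ∏ i, (t - w' i) := by
  have := (h t).symm.trans (h' t)
  exact mul_left_cancel₀ hm this
def cnt (χ : 𝒞 → Bool) (v m : 𝒞) (w : Fin 4 → ℂ) : ℕ :=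
  (Finset.univ.filter (fun i => χ (v + w i • m))).card
theorem cnt_eq {v m : 𝒞} {w w'} (hm : ev f m ≠ 0) (h : IsRV f v m w) (h' : IsRV f v m w')
    (χ : 𝒞 → Bool) : cnt χ v m w = cnt χ v m w' :=
  roots_count (rv_perm hm h h') (fun z => χ (v + z • m))
theorem cnt_const (hf : f.IsHomogeneous 4) {T : Type*} [TopologicalSpace T] [PreconnectedSpace T]
    {v m : T → 𝒞} (hv : Continuous v) (hm : Continuous m) (h0 : ∀ t, ev f (m t) ≠ 0)
    {S : Set 𝒞} {χ : 𝒞 → Bool} (hχ : ContinuousOn χ S)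
    (hS : ∀ t (s : ℂ), ev f (v t + s • m t) = 0 → v t + s • m t ∈ S)
    {w : T → Fin 4 → ℂ} (hw : ∀ t, IsRV f (v t) (m t) (w t)) (t t' : T) :
    cnt χ (v t) (m t) (w t) = cnt χ (v t') (m t') (w t') := by
  suffices h : IsLocallyConstant (fun t => cnt χ (v t) (m t) (w t)) from
    h.apply_eq_of_isPreconnected isPreconnected_univ trivial trivial
  rw [IsLocallyConstant.iff_eventually_eq]
  intro x
  by_contra hx
  rw [not_eventually] at hx
  haveI := frequently_iff_neBot.1 hx
  obtain ⟨U, hU⟩ := Ultrafilter.exists_le (𝓝 x ⊓ 𝓟 {y | ¬cnt χ (v y) (m y) (w y) = cnt χ (v x) (m x) (w x)})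
  rw [le_inf_iff, le_principal_iff] at hU
  obtain ⟨w0, h1, h2⟩ := rv_lim hf U (hv.continuousAt.tendsto.mono_left hU.1)
    (hm.continuousAt.tendsto.mono_left hU.1) (h0 x) hw
  have key : ∀ i, ∀ᶠ t in U, χ (v t + w t i • m t) = χ (v x + w0 i • m x) := by
    intro i
    have h3 : Tendsto (fun t => v t + w t i • m t) U (𝓝[S] (v x + w0 i • m x)) := by
      refine tendsto_nhdsWithin_iff.2 ⟨?_, Eventually.of_forall fun t => hS t _ (rv_zero (hw t) i)⟩
      exact (hv.continuousAt.tendsto.mono_left hU.1).add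
        (((continuous_apply i).continuousAt.tendsto.comp h1).smul (hm.continuousAt.tendsto.mono_left hU.1))
    have h4 := (hχ _ (hS x _ (rv_zero h2 i))).tendsto.comp h3
    simp_all
  have : ∀ᶠ t in (U : Filter T), False := by
    filter_upwards [eventually_all.2 key, hU.2] with t ht h
    refine h ?_
    rw [cnt_eq (h0 x) (hw x) h2]
    simp  [cnt, ht]
  exact U.neBot.ne (by simpa using this)
end
theorem hasDeriv {𝕜 : Type*} [NontriviallyNormedField 𝕜] (p : MvPolynomial (Fin 3) 𝕜) (z : Fin 3 → 𝕜) :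
    HasStrictFDerivAt (fun z => eval z p)
      (∑ i, eval z (pderiv i p) • ContinuousLinearMap.proj (R := 𝕜) (φ := fun _ : Fin 3 => 𝕜) i) z := by
  induction p using MvPolynomial.induction_on with
  | C a =>
    simp
    exact (hasStrictFDerivAt_const  a z).congr_fderiv (by ext; simp)
  | add p q hp hq =>
    simp
    exact (hp.add hq).congr_fderiv (by ext; simp [Finset.sum_add_distrib, add_mul])
  | mul_X p i hp =>
    have h1 : HasStrictFDerivAt (fun z : Fin 3 → 𝕜 => z i) (ContinuousLinearMap.proj   i) z :=
      (ContinuousLinearMap.proj (R := 𝕜) (φ := fun _ : Fin 3 => 𝕜) i).hasStrictFDerivAt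
    simp
    refine (hp.mul h1).congr_fderiv ?_
    ext h
    simp [add_mul, Finset.sum_add_distrib, Finset.mul_sum, mul_assoc, Pi.single_apply,
      apply_ite (eval z)]
section
variable {f : 𝒫}
def grc (f : 𝒫) (z : 𝒞) : 𝒞 := fun i => eval z (pderiv i (f.map (algebraMap ℝ ℂ)))
def gr (f : 𝒫) (v : ℛ) : ℛ := fun i => eval v (pderiv i f)
theorem grc_rl (v : ℛ) : grc f (rl v) = rl (gr f v) := by
  ext i
  simp only [grc, gr, rl, pderiv_map]
  exact ev_rl v
theorem euler {𝕜 : Type*} [CommRing 𝕜] {p : MvPolynomial (Fin 3) 𝕜} (hp : p.IsHomogeneous 4) (z : Fin 3 → 𝕜) :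
    ∑ i, z i * eval z (pderiv i p) = 4 * eval z p := by
  have := congrArg (eval z) hp.sum_X_mul_pderiv
  simpa using this
theorem gr_ne (hf : IsSmoothQuartic f) {v : ℛ} (hv : v ≠ 0) (h : eval v f = 0) : gr f v ≠ 0 := by
  intro h0
  have hv' : rl v ≠ 0 := fun h => hv (by ext i; have := congrFun h i; simpa [rl] using this)
  obtain ⟨i, hi⟩ := hf.2 (rl v) hv' (by have := ev_rl (f := f) v; rw [h] at this; simpa using this)
  refine hi ?_
  have := congrFun (grc_rl (f := f) v) i
  rw [h0] at this
  simpa [grc, rl] using this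
theorem gr_dot (hf : f.IsHomogeneous 4) {v : ℛ} (h : eval v f = 0) :
    v 0 * gr f v 0 + v 1 * gr f v 1 + v 2 * gr f v 2 = 0 := by
  have := euler hf v
  rw [h, Fin.sum_univ_three] at this
  simpa [gr] using this
def nn (z : 𝒞) : ℛ :=
  ![(z 1).re * (z 2).im - (z 2).re * (z 1).im, (z 2).re * (z 0).im - (z 0).re * (z 2).im,
    (z 0).re * (z 1).im - (z 1).re * (z 0).im]
theorem nn_smul (t : ℂ) (z : 𝒞) : nn (t • z) = Complex.normSq t • nn z := by
  ext i
  fin_cases i <;> simp [nn, Complex.normSq_apply] <;> ring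
theorem nn_star (z : 𝒞) : nn (star z) = - nn z := by
  ext i
  fin_cases i <;> simp [nn] <;> ring
theorem nn_rl (v : ℛ) : nn (rl v) = 0 := by
  ext i
  fin_cases i <;> simp [nn, rl]
theorem nn_cont : Continuous nn := by
  refine continuous_pi fun i => ?_
  fin_cases i <;> simp [nn] <;> fun_prop
theorem nn_eq_zero {z : 𝒞} (hz : z ≠ 0) (h : nn z = 0) : ∃ v : ℛ, ∃ t : ℂ, v ≠ 0 ∧ t ≠ 0 ∧ z = t • rl v := by
  obtain ⟨k, hk⟩ : ∃ k, z k ≠ 0 := by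
    by_contra! h0; exact hz (funext h0)
  have key : ∀ i, (z i).re * (z k).im = (z k).re * (z i).im := by
    have h0 := congrFun h 0
    have h1 := congrFun h 1
    have h2 := congrFun h 2
    simp [nn] at h0 h1 h2
    intro i
    fin_cases i <;> fin_cases k <;> simp <;> linarith
  have e : ∀ i, (((z i) / z k).re) * z k = z i := by
    intro i
    have him : (z i / z k).im = 0 := by
      rw [Complex.div_im, ← sub_div, div_eq_zero_iff]; left; linarith [key i]
    have : (((z i) / z k).re) = z i / z k := by
      apply Complex.ext <;> simp [him]
    rw [this, div_mul_cancel₀ _ hk]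
  refine ⟨fun i => (z i / z k).re, z k, fun h0 => ?_, hk, ?_⟩
  · have := e k; rw [show (z k / z k).re = 0 from congrFun h0 k] at this
    simp at this; exact hk this.symm
  · ext i; simp; rw [mul_comm]; exact (e i).symm
def KK (f : 𝒫) : Set ℛ := {v | v ≠ 0 ∧ eval v f = 0}
def XX (f : 𝒫) : Set 𝒞 := {z | ev f z = 0 ∧ nn z ≠ 0}
theorem mem_rl (hf : f.IsHomogeneous 4) {v : ℛ} (hv : v ≠ 0) :
    Projectivization.mk ℝ v hv ∈ realLocus f ↔ eval v f = 0 := by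
  obtain ⟨t, ht⟩ := Projectivization.exists_smul_eq_mk_rep ℝ v hv
  simp  [realLocus]
  rw [← ht, Units.smul_def, eval_smul4 hf]
  simp
theorem mem_cl (hf : f.IsHomogeneous 4) {v : 𝒞} (hv : v ≠ 0) :
    Projectivization.mk ℂ v hv ∈ complexLocus f ↔ ev f v = 0 := by
  obtain ⟨t, ht⟩ := Projectivization.exists_smul_eq_mk_rep ℂ v hv
  simp only [complexLocus, Set.mem_setOf_eq]
  rw [← ht, Units.smul_def]
  rw [show eval ((t : ℂ) • v) (f.map (algebraMap ℝ ℂ)) = _ from ev_smul hf _ _]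
  simp
theorem twoR (hf : f.IsHomogeneous 4) : Nat.card (ConnectedComponents ↥(realLocus f)) = 2 ↔ TwoC (KK f) := by
  rw [two_prj qR]
  have : {v | ∃ hv : v ≠ 0, prj ⟨v, hv⟩ ∈ realLocus f} = KK f := by
    ext v
    exact ⟨fun ⟨h, h'⟩ => ⟨h, (mem_rl hf h).1 h'⟩, fun ⟨h, h'⟩ => ⟨h, (mem_rl hf h).2 h'⟩⟩
  rw [this]
theorem nn_zero : nn 0 = 0 := by ext i; fin_cases i <;> simp [nn]
theorem twoX (hf : f.IsHomogeneous 4) :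
    Nat.card (ConnectedComponents ↥(complexLocus f \ realPointsInCP2 f)) = 2 ↔ TwoC (XX f) := by
  rw [two_prj qC]
  have : {v | ∃ hv : v ≠ 0, prj ⟨v, hv⟩ ∈ complexLocus f \ realPointsInCP2 f} = XX f := by
    ext z
    simp only [prj, XX, Set.mem_setOf_eq, realPointsInCP2, Set.mem_diff, not_and, not_exists]
    constructor
    · rintro ⟨hz, h, h'⟩
      refine ⟨(mem_cl hf hz).1 h, fun h0 => ?_⟩
      obtain ⟨v, t, hv, ht, rfl⟩ := nn_eq_zero hz h0
      refine h' h v (fun h => hz (by rw [show rl v = 0 from h, smul_zero])) ?_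
      rw [Projectivization.mk_eq_mk_iff']
      exact ⟨t, rfl⟩
    · rintro ⟨h, h'⟩
      have hz : z ≠ 0 := by rintro rfl; exact h' nn_zero
      refine ⟨hz, (mem_cl hf hz).2 h, fun _ v hv e => ?_⟩
      rw [Projectivization.mk_eq_mk_iff'] at e
      obtain ⟨t, rfl⟩ := e
      exact h' ((nn_smul _ _).trans (by rw [show (fun i => (v i : ℂ)) = rl v from rfl, nn_rl, smul_zero]))
  rw [this]
theorem restr_eval (φ : (Fin 2 → ℝ) →ₗ[ℝ] ℛ) (u : Fin 2 → ℝ) :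
    eval u (restrictToLine f φ) = eval (φ u) f := by
  have hφ : ∀ i, φ u i = φ (Pi.single 0 1) i * u 0 + φ (Pi.single 1 1) i * u 1 := by
    intro i
    have : u = u 0 • Pi.single 0 1 + u 1 • Pi.single 1 1 := by
      ext j; fin_cases j <;> simp
    conv_lhs => rw [this]
    simp; ring
  simp only [restrictToLine]
  induction f using MvPolynomial.induction_on with
  | C a => simp
  | add p q hp hq => rw [map_add, map_add, map_add, hp, hq]
  | mul_X p i hp => simp_all
theorem hom2_eval {q : MvPolynomial (Fin 2) ℝ} (hq : q.IsHomogeneous 2) :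
    ∃ a b d : ℝ, ∀ u, eval u q = a * u 0 ^ 2 + b * u 0 * u 1 + d * u 1 ^ 2 := by
  refine ⟨∑ m ∈ q.support, if m 1 = 0 then coeff m q else 0, ∑ m ∈ q.support, if m 1 = 1 then coeff m q else 0,
    ∑ m ∈ q.support, if m 1 = 2 then coeff m q else 0, fun u => ?_⟩
  rw [eval_eq', Finset.sum_mul, Finset.sum_mul, Finset.sum_mul, Finset.sum_mul, ← Finset.sum_add_distrib,
    ← Finset.sum_add_distrib]
  refine Finset.sum_congr rfl fun m hm => ?_
  have h2 : m 0 + m 1 = 2 := by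
    have := hq (mem_support_iff.1 hm)
    rw [Finsupp.weight_apply, Finsupp.sum_fintype _ _ (by simp)] at this
    simpa using this
  have : m 1 ≤ 2 := by omega
  rw [Fin.prod_univ_two]
  interval_cases h : m 1
  · rw [show m 0 = 2 by omega]; simp
  · rw [show m 0 = 1 by omega]; simp; ring
  · rw [show m 0 = 0 by omega]; simp
def Bit (f : 𝒫) (p m : ℛ) : Prop :=
  ∃ a b d e : ℝ, (a ≠ 0 ∨ b ≠ 0 ∨ d ≠ 0) ∧ e ≠ 0 ∧
    ∀ s t : ℝ, eval (s • p + t • m) f = e * (a * s ^ 2 + b * s * t + d * t ^ 2) ^ 2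
theorem bit_iff {p m : ℛ} (hpm : LinearIndependent ℝ ![p, m]) :
    IsRealBitangent f (Submodule.span ℝ {p, m}) ↔ Bit f p m := by
  have hr : Submodule.span ℝ {p, m} = Submodule.span ℝ (Set.range ![p, m]) := by
    simp [Set.pair_comm]
  constructor
  · rintro ⟨-, φ, hφ, q, c, hq, hq0, hc, h⟩
    obtain ⟨u, hu⟩ : p ∈ LinearMap.range φ := hφ ▸ Submodule.subset_span (by simp)
    obtain ⟨w, hw⟩ : m ∈ LinearMap.range φ := hφ ▸ Submodule.subset_span (by simp)
    obtain ⟨a, b, d, hab⟩ := hom2_eval hq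
    have huw : u 0 * w 1 - u 1 * w 0 ≠ 0 := by
      intro h0
      have h1 := LinearIndependent.pair_iff.1 hpm
      have e0 := h1 (w 0) (-u 0) (by rw [← hu, ← hw, ← map_smul, ← map_smul, ← map_add]; convert map_zero φ; ext i; fin_cases i <;> simp <;> linarith)
      have e1 := h1 (w 1) (-u 1) (by rw [← hu, ← hw, ← map_smul, ← map_smul, ← map_add]; convert map_zero φ; ext i; fin_cases i <;> simp <;> linarith)
      have hu0 : u = 0 := by ext i; fin_cases i <;> simp <;> linarith []
      have := hpm.ne_zero 0
      simp [← hu, hu0] at this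
    refine ⟨a * u 0 ^ 2 + b * u 0 * u 1 + d * u 1 ^ 2,
      2 * a * u 0 * w 0 + b * (u 0 * w 1 + u 1 * w 0) + 2 * d * u 1 * w 1,
      a * w 0 ^ 2 + b * w 0 * w 1 + d * w 1 ^ 2, c, ?_, hc, fun s t => ?_⟩
    · by_contra! h0
      obtain ⟨h1, h2, h3⟩ := h0
      refine hq0 (MvPolynomial.funext fun x => ?_)
      grind
    · rw [← hu, ← hw, ← map_smul, ← map_smul, ← map_add, ← restr_eval, h]
      simp only [smul_eval, map_pow, hab]
      simp only [Pi.add_apply, Pi.smul_apply]; ring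
  · rintro ⟨a, b, d, e, h1, he, h⟩
    refine ⟨by rw [hr, finrank_span_eq_card hpm]; simp, Fintype.linearCombination ℝ ![p, m], ?_,
      C a * X 0 ^ 2 + C b * X 0 * X 1 + C d * X 1 ^ 2, e, ?_, fun h0 => ?_, he, ?_⟩
    · simp_all
    · refine IsHomogeneous.add (IsHomogeneous.add ?_ ?_) ?_
      · exact ((isHomogeneous_C _ a).mul ((isHomogeneous_X _ 0).pow 2))
      · exact (((isHomogeneous_C _ b).mul (isHomogeneous_X _ 0)).mul (isHomogeneous_X _ 1))
      · exact ((isHomogeneous_C _ d).mul ((isHomogeneous_X _ 1).pow 2))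
    · have e1 := congrArg (eval ![1, 0]) h0
      have e2 := congrArg (eval ![0, 1]) h0
      have e3 := congrArg (eval ![1, 1]) h0
      simp at e1 e2 e3
      grind
    · refine MvPolynomial.funext fun u => ?_
      rw [restr_eval, Fintype.linearCombination_apply, Fin.sum_univ_two]
      simpa using h (u 0) (u 1)
open Matrix
def cg (f : 𝒫) (M : Matrix (Fin 3) (Fin 3) ℝ) (c : ℝ) : 𝒫 :=
  C c * aeval (fun i => ∑ j, C (M i j) * X j) f
theorem eval_cg (M c) (v : ℛ) : eval v (cg f M c) = c * eval (M *ᵥ v) f := by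
  rw [cg, map_mul, eval_C]
  congr 1
  induction f using MvPolynomial.induction_on with
  | C a => simp
  | add p q hp hq => rw [map_add, map_add, map_add, hp, hq]
  | mul_X p i hp => rw [map_mul, map_mul, map_mul, hp]; simp [Matrix.mulVec, dotProduct]
abbrev mc (M : Matrix (Fin 3) (Fin 3) ℝ) : Matrix (Fin 3) (Fin 3) ℂ := M.map Complex.ofReal
theorem ev_cg (M c) (z : 𝒞) : ev (cg f M c) z = c * ev f (mc M *ᵥ z) := by
  rw [ev, cg, map_mul, map_C, map_mul, eval_C]
  congr 1
  induction f using MvPolynomial.induction_on with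
  | C a => simp
  | add p q hp hq => simp_all
  | mul_X p i hp => simp at *; rw [hp]; simp [Matrix.mulVec, dotProduct]
theorem mc_inv {M N : Matrix (Fin 3) (Fin 3) ℝ} (h : M * N = 1) : mc M * mc N = 1 := by
  have := congrArg (fun A => A.map (Complex.ofRealHom)) h
  simp at this
  refine this.trans ?_
  simp
theorem cg_inv {M N : Matrix (Fin 3) (Fin 3) ℝ} (h : M * N = 1) {c : ℝ} (hc : c ≠ 0) :
    cg (cg f M c) N c⁻¹ = f := by
  refine MvPolynomial.funext fun v => ?_
  rw [eval_cg, eval_cg, Matrix.mulVec_mulVec, h, Matrix.one_mulVec, inv_mul_cancel_left₀ hc]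
theorem mul_ne {K : Type*} [Field K] {M N : Matrix (Fin 3) (Fin 3) K} (h : N * M = 1) {v : Fin 3 → K} (hv : v ≠ 0) : M *ᵥ v ≠ 0 := by
  intro h0
  apply hv
  rw [← Matrix.one_mulVec v, ← h, ← Matrix.mulVec_mulVec, h0, Matrix.mulVec_zero]
theorem cg_smooth {M N : Matrix (Fin 3) (Fin 3) ℝ} (h : N * M = 1) {c : ℝ} (hc : c ≠ 0) (hf : IsSmoothQuartic f) :
    IsSmoothQuartic (cg f M c) := by
  have h' : M * N = 1 := mul_eq_one_comm.1 h
  constructor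
  · rw [cg]
    have := (isHomogeneous_C (Fin 3) c).mul (hf.1.aeval (g := fun i => ∑ j, C (M i j) * X j) (n := 1)
      (fun i => IsHomogeneous.sum _ _ _ fun j _ => (isHomogeneous_C _ _).mul (isHomogeneous_X _ j)))
    simpa using this
  · intro z hz h0
    by_contra! hg
    have hc' : (c : ℂ) ≠ 0 := by exact_mod_cast hc
    have hw : ev f (mc M *ᵥ z) = 0 := by
      have := (ev_cg  M c z).symm.trans h0
      simpa [hc'] using this
    obtain ⟨i, hi⟩ := hf.2 _ (mul_ne (mc_inv h) hz) hw
    have d1 := hasDeriv ((cg f M c).map (algebraMap ℝ ℂ)) z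
    have d2 := (hasDeriv (f.map (algebraMap ℝ ℂ)) (mc M *ᵥ z))
    let L : 𝒞 →L[ℂ] 𝒞 := (Matrix.mulVecLin (mc M)).toContinuousLinearMap
    have d3 := (HasStrictFDerivAt.comp (f := L) z d2 L.hasStrictFDerivAt).const_mul (c)
    have e : (fun z => eval z ((cg f M c).map (algebraMap ℝ ℂ))) = fun z => (c) * ((fun z => eval z (f.map (algebraMap ℝ ℂ))) ∘ L) z := by
      ext z
      exact ev_cg M c z
    rw [e] at d1
    have := congrArg (fun A : 𝒞 →L[ℂ] ℂ => A (mc N *ᵥ Pi.single i 1)) (d1.hasFDerivAt.unique d3.hasFDerivAt)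
    simp only [hg] at this
    have hL : L (mc N *ᵥ Pi.single i 1) = Pi.single i 1 := by
      show mc M *ᵥ (mc N *ᵥ Pi.single i 1) = _
      rw [Matrix.mulVec_mulVec, mc_inv h', Matrix.one_mulVec]
    simp only [ContinuousLinearMap.smul_apply, ContinuousLinearMap.comp_apply, hL] at this
    simp [Pi.single_apply, hc'] at this
    exact hi this
theorem TwoC_lin {K : Type*} [NontriviallyNormedField K] {A B : Set (Fin 3 → K)} {M N : Matrix (Fin 3) (Fin 3) K}
    (h : M * N = 1) (hA : ∀ v, v ∈ B ↔ M *ᵥ v ∈ A) (hT : TwoC A) : TwoC B := by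
  have h' : N * M = 1 := mul_eq_one_comm.1 h
  have cM : ∀ M : Matrix (Fin 3) (Fin 3) K, Continuous fun v : Fin 3 → K => M *ᵥ v := fun M => by fun_prop
  obtain ⟨χ, hi, hs, hc⟩ := hT
  have key : ∀ a, M *ᵥ (N *ᵥ a) = a := fun a => by simp_all
  have key' : ∀ a, N *ᵥ (M *ᵥ a) = a := fun a => by simp_all
  refine ⟨fun v => χ (M *ᵥ v), ⟨hi.1.comp (cM M).continuousOn fun v hv => (hA v).1 hv, fun t ht v => ?_⟩, fun b => ?_, fun φ hφ a ha b hb hab => ?_⟩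
  · simp  [Matrix.mulVec_smul, hi.2 t ht]
  · obtain ⟨a, ha, hb⟩ := hs b
    exact ⟨N *ᵥ a, (hA _).2 (by rwa [key]), by simpa [key] using hb⟩
  · have := hc (fun v => φ (N *ᵥ v)) ⟨hφ.1.comp (cM N).continuousOn fun v hv => (hA _).2 (by rwa [key]), fun t ht v => by
      simp  [Matrix.mulVec_smul, hφ.2 t ht]⟩ _ ((hA a).1 ha) _ ((hA b).1 hb) hab
    simpa [key'] using this
theorem cg_KK {M N : Matrix (Fin 3) (Fin 3) ℝ} (h : N * M = 1) {c : ℝ} (hc : c ≠ 0) (hT : TwoC (KK f)) : TwoC (KK (cg f M c)) := by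
  refine TwoC_lin (mul_eq_one_comm.1 h) (fun v => ?_) hT
  simp only [KK, eval_cg, mul_eq_zero, hc, false_or]
  refine and_congr_left fun _ => ⟨fun hv => mul_ne h hv, fun hv h0 => hv (by rw [h0, Matrix.mulVec_zero])⟩
theorem nn_ne_iff (z : 𝒞) : nn z ≠ 0 ↔ z ≠ 0 ∧ ∀ (v : ℛ) (t : ℂ), z ≠ t • rl v := by
  constructor
  · refine fun h => ⟨fun h0 => h (by rw [h0, nn_zero]), fun v t h0 => h ?_⟩
    rw [h0, nn_smul, nn_rl, smul_zero]
  · intro h h0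
    obtain ⟨v, t, -, -, e⟩ := nn_eq_zero h.1 h0
    exact h.2 v t e
theorem mc_rl (M : Matrix (Fin 3) (Fin 3) ℝ) (v : ℛ) : mc M *ᵥ rl v = rl (M *ᵥ v) := by
  ext i; simp [Matrix.mulVec, dotProduct, rl]
theorem cg_XX {M N : Matrix (Fin 3) (Fin 3) ℝ} (h : N * M = 1) {c : ℝ} (hc : c ≠ 0) (hT : TwoC (XX f)) : TwoC (XX (cg f M c)) := by
  have h' : M * N = 1 := mul_eq_one_comm.1 h
  refine TwoC_lin (mc_inv h') (fun z => ?_) hT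
  have hc' : (c : ℂ) ≠ 0 := by exact_mod_cast hc
  simp only [XX, ev_cg, mul_eq_zero, hc', false_or]
  refine and_congr_right fun _ => ?_
  rw [nn_ne_iff, nn_ne_iff]
  refine and_congr ⟨fun hv => mul_ne (mc_inv h) hv, fun hv h0 => hv (by rw [h0, Matrix.mulVec_zero])⟩
    ⟨fun h1 v t e => h1 (N *ᵥ v) t ?_, fun h1 v t e => h1 (M *ᵥ v) t ?_⟩
  · rw [← mc_rl, ← Matrix.mulVec_smul, ← e, Matrix.mulVec_mulVec, mc_inv h, Matrix.one_mulVec]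
  · rw [← mc_rl, ← Matrix.mulVec_smul, ← e]
theorem cg_bit1 {M N : Matrix (Fin 3) (Fin 3) ℝ} (h : N * M = 1) {c : ℝ} (hc : c ≠ 0) {W : Submodule ℝ ℛ}
    (hW : IsRealBitangent (cg f M c) W) : IsRealBitangent f (W.map M.mulVecLin) := by
  obtain ⟨h1, φ, hφ, q, d, hq, hq0, hd, e⟩ := hW
  have inj : Function.Injective M.mulVecLin := fun a b hab => by
    have := congrArg (fun v => N *ᵥ v) hab
    simpa [h] using this
  refine ⟨by rw [← h1]; exact ((Submodule.equivMapOfInjective _ inj W).finrank_eq).symm, M.mulVecLin ∘ₗ φ, ?_, q, c⁻¹ * d, hq, hq0, by positivity, ?_⟩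
  · rw [LinearMap.range_comp, hφ]
  · refine MvPolynomial.funext fun u => ?_
    have := congrArg (eval u) e
    rw [restr_eval, eval_cg] at this
    rw [restr_eval, mul_smul, smul_eval, ← this]
    simp [hc]
def P1 (f : 𝒫) := Nat.card {W : Submodule ℝ ℛ // IsRealBitangent f W} = 4
theorem cg_P1 {M N : Matrix (Fin 3) (Fin 3) ℝ} (h : N * M = 1) {c : ℝ} (hc : c ≠ 0) : P1 (cg f M c) ↔ P1 f := by
  have h' : M * N = 1 := mul_eq_one_comm.1 h
  have hh : ∀ {M N : Matrix (Fin 3) (Fin 3) ℝ} (h : N * M = 1) (W : Submodule ℝ ℛ), (W.map M.mulVecLin).map N.mulVecLin = W := by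
    intro M N h W
    rw [← Submodule.map_comp, ← Matrix.mulVecLin_mul, h, Matrix.mulVecLin_one, Submodule.map_id]
  unfold P1
  rw [Nat.card_congr (⟨fun W => ⟨_, cg_bit1 h hc W.2⟩, fun W => ⟨W.1.map N.mulVecLin, cg_bit1   h' (inv_ne_zero hc) (by rw [cg_inv h' hc]; exact W.2)⟩,
    fun W => Subtype.ext (hh h _), fun W => Subtype.ext (hh h' _)⟩)]
def P3 (f : 𝒫) := ∃ x₁ ∈ realLocus f, ∃ x₂ ∈ realLocus f,
        ovalThrough f x₁ ≠ ovalThrough f x₂ ∧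
        NestedOvals (ovalThrough f x₁) (ovalThrough f x₂)
theorem rl_iff (hf : f.IsHomogeneous 4) (v : {v : ℛ // v ≠ 0}) : prj v ∈ realLocus f ↔ eval v.1 f = 0 := mem_rl hf v.2
def pH {M N : Matrix (Fin 3) (Fin 3) ℝ} (h : N * M = 1) : RP2 ≃ₜ RP2 := by
  have h' : M * N = 1 := mul_eq_one_comm.1 h
  have inj : ∀ {M N : Matrix (Fin 3) (Fin 3) ℝ} (h : N * M = 1), Function.Injective M.mulVecLin := fun {M N} h a b hab => by
    have := congrArg (fun v => N *ᵥ v) hab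
    simpa [h] using this
  have ct : ∀ {M N : Matrix (Fin 3) (Fin 3) ℝ} (h : N * M = 1), Continuous (Projectivization.map M.mulVecLin (inj h) : RP2 → RP2) := by
    intro M N h
    rw [qR.continuous_iff]
    have : (Projectivization.map M.mulVecLin (inj h) : RP2 → RP2) ∘ prj = prj ∘ fun v => ⟨M *ᵥ v.1, mul_ne h v.2⟩ := by
      rfl
    rw [this]
    refine qR.continuous.comp (Continuous.subtype_mk ?_ _)
    fun_prop
  have li : ∀ {M N : Matrix (Fin 3) (Fin 3) ℝ} (h : N * M = 1) (h' : M * N = 1) (x : RP2), Projectivization.map N.mulVecLin (inj h') (Projectivization.map M.mulVecLin (inj h) x) = x := by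
    intro M N h h' x
    induction x using Projectivization.ind with
    | h v hv =>
      rw [Projectivization.map_mk, Projectivization.map_mk]
      simp [h]
  exact { toFun := Projectivization.map M.mulVecLin (inj h), invFun := Projectivization.map N.mulVecLin (inj h'),
          left_inv := li h h', right_inv := li h' h, continuous_toFun := ct h, continuous_invFun := ct h' }
theorem cg_P3' {M N : Matrix (Fin 3) (Fin 3) ℝ} (h : N * M = 1) {c : ℝ} (hc : c ≠ 0) (hf : IsSmoothQuartic f) (hP : P3 (cg f M c)) : P3 f := by
  have hr : ∀ x, x ∈ realLocus (cg f M c) ↔ pH h x ∈ realLocus f := by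
    intro x
    induction x using Projectivization.ind with
    | h v hv =>
      refine (rl_iff (cg_smooth h hc hf).1 ⟨v, hv⟩).trans (Iff.trans ?_ (rl_iff hf.1 ⟨M *ᵥ v, mul_ne h hv⟩).symm)
      simp [eval_cg, hc]
  have hi : pH h '' realLocus (cg f M c) = realLocus f := by
    ext x
    rw [← (pH h).apply_symm_apply x, (pH h).injective.mem_set_image, hr]
  have ho : ∀ x ∈ realLocus (cg f M c), ovalThrough f (pH h x) = pH h '' ovalThrough (cg f M c) x := by
    intro x hx
    rw [ovalThrough, ovalThrough, ← hi, (pH h).image_connectedComponentIn hx]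
  obtain ⟨x, hx, y, hy, hne, D, ⟨⟨w, hw, hD⟩, ⟨e⟩⟩, hs⟩ := hP
  refine ⟨pH h x, (hr x).1 hx, pH h y, (hr y).1 hy, ?_, pH h '' D, ⟨⟨pH h w, ?_, ?_⟩, ⟨?_⟩⟩, ?_⟩
  · rw [ho x hx, ho y hy]
    exact fun e => hne ((pH h).injective.image_injective e)
  · simp_all
  · rw [ho y hy, ← Set.image_compl_eq (pH h).bijective, hD, (pH h).image_connectedComponentIn hw]
  · exact ((pH h).image D).symm.trans e
  grind
theorem cg_P3 {M N : Matrix (Fin 3) (Fin 3) ℝ} (h : N * M = 1) {c : ℝ} (hc : c ≠ 0) (hf : IsSmoothQuartic f) : P3 (cg f M c) ↔ P3 f := by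
  have h' : M * N = 1 := mul_eq_one_comm.1 h
  refine ⟨cg_P3' h hc hf, fun hP => cg_P3'   h' (inv_ne_zero hc) (cg_smooth h hc hf) ?_⟩
  rwa [cg_inv h' hc]
theorem cg_P2 {M N : Matrix (Fin 3) (Fin 3) ℝ} (h : N * M = 1) {c : ℝ} (hc : c ≠ 0) : TwoC (XX (cg f M c)) ↔ TwoC (XX f) := by
  have h' : M * N = 1 := mul_eq_one_comm.1 h
  refine ⟨fun hP => ?_, cg_XX h hc⟩
  have := cg_XX   h' (inv_ne_zero hc) hP
  rwa [cg_inv h' hc] at this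
theorem dec_cont {X : Type*} [TopologicalSpace X] {S : Set X} {g : X → ℝ} (hg : ContinuousOn g S) (h : ∀ x ∈ S, g x ≠ 0) :
    ContinuousOn (fun x => decide (0 < g x)) S := by
  intro x hx
  have hc := hg x hx
  refine tendsto_nhds_of_eventually_eq ?_ |>.mono_right le_rfl
  rcases lt_or_gt_of_ne (h x hx) with h0 | h0
  · filter_upwards [hc.eventually_lt continuousWithinAt_const h0] with y hy
    simp [not_lt.2 hy.le, not_lt.2 h0.le]
  · filter_upwards [continuousWithinAt_const.eventually_lt hc h0] with y hy
    simp [hy, h0]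
theorem exp_lift {h : ℝ × ℝ → ℂ} (hc : Continuous h) (h0 : ∀ x, h x ≠ 0) :
    ∃ l : ℝ × ℝ → ℂ, Continuous l ∧ ∀ x, Complex.exp (l x) = h x := by
  obtain ⟨F, ⟨-, hF⟩, -⟩ := Complex.isCoveringMap_exp.existsUnique_continuousMap_lifts
    (⟨fun x => ⟨h x, h0 x⟩, by fun_prop⟩) 0 (Complex.log (h 0)) (Subtype.ext (Complex.exp_log (h0 0)))
  exact ⟨F, F.continuous, fun x => congrArg Subtype.val (congrFun hF x)⟩
def PC {K : Type*} [NontriviallyNormedField K] (A : Set (Fin 3 → K)) : Prop :=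
  ∀ φ, InvOn A φ → ∀ a ∈ A, ∀ b ∈ A, φ a = φ b
theorem PC_int {A : Set ℛ} (hA : PC A) {g : ℛ → ℂ} (hg : ContinuousOn g A)
    (hi : ∀ t : ℝ, t ≠ 0 → ∀ v, g (t • v) = g v) (hk : ∀ v ∈ A, ∃ k : ℤ, g v = k * (2 * Real.pi * Complex.I)) :
    ∀ a ∈ A, ∀ b ∈ A, g a = g b := by
  intro a ha b hb
  obtain ⟨k, hk1⟩ := hk a ha
  have hpi := Real.pi_gt_three
  have him : ∀ k : ℤ, ((k) * (2 * Real.pi * Complex.I)).im = k * (2 * Real.pi) := by simp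
  have key : ∀ v ∈ A, ∀ j : ℤ, g v = j * (2 * Real.pi * Complex.I) →
      (0 < 1 - |(g v).im - (g a).im| ↔ j = k) ∧ 1 - |(g v).im - (g a).im| ≠ 0 := by
    intro v hv j hj
    rw [hj, hk1, him, him, ← sub_mul, abs_mul, abs_of_pos (by positivity : 0 < 2 * Real.pi)]
    rcases eq_or_ne j k with e | e
    · simp [e]
    · have : (1) ≤ |(j : ℝ) - k| := by
        have := Int.one_le_abs (sub_ne_zero.2 e)
        exact_mod_cast this
      refine ⟨⟨fun h => ?_, fun h => absurd h e⟩, ?_⟩ <;> nlinarith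
  have := hA (fun v => decide (0 < 1 - |(g v).im - (g a).im|)) ⟨dec_cont ?_ fun v hv => ?_, fun t ht v => by simp  [hi t ht]⟩ a ha b hb
  · grind
  · fun_prop
  grind
def nrm (v : ℛ) : ℝ := √(v 0 ^ 2 + v 1 ^ 2 + v 2 ^ 2)
theorem nrm_cont : Continuous nrm := by unfold nrm; fun_prop
theorem nrm_sq (v) : nrm v ^ 2 = v 0 ^ 2 + v 1 ^ 2 + v 2 ^ 2 := Real.sq_sqrt (by positivity)
theorem nrm_pos {v} (hv : v ≠ 0) : 0 < nrm v := by
  refine Real.sqrt_pos.2 ?_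
  by_contra h
  apply hv
  ext i; fin_cases i <;> simp <;> nlinarith
theorem nrm_smul (t : ℝ) (v) : nrm (t • v) = |t| * nrm v := by
  rw [nrm, nrm, ← Real.sqrt_sq_eq_abs, ← Real.sqrt_mul (sq_nonneg t)]
  simp; ring
theorem rp_lift {g : ℛ → ℂ} (hg : ContinuousOn g {0}ᶜ) (hi : ∀ t : ℝ, t ≠ 0 → ∀ v, g (t • v) = g v)
    (h0 : ∀ v, g v ≠ 0) : ∃ l : ℛ → ℂ, ContinuousOn l {0}ᶜ ∧ (∀ t : ℝ, t ≠ 0 → ∀ v, l (t • v) = l v) ∧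
      ∀ v, v ≠ 0 → Complex.exp (l v) = g v := by
  let e : ℝ × ℝ → ℛ := fun u => ![u.1, u.2, √(1 - (u.1 ^ 2 + u.2 ^ 2))]
  have ec : Continuous e := by
    fun_prop
  have e0 : ∀ u, e u ≠ 0 := by
    intro u h
    have h1 := congrFun h 0; have h2 := congrFun h 1; have h3 := congrFun h 2
    simp [e] at h1 h2 h3
    simp [h1, h2] at h3
  obtain ⟨ψ, ψc, hψ⟩ := exp_lift  (by
    rw [← continuousOn_univ]
    exact hg.comp ec.continuousOn fun u _ => e0 u) (fun _ => h0 _)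
  have hbd : ∀ u : ℝ × ℝ, u.1 ^ 2 + u.2 ^ 2 = 1 → ψ (-u) = ψ u := by
    let c := fun θ => (Real.cos θ, Real.sin θ)
    have cpi : ∀ θ, c (θ + Real.pi) = - c θ := by simp [c]
    have hint : ∀ θ, ∃ k : ℤ, ψ (-c θ) - ψ (c θ) = k * (2 * Real.pi * Complex.I) := by
      intro θ
      have : Complex.exp (ψ (- c θ)) = Complex.exp (ψ (c θ)) := by
        rw [hψ, hψ, ← hi (-1) (by norm_num) (e (c θ))]
        congr 1
        ext i; fin_cases i <;> simp [e, c]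
      obtain ⟨k, hk⟩ := Complex.exp_eq_exp_iff_exists_int.1 this
      exact ⟨k, by rw [hk]; ring⟩
    have hconst : ∀ θ θ', ψ (-c θ) - ψ (c θ) = ψ (-c θ') - ψ (c θ') := by
      choose k hk using hint
      have kc : Continuous k := by
        have h1 : Continuous fun θ => (k θ : ℝ) := by
          have : (fun θ => (k θ : ℝ)) = fun θ => (ψ (-c θ) - ψ (c θ)).im / (2 * Real.pi) := by
            ext θ; rw [hk]; simp
          rw [this]; fun_prop
        exact Int.isClosedEmbedding_coe_real.isEmbedding.continuous_iff.2 h1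
      intro θ θ'
      have := (IsPreconnected.constant isPreconnected_univ kc.continuousOn (Set.mem_univ θ) (Set.mem_univ θ'))
      rw [hk, hk, this]
    intro u hu
    obtain ⟨θ, hθ⟩ : ∃ θ, u = c θ := by
      have hz : ‖(⟨u.1, u.2⟩ : ℂ)‖ = 1 := by
        rw [← sq_eq_sq₀ (norm_nonneg _) zero_le_one, ← Complex.normSq_eq_norm_sq, Complex.normSq_mk]; linarith
      refine ⟨Complex.arg ⟨u.1, u.2⟩, ?_⟩
      have hne : (⟨u.1, u.2⟩ : ℂ) ≠ 0 := by rw [← norm_ne_zero_iff, hz]; norm_num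
      ext
      · simp [c, Complex.cos_arg hne, hz]
      · simp [c, Complex.sin_arg, hz]
    have := hconst θ (θ + Real.pi)
    rw [cpi, neg_neg] at this
    rw [hθ]
    linear_combination this / 2
  let r := fun v => (v 0 / nrm v, v 1 / nrm v)
  have rc : ContinuousOn r {0}ᶜ := by
    refine ContinuousOn.prodMk ?_ ?_ <;> refine ContinuousOn.div (by fun_prop) nrm_cont.continuousOn fun v hv => (nrm_pos hv).ne'
  have rn : ∀ v, v ≠ 0 → (r v).1 ^ 2 + (r v).2 ^ 2 = 1 - (v 2 / nrm v) ^ 2 := by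
    intro v hv
    have := nrm_pos hv; have h2 := nrm_sq v
    simp  [r]; field_simp; linarith
  refine ⟨fun v => if 0 ≤ v 2 then ψ (r v) else ψ (- r v), ?_, ?_, ?_⟩
  · rw [continuousOn_iff_continuous_domRestrict] at rc ⊢
    refine Continuous.if_le   (ψc.comp rc) (ψc.comp rc.neg) (by fun_prop) ((continuous_apply 2).comp continuous_subtype_val) ?_
    intro v hv
    refine (hbd _ ?_).symm
    rw [rn _ v.2, ← hv]; simp
  · intro t ht v
    rcases eq_or_ne v 0 with rfl | hv
    · simp
    have hr : ∀ t : ℝ, 0 < t → r (t • v) = r v := by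
      intro t ht
      simp only [r, nrm_smul, abs_of_pos ht]
      ext <;> simp <;> field_simp
    have hr' : ∀ t : ℝ, t < 0 → r (t • v) = - r v := by
      intro t ht
      have := ht.ne
      simp only [r, nrm_smul, abs_of_neg ht]
      ext <;> simp <;> field_simp
    rcases lt_or_gt_of_ne ht with h | h
    · simp only [hr' t h, neg_neg]
      rw [Pi.smul_apply, smul_eq_mul]
      rcases lt_trichotomy (v 2) 0 with h2 | h2 | h2
      · rw [if_pos (by nlinarith), if_neg (by linarith)]
      · simp  [h2]
        exact hbd _ (by rw [rn v hv, h2]; simp)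
      · rw [if_neg (by nlinarith), if_pos h2.le]
    simp_all
  · intro v hv
    have hp := nrm_pos hv
    have hs : ∀ s : ℝ, 0 ≤ s * v 2 → s ^ 2 = 1 → e (s • r v) = (s / nrm v) • v := by
      intro s hs h1
      ext i; fin_cases i
      · simp [e, r]; ring
      · simp [e, r]; ring
      · simp only [e, Prod.smul_fst, Prod.smul_snd, smul_eq_mul, mul_pow, h1, one_mul, rn v hv]
        have : (1 - (1 - (v 2 / nrm v) ^ 2)) = (s * v 2 / nrm v) ^ 2 := by field_simp; rw [h1]; ring
        simp [this, Real.sqrt_sq (div_nonneg hs hp.le)]; ring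
    beta_reduce
    split_ifs with h
    · have := hs 1 (by linarith) (by norm_num)
      rw [one_smul] at this
      rw [hψ, this, hi _ (by positivity)]
    · have := hs (-1) (by linarith) (by norm_num)
      rw [neg_one_smul] at this
      rw [hψ, this, hi _ (div_ne_zero (by norm_num) hp.ne')]
theorem not_both (hf : IsSmoothQuartic f) (h2 : TwoC (KK f)) : ¬ (PC {v | v ≠ 0 ∧ eval v f ≤ 0} ∧ PC {v | v ≠ 0 ∧ 0 ≤ eval v f}) := by
  rintro ⟨hA, hB⟩
  obtain ⟨χ, hχ, hs, -⟩ := h2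
  let R := fun b => {v | (v ∈ KK f ∧ χ v = b) ∧ nrm v = 1}
  have K1 : IsClosed {v | v ∈ KK f ∧ nrm v = 1} := by
    have : {v | v ∈ KK f ∧ nrm v = 1} = {v | eval v f = 0 ∧ nrm v = 1} := by
      ext v; refine ⟨fun h => ⟨h.1.2, h.2⟩, fun h => ⟨⟨?_, h.1⟩, h.2⟩⟩
      rintro rfl
      have := h.2; simp [nrm] at this
    rw [this]
    exact (isClosed_eq eval_cont continuous_const).inter (isClosed_eq nrm_cont continuous_const)
  have Rc : ∀ b, IsClosed (R b) := by
    intro b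
    have : R b = {v | v ∈ KK f ∧ nrm v = 1} ∩ χ ⁻¹' {b} := by ext v; simp [R]; tauto
    rw [this]
    exact (hχ.1.mono fun v hv => hv.1).preimage_isClosed_of_isClosed K1 (isClosed_discrete _)
  obtain ⟨h, h0, h1, -⟩ := exists_continuous_zero_one_of_isClosed (Rc false) (Rc true)
    (Set.disjoint_left.2 fun v hv hw => by simp [R] at hv hw; simp [hv.1.2] at hw)
  let lam := fun v => (h ((nrm v)⁻¹ • v) + h (-((nrm v)⁻¹ • v))) / 2
  have lc : ContinuousOn lam {0}ᶜ := by
    have : ContinuousOn (fun v => (nrm v)⁻¹ • v) {0}ᶜ := (nrm_cont.continuousOn.inv₀ fun v hv => (nrm_pos hv).ne').smul continuousOn_id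
    fun_prop
  have li : ∀ t : ℝ, t ≠ 0 → ∀ v, lam (t • v) = lam v := by
    intro t ht v
    simp only [lam, nrm_smul, smul_smul, mul_inv]
    rcases lt_or_gt_of_ne ht with h | h
    · rw [abs_of_neg h, show (-t)⁻¹ * (nrm v)⁻¹ * t = -(nrm v)⁻¹ by field_simp, neg_smul, neg_neg, add_comm]
    · rw [abs_of_pos h, show (t)⁻¹ * (nrm v)⁻¹ * t = (nrm v)⁻¹ by field_simp]
  have hmem : ∀ v ∈ KK f, ∀ s : ℝ, |s| = (nrm v)⁻¹ → s • v ∈ R (χ v) := by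
    intro v hv s hs
    have hp := nrm_pos hv.1
    have s0 : s ≠ 0 := by intro h; simp [h] at hs; exact hp.ne hs
    refine ⟨⟨⟨smul_ne_zero s0 hv.1, ?_⟩, hχ.2 s s0 v⟩, ?_⟩
    · rw [eval_smul4 hf.1, hv.2, mul_zero]
    · rw [nrm_smul, hs, inv_mul_cancel₀ hp.ne']
  have lv : ∀ v ∈ KK f, lam v = if χ v then 1 else 0 := by
    intro v hv
    have hp := nrm_pos hv.1
    have e1 := hmem v hv (nrm v)⁻¹ (abs_of_pos (by positivity))
    have e2 := hmem v hv (-(nrm v)⁻¹) (by rw [abs_neg, abs_of_pos (by positivity)])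
    rw [neg_smul] at e2
    simp  [lam]
    cases hb : χ v <;> rw [hb] at e1 e2
    · rw [h0 e1, h0 e2]; simp
    · rw [h1 e1, h1 e2]; simp
  let σ := fun v => Real.pi * lam v * Complex.I
  have σc : ContinuousOn (fun v => (Real.pi * lam v * Complex.I)) {0}ᶜ := by
    fun_prop
  have hexp : ∀ v ∈ KK f, Complex.exp (σ v) = Complex.exp (-σ v) := by
    intro v hv
    simp  [σ, lv v hv]
    split_ifs
    · simp
    · simp
  obtain ⟨l, lcc, lii, hl⟩ := rp_lift (g := fun v => if eval v f ≤ 0 then Complex.exp (σ v) else Complex.exp (-σ v)) (by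
      rw [continuousOn_iff_continuous_domRestrict] at σc ⊢
      refine Continuous.if_le   (Complex.continuous_exp.comp σc) (Complex.continuous_exp.comp σc.neg) (eval_cont.comp continuous_subtype_val) (by fun_prop) ?_
      intro v hv
      exact hexp v.1 ⟨v.2, hv⟩) (by
      intro t ht v
      simp  [eval_smul4 hf.1, σ, li t ht]
      have : (t ^ 4 * eval v f ≤ 0) ↔ (eval v f ≤ 0) := by
        have : 0 < t ^ 4 := by positivity
        constructor <;> intro h <;> nlinarith
      simp  [this]) (by intro v; split_ifs <;> exact Complex.exp_ne_zero _)
  have c1 := PC_int hA (g := fun v => l v - σ v) ((lcc.sub σc).mono fun v hv => hv.1) (fun t ht v => by simp  [lii t ht, σ, li t ht]) (by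
    intro v hv
    have := hl v hv.1
    rw [if_pos hv.2] at this
    obtain ⟨k, hk⟩ := Complex.exp_eq_exp_iff_exists_int.1 this
    exact ⟨k, by rw [hk]; ring⟩)
  have c2 := PC_int hB (g := fun v => l v + σ v) ((lcc.add σc).mono fun v hv => hv.1) (fun t ht v => by simp  [lii t ht, σ, li t ht]) (by
    intro v hv
    have := hl v hv.1
    have h3 : Complex.exp (l v) = Complex.exp (-σ v) := by
      rw [this]; split_ifs with h
      · exact hexp v ⟨hv.1, le_antisymm h hv.2⟩
      · rfl
    obtain ⟨k, hk⟩ := Complex.exp_eq_exp_iff_exists_int.1 h3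
    exact ⟨k, by rw [hk]; ring⟩)
  obtain ⟨p, hp, hp1⟩ := hs false
  obtain ⟨q, hq, hq1⟩ := hs true
  have e1 := c1 p ⟨hp.1, hp.2.le⟩ q ⟨hq.1, hq.2.le⟩
  have e2 := c2 p ⟨hp.1, hp.2.ge⟩ q ⟨hq.1, hq.2.ge⟩
  simp only [σ, lv p hp, lv q hq, hp1, hq1] at e1 e2
  simp at e1 e2
  have : (Real.pi) * Complex.I = 0 := by linear_combination (e1 - e2) / 2
  simp at this
def NP (f : 𝒫) : Set ℛ := {v | v ≠ 0 ∧ eval v f ≤ 0}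
theorem bool_ev {X : Type*} [TopologicalSpace X] {S : Set X} {φ : X → Bool} (h : ContinuousOn φ S) {x} (hx : x ∈ S) :
    ∀ᶠ y in 𝓝 x, y ∈ S → φ y = φ x := by
  have := (h x hx) (mem_nhds_discrete.2 (Set.mem_singleton (φ x)))
  exact eventually_nhdsWithin_iff.1 this
theorem meets {φ} (hφ : InvOn (NP f) φ) {a b} (ha : a ∈ NP f) (hb : b ∈ NP f) (hab : φ a ≠ φ b) :
    ∃ x ∈ KK f, φ x = φ a := by
  by_contra! hcon
  have h1 : ∀ v ∈ NP f, φ v = φ a → eval v f < 0 := fun v hv h => lt_of_le_of_ne hv.2 fun h0 => hcon v ⟨hv.1, h0⟩ h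
  have hV : IsPreconnected ({0}ᶜ : Set ℛ) := (isConnected_compl_singleton_of_one_lt_rank (by simp) 0).isPreconnected
  have hc : ContinuousOn (fun v => decide (eval v f < 0 ∧ φ v = φ a)) ({0}ᶜ) := by
    intro v hv
    have hev : ∀ᶠ y in 𝓝 v, y ≠ 0 := isOpen_ne.mem_nhds hv
    refine ContinuousAt.continuousWithinAt (tendsto_nhds_of_eventually_eq ?_)
    rcases lt_trichotomy (eval v f) 0 with h | h | h
    · filter_upwards [hev, bool_ev hφ.1  ⟨hv, h.le⟩, eval_cont.continuousAt.eventually_lt continuousAt_const h] with y h1 h2 h3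
      simp [h, h3, h2 ⟨h1, h3.le⟩]
    · have hn : φ v ≠ φ a := fun e => (h1 v ⟨hv, h.le⟩ e).ne h
      filter_upwards [hev, bool_ev hφ.1  ⟨hv, h.le⟩] with y h1 h2
      simp  [h]
      intro h3
      rwa [h2 ⟨h1, h3.le⟩]
    · filter_upwards [continuousAt_const.eventually_lt eval_cont.continuousAt h] with y h1
      simp [h1.not_gt, h.not_gt]
  have := hV.constant hc ha.1 hb.1
  simp [h1 a ha rfl, Ne.symm hab] at this
structure Spl (f : 𝒫) (φ : ℛ → Bool) : Prop where
  inv : InvOn (NP f) φ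
  pc : ∀ b, PC {v | v ∈ NP f ∧ φ v = b}
  neg : ∀ b, ∃ v, v ≠ 0 ∧ eval v f < 0 ∧ φ v = b
theorem der_line (p : 𝒫) (x n : ℛ) :
    HasDerivAt (fun t : ℝ => eval (x + t • n) p) (∑ i, gr p x i * n i) 0 := by
  have h := (hasDeriv p (x + (0:ℝ) • n)).hasFDerivAt.comp_hasDerivAt (0) (((hasDerivAt_id (0:ℝ)).smul_const n).const_add x)
  refine h.congr_deriv ?_
  simp [gr]
theorem spl_exists (hf : IsSmoothQuartic f) (h2 : TwoC (KK f)) (hn : ¬ PC (NP f)) : ∃ φ, Spl f φ := by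
  unfold PC at hn
  push Not at hn
  obtain ⟨φ, hφ, a, ha, b, hb, hab⟩ := hn
  have hKN : ∀ v ∈ KK f, v ∈ NP f := fun v hv => ⟨hv.1, hv.2.le⟩
  have hm : ∀ c, ∃ x ∈ KK f, φ x = c := by
    intro c
    rcases Bool.eq_or_eq_not c (φ a) with e | e
    · rw [e]; exact meets hφ ha hb hab
    · have : c = φ b := by rw [e]; revert hab; cases φ a <;> cases φ b <;> simp
      rw [this]; exact meets hφ hb ha hab.symm
  obtain ⟨χ, hχ, hs, hd⟩ := h2
  refine ⟨φ, hφ, ?_, ?_⟩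
  · intro c ψ hψ u hu v hv
    by_contra huv
    obtain ⟨z, hz, hzc⟩ := hm (!c)
    have hΨ : ∀ d, InvOn (NP f) (fun w => (φ w == c) && (ψ w == d)) := by
      intro d
      refine ⟨?_, fun t ht w => by simp  [hφ.2 t ht, hψ.2 t ht]⟩
      intro w hw
      refine tendsto_nhds_of_eventually_eq ?_
      have e1 := eventually_nhdsWithin_iff.2 (bool_ev hφ.1 hw)
      by_cases h : φ w = c
      · have e2 := bool_ev hψ.1  ⟨hw, h⟩
        filter_upwards [e1, nhdsWithin_le_nhds e2, self_mem_nhdsWithin] with y h1 h2 h3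
        rw [h1, h2 ⟨h3, by rw [h1, h]⟩]
      · filter_upwards [e1] with y h1
        grind
    have key : ∀ u v, (u ∈ NP f ∧ φ u = c) → (v ∈ NP f ∧ φ v = c) → ψ u ≠ ψ v → ∃ x ∈ KK f, φ x = c ∧ ψ x = ψ u := by
      intro u v hu hv h
      obtain ⟨x, hx, h3⟩ := meets (hΨ (ψ u)) hu.1 hv.1 (by simp [hu.2, h.symm])
      simp [hu.2] at h3
      exact ⟨x, hx, h3⟩
    obtain ⟨x, hx, hx1, hx2⟩ := key u v hu hv huv
    obtain ⟨y, hy, hy1, hy2⟩ := key v u hv hu (Ne.symm huv)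
    have hK := hd φ ⟨hφ.1.mono hKN, hφ.2⟩
    have e : χ x = χ y := by
      have n1 : χ z ≠ χ x := fun e => by have := hK z hz x hx e; simp [hzc, hx1] at this
      have n2 : χ z ≠ χ y := fun e => by have := hK z hz y hy e; simp [hzc, hy1] at this
      revert n1 n2; cases χ x <;> cases χ y <;> cases χ z <;> simp
    have := hd _ ⟨(hΨ (ψ u)).1.mono hKN, (hΨ (ψ u)).2⟩ x hx y hy e
    grind
  · intro c
    obtain ⟨x, hx, hxc⟩ := hm c
    have hg := gr_ne hf hx.1 hx.2
    have hd := der_line f x (gr f x)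
    have hpos : 0 < ∑ i, gr f x i * gr f x i := by
      refine lt_of_le_of_ne (Finset.sum_nonneg fun i _ => mul_self_nonneg _) fun h => hg ?_
      rw [eq_comm, Finset.sum_eq_zero_iff_of_nonneg fun i _ => mul_self_nonneg _] at h
      ext i; simpa using h i (Finset.mem_univ i)
    have h1 : ∀ᶠ t in 𝓝[<] (0:ℝ), eval (x + t • gr f x) f < 0 := by
      have := (hasDerivAt_iff_tendsto_slope.1 hd).eventually_const_lt hpos
      have := this.filter_mono (nhdsWithin_mono (0:ℝ) (fun t (ht : t < 0) => ht.ne))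
      filter_upwards [this, self_mem_nhdsWithin] with t ht h0
      simp  [slope_def_field, hx.2] at ht
      have h0' : t < 0 := h0
      by_contra h
      exact absurd ht (not_lt.2 (div_nonpos_of_nonneg_of_nonpos (not_lt.1 h) h0'.le))
    have hcont : Tendsto (fun t : ℝ => x + t • gr f x) (𝓝[<] 0) (𝓝 x) := by
      have : Continuous (fun t : ℝ => x + t • gr f x) := by fun_prop
      have := this.tendsto 0
      simp at this
      exact this.mono_left nhdsWithin_le_nhds
    have h3 := hcont.eventually (bool_ev hφ.1 (hKN x hx))
    have h4 := hcont.eventually (isOpen_ne.mem_nhds hx.1)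
    obtain ⟨t, e1, e2, e3⟩ := (h1.and (h3.and h4)).exists
    exact ⟨_, e3, e1, by rw [e2 ⟨e3, e1.le⟩, hxc]⟩
theorem line_poly (hf : f.IsHomogeneous 4) (v m : ℛ) : ∃ P : Polynomial ℝ, P.natDegree ≤ 4 ∧ P.coeff 4 = eval m f ∧
    ∀ t, P.eval t = eval (v + t • m) f := by
  let P : Polynomial ℝ := f.eval₂ Polynomial.C (fun i => Polynomial.C (v i) + Polynomial.X * Polynomial.C (m i))
  have hP : ∀ t, P.eval t = eval (v + t • m) f := by
    intro t
    rw [← Polynomial.coe_evalRingHom, MvPolynomial.hom_eval₂]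
    have : (Polynomial.evalRingHom t).comp Polynomial.C = RingHom.id ℝ := by ext; simp
    congr 2
    ext i; simp; ring
  have hmap : P.map (algebraMap ℝ ℂ) = lpo f (rl v) (rl m) := by
    refine Polynomial.eq_of_infinite_eval_eq _ _ ((Set.infinite_range_of_injective Complex.ofReal_injective).mono ?_)
    rintro _ ⟨t, rfl⟩
    simp only [Set.mem_setOf_eq, lpo_eval]
    rw [Polynomial.eval_map, show (t) = algebraMap ℝ ℂ t from rfl, Polynomial.eval₂_at_apply, hP]
    have : rl v + (algebraMap ℝ ℂ t) • rl m = rl (v + t • m) := by ext i; simp [rl]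
    rw [this, ev_rl]; rfl
  have hd := lpo_deg hf (rl v) (rl m)
  refine ⟨P, ?_, ?_, hP⟩
  · have := hd.1
    rwa [← hmap, Polynomial.natDegree_map] at this
  · have := hd.2
    rw [← hmap, Polynomial.coeff_map, ev_rl] at this
    exact Complex.ofReal_injective this
theorem pos_far (hf : f.IsHomogeneous 4) (v : ℛ) {m} (hm : 0 < eval m f) (B : ℝ) :
    (∃ t < B, 0 < eval (v + t • m) f) ∧ ∃ t > B, 0 < eval (v + t • m) f := by
  have hc : ContinuousAt (fun s : ℝ => eval (m + s • v) f) 0 := (eval_cont.comp (by fun_prop)).continuousAt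
  have hev : ∀ᶠ s in 𝓝 (0:ℝ), 0 < eval (m + s • v) f := by
    refine hc.eventually_const_lt ?_
    simpa using hm
  have key : ∀ t : ℝ, t ≠ 0 → 0 < eval (m + t⁻¹ • v) f → 0 < eval (v + t • m) f := by
    intro t ht h
    have : v + t • m = t • (m + t⁻¹ • v) := by rw [smul_add, smul_smul, mul_inv_cancel₀ ht, one_smul, add_comm]
    rw [this, eval_smul4 hf]; positivity
  constructor
  · have h1 := tendsto_inv_atBot_zero.eventually hev
    obtain ⟨t, h1, h2, h3⟩ := (h1.and ((eventually_lt_atBot B).and (eventually_lt_atBot 0))).exists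
    exact ⟨t, h2, key t h3.ne h1⟩
  · have h1 := tendsto_inv_atTop_zero.eventually hev
    obtain ⟨t, h1, h2, h3⟩ := (h1.and ((eventually_gt_atTop B).and (eventually_gt_atTop 0))).exists
    exact ⟨t, h2, key t h3.ne' h1⟩
theorem poly_ivt (P : Polynomial ℝ) {x y : ℝ} (h : x < y) (hP : P.eval x * P.eval y < 0) : ∃ z, x < z ∧ z < y ∧ P.eval z = 0 := by
  rcases mul_neg_iff.1 hP with ⟨h1, h2⟩ | ⟨h1, h2⟩
  · obtain ⟨z, hz, e⟩ := intermediate_value_Ioo' h.le P.continuous.continuousOn ⟨h2, h1⟩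
    exact ⟨z, hz.1, hz.2, e⟩
  · obtain ⟨z, hz, e⟩ := intermediate_value_Ioo h.le P.continuous.continuousOn ⟨h1, h2⟩
    exact ⟨z, hz.1, hz.2, e⟩
theorem six (hf : f.IsHomogeneous 4) {v m : ℛ} (hm : 0 < eval m f) {t1 a t2 b t3 : ℝ} (h1 : t1 < a) (h2 : a < t2)
    (h3 : t2 < b) (h4 : b < t3) (e1 : eval (v + t1 • m) f ≤ 0) (e2 : eval (v + t2 • m) f ≤ 0) (e3 : eval (v + t3 • m) f ≤ 0)
    (ea : 0 < eval (v + a • m) f) (eb : 0 < eval (v + b • m) f) : False := by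
  obtain ⟨P, hd, -, hP⟩ := line_poly hf v m
  obtain ⟨⟨t0, h0, e0⟩, -⟩ := pos_far hf v hm t1
  simp only [← hP] at *
  obtain ⟨ε, hε, g1, g2, g3⟩ : ∃ ε > 0, ε < P.eval t0 ∧ ε < P.eval a ∧ ε < P.eval b := by
    refine ⟨min (P.eval t0) (min (P.eval a) (P.eval b)) / 2, by positivity, ?_, ?_, ?_⟩
    all_goals
      grind
  let Q := P - Polynomial.C ε
  have hQ : ∀ t, Q.eval t = P.eval t - ε := fun t => by simp [Q]
  obtain ⟨r1, a1, b1, c1⟩ := poly_ivt Q h0 (by rw [hQ, hQ]; nlinarith)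
  obtain ⟨r2, a2, b2, c2⟩ := poly_ivt Q h1 (by rw [hQ, hQ]; nlinarith)
  obtain ⟨r3, a3, b3, c3⟩ := poly_ivt Q h2 (by rw [hQ, hQ]; nlinarith)
  obtain ⟨r4, a4, b4, c4⟩ := poly_ivt Q h3 (by rw [hQ, hQ]; nlinarith)
  obtain ⟨r5, a5, b5, c5⟩ := poly_ivt Q h4 (by rw [hQ, hQ]; nlinarith)
  have hinj : Function.Injective ![r1, r2, r3, r4, r5] := by
    refine StrictMono.injective (Fin.strictMono_iff_lt_succ.2 fun i => ?_)
    fin_cases i <;> simp <;> linarith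
  have := Polynomial.eq_zero_of_natDegree_lt_card_of_eval_eq_zero Q hinj (fun i => by fin_cases i <;> simpa) (by
    have : Q.natDegree ≤ 4 := (Polynomial.natDegree_sub_le _ _).trans (by simp [hd])
    simp; omega)
  have h := hQ t1
  rw [this] at h; simp at h; linarith
theorem li_ne {u v : ℛ} (h : LinearIndependent ℝ ![u, v]) {a b : ℝ} (hab : a ≠ 0 ∨ b ≠ 0) : a • u + b • v ≠ 0 := by
  intro h0
  have := LinearIndependent.pair_iff.1 h a b h0
  tauto
theorem sepS {φ} (hφ : InvOn (NP f) φ) {u v : ℛ} (hu : u ∈ NP f) (hl : LinearIndependent ℝ ![u, v])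
    (hv : v ∈ NP f → φ v ≠ φ u) : ∃ s : ℝ, 0 < s ∧ s < 1 ∧ 0 < eval ((1 - s) • u + s • v) f := by
  by_contra! hcon
  have hc : Continuous fun s : ℝ => (1 - s) • u + s • v := by fun_prop
  have hcl : IsClosed {s : ℝ | eval ((1 - s) • u + s • v) f ≤ 0} := isClosed_le (eval_cont.comp hc) continuous_const
  have h1 : Set.Icc (0) 1 ⊆ {s : ℝ | eval ((1 - s) • u + s • v) f ≤ 0} := by
    rw [← closure_Ioo (zero_ne_one)]
    exact hcl.closure_subset_iff.2 fun s hs => hcon s hs.1 hs.2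
  have h2 : ∀ s ∈ Set.Icc (0:ℝ) 1, (1 - s) • u + s • v ∈ NP f := fun s hs => ⟨li_ne hl (by
    by_contra! h; linarith []), h1 hs⟩
  have := isPreconnected_Icc.constant (hφ.1.comp hc.continuousOn h2) (Set.left_mem_Icc.2 zero_le_one) (Set.right_mem_Icc.2 zero_le_one)
  simp at this
  refine hv ?_ this.symm
  have := h2 1 (Set.right_mem_Icc.2 zero_le_one)
  simpa using this
theorem li_line {x m : ℛ} (hl : LinearIndependent ℝ ![x, m]) {a b c d : ℝ} (h : a * d - b * c ≠ 0) :
    LinearIndependent ℝ ![a • x + b • m, c • x + d • m] := by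
  rw [LinearIndependent.pair_iff] at hl ⊢
  intro s t hst
  obtain ⟨h1, h2⟩ := hl (s * a + t * c) (s * b + t * d) (by rw [← hst]; module)
  grind
theorem six' (hf : f.IsHomogeneous 4) {φ} (hφ : InvOn (NP f) φ) {x m : ℛ} (hl : LinearIndependent ℝ ![x, m]) (hm : 0 < eval m f)
    {t1 t2 t3 : ℝ} (h1 : t1 < t2) (h2 : t2 < t3) (e1 : x + t1 • m ∈ NP f) (e2 : x + t2 • m ∈ NP f) (e3 : x + t3 • m ∈ NP f)
    (n1 : φ (x + t1 • m) ≠ φ (x + t2 • m)) (n2 : φ (x + t3 • m) ≠ φ (x + t2 • m)) : False := by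
  have key : ∀ t t' : ℝ, t < t' → x + t • m ∈ NP f → φ (x + t' • m) ≠ φ (x + t • m) → ∃ a, t < a ∧ a < t' ∧ 0 < eval (x + a • m) f := by
    intro t t' h e n
    have hl' := li_line hl (a := 1) (b := t) (c := 1)  (by linarith)
    simp at hl'
    obtain ⟨s, s0, s1, hs⟩ := sepS hφ e hl' fun _ => n
    refine ⟨(1 - s) * t + s * t', by nlinarith, by nlinarith, ?_⟩
    rw [show x + ((1 - s) * t + s * t') • m = (1 - s) • (x + t • m) + s • (x + t' • m) by module]
    exact hs
  obtain ⟨a, a1, a2, a3⟩ := key _ _ h1 e1 n1.symm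
  obtain ⟨b, b1, b2, b3⟩ := key _ _ h2 e2 n2
  exact six hf hm a1 a2 b1 b2 e1.2 e2.2 e3.2 a3 b3
theorem NP_smul (hf : f.IsHomogeneous 4) {t : ℝ} (ht : t ≠ 0) {v} (hv : v ∈ NP f) : t • v ∈ NP f := by
  refine ⟨smul_ne_zero ht hv.1, ?_⟩
  rw [eval_smul4 hf]
  have : 0 < t ^ 4 := by positivity
  nlinarith [hv.2]
theorem lemIn (hf : f.IsHomogeneous 4) {φ} (hφ : InvOn (NP f) φ) {x x' : ℛ} (hl : LinearIndependent ℝ ![x, x'])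
    (hx : x ∈ NP f) (hx' : x' ∈ NP f) (hd : x - x' ∈ NP f → φ (x - x') ≠ φ x) (e : φ x' = φ x) {α β : ℝ} (hα : 0 < α) (hβ : 0 < β)
    (hy : α • x + β • x' ∈ NP f) (hn : φ (α • x + β • x') ≠ φ x) : False := by
  have hl2 : LinearIndependent ℝ ![x, x - x'] := by
    have := li_line hl (a := 1) (b := 0) (c := 1) (d := -1) (by norm_num)
    convert this using 2
    · module
    · congr 1; module
  obtain ⟨r, r0, r1, hr⟩ := sepS hφ hx hl2 hd
  set m := (1 - r) • x + r • (x - x') with hmdef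
  have hm : m = x - r • x' := by module
  have hl3 : LinearIndependent ℝ ![x, m] := by
    have := li_line hl (a := 1) (b := 0) (c := 1) (d := -r) (by simpa using r0.ne')
    convert this using 2
    · module
    · congr 1; module
  have hk : 0 < α * r + β := by positivity
  have y1 : x + (-(β / (α * r + β))) • m = (r / (α * r + β)) • (α • x + β • x') := by
    rw [hm, smul_sub, smul_add, smul_smul, smul_smul, smul_smul]
    have e1 : r / (α * r + β) * α = 1 + -(β / (α * r + β)) := by field_simp; ring
    have e2 : r / (α * r + β) * β = - (-(β / (α * r + β)) * r) := by field_simp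
    rw [e1, e2]; module
  have c1 : r / (α * r + β) ≠ 0 := by positivity
  have y2 : x + (-1 : ℝ) • m = r • x' := by module
  have hlt : β / (α * r + β) < 1 := by rw [div_lt_one hk]; nlinarith []
  refine six' hf hφ hl3 hr (t1 := -1) (t2 := -(β / (α * r + β))) (t3 := 0) (by linarith) (by simp_all) ?_ ?_ ?_ ?_ ?_
  · rw [y2]; exact NP_smul hf r0.ne' hx'
  · rw [y1]; exact NP_smul hf c1 hy
  · simpa using hx
  · rw [y1, y2, hφ.2 _ c1, hφ.2 _ r0.ne', e]; exact hn.symm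
  · rw [y1, hφ.2 _ c1]; simpa using hn.symm
theorem lemOut (hf : f.IsHomogeneous 4) {φ} (hφ : InvOn (NP f) φ) {x x' : ℛ} (hl : LinearIndependent ℝ ![x, x'])
    (hx : x ∈ NP f) (hx' : x' ∈ NP f) (e : φ x' = φ x) {s : ℝ} (hs : 0 < s) (hs1 : s < 1) (ho : 0 < eval ((1 - s) • x + s • x') f)
    {α β : ℝ} (hα : 0 < α) (hβ : 0 < β) (hy : α • x - β • x' ∈ NP f) (hn : φ (α • x - β • x') ≠ φ x) : False := by
  set o := (1 - s) • x + s • x' with hodef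
  have hl3 : LinearIndependent ℝ ![x, o] := by
    have := li_line hl (a := 1) (b := 0) (c := 1 - s)  (by simpa using hs.ne')
    convert this using 2
    module
  have h1s : 0 < 1 - s := by linarith
  have hk : 0 < s * α + β * (1 - s) := by positivity
  have y1 : x + (-(β / (s * α + β * (1 - s)))) • o = (s / (s * α + β * (1 - s))) • (α • x - β • x') := by
    rw [hodef]
    ext i; simp; field_simp; ring
  have y2 : x + (-(1 / (1 - s))) • o = (-(s / (1 - s))) • x' := by
    rw [hodef]
    ext i; simp; field_simp; ring
  have c1 : s / (s * α + β * (1 - s)) ≠ 0 := by positivity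
  have c2 : -(s / (1 - s)) ≠ 0 := neg_ne_zero.2 (by positivity)
  have hlt : β / (s * α + β * (1 - s)) < 1 / (1 - s) := by rw [div_lt_div_iff₀ hk h1s]; nlinarith []
  refine six' hf hφ hl3 ho (t1 := -(1 / (1 - s))) (t2 := -(β / (s * α + β * (1 - s)))) (t3 := 0) (by linarith) (by
    simp_all) ?_ ?_ ?_ ?_ ?_
  · rw [y2]; exact NP_smul hf c2 hx'
  · rw [y1]; exact NP_smul hf c1 hy
  · simpa using hx
  · rw [y1, y2, hφ.2 _ c1, hφ.2 _ c2, e]; exact hn.symm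
  · rw [y1, hφ.2 _ c1]; simpa using hn.symm
theorem FB {w : ℛ →ₗ[ℝ] ℝ} {T : Set ℛ} (hw : ∀ v ∈ T, w v = 1) (hT : IsPreconnected T) {o} (ho : o ∈ convexHull ℝ T) :
    ∃ x ∈ T, ∃ x' ∈ T, ∃ s : ℝ, 0 ≤ s ∧ s ≤ 1 ∧ o = (1 - s) • x + s • x' := by
  obtain ⟨ι, _, z, l, hz, hai, hl, hs, rfl⟩ := eq_pos_convex_span_of_mem_convexHull ho
  have hzT := fun i => hz ⟨i, rfl⟩
  have hli : LinearIndependent ℝ z := by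
    rw [Fintype.linearIndependent_iff]
    intro g hg i
    have h0 : ∑ i, g i = 0 := by
      have := congrArg w hg
      simpa [hw _ (hzT _)] using this
    exact (affineIndependent_iff.1 hai) Finset.univ g h0 hg i (Finset.mem_univ i)
  have hc : Fintype.card ι ≤ 3 := by simpa using hli.fintype_card_le_finrank
  obtain ⟨n, hn⟩ : ∃ n, n = Fintype.card ι := ⟨_, rfl⟩
  have e := hn ▸ Fintype.equivFin ι
  have key : ∀ i v, v ∈ T → ∀ c μ : ℝ, 0 ≤ μ → c • (∑ i, l i • z i) = v + μ • z i → ∃ x ∈ T, ∃ x' ∈ T, ∃ s : ℝ, 0 ≤ s ∧ s ≤ 1 ∧ (∑ i, l i • z i) = (1 - s) • x + s • x' := by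
    intro i v hv c μ hμ h
    have hcv : c = 1 + μ := by
      have := congrArg w h
      simpa [hw _ (hzT _), hs, hw _ hv] using this
    have hp : 0 < 1 + μ := by linarith
    refine ⟨v, hv, z i, hzT i, μ / (1 + μ), by positivity, by rw [div_le_one hp]; linarith, ?_⟩
    have : (∑ i, l i • z i) = (1 / c) • (v + μ • z i) := by rw [← h, smul_smul, one_div_mul_cancel (by linarith), one_smul]
    rw [this, hcv]
    ext k; simp; field_simp; ring
  have h3 := hn ▸ hc
  interval_cases n
  · haveI := e.isEmpty
    simp at hs
  · haveI := e.unique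
    simp at hs
    exact ⟨z default, hzT _, z default, hzT _, 0, by simp, by simp, by simp [hs]⟩
  · have e1 : ∑ i, l i = l (e.symm 0) + l (e.symm 1) := by rw [← e.symm.sum_comp]; simp
    have e2 : ∑ i, l i • z i = l (e.symm 0) • z (e.symm 0) + l (e.symm 1) • z (e.symm 1) := by rw [← e.symm.sum_comp]; simp
    refine ⟨_, hzT (e.symm 0), _, hzT (e.symm 1), l (e.symm 1), (hl _).le, by linarith [hl (e.symm 0)], ?_⟩
    rw [e2]; congr 2; linarith
  · let b : Module.Basis ι ℝ ℛ := basisOfLinearIndependentOfCardEqFinrank' z hli (by simp [← hn])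
    have hb : ∀ i, b i = z i := fun i => by simp [b]
    let c := fun i v => b.repr v i / l i
    have hcc : ∀ i, Continuous (c i) := fun i => ((LinearMap.continuous_of_finiteDimensional (b.coord i))).div_const _
    have hsum : ∀ v, v = (c (e.symm 0) v * l (e.symm 0)) • z (e.symm 0) + (c (e.symm 1) v * l (e.symm 1)) • z (e.symm 1) + (c (e.symm 2) v * l (e.symm 2)) • z (e.symm 2) := by
      intro v
      have := b.sum_repr v
      rw [← e.symm.sum_comp, Fin.sum_univ_three] at this
      conv_lhs => rw [← this]
      simp  [c, hb]
      simp  [div_mul_cancel₀ _ (hl _).ne']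
    have hzc : ∀ i j, i ≠ j → c i (z j) = 0 := by
      intro i j hij; simp [c, ← hb, Ne.symm hij]
    have hzc' : ∀ i, 0 < c i (z i) := by
      intro i; simp [c, ← hb]; exact hl i
    have eo : ∑ i, l i • z i = l (e.symm 0) • z (e.symm 0) + l (e.symm 1) • z (e.symm 1) + l (e.symm 2) • z (e.symm 2) := by
      rw [← e.symm.sum_comp, Fin.sum_univ_three]
    have hg : ContinuousOn (fun v => c (e.symm 0) v - max (c (e.symm 1) v) (c (e.symm 2) v)) T := ((hcc _).sub ((hcc _).max (hcc _))).continuousOn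
    obtain ⟨v, hv, hv0⟩ := hT.intermediate_value (hzT (e.symm 1)) (hzT (e.symm 0)) hg (show (0) ∈ _ by
      constructor
      · rw [hzc _ _ (by simp)]
        have := le_max_left (c (e.symm 1) (z (e.symm 1))) (c (e.symm 2) (z (e.symm 1)))
        linarith [hzc' (e.symm 1)]
      · rw [hzc (e.symm 1) _ (by simp), hzc (e.symm 2) _ (by simp)]
        simpa using (hzc' _).le)
    beta_reduce at hv0
    have hv' := hsum v
    rcases le_total (c (e.symm 1) v) (c (e.symm 2) v) with h | h
    · rw [max_eq_right h] at hv0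
      have h0 : c (e.symm 0) v = c (e.symm 2) v := by linarith
      refine key (e.symm 1) v hv (c (e.symm 2) v) ((c (e.symm 2) v - c (e.symm 1) v) * l (e.symm 1)) (mul_nonneg (by linarith) (hl _).le) ?_
      rw [h0] at hv'
      generalize c (e.symm 2) v = c2 at *
      generalize c (e.symm 1) v = c1 at *
      rw [eo, hv']; module
    · rw [max_eq_left h] at hv0
      have h0 : c (e.symm 0) v = c (e.symm 1) v := by linarith
      refine key (e.symm 2) v hv (c (e.symm 1) v) ((c (e.symm 1) v - c (e.symm 2) v) * l (e.symm 2)) (mul_nonneg (by linarith) (hl _).le) ?_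
      rw [h0] at hv'
      generalize c (e.symm 2) v = c2 at *
      generalize c (e.symm 1) v = c1 at *
      rw [eo, hv']; module
def NN (f : 𝒫) : Prop := ∃ a b : ℛ →ₗ[ℝ] ℝ, (∀ v, v ≠ 0 → a v * b v = 0 → 0 < eval v f) ∧
  (∃ v, 0 < a v * b v ∧ eval v f < 0) ∧ ∃ v, a v * b v < 0 ∧ eval v f < 0
theorem T_conn {A : Set ℛ} (hA : PC A) {w : ℛ →ₗ[ℝ] ℝ} (hw : ∀ v ∈ A, w v ≠ 0)
    (hs : ∀ t : ℝ, t ≠ 0 → ∀ v ∈ A, t • v ∈ A) : IsPreconnected {v | v ∈ A ∧ w v = 1} := by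
  rw [isPreconnected_iff_preconnectedSpace]
  set T := {v | v ∈ A ∧ w v = 1}
  refine preconnectedSpace_of_forall_constant fun g hg x y => ?_
  let G := Function.extend Subtype.val g fun _ => false
  have hG : ∀ v : T, G v = g v := fun v => Subtype.val_injective.extend_apply _ _ _
  have hGc : ContinuousOn G T := by
    rw [continuousOn_iff_continuous_domRestrict]
    have : T.domRestrict G = g := _root_.funext hG
    rw [this]; exact hg
  have hwc : Continuous w := w.continuous_of_finiteDimensional
  have := hA (fun v => G ((w v)⁻¹ • v)) ⟨hGc.comp (((hwc.continuousOn.inv₀ hw)).smul continuousOn_id) fun v hv => ⟨hs _ (inv_ne_zero (hw v hv)) _ hv, by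
      simp [hw v hv]⟩, fun t ht v => by
        simp only [map_smul, smul_eq_mul, mul_inv, smul_smul]
        rw [mul_right_comm, inv_mul_cancel₀ ht, one_mul]⟩ x.1 x.2.1 y.1 y.2.1
  simp  [x.2.2, y.2.2, hG] at this
  exact this
theorem T_comp (hf : f.IsHomogeneous 4) {φ} (hφ : InvOn (NP f) φ) (b : Bool) {w : ℛ →ₗ[ℝ] ℝ}
    (hw : ∀ v ∈ NP f, φ v = b → w v ≠ 0) : IsCompact {v | (v ∈ NP f ∧ φ v = b) ∧ w v = 1} := by
  have h1 : IsClosed (Metric.sphere (0) 1 ∩ {v | eval v f ≤ 0}) := Metric.isClosed_sphere.inter (isClosed_le eval_cont continuous_const)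
  have hsub : Metric.sphere (0) 1 ∩ {v | eval v f ≤ 0} ⊆ NP f := fun v hv => ⟨by rintro rfl; simpa using hv.1, hv.2⟩
  have h2 := ContinuousOn.preimage_isClosed_of_isClosed (hφ.1.mono hsub) h1 (isClosed_discrete {b})
  have h3 := (isCompact_sphere (0) 1).of_isClosed_subset h2 (fun v hv => hv.1.1)
  have hwc : Continuous w := w.continuous_of_finiteDimensional
  have h4 := h3.image_of_continuousOn (f := fun v => (w v)⁻¹ • v) ((hwc.continuousOn.inv₀ fun v hv => hw v (hsub hv.1) hv.2).smul continuousOn_id)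
  convert h4 using 1
  ext v; constructor
  · rintro ⟨⟨h, e⟩, hv⟩
    have hn : ‖v‖ ≠ 0 := norm_ne_zero_iff.2 h.1
    have hn' : (‖v‖)⁻¹ ≠ 0 := inv_ne_zero hn
    refine ⟨(‖v‖)⁻¹ • v, ⟨⟨by simp [norm_smul, hn], (NP_smul hf hn' h).2⟩, by simpa [hφ.2 _ hn'] using e⟩, ?_⟩
    simp [hv, hn]
  · rintro ⟨v, ⟨h, e⟩, rfl⟩
    have h' := hw v (hsub h) e
    have := inv_ne_zero h'
    exact ⟨⟨NP_smul hf this (hsub h), by simpa [hφ.2 _ this] using e⟩, by simp [h']⟩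
theorem li_w {w : ℛ →ₗ[ℝ] ℝ} {x x' : ℛ} (h : w x = 1) (h' : w x' = 1) (hn : x ≠ x') : LinearIndependent ℝ ![x, x'] := by
  rw [LinearIndependent.pair_iff]
  intro s t hst
  have h1 := congrArg w hst
  simp [h, h'] at h1
  have : s = -t := by linarith
  subst this
  have h2 : t • (x' - x) = 0 := by rw [← hst]; module
  rcases smul_eq_zero.1 h2 with h3 | h3
  · simp [h3]
  grind
theorem segIn (hf : f.IsHomogeneous 4) {φ} (hφ : InvOn (NP f) φ) {b : Bool} {w : ℛ →ₗ[ℝ] ℝ}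
    (hw : ∀ v ∈ NP f, φ v = b → w v ≠ 0) {x x'} (hx : x ∈ NP f) (ex : φ x = b) (wx : w x = 1) (hx' : x' ∈ NP f) (ex' : φ x' = b) (wx' : w x' = 1)
    {α β : ℝ} (hα : 0 < α) (hβ : 0 < β) (h : α • x + β • x' ∈ NP f) : φ (α • x + β • x') = b := by
  by_contra hn
  rcases eq_or_ne x x' with rfl | hne
  · rw [← add_smul, hφ.2 _ (by positivity)] at hn; exact hn ex
  · refine lemIn hf hφ (li_w wx wx' hne) hx hx' (fun h1 h2 => hw _ h1 (h2.trans ex) (by simp [wx, wx'])) (by rw [ex, ex']) hα hβ h (by rw [ex]; exact hn)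
theorem hullIn (hf : f.IsHomogeneous 4) {φ} (hφ : InvOn (NP f) φ) {b : Bool} {w : ℛ →ₗ[ℝ] ℝ}
    (hw : ∀ v ∈ NP f, φ v = b → w v ≠ 0) {x x'} (hx : x ∈ NP f) (ex : φ x = b) (wx : w x = 1) (hx' : x' ∈ NP f) (ex' : φ x' = b) (wx' : w x' = 1)
    {s : ℝ} (hs : 0 ≤ s) (hs1 : s ≤ 1) (h : (1 - s) • x + s • x' ∈ NP f) : φ ((1 - s) • x + s • x') = b := by
  rcases hs.eq_or_lt with rfl | hs
  · simpa using ex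
  rcases hs1.eq_or_lt with rfl | hs1
  · simpa using ex'
  exact segIn hf hφ hw hx ex wx hx' ex' wx' (by linarith) hs h
theorem coplanar {x x' v : ℛ} (h : LinearIndependent ℝ ![x, x']) (hd : dotProduct (crossProduct x x') v = 0) : ∃ α β : ℝ, v = α • x + β • x' := by
  by_contra! hc
  have : LinearIndependent ℝ ![v, x, x'] := by
    refine linearIndependent_finCons.2 ⟨h, fun hm => ?_⟩
    simp only [Matrix.range_cons, Matrix.range_empty, Set.union_empty] at hm
    obtain ⟨α, β, e⟩ := Submodule.mem_span_pair.1 hm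
    exact hc α β e.symm
  have h2 := (Matrix.linearIndependent_rows_iff_isUnit (A := Matrix.of ![v, x, x'])).1 this
  have h3 := (Matrix.isUnit_iff_isUnit_det _).1 h2
  apply h3.ne_zero
  rw [← hd, Matrix.det_fin_three]
  simp [crossProduct, dotProduct, Fin.sum_univ_three]
  ring
theorem ccpos {t p q : ℝ} (t0 : 0 ≤ t) (t1 : t ≤ 1) (hp : 0 < p) (hq : 0 < q) : 0 < (1 - t) * p + t * q := by
  rcases t0.eq_or_lt with rfl | h
  · linarith
  nlinarith
theorem claimO (hf : f.IsHomogeneous 4) {φ} (hS : Spl f φ) {w : Bool → ℛ →ₗ[ℝ] ℝ}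
    (hw : ∀ b, ∀ v ∈ NP f, φ v = b → w b v ≠ 0) {o o'} (ho : o ∈ convexHull ℝ {v | (v ∈ NP f ∧ φ v = true) ∧ w true v = 1})
    (ho' : o' ∈ convexHull ℝ {v | (v ∈ NP f ∧ φ v = false) ∧ w false v = 1}) {c : ℝ} (hc : c ≠ 0) (e : o' = c • o) : False := by
  have hφ := hS.inv
  have hcn : ∀ b, IsPreconnected {v | (v ∈ NP f ∧ φ v = b) ∧ w b v = 1} := fun b =>
    T_conn (hS.pc b) (fun v hv => hw b v hv.1 hv.2) fun t ht v hv => ⟨NP_smul hf ht hv.1, by rw [hφ.2 _ ht]; exact hv.2⟩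
  obtain ⟨x, ⟨⟨hx, ex⟩, wx⟩, x', ⟨⟨hx', ex'⟩, wx'⟩, s, s0, s1, eo⟩ := FB (fun v hv => hv.2) (hcn _) ho
  obtain ⟨y, ⟨⟨hy, ey⟩, wy⟩, y', ⟨⟨hy', ey'⟩, wy'⟩, t, t0, t1, eo'⟩ := FB (fun v hv => hv.2) (hcn _) ho'
  have hwo : w true o = 1 := by simp [eo, wx, wx']
  have ho0 : o ≠ 0 := by rintro rfl; simp at hwo
  by_cases hF : eval o f ≤ 0
  · have h1 : o ∈ NP f := ⟨ho0, hF⟩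
    have h2 := e ▸ NP_smul hf hc h1
    have h3 : φ o = true := by rw [eo] at h1 ⊢; exact hullIn hf hφ (hw _) hx ex wx hx' ex' wx' s0 s1 h1
    have h4 : φ o' = false := by rw [eo'] at h2 ⊢; exact hullIn hf hφ (hw _) hy ey wy hy' ey' wy' t0 t1 h2
    rw [e, hφ.2 _ hc, h3] at h4
    simp at h4
  · push Not at hF
    have hne : x ≠ x' := by
      rintro rfl
      rw [← add_smul, sub_add_cancel, one_smul] at eo
      exact absurd hx.2 (by rw [← eo]; linarith)
    have s0' : 0 < s := s0.lt_of_ne (by rintro rfl; simp at eo; exact absurd hx.2 (by rw [← eo]; linarith))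
    have s1' : s < 1 := s1.lt_of_ne (by rintro rfl; simp at eo; exact absurd hx'.2 (by rw [← eo]; linarith))
    have hl := li_w wx wx' hne
    set n := crossProduct x x'
    have hn : ∀ v ∈ {v | (v ∈ NP f ∧ φ v = false) ∧ w false v = 1}, dotProduct n v ≠ 0 := by
      rintro v ⟨⟨hv, ev⟩, -⟩ h0
      obtain ⟨α, β, rfl⟩ := coplanar hl h0
      have hz : ∀ {α β : ℝ}, α • x + β • x' ∈ NP f → φ (α • x + β • x') = false → 0 < α → False := by
        intro α β hv ev hα
        rcases lt_trichotomy β 0 with hβ | rfl | hβ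
        · refine lemOut hf hφ hl hx hx' (ex'.trans ex.symm) s0' s1' (eo ▸ hF) hα (neg_pos.2 hβ) (by simpa using hv) (by simp [ev, ex])
        · simp [hφ.2 _ hα.ne', ex] at ev
        · have := segIn hf hφ (hw _) hx ex wx hx' ex' wx' hα hβ hv
          simp [this] at ev
      rcases lt_trichotomy α 0 with hα | rfl | hα
      · refine hz (α := -α) (β := -β) ?_ ?_ (by linarith)
        · convert NP_smul hf (by norm_num : (-1:ℝ) ≠ 0) hv using 1; module
        · rw [← ev, ← hφ.2 (-1) (by norm_num)]; congr 1; module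
      · have : β ≠ 0 := by rintro rfl; exact hv.1 (by simp)
        simp [hφ.2 _ this, ex'] at ev
      · exact hz hv ev hα
    have hno : dotProduct n o = 0 := by rw [eo]; simp [n, crossProduct, dotProduct, Fin.sum_univ_three]; ring
    have hno' : (1 - t) * dotProduct n y + t * dotProduct n y' = 0 := by
      have := congrArg (dotProduct n) e
      rw [eo', dotProduct_smul, hno] at this
      simpa using this
    have hyT : y ∈ {v | (v ∈ NP f ∧ φ v = false) ∧ w false v = 1} := ⟨⟨hy, ey⟩, wy⟩
    have hyT' : y' ∈ {v | (v ∈ NP f ∧ φ v = false) ∧ w false v = 1} := ⟨⟨hy', ey'⟩, wy'⟩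
    have hcon := (hcn false).constant (dec_cont  (by fun_prop) hn) hyT hyT'
    simp at hcon
    rcases lt_or_gt_of_ne (hn y hyT) with h | h <;> rcases lt_or_gt_of_ne (hn y' hyT') with h' | h'
    · linarith [ccpos t0 t1 (neg_pos.2 h) (neg_pos.2 h')]
    · linarith [hcon.2 h']
    · linarith [hcon.1 h]
    · linarith [ccpos t0 t1 h h']
theorem join_comp {A B : Set ℛ} (hA : IsCompact A) (hB : IsCompact B) : IsCompact (convexJoin ℝ A B) := by
  convert ((hA.prod hB).prod (isCompact_Icc (a := (0:ℝ)) )).image (f := fun p => (1 - p.2) • p.1.1 + p.2 • p.1.2) (by fun_prop) using 1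
  ext v
  simp only [mem_convexJoin, segment_eq_image, Set.mem_image, Prod.exists]
  constructor
  · rintro ⟨a, ha, b, hb, s, hs, e⟩; exact ⟨a, b, s, ⟨⟨ha, hb⟩, hs⟩, e⟩
  · rintro ⟨a, b, s, ⟨⟨ha, hb⟩, hs⟩, e⟩; exact ⟨a, ha, b, hb, s, hs, e⟩
theorem hull_comp2 {A B : Set ℛ} (h1 : A.Nonempty) (h2 : B.Nonempty) (hA : IsCompact (convexHull ℝ A)) (hB : IsCompact (convexHull ℝ B)) :
    IsCompact (convexHull ℝ (A ∪ B)) := by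
  rw [convexHull_union h1 h2]; exact join_comp hA hB
open scoped Pointwise in
theorem caseA (hf : f.IsHomogeneous 4) {φ} (hS : Spl f φ) {w : Bool → ℛ →ₗ[ℝ] ℝ}
    (hw : ∀ b, ∀ v ∈ NP f, φ v = b → w b v ≠ 0) : NN f := by
  have hφ := hS.inv
  let T := fun b => {v | (v ∈ NP f ∧ φ v = b) ∧ w b v = 1}
  have hTc : ∀ b, IsCompact (T b) := fun b => T_comp hf hφ b (hw b)
  have hC : ∀ b, IsCompact (convexHull ℝ (T b)) := by
    intro b
    have : convexHull ℝ (T b) = convexJoin ℝ (T b) (T b) := by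
      apply Set.Subset.antisymm
      · intro o ho
        obtain ⟨x, hx, x', hx', s, s0, s1, e⟩ := FB  (fun v hv => hv.2) (T_conn (hS.pc b) (fun v hv => hw b v hv.1 hv.2) fun t ht v hv => ⟨NP_smul hf ht hv.1, by rw [hφ.2 _ ht]; exact hv.2⟩) ho
        exact mem_convexJoin.2 ⟨x, hx, x', hx', 1 - s, s, by linarith, s0, by ring, e.symm⟩
      · intro o ho
        obtain ⟨x, hx, x', hx', h⟩ := mem_convexJoin.1 ho
        exact segment_subset_convexHull hx hx' h
    rw [this]; exact join_comp (hTc b) (hTc b)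
  have hin : ∀ b, ∀ v ∈ NP f, φ v = b → (w b v)⁻¹ • v ∈ T b := fun b v hv e =>
    have := hw b v hv e
    ⟨⟨NP_smul hf (inv_ne_zero this) hv, by simpa [hφ.2 _ (inv_ne_zero this)] using e⟩, by simp [this]⟩
  have hne : ∀ b, (T b).Nonempty := fun b => by
    obtain ⟨v, v0, hv, e⟩ := hS.neg b
    exact ⟨_, hin b v ⟨v0, hv.le⟩ e⟩
  have sep : ∀ ε : ℝ, ε ≠ 0 → ∃ l : ℛ →ₗ[ℝ] ℝ, (∀ v ∈ T true, 0 < l v) ∧ ∀ v ∈ T false, 0 < ε * l v := by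
    intro ε hε
    have hK : IsCompact (convexHull ℝ (T true ∪ ε • T false)) := hull_comp2 (hne _) ((hne _).smul_set) (hC _) (by rw [convexHull_smul]; exact (hC _).smul ε)
    have h0 : (0) ∉ convexHull ℝ (T true ∪ ε • T false) := by
      rw [convexHull_union (hne _) ((hne _).smul_set), convexHull_smul]
      intro h
      obtain ⟨a, ha, b', ⟨b, hb, rfl⟩, s, t, hs, ht, hst, e⟩ := mem_convexJoin.1 h
      have ha1 : w true a = 1 := by
        have : convexHull ℝ (T true) ⊆ {v | w true v = 1} := convexHull_min (fun v hv => hv.2) (convex_hyperplane (w true).isLinear 1)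
        exact this ha
      have hb1 : w false b = 1 := by
        have : convexHull ℝ (T false) ⊆ {v | w false v = 1} := convexHull_min (fun v hv => hv.2) (convex_hyperplane (w false).isLinear 1)
        exact this hb
      have hs0 : s ≠ 0 := by
        rintro rfl
        simp_all
      have ht0 : t ≠ 0 := by
        rintro rfl
        simp_all
      refine claimO hf hS hw ha hb (c := -(s / (t * ε))) (by simp [hs0, ht0, hε]) ?_
      have e' : s • a = -(t * ε) • b := by
        have : s • a = -(t • ε • b) := eq_neg_of_add_eq_zero_left e
        rw [this]; module
      rw [neg_smul, div_eq_inv_mul, mul_smul, e']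
      rw [neg_smul, smul_neg, neg_neg, smul_smul, inv_mul_cancel₀ (mul_ne_zero ht0 hε), one_smul]
    obtain ⟨l, u, h1, h2⟩ := geometric_hahn_banach_point_closed (convex_convexHull ℝ _) hK.isClosed h0
    simp at h1
    refine ⟨l.toLinearMap, fun v hv => h1.trans (h2 _ (subset_convexHull _ _ (Or.inl hv))), fun v hv => ?_⟩
    have := h1.trans (h2 _ (subset_convexHull _ _ (Or.inr ⟨v, hv, rfl⟩)))
    simpa using this
  obtain ⟨a, a1, a2⟩ := sep 1 one_ne_zero
  obtain ⟨b, b1, b2⟩ := sep (-1) (by norm_num)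
  have hpt : ∀ c, ∀ v ∈ NP f, φ v = c → ∃ u ∈ T c, ∃ r : ℝ, r ≠ 0 ∧ v = r • u := fun c v hv e =>
    ⟨_, hin c v hv e, w c v, hw c v hv e, by rw [smul_smul, mul_inv_cancel₀ (hw c v hv e), one_smul]⟩
  have s1 : ∀ v ∈ NP f, φ v = true → 0 < a v * b v := by
    intro v hv e
    obtain ⟨u, hu, r, hr, rfl⟩ := hpt _ v hv e
    have := mul_pos (a1 u hu) (b1 u hu)
    have hr2 : 0 < r ^ 2 := by positivity
    simp; nlinarith
  have s2 : ∀ v ∈ NP f, φ v = false → a v * b v < 0 := by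
    intro v hv e
    obtain ⟨u, hu, r, hr, rfl⟩ := hpt _ v hv e
    have := mul_pos (a2 u hu) (b2 u hu)
    have hr2 : 0 < r ^ 2 := by positivity
    simp; nlinarith
  refine ⟨a, b, fun v v0 h0 => ?_, ?_, ?_⟩
  · by_contra! hle
    rcases hb : φ v
    · linarith [s2 v ⟨v0, hle⟩ hb]
    · linarith [s1 v ⟨v0, hle⟩ hb]
  · obtain ⟨v, v0, hv, e⟩ := hS.neg true
    exact ⟨v, s1 v ⟨v0, hv.le⟩ e, hv⟩
  · obtain ⟨v, v0, hv, e⟩ := hS.neg false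
    exact ⟨v, s2 v ⟨v0, hv.le⟩ e, hv⟩
def HY (f : 𝒫) (p : ℛ) : Prop := eval p f ≠ 0 ∧ ∀ v, LinearIndependent ℝ ![v, p] →
  ∃ r1 r2 r3 r4 : ℝ, r1 < r2 ∧ r2 < r3 ∧ r3 < r4 ∧ eval (v + r1 • p) f = 0 ∧ eval (v + r2 • p) f = 0 ∧ eval (v + r3 • p) f = 0 ∧ eval (v + r4 • p) f = 0
theorem two_double {P : Polynomial ℝ} (hd : P.natDegree ≤ 4) (hc : P.coeff 4 < 0) {a b : ℝ} (hab : a ≠ b) (ha : P.eval a = 0) (ha' : P.derivative.eval a = 0)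
    (hb : P.eval b = 0) (hb' : P.derivative.eval b = 0) (t : ℝ) : P.eval t ≤ 0 := by
  have h0 : P ≠ 0 := by rintro rfl; simp at hc
  have dv : ∀ a, P.eval a = 0 → P.derivative.eval a = 0 → (Polynomial.X - Polynomial.C a) ^ 2 ∣ P := fun a ha ha' =>
    (Polynomial.le_rootMultiplicity_iff h0).1 ((Polynomial.one_lt_rootMultiplicity_iff_isRoot h0).2 ⟨ha, ha'⟩)
  have cop : IsCoprime ((Polynomial.X - Polynomial.C a) ^ 2) ((Polynomial.X - Polynomial.C b) ^ 2) :=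
    (Polynomial.isCoprime_X_sub_C_of_isUnit_sub (sub_ne_zero.2 hab).isUnit).pow
  obtain ⟨Q, hQ⟩ := cop.mul_dvd (dv a ha ha') (dv b hb hb')
  have hm : ((Polynomial.X - Polynomial.C a) ^ 2 * (Polynomial.X - Polynomial.C b) ^ 2).Monic := ((Polynomial.monic_X_sub_C a).pow 2).mul ((Polynomial.monic_X_sub_C b).pow 2)
  have hm4 : ((Polynomial.X - Polynomial.C a) ^ 2 * (Polynomial.X - Polynomial.C b) ^ 2).natDegree = 4 := by
    rw [((Polynomial.monic_X_sub_C a).pow 2).natDegree_mul ((Polynomial.monic_X_sub_C b).pow 2)]; simp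
  have hQ0 : Q ≠ 0 := by rintro rfl; simp at hQ; exact h0 hQ
  have hQd : Q.natDegree = 0 := by
    have := hm.natDegree_mul' hQ0
    rw [← hQ, hm4] at this; omega
  rw [Polynomial.eq_C_of_natDegree_eq_zero hQd] at hQ
  have hq : P.coeff 4 = Q.coeff 0 := by
    rw [hQ, Polynomial.coeff_mul_C]
    have : ((Polynomial.X - Polynomial.C a) ^ 2 * (Polynomial.X - Polynomial.C b) ^ 2).coeff 4 = 1 := by rw [← hm4]; exact hm
    rw [this]; simp
  rw [hQ]; simp
  have := mul_nonneg (sq_nonneg (t - a)) (sq_nonneg (t - b))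
  nlinarith
theorem bothsides {φ} (hφ : InvOn (NP f) φ) {x p} (hx : x ∈ NP f) (hl : LinearIndependent ℝ ![x, p]) (hp : φ p ≠ φ x) (hf : f.IsHomogeneous 4) :
    ∃ k : ℝ, 0 < k ∧ 0 < eval (x + k • p) f := by
  obtain ⟨s, s0, s1, h⟩ := sepS hφ hx hl fun _ => hp
  have h1 : 0 < 1 - s := by linarith
  refine ⟨s / (1 - s), by positivity, ?_⟩
  have e : (1 - s) • x + s • p = (1 - s) • (x + (s / (1 - s)) • p) := by
    rw [smul_add, smul_smul, mul_div_cancel₀ _ h1.ne']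
  rw [e, eval_smul4 hf] at h
  simp_all
theorem li_add {v p : ℛ} (h : LinearIndependent ℝ ![v, p]) (r : ℝ) : LinearIndependent ℝ ![v + r • p, p] := by
  simp_all
theorem li_ne1 {v p : ℛ} (h : LinearIndependent ℝ ![v, p]) : v ≠ 0 := by
  have := li_ne h (a := 1) (b := 0) (by simp); simpa using this
theorem onLine (hf : f.IsHomogeneous 4) {φ} (hφ : InvOn (NP f) φ) {b : Bool} (hm : ∀ w : ℛ →ₗ[ℝ] ℝ, w ≠ 0 → ∃ v ∈ NP f, φ v = b ∧ w v = 0)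
    {p v : ℛ} (hp : φ p ≠ b) (h : LinearIndependent ℝ ![v, p]) : ∃ r : ℝ, v + r • p ∈ NP f ∧ φ (v + r • p) = b := by
  let w : ℛ →ₗ[ℝ] ℝ := dotProductBilin ℝ ℝ (crossProduct v p)
  have hw : w ≠ 0 := by
    intro h0
    have h1 := fun u => coplanar h (by have := LinearMap.congr_fun h0 u; simpa [w] using this)
    have h2 : (⊤) ≤ Submodule.span ℝ {v, p} := fun u _ => by
      obtain ⟨α, β, e⟩ := h1 u
      exact Submodule.mem_span_pair.2 ⟨α, β, e.symm⟩
    have h3 := Submodule.finrank_mono h2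
    have h4 := finrank_span_finset_le_card (R := ℝ) ({v, p})
    have h5 := Finset.card_le_two (a := v) (b := p)
    simp at h3
    have h6 : Set.finrank ℝ (({v, p} : Finset ℛ) : Set ℛ) = Module.finrank ℝ (Submodule.span ℝ {v, p}) := by rw [Finset.coe_pair]; rfl
    omega
  obtain ⟨x, hx, e, h0⟩ := hm w hw
  obtain ⟨α, β, rfl⟩ := coplanar h  h0
  have hα : α ≠ 0 := by
    rintro rfl
    have : β ≠ 0 := by rintro rfl; exact hx.1 (by simp)
    simp [hφ.2 _ this] at e; exact hp e
  have e2 : v + (α⁻¹ * β) • p = α⁻¹ • (α • v + β • p) := by rw [smul_add, smul_smul, smul_smul, inv_mul_cancel₀ hα, one_smul]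
  exact ⟨α⁻¹ * β, e2 ▸ NP_smul hf (inv_ne_zero hα) hx, by rw [e2, hφ.2 _ (inv_ne_zero hα), e]⟩
theorem negpt (hf : IsSmoothQuartic f) {φ} (hφ : InvOn (NP f) φ) {b : Bool} (hm : ∀ w : ℛ →ₗ[ℝ] ℝ, w ≠ 0 → ∃ v ∈ NP f, φ v = b ∧ w v = 0)
    {p v : ℛ} (hp0 : p ≠ 0) (hF : eval p f < 0) (hp : φ p ≠ b) (h : LinearIndependent ℝ ![v, p]) : ∃ r : ℝ, v + r • p ∈ NP f ∧ φ (v + r • p) = b ∧ eval (v + r • p) f < 0 := by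
  by_contra! hcon
  obtain ⟨r0, hx, ex⟩ := onLine hf.1 hφ hm hp h
  set x := v + r0 • p with hxd
  have hl : LinearIndependent ℝ ![x, p] := li_add h r0
  have hcon' : ∀ r : ℝ, x + r • p ∈ NP f → φ (x + r • p) = b → eval (x + r • p) f = 0 := by
    intro r h1 h2
    have e : x + r • p = v + (r0 + r) • p := by module
    rw [e] at h1 h2 ⊢
    exact le_antisymm h1.2 (hcon _ h1 h2)
  obtain ⟨P, hPd, hPc, hP⟩ := line_poly hf.1 x p
  have near : ∀ r : ℝ, x + r • p ∈ NP f → φ (x + r • p) = b → ∀ᶠ t in 𝓝 r, 0 ≤ eval (x + t • p) f := by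
    intro r h1 h2
    have hc := (by fun_prop : Continuous fun t : ℝ => x + t • p).tendsto r
    filter_upwards [hc.eventually (bool_ev hφ.1 h1)] with t ht
    by_contra! hlt
    have hmem : x + t • p ∈ NP f := ⟨li_ne1 (li_add hl t), hlt.le⟩
    have := hcon' t hmem ((ht hmem).trans h2)
    linarith
  have der : ∀ r : ℝ, x + r • p ∈ NP f → φ (x + r • p) = b → P.eval r = 0 ∧ P.derivative.eval r = 0 := by
    intro r h1 h2
    have e0 : P.eval r = 0 := by rw [hP]; exact hcon' r h1 h2
    refine ⟨e0, IsLocalMin.hasDerivAt_eq_zero  ?_ (P.hasDerivAt r)⟩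
    filter_upwards [near r h1 h2] with t ht
    rw [e0, hP]; exact ht
  have x0 : x + (0:ℝ) • p = x := by simp
  obtain ⟨k, hk, hkp⟩ := bothsides hφ hx hl (by rw [ex]; exact hp) hf.1
  have uniq : ∀ r : ℝ, x + r • p ∈ NP f → φ (x + r • p) = b → r = 0 := by
    intro r h1 h2
    by_contra hr
    obtain ⟨a1, a2⟩ := der 0 (by rw [x0]; exact hx) (by rw [x0]; exact ex)
    obtain ⟨b1, b2⟩ := der r h1 h2
    have := two_double hPd (by rw [hPc]; exact hF) (Ne.symm hr) a1 a2 b1 b2 k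
    rw [hP] at this; linarith
  have hF0 : eval x f = 0 := by have := hcon' 0 (by rw [x0]; exact hx) (by rw [x0]; exact ex); rwa [x0] at this
  set n := gr f x
  have hn : n ≠ 0 := gr_ne hf hx.1 hF0
  have hD := (hasDeriv f x).isLittleO
  set D : ℛ →L[ℝ] ℝ := ∑ i, eval x (pderiv i f) • ContinuousLinearMap.proj   i with hDd
  have hDn : 0 < D n := by
    have : D n = ∑ i, n i * n i := by simp [hDd, n, gr]
    obtain ⟨i, hi⟩ := Function.ne_iff.1 hn
    exact Finset.sum_pos' (fun i _ => mul_self_nonneg _) ⟨i, Finset.mem_univ _, mul_self_pos.2 hi⟩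
  have hev := hD.bound (show 0 < D n / (2 * ‖n‖) by positivity)
  have hli : ∀ᶠ ε in 𝓝 (0:ℝ), LinearIndependent ℝ ![x + ε • n, p] := by
    have hc : Continuous fun ε : ℝ => ![x + ε • n, p] := by
      fun_prop
    have := (isOpen_setOfPred_linearIndependent (𝕜 := ℝ)  (ι := Fin 2)).preimage hc
    exact this.mem_nhds (by simpa using hl)
  let e : ℕ → ℝ := fun k => 1 / ((k) + 1)
  have he : Tendsto e atTop (𝓝 0) := tendsto_one_div_add_atTop_nhds_zero_nat
  have hepos : ∀ k, 0 < e k := fun k => Nat.one_div_pos_of_nat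
  let U := hyperfilter ℕ
  have hU : (U : Filter ℕ) ≤ atTop := by rw [← Nat.cofinite_eq_atTop]; exact hyperfilter_le_cofinite
  have heU := he.mono_left hU
  have hex : ∀ k, ∃ r : ℝ, LinearIndependent ℝ ![x + e k • n, p] → (x + e k • n + r • p ∈ NP f ∧ φ (x + e k • n + r • p) = b) := by
    intro k
    by_cases hk : LinearIndependent ℝ ![x + e k • n, p]
    · obtain ⟨r, hr⟩ := onLine hf.1 hφ hm hp hk
      exact ⟨r, fun _ => hr⟩
    · exact ⟨0, fun h => absurd h hk⟩
  choose r hr using hex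
  have hrU : ∀ᶠ k in U, x + e k • n + r k • p ∈ NP f ∧ φ (x + e k • n + r k • p) = b := by
    filter_upwards [heU.eventually hli] with k hk using hr k hk
  by_cases hB : ∃ B : ℝ, ∀ᶠ k in U, r k ∈ Set.Icc (-B) B
  · obtain ⟨B, hB⟩ := hB
    obtain ⟨rs, -, hrs⟩ := isCompact_Icc.ultrafilter_le_nhds (U.map r) (le_principal_iff.2 hB)
    have hrs : Tendsto r U (𝓝 rs) := hrs
    have hlim : Tendsto (fun k => x + e k • n + r k • p) U (𝓝 (x + rs • p)) := by
      have := ((tendsto_const_nhds (x := x)).add (heU.smul_const n)).add (hrs.smul_const p)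
      simpa using this
    have hmem : x + rs • p ∈ NP f := ⟨li_ne1 (li_add hl rs), le_of_tendsto ((eval_cont.tendsto _).comp hlim) (hrU.mono fun k hk => hk.1.2)⟩
    have hφs : φ (x + rs • p) = b := by
      obtain ⟨k, h1, h2⟩ := ((hlim.eventually (bool_ev hφ.1 hmem)).and hrU).exists
      rw [← h1 h2.1, h2.2]
    obtain rfl := uniq rs hmem hφs
    rw [x0] at hlim
    have hlim2 : Tendsto (fun k => x + r k • p) U (𝓝 x) := by
      have := (tendsto_const_nhds (x := x)).add (hrs.smul_const p)
      simpa using this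
    obtain ⟨k, h1, h2, h3⟩ := (((hlim.prodMk_nhds hlim2).eventually hev).and (hrU.and (hrs.eventually (near 0 (by rw [x0]; exact hx) (by rw [x0]; exact ex))))).exists
    have e1 : x + e k • n + r k • p - (x + r k • p) = e k • n := by module
    simp  [e1, norm_smul, abs_of_pos (hepos k)] at h1
    have e2 : D n / (2 * ‖n‖) * (e k * ‖n‖) = e k * D n / 2 := by field_simp
    have := (abs_le.1 h1).1
    have := h2.1.2
    have := mul_pos (hepos k) hDn
    linarith
  · push Not at hB
    have hcb : Tendsto r U (Bornology.cobounded ℝ) := by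
      rw [← tendsto_norm_atTop_iff_cobounded, tendsto_atTop]
      intro B
      filter_upwards [hB B] with k hk
      by_contra! hlt
      exact hk (abs_le.1 hlt.le)
    have hinv : Tendsto (fun k => (r k)⁻¹) U (𝓝 0) := tendsto_inv₀_cobounded.comp hcb
    have hne : ∀ᶠ k in U, r k ≠ 0 := by
      filter_upwards [hB 0] with k hk h0
      exact hk (by rw [h0]; simp)
    have hlim : Tendsto (fun k => (r k)⁻¹ • (x + e k • n + r k • p)) U (𝓝 p) := by
      have := (hinv.smul ((tendsto_const_nhds (x := x)).add (heU.smul_const n))).add (tendsto_const_nhds (x := p))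
      simp only [zero_smul, zero_add] at this
      refine this.congr' ?_
      filter_upwards [hne] with k hk
      rw [smul_add (r k)⁻¹ _ (r k • p), smul_smul, inv_mul_cancel₀ hk, one_smul]
    obtain ⟨k, h1, h2, h3⟩ := ((hlim.eventually (bool_ev hφ.1 (⟨hp0, hF.le⟩))).and (hrU.and hne)).exists
    have := h1 (NP_smul hf.1 (inv_ne_zero h3) h2.1)
    rw [hφ.2 _ (inv_ne_zero h3), h2.2] at this
    exact hp this.symm
theorem caseB (hf : IsSmoothQuartic f) {φ} (hφ : InvOn (NP f) φ) {b : Bool} (hm : ∀ w : ℛ →ₗ[ℝ] ℝ, w ≠ 0 → ∃ v ∈ NP f, φ v = b ∧ w v = 0)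
    {p : ℛ} (hp0 : p ≠ 0) (hF : eval p f < 0) (hp : φ p ≠ b) : HY f p := by
  refine ⟨hF.ne, fun v h => ?_⟩
  obtain ⟨r, h1, h2, h3⟩ := negpt hf hφ hm hp0 hF hp h
  have hl := li_add h r
  obtain ⟨k, k0, hk⟩ := bothsides hφ h1 hl (by rw [h2]; exact hp) hf.1
  obtain ⟨k', k0', hk'⟩ := bothsides (p := -p) hφ h1 (by simp_all) (by rw [h2, ← neg_one_smul ℝ, hφ.2 _ (by norm_num)]; exact hp) hf.1
  obtain ⟨P, hPd, hPc, hP⟩ := line_poly hf.1 v p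
  have hm' : 0 < eval p (-f) := by simpa using hF
  obtain ⟨⟨t1, ht1, e1⟩, -⟩ := pos_far hf.1.neg v hm' (r - k')
  obtain ⟨-, ⟨t2, ht2, e2⟩⟩ := pos_far hf.1.neg v hm' (r + k)
  rw [map_neg, ← hP] at e1 e2
  rw [show v + r • p + k • p = v + (r + k) • p by module, ← hP] at hk
  rw [show v + r • p + k' • -p = v + (r - k') • p by module, ← hP] at hk'
  rw [← hP] at h3
  obtain ⟨r1, a1, b1, c1⟩ := poly_ivt P ht1 (by nlinarith)
  obtain ⟨r2, a2, b2, c2⟩ := poly_ivt P (x := r - k') (y := r) (by linarith) (by nlinarith)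
  obtain ⟨r3, a3, b3, c3⟩ := poly_ivt P (x := r) (y := r + k) (by linarith) (by nlinarith)
  obtain ⟨r4, a4, b4, c4⟩ := poly_ivt P ht2 (by nlinarith)
  simp  [hP] at c1 c2 c3 c4
  exact ⟨r1, r2, r3, r4, by linarith, by linarith, by linarith, c1, c2, c3, c4⟩
theorem T1a (hf : IsSmoothQuartic f) (h2 : TwoC (KK f)) (hn : ¬ PC (NP f)) : (∃ p, HY f p) ∨ NN f := by
  obtain ⟨φ, hS⟩ := spl_exists hf h2 hn
  by_cases h : ∀ b, ∃ w : ℛ →ₗ[ℝ] ℝ, ∀ v ∈ NP f, φ v = b → w v ≠ 0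
  · choose w hw using h
    exact Or.inr (caseA hf.1 hS hw)
  · push Not at h
    obtain ⟨b, hb⟩ := h
    obtain ⟨p, p0, hp, e⟩ := hS.neg (!b)
    exact Or.inl ⟨p, caseB hf hS.inv (fun w _ => hb w) p0 hp (by simp [e])⟩
theorem T1 (hf : IsSmoothQuartic f) (h2 : TwoC (KK f)) : (∃ p, HY f p) ∨ NN f ∨ NN (cg f 1 (-1)) := by
  have he : ∀ v, eval v (cg f 1 (-1)) = - eval v f := fun v => by rw [eval_cg]; simp
  rcases not_and_or.1 (not_both hf h2) with h | h
  · rcases T1a hf h2 h with h | h <;> tauto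
  · have := T1a (f := cg f 1 (-1)) (cg_smooth  (one_mul 1) (by norm_num) hf) (cg_KK  (one_mul 1) (by norm_num) h2) (by
      convert h using 2
      simp [NP, he])
    rcases this with ⟨p, hp⟩ | h
    · left
      refine ⟨p, ?_, ?_⟩
      · have := hp.1; rw [he] at this; simpa using this
      · have := hp.2; simpa [he] using this
    · tauto
def NN0 (f : 𝒫) : Prop := (∀ v, v ≠ 0 → v 0 * v 2 = 0 → 0 < eval v f) ∧
  (∃ c : ℝ, 0 < c ∧ eval ![-c, 0, 1] f < 0) ∧ ∃ c : ℝ, 0 < c ∧ eval ![c, 0, 1] f < 0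
open Matrix in
theorem NN_norm (hf : f.IsHomogeneous 4) (h : NN f) : ∃ M N : Matrix (Fin 3) (Fin 3) ℝ, N * M = 1 ∧ NN0 (cg f M 1) := by
  obtain ⟨a, b, hab, ⟨q1, h1, F1⟩, q2, h2, F2⟩ := h
  have hl : LinearIndependent ℝ ![q1, q2] := by
    rw [LinearIndependent.pair_iff]
    intro s t e
    have ha := congrArg a e
    have hb := congrArg b e
    simp at ha hb
    have e1 : s ^ 2 * (a q1 * b q1) = t ^ 2 * (a q2 * b q2) := by
      have ha' : s * a q1 = - (t * a q2) := by linarith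
      have hb' : s * b q1 = - (t * b q2) := by linarith
      calc s ^ 2 * (a q1 * b q1) = (s * a q1) * (s * b q1) := by ring
        _ = _ := by rw [ha', hb']; ring
    have hs : s = 0 := by
      by_contra hs
      have : 0 < s ^ 2 := by positivity
      nlinarith []
    subst hs
    have ht : t = 0 := by
      by_contra ht
      simp_all
    exact ⟨rfl, ht⟩
  let N : Matrix (Fin 3) (Fin 3) ℝ := Matrix.of ![fun i => a (Pi.single i 1), crossProduct q1 q2, fun i => b (Pi.single i 1)]
  have lin : ∀ (l : ℛ →ₗ[ℝ] ℝ) v, (fun i => l (Pi.single i 1)) ⬝ᵥ v = l v := by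
    intro l v
    conv_rhs => rw [← Finset.univ_sum_single v, map_sum]
    refine Finset.sum_congr rfl fun i _ => ?_
    have : Pi.single i (v i) = v i • (Pi.single i 1) := by rw [← Pi.single_smul]; simp
    rw [this, map_smul, smul_eq_mul, mul_comm]
  have hN : ∀ v, N *ᵥ v = ![a v, crossProduct q1 q2 ⬝ᵥ v, b v] := by
    intro v; ext i; fin_cases i
    · exact lin a v
    · rfl
    · exact lin b v
  have hinj : Function.Injective N.mulVec := by
    refine (injective_iff_map_eq_zero N.mulVecLin).2 fun v hv => ?_
    simp only [mulVecLin_apply, hN] at hv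
    have v0 := congrFun hv 0
    have v1 := congrFun hv 1
    have v2 := congrFun hv 2
    simp at v0 v1 v2
    by_contra hv0
    obtain ⟨α, β, rfl⟩ := coplanar hl v1
    simp at v0 v2
    have hd : a q1 * b q2 - a q2 * b q1 ≠ 0 := by
      intro hd
      have : (a q1 * b q1) * (a q2 * b q2) = (a q1 * b q2) ^ 2 := by
        rw [sq]; nth_rw 2 [show a q1 * b q2 = a q2 * b q1 by linarith]; ring
      nlinarith
    have hα : α * (a q1 * b q2 - a q2 * b q1) = 0 := by linear_combination b q2 * v0 - a q2 * v2
    have hβ : β * (a q1 * b q2 - a q2 * b q1) = 0 := by linear_combination a q1 * v2 - b q1 * v0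
    simp [hd] at hα hβ
    simp [hα, hβ] at hv0
  have hu := mulVec_injective_iff_isUnit.1 hinj
  have hdet := (isUnit_iff_isUnit_det _).1 hu
  have hNM : N * N⁻¹ = 1 := mul_nonsing_inv N hdet
  have hMN : N⁻¹ * N = 1 := nonsing_inv_mul N hdet
  have hev : ∀ v, eval (N *ᵥ v) (cg f N⁻¹ 1) = eval v f := fun v => by
    rw [eval_cg, mulVec_mulVec, hMN, one_mulVec, one_mul]
  have hsc : ∀ (t : ℝ) v, eval (t • v) (cg f N⁻¹ 1) = t ^ 4 * eval v (cg f N⁻¹ 1) := fun t v => by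
    rw [eval_cg, eval_cg, mulVec_smul, eval_smul4 hf]; ring
  have hpt : ∀ q, b q ≠ 0 → crossProduct q1 q2 ⬝ᵥ q = 0 → eval q f < 0 → eval ![a q / b q, 0, 1] (cg f N⁻¹ 1) < 0 := by
    intro q hb hc hq
    have : ![a q / b q, 0, 1] = (b q)⁻¹ • (N *ᵥ q) := by
      rw [hN, hc]; ext i; fin_cases i <;> simp [hb]; field_simp
    rw [this, hsc, hev]
    have : 0 < ((b q)⁻¹) ^ 4 := by positivity
    nlinarith
  refine ⟨N⁻¹, N, hNM, fun v v0 h => ?_, ?_, ?_⟩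
  · have e : v = N *ᵥ (N⁻¹ *ᵥ v) := by rw [mulVec_mulVec, hNM, one_mulVec]
    rw [e, hev]
    refine hab _ (fun h0 => v0 (by rw [e, h0, mulVec_zero])) ?_
    rw [e, hN] at h
    simpa using h
  · have hb : b q2 ≠ 0 := by rintro h0; simp [h0] at h2
    refine ⟨-(a q2 / b q2), ?_, ?_⟩
    · rw [← neg_div, div_pos_iff]
      rcases mul_neg_iff.1 h2 with h | h
      · right; exact ⟨by linarith, h.2⟩
      · left; exact ⟨by linarith, h.2⟩
    · rw [neg_neg]; exact hpt q2 hb (by simp [crossProduct, dotProduct, Fin.sum_univ_three]; ring) F2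
  · have hb : b q1 ≠ 0 := by rintro h0; simp [h0] at h1
    refine ⟨a q1 / b q1, ?_, hpt q1 hb (by simp [crossProduct, dotProduct, Fin.sum_univ_three]; ring) F1⟩
    rw [div_pos_iff]
    rcases mul_pos_iff.1 h1 with h | h
    · exact Or.inl h
    · exact Or.inr h
theorem FRstep (P : Polynomial ℝ) (hd : P.natDegree ≠ 0) (hp : ∀ t, 0 ≤ P.eval t) :
    ∃ z : ℂ, 0 ≤ z.im ∧ ∃ Q : Polynomial ℝ, P = (Polynomial.X ^ 2 - Polynomial.C (2 * z.re) * Polynomial.X + Polynomial.C (‖z‖ ^ 2)) * Q ∧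
      ∀ t, 0 ≤ Q.eval t := by
  obtain ⟨z, hz⟩ : ∃ z : ℂ, Polynomial.aeval z P = 0 := by
    obtain ⟨z, hz⟩ := IsAlgClosed.exists_aeval_eq_zero ℂ P (fun h => hd (Polynomial.natDegree_eq_of_degree_eq_some h))
    exact ⟨z, hz⟩
  have hP0 : P ≠ 0 := by rintro rfl; simp at hd
  have fin : ∀ z : ℂ, 0 ≤ z.im → (∃ Q : Polynomial ℝ, P = (Polynomial.X ^ 2 - Polynomial.C (2 * z.re) * Polynomial.X + Polynomial.C (‖z‖ ^ 2)) * Q) →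
      ∃ z : ℂ, 0 ≤ z.im ∧ ∃ Q : Polynomial ℝ, P = (Polynomial.X ^ 2 - Polynomial.C (2 * z.re) * Polynomial.X + Polynomial.C (‖z‖ ^ 2)) * Q ∧
      ∀ t, 0 ≤ Q.eval t := by
    rintro z h0 ⟨Q, hQ⟩
    refine ⟨z, h0, Q, hQ, ?_⟩
    have hc : IsClosed {t | 0 ≤ Q.eval t} := isClosed_le continuous_const Q.continuous
    have hdn : Dense ({z.re}ᶜ) := dense_compl_singleton _
    intro t
    refine hc.closure_subset_iff.2 ?_ (hdn t)
    intro s hs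
    have h1 := hp s
    rw [hQ] at h1
    simp at h1
    have h2 : 0 < s ^ 2 - 2 * z.re * s + ‖z‖ ^ 2 := by
      have := Complex.sq_norm z; rw [Complex.normSq_apply] at this
      have h3 : 0 < (s - z.re) ^ 2 := by have : s - z.re ≠ 0 := sub_ne_zero.2 hs
                                         positivity
      nlinarith []
    exact nonneg_of_mul_nonneg_right h1 h2
  by_cases him : z.im = 0
  · have hzr : P.eval z.re = 0 := by
      have : z = ((z.re)) := by apply Complex.ext <;> simp [him]
      rw [this, show ((z.re)) = algebraMap ℝ ℂ z.re from rfl, Polynomial.aeval_algebraMap_apply] at hz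
      simpa using hz
    have hder : P.derivative.eval z.re = 0 :=
      IsLocalMin.hasDerivAt_eq_zero (Filter.Eventually.of_forall fun t => by rw [hzr]; exact hp t) (P.hasDerivAt z.re)
    have h2 := (Polynomial.one_lt_rootMultiplicity_iff_isRoot hP0).2 ⟨hzr, hder⟩
    obtain ⟨Q, hQ⟩ := (Polynomial.le_rootMultiplicity_iff hP0).1 h2
    refine fin z him.ge ⟨Q, ?_⟩
    rw [hQ]; have := Complex.sq_norm z; rw [Complex.normSq_apply, him] at this
    rw [this]; simp only [map_mul, map_add, map_ofNat, map_zero]; ring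
  · obtain ⟨Q, hQ⟩ := Polynomial.quadratic_dvd_of_aeval_eq_zero_im_ne_zero P hz him
    rcases lt_or_gt_of_ne him with h | h
    · exact fin (star z) (by simp; exact h.le) ⟨Q, by simpa using hQ⟩
    · exact fin z h.le ⟨Q, hQ⟩
theorem FR (hf : f.IsHomogeneous 4) {v m : ℛ} (hm : 0 < eval m f) (hp : ∀ t : ℝ, 0 ≤ eval (v + t • m) f) :
    ∃ z1 z2 : ℂ, 0 ≤ z1.im ∧ 0 ≤ z2.im ∧ IsRV f (rl v) (rl m) ![z1, star z1, z2, star z2] := by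
  obtain ⟨P, hd, h4, hP⟩ := line_poly hf v m
  have hn := le_antisymm hd (Polynomial.le_natDegree_of_ne_zero (by rw [h4]; exact hm.ne'))
  have hqd : ∀ z : ℂ, (Polynomial.X ^ 2 - Polynomial.C (2 * z.re) * Polynomial.X + Polynomial.C (‖z‖ ^ 2)).natDegree = 2 := by
    intro z; compute_degree!
  have hqm : ∀ z : ℂ, (Polynomial.X ^ 2 - Polynomial.C (2 * z.re) * Polynomial.X + Polynomial.C (‖z‖ ^ 2)).Monic := by
    intro z; monicity!
  obtain ⟨z1, i1, Q, e1, hQ⟩ := FRstep P (by omega) (fun t => by rw [hP]; exact hp t)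
  have hQd : Q.natDegree = 2 := by
    have := (hqm z1).natDegree_mul' (q := Q) (by rintro rfl; simp [e1] at hn)
    rw [← e1, hn, hqd] at this; omega
  obtain ⟨z2, i2, R, e2, hR⟩ := FRstep Q (by omega) hQ
  have hRd : R.natDegree = 0 := by
    have := (hqm z2).natDegree_mul' (q := R) (by grind)
    rw [← e2, hQd, hqd] at this; omega
  have hRc : R.coeff 0 = eval m f := by
    have hl : P.leadingCoeff = R.leadingCoeff := by
      rw [e1, e2, Polynomial.leadingCoeff_mul, Polynomial.leadingCoeff_mul, hqm, hqm]; simp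
    rw [Polynomial.leadingCoeff, Polynomial.leadingCoeff, hn, hRd, h4] at hl; exact hl.symm
  refine ⟨z1, z2, i1, i2, fun t => ?_⟩
  have hq : ∀ z t : ℂ, Polynomial.aeval t (Polynomial.X ^ 2 - Polynomial.C (2 * z.re) * Polynomial.X + Polynomial.C (‖z‖ ^ 2) : Polynomial ℝ) = (t - z) * (t - star z) := by
    intro z t
    have := Complex.mul_conj' z
    have h2 := Complex.add_conj z
    simp
    push_cast at h2 ⊢
    rw [← h2, ← this]; simp only [starRingEnd_apply]; ring
  have hA : ∀ t : ℂ, Polynomial.aeval t P = ev f (rl v + t • rl m) := by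
    have : P.map (algebraMap ℝ ℂ) = lpo f (rl v) (rl m) := by
      refine Polynomial.eq_of_infinite_eval_eq _ _ ((Set.infinite_range_of_injective Complex.ofReal_injective).mono ?_)
      rintro _ ⟨t, rfl⟩
      simp only [Set.mem_setOf_eq, lpo_eval]
      rw [Polynomial.eval_map, show (t) = algebraMap ℝ ℂ t from rfl, Polynomial.eval₂_at_apply, hP]
      have : rl v + (algebraMap ℝ ℂ t) • rl m = rl (v + t • m) := by ext i; simp [rl]
      rw [this, ev_rl]; rfl
    intro t; rw [← lpo_eval, ← this, Polynomial.eval_map_algebraMap]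
  rw [← hA, ev_rl, e1, e2, map_mul (Polynomial.aeval t), map_mul (Polynomial.aeval t), hq, hq, Polynomial.eq_C_of_natDegree_eq_zero hRd, Polynomial.aeval_C, hRc, Fin.prod_univ_four]
  simp; ring
theorem FR_uniq {z1 z2 z1' z2' : ℂ} (h1 : 0 ≤ z1.im) (h2 : 0 ≤ z2.im) (h1' : 0 ≤ z1'.im) (h2' : 0 ≤ z2'.im)
    (h : ∀ t : ℂ, ∏ i, (t - (![z1, star z1, z2, star z2] : Fin 4 → ℂ) i) = ∏ i, (t - (![z1', star z1', z2', star z2'] : Fin 4 → ℂ) i)) :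
    (z1 = z1' ∧ z2 = z2') ∨ (z1 = z2' ∧ z2 = z1') := by
  have hm := roots_perm h
  have e : ∀ a b c d : ℂ, (Finset.univ : Finset (Fin 4)).val.map (![a, b, c, d] : Fin 4 → ℂ) = a ::ₘ b ::ₘ {c, d} := fun a b c d => rfl
  rw [e, e] at hm
  have key : ∀ a b : ℂ, 0 ≤ a.im → 0 ≤ b.im → a = star b → a = b := by
    intro a b ha hb h
    have h1 := congrArg Complex.im h
    have h2 := congrArg Complex.re h
    simp at h1 h2
    apply Complex.ext <;> linarith
  have two : ∀ a b : ℂ, 0 ≤ a.im → 0 ≤ b.im → ({a, star a} : Multiset ℂ) = {b, star b} → a = b := by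
    intro a b ha hb hh
    have : a ∈ ({b, star b} : Multiset ℂ) := by rw [← hh]; simp
    simp at this
    rcases this with h | h
    · exact h
    · exact key _ _ ha hb h
  have mem : z1 ∈ z1' ::ₘ star z1' ::ₘ ({z2', star z2'}) := by rw [← hm]; simp
  have c : z1 = z1' ∨ z1 = z2' := by
    simp at mem
    rcases mem with h | h | h | h
    · exact Or.inl h
    · exact Or.inl (key _ _ h1 h1' h)
    · exact Or.inr h
    · exact Or.inr (key _ _ h1 h2' h)
  rcases c with rfl | rfl
  · left; refine ⟨rfl, two _ _ h2 h2' ?_⟩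
    rwa [Multiset.cons_inj_right, Multiset.cons_inj_right] at hm
  · right; refine ⟨rfl, two _ _ h2 h1' ?_⟩
    rw [show z1' ::ₘ star z1' ::ₘ ({z1, star z1}) = z1 ::ₘ star z1 ::ₘ {z1', star z1'} by
      rw [show ({z1, star z1}) = {z1} + {star z1} from rfl, show ({z1', star z1'}) = {z1'} + {star z1'} from rfl]
      simp only [← Multiset.singleton_add]; abel] at hm
    rwa [Multiset.cons_inj_right, Multiset.cons_inj_right] at hm
theorem SP (hf : f.IsHomogeneous 4) {T : Type*} [TopologicalSpace T] {v m : T → ℛ} (hv : Continuous v) (hm : Continuous m)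
    (h0 : ∀ t, 0 < eval (m t) f) (hp : ∀ x, ∀ t : ℝ, 0 ≤ eval (v x + t • m x) f) :
    ∃ S Q : T → ℂ, Continuous S ∧ Continuous Q ∧ ∀ x, ∃ z1 z2 : ℂ, 0 ≤ z1.im ∧ 0 ≤ z2.im ∧ z1 + z2 = S x ∧ z1 * z2 = Q x ∧
      IsRV f (rl (v x)) (rl (m x)) ![z1, star z1, z2, star z2] := by
  choose z1 z2 i1 i2 hz using fun x => FR hf (h0 x) (hp x)
  have hrl : Continuous rl := by unfold rl; fun_prop
  have key : ∀ x, ∀ U : Ultrafilter T, (U : Filter T) ≤ 𝓝 x → Tendsto (fun y => (z1 y + z2 y, z1 y * z2 y)) U (𝓝 (z1 x + z2 x, z1 x * z2 x)) := by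
    intro x U hU
    obtain ⟨w0, hw, hr⟩ := rv_lim hf U ((hrl.comp hv).continuousAt.tendsto.mono_left hU) ((hrl.comp hm).continuousAt.tendsto.mono_left hU)
      (by change ev f (rl (m x)) ≠ 0; rw [ev_rl]; exact_mod_cast (h0 x).ne') hz
    have hi := fun i => (tendsto_pi_nhds.1 hw) i
    have t1 : Tendsto z1 U (𝓝 (w0 0)) := by simpa using hi 0
    have t2 : Tendsto z2 U (𝓝 (w0 2)) := by simpa using hi 2
    have t1' : Tendsto (fun y => star (z1 y)) U (𝓝 (w0 1)) := by simpa using hi 1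
    have t2' : Tendsto (fun y => star (z2 y)) U (𝓝 (w0 3)) := by simpa using hi 3
    have e1 := tendsto_nhds_unique t1' (t1.star)
    have e2 := tendsto_nhds_unique t2' (t2.star)
    have hw0 : w0 = ![w0 0, star (w0 0), w0 2, star (w0 2)] := by
      ext i; fin_cases i <;> simp [e1, e2]
    have p1 : 0 ≤ (w0 0).im := ge_of_tendsto ((Complex.continuous_im.tendsto _).comp t1) (Eventually.of_forall i1)
    have p2 : 0 ≤ (w0 2).im := ge_of_tendsto ((Complex.continuous_im.tendsto _).comp t2) (Eventually.of_forall i2)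
    rw [hw0] at hr
    have := (t1.add t2).prodMk_nhds (t1.mul t2)
    convert this using 2
    have hne : ev f (rl (m x)) ≠ 0 := by rw [ev_rl]; exact_mod_cast (h0 x).ne'
    rcases FR_uniq (i1 x) (i2 x) p1 p2 (rv_perm hne (hz x) hr) with ⟨a, b⟩ | ⟨a, b⟩
    · rw [a, b]
    · rw [a, b, add_comm, mul_comm]
  have hc := continuous_iff_ultrafilter.2 fun x U hU => key x U hU
  exact ⟨_, _, hc.fst, hc.snd, fun x => ⟨z1 x, z2 x, i1 x, i2 x, rfl, rfl, hz x⟩⟩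
theorem sinlem {θ : ℝ → ℝ} (hc : Continuous θ) {a b : ℝ} (hab : a < b) (hs : ∀ x, a < x → x < b → Real.sin (θ x) < 0)
    (ha : Real.cos (θ a) = 1) (hb : Real.cos (θ b) = -1) : θ b = θ a - Real.pi := by
  obtain ⟨k, hk⟩ := (Real.cos_eq_one_iff _).1 ha
  have pi := Real.pi_gt_three
  have hs' : ∀ x, a ≤ x → x ≤ b → Real.sin (θ x) ≤ 0 := by
    intro x h1 h2
    have : closure (Set.Ioo a b) ⊆ {x | Real.sin (θ x) ≤ 0} :=
      (isClosed_le (Real.continuous_sin.comp hc) continuous_const).closure_subset_iff.2 fun x hx => (hs x hx.1 hx.2).le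
    rw [closure_Ioo hab.ne] at this
    exact this ⟨h1, h2⟩
  have no : ∀ u, 0 < u → u < Real.pi → ∀ j : ℤ, ∀ x, a ≤ x → x ≤ b → θ x ≠ u + j * (2 * Real.pi) := by
    intro u h0 h1 j x hx hx' e
    have := hs' x hx hx'
    rw [e, Real.sin_add_int_mul_two_pi] at this
    linarith [Real.sin_pos_of_pos_of_lt_pi h0 h1]
  have up : θ b ≤ θ a := by
    by_contra h; push Not at h
    have hm : min (θ b) (θ a + 1) ∈ Set.Icc (θ a) (θ b) := ⟨le_min h.le (by linarith), min_le_left _ _⟩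
    obtain ⟨x, hx, e⟩ := intermediate_value_Icc hab.le hc.continuousOn hm
    refine no (min (θ b) (θ a + 1) - θ a) (by grind) (by grind) k x hx.1 hx.2 ?_
    rw [e, hk]; ring
  have dn : θ a - Real.pi ≤ θ b := by
    by_contra h; push Not at h
    have hm : max (θ b) (θ a - Real.pi - 1) ∈ Set.Icc (θ b) (θ a) := ⟨le_max_left _ _, max_le up (by linarith)⟩
    obtain ⟨x, hx, e⟩ := intermediate_value_Icc' hab.le hc.continuousOn hm
    have := le_max_right (θ b) (θ a - Real.pi - 1)
    have h3 : max (θ b) (θ a - Real.pi - 1) < θ a - Real.pi := max_lt h (by linarith)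
    refine no (max (θ b) (θ a - Real.pi - 1) - θ a + 2 * Real.pi) (by linarith) (by linarith) (k - 1) x hx.1 hx.2 ?_
    push_cast; linarith
  have : Real.cos (θ a - θ b) = Real.cos Real.pi := by
    rw [Real.cos_sub, Real.sin_eq_zero_iff_cos_eq.2 (Or.inl ha), ha, hb]; simp
  linarith [Real.injOn_cos ⟨by linarith, by linarith⟩ ⟨by linarith, le_rfl⟩ this]
def pt (α β t : ℝ) : ℛ := ![α * t + β, t, 1]
def vβ (β : ℝ) : ℛ := ![β, 0, 1]
def mα (α : ℝ) : ℛ := ![α, 1, 0]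
theorem pt_eq (α β t : ℝ) : pt α β t = vβ β + t • mα α := by
  ext i; fin_cases i <;> simp [pt, vβ, mα]; ring
theorem first_zero {ψ : ℝ → ℝ} (hc : Continuous ψ) (h0 : ψ 0 < 0) (h1 : ∃ a, 0 < a ∧ 0 ≤ ψ a) :
    ∃ a, 0 < a ∧ ψ a = 0 ∧ ∀ x, 0 ≤ x → x < a → ψ x < 0 := by
  obtain ⟨a1, ha1, hψ⟩ := h1
  let A := {x | 0 ≤ x ∧ 0 ≤ ψ x}
  have hA : IsClosed A := (isClosed_le continuous_const continuous_id).inter (isClosed_le continuous_const hc)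
  have hb : BddBelow A := ⟨0, fun x hx => hx.1⟩
  have hm := hA.csInf_mem ⟨a1, ha1.le, hψ⟩ hb
  have hlt : ∀ x, 0 ≤ x → x < sInf A → ψ x < 0 := by
    intro x hx hx'
    by_contra h
    exact absurd (csInf_le hb ⟨hx, not_lt.1 h⟩) (not_le.2 hx')
  have hp : 0 < sInf A := lt_of_le_of_ne hm.1 (fun h => by grind)
  refine ⟨sInf A, hp, le_antisymm ?_ hm.2, hlt⟩
  have : closure (Set.Ico 0 (sInf A)) ⊆ {x | ψ x ≤ 0} := (isClosed_le hc continuous_const).closure_subset_iff.2 fun x hx => (hlt x hx.1 hx.2).le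
  rw [closure_Ico hp.ne] at this
  exact this ⟨hp.le, le_rfl⟩
structure Reg (f : 𝒫) (b1 b2 : ℝ → ℝ) (am ap : ℝ) : Prop where
  c1 : Continuous b1
  c2 : Continuous b2
  m0 : am < 0
  p0 : 0 < ap
  em : b1 am = b2 am
  ep : b1 ap = b2 ap
  lt : ∀ α, am < α → α < ap → b1 α < b2 α
  nn : ∀ α, am ≤ α → α ≤ ap → ∀ β, b1 α ≤ β → β ≤ b2 α → ∀ t, 0 ≤ eval (pt α β t) f
  k1 : ∀ α, am ≤ α → α ≤ ap → ∃ t, α * t + b1 α < 0 ∧ eval (pt α (b1 α) t) f = 0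
  k2 : ∀ α, am ≤ α → α ≤ ap → ∃ t, 0 < α * t + b2 α ∧ eval (pt α (b2 α) t) f = 0
  l1 : ∀ α β t, eval (pt α β t) f ≤ 0 → α * t + β < 0 → β ≤ b1 α
  l2 : ∀ α β t, eval (pt α β t) f ≤ 0 → 0 < α * t + β → b2 α ≤ β
  ne : ∀ α β t, eval (pt α β t) f ≤ 0 → α * t + β ≠ 0
  mp : ∀ α, 0 < eval (mα α) f
theorem reg_exists (hf : f.IsHomogeneous 4) (h : NN0 f) : ∃ b1 b2 am ap, Reg f b1 b2 am ap := by
  obtain ⟨h0, ⟨c, hc, Fc⟩, c', hc', Fc'⟩ := h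
  let φ : ℛ → Bool := fun v => decide (0 < v 0 * v 2)
  have hn : ∀ v ∈ NP f, v 0 * v 2 ≠ 0 := fun v hv e => not_le.2 (h0 v hv.1 e) hv.2
  have hφ : InvOn (NP f) φ := by
    refine ⟨dec_cont  (by fun_prop) hn, fun t ht v => ?_⟩
    simp  [φ]
    rw [show t * v 0 * (t * v 2) = t ^ 2 * (v 0 * v 2) by ring]
    exact mul_pos_iff_of_pos_left (by positivity)
  let w : ℛ →ₗ[ℝ] ℝ := LinearMap.proj 2
  let T := fun b => {v | (v ∈ NP f ∧ φ v = b) ∧ w v = 1}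
  have hT : ∀ b, IsCompact (T b) := fun b => T_comp hf hφ b fun v hv _ => right_ne_zero_of_mul (hn v hv)
  have hpt : ∀ α β t, pt α β t ≠ 0 := fun α β t e => by have := congrFun e 2; simp [pt] at this
  have inT : ∀ α β t, eval (pt α β t) f ≤ 0 → (α * t + β < 0 → pt α β t ∈ T false) ∧ (0 < α * t + β → pt α β t ∈ T true) := by
    intro α β t h
    refine ⟨fun hh => ⟨⟨⟨hpt _ _ _, h⟩, ?_⟩, ?_⟩, fun hh => ⟨⟨⟨hpt _ _ _, h⟩, ?_⟩, ?_⟩⟩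
    all_goals simp [φ, pt, w] <;> linarith
  have n1 : (T false).Nonempty := ⟨pt 0 (-c) 0, (inT _ _ _ (by simpa [pt] using Fc.le)).1 (by simpa using hc)⟩
  have n2 : (T true).Nonempty := ⟨pt 0 c' 0, (inT _ _ _ (by simpa [pt] using Fc'.le)).2 (by simpa using hc')⟩
  let g : ℝ → ℛ → ℝ := fun α v => v 0 - α * v 1
  have gc : Continuous ↿g := by
    fun_prop
  have gc' : ∀ α, Continuous (g α) := fun α => by fun_prop
  let b1 := fun α => sSup (g α '' T false)
  let b2 := fun α => sInf (g α '' T true)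
  have b1c : Continuous b1 := (hT false).continuous_sSup gc
  have b2c : Continuous b2 := (hT true).continuous_sInf gc
  have le1 : ∀ α, ∀ v ∈ T false, g α v ≤ b1 α := fun α v hv => le_csSup ((hT false).image (gc' α)).bddAbove ⟨v, hv, rfl⟩
  have le2 : ∀ α, ∀ v ∈ T true, b2 α ≤ g α v := fun α v hv => csInf_le ((hT true).image (gc' α)).bddBelow ⟨v, hv, rfl⟩
  have at1 : ∀ α, ∃ v ∈ T false, g α v = b1 α := fun α => ((hT false).image (gc' α)).sSup_mem (n1.image _)
  have at2 : ∀ α, ∃ v ∈ T true, g α v = b2 α := fun α => ((hT true).image (gc' α)).sInf_mem (n2.image _)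
  have vpt : ∀ b, ∀ v ∈ T b, ∀ α, v = pt α (g α v) (v 1) := by
    intro b v hv α
    have := hv.2; simp [w] at this
    ext i; fin_cases i <;> simp [pt, g, this]
  have s1 : ∀ v ∈ T false, v 0 < 0 := by
    intro v hv
    have h2 := hv.2; have h1 := hv.1.2; have := hn v hv.1.1
    simp [w] at h2; simp [φ, h2] at h1; simp [h2] at this
    exact lt_of_le_of_ne h1 this
  have s2 : ∀ v ∈ T true, 0 < v 0 := by
    intro v hv
    have h2 := hv.2; have h1 := hv.1.2
    simp [w] at h2; simpa [φ, h2] using h1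
  have gpt : ∀ α β t, g α (pt α β t) = β := by simp [g, pt]
  have l1 := fun α β t h h' => by
    simpa [gpt] using le1 α _ ((inT α β t h).1 h')
  have l2 := fun α β t h h' => by
    simpa [gpt] using le2 α _ ((inT α β t h).2 h')
  have ne : ∀ α β t, eval (pt α β t) f ≤ 0 → α * t + β ≠ 0 := by
    intro α β t h e
    exact hn _ ⟨hpt α β t, h⟩ (by simp [pt, e])
  have mp : ∀ α, 0 < eval (mα α) f := fun α => h0 _ (fun e => by have := congrFun e 1; simp [mα] at this) (by simp [mα])
  have hneg : ∀ α β t, eval (pt α β t) f < 0 → b1 α ≤ β → β ≤ b2 α → False := by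
    intro α β t h hb1 hb2
    have hcont : Continuous fun e : ℝ => eval (pt α (β + e) t) f := eval_cont.comp (by unfold pt; fun_prop)
    have hev : ∀ᶠ e in 𝓝 (0), eval (pt α (β + e) t) f < 0 := hcont.continuousAt.eventually_lt continuousAt_const (by simpa using h)
    have hev2 : ∀ᶠ e in 𝓝 (0), α * t + β < 0 → α * t + (β + e) < 0 := by
      by_cases hh : α * t + β < 0
      · have : Tendsto (fun e : ℝ => α * t + (β + e)) (𝓝 0) (𝓝 (α * t + (β + 0))) := Continuous.tendsto (by fun_prop) _
        filter_upwards [this.eventually (gt_mem_nhds (by simpa using hh))] with e he _ using he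
      · exact Eventually.of_forall fun e he => absurd he hh
    have hev3 : ∀ᶠ e in 𝓝 (0), 0 < α * t + β → 0 < α * t + (β + e) := by
      by_cases hh : 0 < α * t + β
      · have : Tendsto (fun e : ℝ => α * t + (β + e)) (𝓝 0) (𝓝 (α * t + (β + 0))) := Continuous.tendsto (by fun_prop) _
        filter_upwards [this.eventually (lt_mem_nhds (by simpa using hh))] with e he _ using he
      · exact Eventually.of_forall fun e he => absurd he hh
    obtain ⟨δ, hδ, hB⟩ := Metric.eventually_nhds_iff.1 ((hev.and hev2).and hev3)
    have p1 := hB (y := δ / 2) (by rw [Real.dist_eq, sub_zero, abs_of_pos] <;> linarith)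
    have p2 := hB (y := -(δ / 2)) (by rw [Real.dist_eq, sub_zero, abs_neg, abs_of_pos] <;> linarith)
    rcases lt_or_gt_of_ne (ne α β t h.le) with hh | hh
    · linarith [l1 α _ t p1.1.1.le (p1.1.2 hh)]
    · linarith [l2 α _ t p2.1.1.le (p2.2 hh)]
  have nn : ∀ α β, b1 α ≤ β → β ≤ b2 α → ∀ t, 0 ≤ eval (pt α β t) f := fun α β h h' t => by
    by_contra hh; exact hneg α β t (not_le.1 hh) h h'
  have z0 : b1 0 < b2 0 := by
    obtain ⟨v, hv, e⟩ := at1 0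
    obtain ⟨u, hu, e'⟩ := at2 0
    rw [← e, ← e']
    simpa [g] using (s1 v hv).trans (s2 u hu)
  have far : ∀ σ : ℝ, σ ≠ 0 → ∃ a, 0 < a ∧ 0 ≤ b1 (σ * a) - b2 (σ * a) := by
    intro σ hσ
    have e1 : ∀ᶠ e in 𝓝 (0), eval ![-c, -σ * e, 1] f < 0 :=
      (eval_cont.comp  (by fun_prop)).continuousAt.eventually_lt continuousAt_const (by simpa using Fc)
    have e2 : ∀ᶠ e in 𝓝 (0), eval ![c', σ * e, 1] f < 0 :=
      (eval_cont.comp  (by fun_prop)).continuousAt.eventually_lt continuousAt_const (by simpa using Fc')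
    obtain ⟨δ, hδ, hB⟩ := Metric.eventually_nhds_iff.1 (e1.and e2)
    have p := hB (y := δ / 2) (by rw [Real.dist_eq, sub_zero, abs_of_pos] <;> linarith)
    refine ⟨(c + c') / (σ ^ 2 * δ), by positivity, ?_⟩
    set a := (c + c') / (σ ^ 2 * δ) with ha
    have haδ : σ * a * (σ * (δ / 2)) = (c + c') / 2 := by rw [ha]; field_simp
    have q1 := l1 (σ * a) (-c + σ * a * (σ * (δ / 2))) (-σ * (δ / 2)) (by rw [show pt (σ * a) (-c + σ * a * (σ * (δ / 2))) (-σ * (δ / 2)) = ![-c, -σ * (δ / 2), 1] by simp [pt]]; exact p.1.le) (by linarith)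
    have q2 := l2 (σ * a) (c' - σ * a * (σ * (δ / 2))) (σ * (δ / 2)) (by rw [show pt (σ * a) (c' - σ * a * (σ * (δ / 2))) (σ * (δ / 2)) = ![c', σ * (δ / 2), 1] by simp [pt]]; exact p.2.le) (by linarith)
    linarith
  obtain ⟨ap, p0, ep, lp⟩ := first_zero (ψ := fun x => b1 x - b2 x) (b1c.sub b2c) (by simpa using z0) (by simpa using far 1 one_ne_zero)
  obtain ⟨am, m0, em, lm⟩ := first_zero (ψ := fun x => b1 (-x) - b2 (-x)) ((b1c.comp continuous_neg).sub (b2c.comp continuous_neg)) (by simpa using z0) (by simpa using far (-1) (by norm_num))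
  have lt : ∀ α, -am < α → α < ap → b1 α < b2 α := by
    intro α h1 h2
    rcases le_total 0 α with h | h
    · linarith [lp α h h2]
    · have := lm (-α) (by linarith) (by linarith); simp at this; linarith
  have le : ∀ α, -am ≤ α → α ≤ ap → b1 α ≤ b2 α := by
    intro α h1 h2
    rcases h1.eq_or_lt with h | h
    · rw [← h]; linarith
    rcases h2.eq_or_lt with h' | h'
    · rw [h']; linarith
    · exact (lt α h h').le
  refine ⟨b1, b2, -am, ap, b1c, b2c, by linarith, p0, by linarith, by linarith, lt, fun α _ _ β h h' => nn α β h h', ?_, ?_, l1, l2, ne, mp⟩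
  · intro α h1 h2
    obtain ⟨v, hv, e⟩ := at1 α
    have := vpt _ v hv α
    rw [e] at this
    have hs := s1 v hv
    refine ⟨v 1, by rw [← e]; simpa [g] using hs, ?_⟩
    refine le_antisymm ?_ (nn α _ le_rfl (le α h1 h2) _)
    rw [← this]; exact hv.1.1.2
  · intro α h1 h2
    obtain ⟨v, hv, e⟩ := at2 α
    have := vpt _ v hv α
    rw [e] at this
    have hs := s2 v hv
    refine ⟨v 1, by rw [← e]; simpa [g] using hs, ?_⟩
    refine le_antisymm ?_ (nn α _ (le α h1 h2) le_rfl _)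
    rw [← this]; exact hv.1.1.2
end
section
variable {f : 𝒫} {b1 b2 : ℝ → ℝ} {am ap : ℝ}
def RP (f : 𝒫) (α β : ℝ) (z1 z2 : ℂ) : Prop :=
  0 ≤ z1.im ∧ 0 ≤ z2.im ∧ IsRV f (rl (vβ β)) (rl (mα α)) ![z1, star z1, z2, star z2]
theorem RP.symm {α β : ℝ} {z1 z2 : ℂ} (h : RP f α β z1 z2) : RP f α β z2 z1 :=
  ⟨h.2.1, h.1, fun t => by rw [h.2.2 t, Fin.prod_univ_four, Fin.prod_univ_four]; simp; left; ring⟩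
theorem ev_pt (α β t : ℝ) : ev f (rl (vβ β) + (t : ℂ) • rl (mα α)) = ((eval (pt α β t) f : ℝ) : ℂ) := by
  rw [← ev_rl, pt_eq]; congr 1; ext i; simp [rl]
theorem RP.root {α β : ℝ} {z1 z2 : ℂ} (h : RP f α β z1 z2) (hm : 0 < eval (mα α) f) {t : ℝ} (ht : eval (pt α β t) f = 0) :
    z1 = (t : ℂ) ∨ z2 = (t : ℂ) := by
  have h1 := h.2.2 t
  rw [ev_pt, ht, ev_rl] at h1
  have h2 : ((eval (mα α) f) : ℂ) ≠ 0 := by exact_mod_cast hm.ne'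
  have h3 : ((t) - z1) * (t - star z1) * (t - z2) * (t - star z2) = 0 := by
    rw [Fin.prod_univ_four] at h1
    simpa [hm.ne'] using h1.symm
  have st : ∀ z : ℂ, (t) - star z = 0 → z = t := by
    intro z hz
    have := congrArg star (sub_eq_zero.1 hz)
    simpa using this.symm
  grind
theorem RP.real {α β : ℝ} {z1 z2 : ℂ} (h : RP f α β z1 z2) (hz : z1.im = 0) : eval (pt α β z1.re) f = 0 := by
  have e : ((z1.re)) = z1 := by apply Complex.ext <;> simp [hz]
  have h1 := h.2.2 z1.re
  rw [ev_pt, Fin.prod_univ_four, e] at h1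
  simpa using h1
theorem Reg.le (hR : Reg f b1 b2 am ap) {α : ℝ} (h1 : am ≤ α) (h2 : α ≤ ap) : b1 α ≤ b2 α := by
  rcases h1.eq_or_lt with h | h
  · rw [← h, hR.em]
  rcases h2.eq_or_lt with h' | h'
  · rw [h', hR.ep]
  · exact (hR.lt α h h').le
theorem sin0const {θ : ℝ → ℝ} (hc : Continuous θ) (h : ∀ t, Real.sin (θ t) = 0) (a b : ℝ) : θ a ≤ θ b := by
  by_contra hlt; push Not at hlt
  have pi := Real.pi_gt_three
  obtain ⟨x, hx⟩ := mem_range_of_exists_le_of_exists_ge hc (c := min (θ a) (θ b + 1)) ⟨b, le_min hlt.le (by linarith)⟩ ⟨a, min_le_left _ _⟩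
  have h1 : Real.sin (θ x - θ b) = 0 := by rw [Real.sin_sub, h, h]; ring
  have h2 : θ b < min (θ a) (θ b + 1) := lt_min hlt (by linarith)
  have h3 := min_le_right (θ a) (θ b + 1)
  linarith [Real.sin_pos_of_pos_of_lt_pi (x := θ x - θ b) (by linarith) (by linarith)]
theorem sgn_const {g : ℝ → ℝ} (hg : Continuous g) {a b x y : ℝ} (h : ∀ x, a < x → x < b → g x ≠ 0) (hx : a < x ∧ x < b) (h0 : g x < 0)
    (hy : a < y ∧ y < b) : g y < 0 := by
  by_contra hh
  obtain ⟨z, hz, e⟩ := isPreconnected_Ioo.intermediate_value  hx hy hg.continuousOn ⟨h0.le, not_lt.1 hh⟩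
  exact h z hz.1 hz.2 e
theorem cl_Icc {g : ℝ → ℝ} (hg : Continuous g) {a b : ℝ} (hab : a < b) (h : ∀ x, a < x → x < b → g x ≤ 0) : g a ≤ 0 ∧ g b ≤ 0 := by
  have : closure (Set.Ioo a b) ⊆ {x | g x ≤ 0} := (isClosed_le hg continuous_const).closure_subset_iff.2 fun x hx => h x hx.1 hx.2
  rw [closure_Ioo hab.ne] at this
  exact ⟨this ⟨le_rfl, hab.le⟩, this ⟨hab.le, le_rfl⟩⟩
theorem core_aux (hR : Reg f b1 b2 am ap) {B : ℝ × ℝ → ℝ} {A : ℝ → ℝ} (hBc : Continuous B) (hAc : Continuous A) (hA : ∀ x, am ≤ x → x ≤ ap → A x = x)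
    (hB0 : ∀ x, am ≤ x → x ≤ ap → B (x, 0) = b1 x) (hB1 : ∀ x, am ≤ x → x ≤ ap → B (x, 1) = b2 x)
    (hBe : ∀ t x, x = am ∨ x = ap → B (x, t) = b1 x) {S l : ℝ × ℝ → ℂ} (hS : Continuous S) (hl : Continuous l)
    (hZ : ∀ p, RP f (A p.1) (B p) ((S p + Complex.exp (l p)) / 2) ((S p - Complex.exp (l p)) / 2))
    (H : ∀ x, am < x → x < ap → ∀ t, ¬ (((S (x, t) + Complex.exp (l (x, t))) / 2).im = 0 ∧ ((S (x, t) - Complex.exp (l (x, t))) / 2).im = 0))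
    (h0 : (Complex.exp (l (0, 0))).im < 0) : False := by
  set E : ℝ × ℝ → ℂ := fun p => Complex.exp (l p) with hE
  set Z1 : ℝ × ℝ → ℂ := fun p => (S p + E p) / 2 with hZ1
  set Z2 : ℝ × ℝ → ℂ := fun p => (S p - E p) / 2 with hZ2
  have EZ : ∀ p, E p = Z1 p - Z2 p := fun p => by ring
  have Ei : ∀ p, (E p).im = (Z1 p).im - (Z2 p).im := fun p => by rw [EZ]; simp
  have Er : ∀ p, (E p).re = (Z1 p).re - (Z2 p).re := fun p => by rw [EZ]; simp
  have m0 := hR.m0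
  have p0 := hR.p0
  have hmp : am < ap := m0.trans p0
  have edge : ∀ t, (∀ x, am < x → x < ap → ∃ s, eval (pt x (B (x, t)) s) f = 0) → (∀ x, am < x → x < ap → (E (x, t)).im ≠ 0) ∧
      ∀ x, am < x → x < ap → (E (x, t)).im < 0 → ∀ s, eval (pt x (B (x, t)) s) f = 0 → Z1 (x, t) = (s) := by
    intro t ht
    have key : ∀ x, am < x → x < ap → ∀ s, eval (pt x (B (x, t)) s) f = 0 → Z1 (x, t) = (s) ∨ Z2 (x, t) = (s) := by
      intro x h1 h2 s hs
      have := hZ (x, t)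
      simp  [hA x h1.le h2.le] at this
      exact this.root (hR.mp x) hs
    refine ⟨fun x h1 h2 h3 => ?_, fun x h1 h2 h3 s hs => ?_⟩
    · obtain ⟨s, hs⟩ := ht x h1 h2
      refine H x h1 h2 t ?_
      rw [Ei] at h3
      rcases key x h1 h2 s hs with h | h
      · have : (Z1 (x, t)).im = 0 := by rw [h]; simp
        exact ⟨this, by linarith⟩
      · have : (Z2 (x, t)).im = 0 := by rw [h]; simp
        exact ⟨by linarith, this⟩
    · rcases key x h1 h2 s hs with h | h
      · exact h
      · have h4 : (Z2 (x, t)).im = 0 := by rw [h]; simp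
        rw [Ei] at h3
        linarith [(hZ (x, t)).1]
  have e0 := edge 0 (fun x h1 h2 => by rw [hB0 x h1.le h2.le]; obtain ⟨t, -, h⟩ := hR.k1 x h1.le h2.le; exact ⟨t, h⟩)
  have e1 := edge 1 (fun x h1 h2 => by rw [hB1 x h1.le h2.le]; obtain ⟨t, -, h⟩ := hR.k2 x h1.le h2.le; exact ⟨t, h⟩)
  have Exc : ∀ t, Continuous fun x : ℝ => (E (x, t)).im := fun t => by fun_prop
  have bot : ∀ x, am < x → x < ap → (E (x, 0)).im < 0 := fun x h1 h2 => sgn_const (Exc 0) e0.1 ⟨m0, p0⟩ h0 ⟨h1, h2⟩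
  have botl := cl_Icc (g := fun x => A x * (Z1 (x, 0)).re + B (x, 0)) (by fun_prop) hmp (fun x h1 h2 => by
    obtain ⟨t, h, ht⟩ := hR.k1 x h1.le h2.le
    rw [e0.2 x h1 h2 (bot x h1 h2) t (by rw [hB0 x h1.le h2.le]; exact ht), hA x h1.le h2.le, hB0 x h1.le h2.le]
    simpa using h.le)
  have corner : ∀ x, x = am ∨ x = ap → ∀ t, ∃ t1 t2 : ℝ, x * t1 + b1 x < 0 ∧ 0 < x * t2 + b1 x ∧
      ((Z1 (x, t) = t1 ∧ Z2 (x, t) = t2) ∨ (Z1 (x, t) = t2 ∧ Z2 (x, t) = t1)) := by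
    intro x hx t
    have hi : am ≤ x ∧ x ≤ ap := by rcases hx with rfl | rfl <;> constructor <;> linarith
    have hb : b1 x = b2 x := by grind
    obtain ⟨t1, q1, r1⟩ := hR.k1 x hi.1 hi.2
    obtain ⟨t2, q2, r2⟩ := hR.k2 x hi.1 hi.2
    rw [← hb] at q2 r2
    refine ⟨t1, t2, q1, q2, ?_⟩
    have hz := hZ (x, t)
    simp  [hA x hi.1 hi.2, hBe t x hx] at hz
    have hne : (t1 : ℂ) ≠ t2 := by intro e; rw [Complex.ofReal_inj] at e; rw [e] at q1; linarith
    rcases hz.root (hR.mp x) r1 with h | h <;> rcases hz.root (hR.mp x) r2 with h' | h'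
    · exact absurd (h.symm.trans h') hne
    · exact Or.inl ⟨h, h'⟩
    · exact Or.inr ⟨h', h⟩
    · exact absurd (h.symm.trans h') hne
  have creal : ∀ x, x = am ∨ x = ap → ∀ t, (E (x, t)).im = 0 ∧ (E (x, t)).re ≠ 0 := by
    intro x hx t
    obtain ⟨t1, t2, q1, q2, h⟩ := corner x hx t
    have hne : t1 - t2 ≠ 0 := by grind
    have hne' : t2 - t1 ≠ 0 := by grind
    rw [Ei, Er]
    rcases h with ⟨h, h'⟩ | ⟨h, h'⟩ <;> rw [h, h'] <;> simp [hne, hne']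
  have c0 : ∀ x, x = am ∨ x = ap → x * (E (x, 0)).re < 0 := by
    intro x hx
    obtain ⟨t1, t2, q1, q2, h⟩ := corner x hx 0
    have hb : x * (Z1 (x, 0)).re + b1 x ≤ 0 := by
      rw [← hBe 0 x hx]
      rcases hx with rfl | rfl
      · simpa [hA _ le_rfl hmp.le] using botl.1
      grind
    rw [Er]
    rcases h with ⟨h, h'⟩ | ⟨h, h'⟩
    · rw [h, h']; simp; linarith
    · rw [h] at hb; simp at hb; linarith
  have vert : ∀ x, x = am ∨ x = ap → x * (E (x, 1)).re < 0 := by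
    intro x hx
    have hx0 : x ≠ 0 := by grind
    refine sgn_const (g := fun t => x * (E (x, t)).re) (by fun_prop) (a := -1) (b := 2)  (fun t _ _ => mul_ne_zero hx0 (creal x hx t).2) (by norm_num) (c0 x hx) (by norm_num)
  have top : ∀ x, am < x → x < ap → 0 < (E (x, 1)).im := by
    by_contra hh; push Not at hh
    obtain ⟨x0, g1, g2, g3⟩ := hh
    have neg : ∀ x, am < x → x < ap → (E (x, 1)).im < 0 := fun x h1 h2 =>
      sgn_const (Exc 1) e1.1 ⟨g1, g2⟩ (lt_of_le_of_ne g3 (e1.1 x0 g1 g2)) ⟨h1, h2⟩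
    have tl := cl_Icc (g := fun x => -(A x * (Z1 (x, 1)).re + B (x, 1))) (by fun_prop) hmp (fun x h1 h2 => by
      obtain ⟨t, h, ht⟩ := hR.k2 x h1.le h2.le
      rw [e1.2 x h1 h2 (neg x h1 h2) t (by rw [hB1 x h1.le h2.le]; exact ht), hA x h1.le h2.le, hB1 x h1.le h2.le, Complex.ofReal_re]
      linarith)
    obtain ⟨t1, t2, q1, q2, h⟩ := corner ap (Or.inr rfl) 1
    have t2' := tl.2
    have v := vert ap (Or.inr rfl)
    rw [Er] at v
    simp only [hA _ hmp.le le_rfl, hBe 1 ap (Or.inr rfl)] at t2'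
    rcases h with ⟨h, h'⟩ | ⟨h, h'⟩
    · rw [h] at t2'; simp at t2'; linarith
    · rw [h, h'] at v; simp at v; linarith
  have eform : ∀ p, (E p).im = Real.exp (l p).re * Real.sin (l p).im ∧ (E p).re = Real.exp (l p).re * Real.cos (l p).im :=
    fun p => ⟨by simp  [hE, Complex.exp_im], by simp  [hE, Complex.exp_re]⟩
  have sin0 : ∀ x, x = am ∨ x = ap → ∀ t, Real.sin (l (x, t)).im = 0 := by
    grind
  have θv : ∀ x, x = am ∨ x = ap → (l (x, 0)).im = (l (x, 1)).im := by
    intro x hx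
    have hc : Continuous fun t => (l (x, t)).im := by fun_prop
    exact le_antisymm (sin0const hc (sin0 x hx) 0 1) (sin0const hc (sin0 x hx) 1 0)
  have cosm : ∀ t, am * (E (am, t)).re < 0 → Real.cos (l (am, t)).im = 1 := by
    intro t h
    have hp : 0 < Real.cos (l (am, t)).im := by
      rw [(eform _).2] at h
      exact pos_of_mul_pos_right (pos_of_mul_neg_right h m0.le) (Real.exp_pos _).le
    rcases Real.sin_eq_zero_iff_cos_eq.1 (sin0 am (Or.inl rfl) t) with h | h <;> [exact h; linarith]
  have cosp : ∀ t, ap * (E (ap, t)).re < 0 → Real.cos (l (ap, t)).im = -1 := by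
    intro t h
    have hp : Real.cos (l (ap, t)).im < 0 := by
      rw [(eform _).2] at h
      exact neg_of_mul_neg_right (neg_of_mul_neg_right h p0.le) (Real.exp_pos _).le
    rcases Real.sin_eq_zero_iff_cos_eq.1 (sin0 ap (Or.inr rfl) t) with h | h <;> [linarith; exact h]
  have r0 := sinlem (θ := fun x => (l (x, 0)).im) (by fun_prop) hmp (fun x h1 h2 => by
    have := bot x h1 h2; rw [(eform _).1] at this; exact neg_of_mul_neg_right this (Real.exp_pos _).le) (cosm 0 (c0 am (Or.inl rfl))) (cosp 0 (c0 ap (Or.inr rfl)))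
  have r1 := sinlem (θ := fun x => -(l (x, 1)).im) (by fun_prop) hmp (fun x h1 h2 => by
    have := top x h1 h2; rw [(eform _).1] at this; rw [Real.sin_neg]; linarith [pos_of_mul_pos_right this (Real.exp_pos _).le])
    (by rw [Real.cos_neg]; exact cosm 1 (vert am (Or.inl rfl))) (by rw [Real.cos_neg]; exact cosp 1 (vert ap (Or.inr rfl)))
  grind
theorem core (hf : f.IsHomogeneous 4) (hR : Reg f b1 b2 am ap) : ∃ α β, am < α ∧ α < ap ∧ b1 α ≤ β ∧ β ≤ b2 α ∧ ∃ z1 z2, RP f α β z1 z2 ∧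
    (z1 = z2 ∨ (z1.im = 0 ∧ z2.im = 0)) := by
  by_contra H; push Not at H
  have m0 := hR.m0
  have p0 := hR.p0
  let A := fun x => max am (min ap x)
  let τ : ℝ → ℝ := fun t => max 0 (min 1 t)
  let B : ℝ × ℝ → ℝ := fun p => (1 - τ p.2) * b1 (A p.1) + τ p.2 * b2 (A p.1)
  have c1 := hR.c1
  have c2 := hR.c2
  have Ac : Continuous A := by fun_prop
  have Bc : Continuous B := by fun_prop
  have A1 : ∀ x, am ≤ A x := fun x => le_max_left _ _
  have A2 : ∀ x, A x ≤ ap := fun x => max_le (by linarith) (min_le_left _ _)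
  have hA : ∀ x, am ≤ x → x ≤ ap → A x = x := fun x h1 h2 => by simp [A, h1, h2]
  have τ0 : ∀ t, 0 ≤ τ t := fun t => le_max_left _ _
  have τ1 : ∀ t, τ t ≤ 1 := fun t => max_le (by norm_num) (min_le_left _ _)
  have B1 : ∀ p, b1 (A p.1) ≤ B p := fun p => by nlinarith [hR.le (A1 p.1) (A2 p.1), τ0 p.2]
  have B2 : ∀ p, B p ≤ b2 (A p.1) := fun p => by nlinarith [hR.le (A1 p.1) (A2 p.1), τ1 p.2]
  obtain ⟨S, Q, Sc, Qc, hz⟩ := SP hf  (v := fun p => vβ (B p)) (m := fun p => mα (A p.1)) (by unfold vβ; fun_prop) (by unfold mα; fun_prop)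
    (fun p => hR.mp _) (fun p t => by rw [← pt_eq]; exact hR.nn _ (A1 _) (A2 _) _ (B1 p) (B2 p) t)
  replace hz : ∀ p, ∃ z1 z2 : ℂ, z1 + z2 = S p ∧ z1 * z2 = Q p ∧ RP f (A p.1) (B p) z1 z2 := fun p => by
    obtain ⟨z1, z2, h1, h2, h3, h4, h5⟩ := hz p; exact ⟨z1, z2, h3, h4, h1, h2, h5⟩
  have hBe : ∀ t x, x = am ∨ x = ap → B (x, t) = b1 x := by
    intro t x hx
    have : b1 x = b2 x := by rcases hx with rfl | rfl; exacts [hR.em, hR.ep]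
    grind
  have D0 : ∀ p, S p ^ 2 - 4 * Q p ≠ 0 := by
    intro p hp
    obtain ⟨z1, z2, h1, h2, h3⟩ := hz p
    have e : z1 = z2 := by
      grind
    by_cases hx : A p.1 = am ∨ A p.1 = ap
    · have hb : b1 (A p.1) = b2 (A p.1) := by rcases hx with h | h <;> rw [h]; exacts [hR.em, hR.ep]
      have hBB := le_antisymm (by rw [hb]; exact B2 p) (B1 p)
      obtain ⟨t1, q1, r1⟩ := hR.k1 _ (A1 p.1) (A2 p.1)
      obtain ⟨t2, q2, r2⟩ := hR.k2 _ (A1 p.1) (A2 p.1)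
      rw [← hb] at q2 r2
      rw [hBB, e] at h3
      have u1 := (h3.root (hR.mp _) r1).elim id id
      have u2 := (h3.root (hR.mp _) r2).elim id id
      rw [u1, Complex.ofReal_inj] at u2
      rw [u2] at q1; linarith
    grind
  obtain ⟨L, Lc, hL⟩ := exp_lift  (by fun_prop) D0
  have main : ∀ l : ℝ × ℝ → ℂ, Continuous l → (∀ p, Complex.exp (l p) ^ 2 = S p ^ 2 - 4 * Q p) → ¬ (Complex.exp (l (0, 0))).im < 0 := by
    intro l lc hl h0
    have hZ : ∀ p, RP f (A p.1) (B p) ((S p + Complex.exp (l p)) / 2) ((S p - Complex.exp (l p)) / 2) := by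
      intro p
      obtain ⟨z1, z2, h1, h2, h3⟩ := hz p
      have : Complex.exp (l p) ^ 2 = (z1 - z2) ^ 2 := by rw [hl, ← h1, ← h2]; ring
      rcases sq_eq_sq_iff_eq_or_eq_neg.1 this with h | h <;> rw [h, ← h1]
      · convert h3 using 1 <;> ring
      · convert h3.symm using 1 <;> ring
    refine core_aux hR Bc Ac hA (fun x h1 h2 => ?_) (fun x h1 h2 => ?_) hBe Sc lc hZ (fun x h1 h2 t h => ?_) h0
    · simp [B, τ, hA x h1 h2]
    · simp [B, τ, hA x h1 h2]
    · have hx := hA x h1.le h2.le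
      have hp := hZ (x, t)
      have g1 := B1 (x, t)
      have g2 := B2 (x, t)
      grind
  have n1 := main (fun p => L p / 2) (by fun_prop) (fun p => by rw [← Complex.exp_nat_mul, ← hL]; ring)
  have n2 := main (fun p => L p / 2 + Real.pi * Complex.I) (by fun_prop) (fun p => by
    rw [Complex.exp_add, Complex.exp_pi_mul_I, mul_neg_one, neg_sq, ← Complex.exp_nat_mul, ← hL]; ring)
  simp at n1 n2
  have him : (Complex.exp (L (0, 0) / 2)).im = 0 := le_antisymm n2 n1
  obtain ⟨z1, z2, h1, h2, h3⟩ := hz (0, 0)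
  have hx := hA 0 m0.le p0.le
  have hB0 : B (0, 0) = b1 0 := by simp [B, τ, hx]
  have g := H 0 (b1 0) m0 p0 le_rfl (hR.le m0.le p0.le) z1 z2 (by simpa  [hx, hB0] using h3)
  obtain ⟨t, -, ht⟩ := hR.k1 0 m0.le p0.le
  simp  [hx, hB0] at h3
  have e2 : Complex.exp (L (0, 0) / 2) ^ 2 = (z1 - z2) ^ 2 := by
    rw [← Complex.exp_nat_mul, show ((2 : ℕ)) * (L (0, 0) / 2) = L (0, 0) by ring, hL, ← h1, ← h2]; ring
  have e3 : z1.im - z2.im = 0 := by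
    rcases sq_eq_sq_iff_eq_or_eq_neg.1 e2 with h | h <;> rw [h] at him <;> simp at him <;> linarith
  rcases h3.root (hR.mp _) ht with h | h
  · have : z1.im = 0 := by rw [h]; simp
    exact g.2 this (by linarith)
  · have : z2.im = 0 := by rw [h]; simp
    exact g.2 (by linarith) this
end
section
variable {f : 𝒫} {b1 b2 : ℝ → ℝ} {am ap : ℝ}
def Wl (α β : ℝ) : Submodule ℝ ℛ := Submodule.span ℝ {vβ β, mα α}
theorem mem_Wl (α β : ℝ) (v : ℛ) : v ∈ Wl α β ↔ v 0 = α * v 1 + β * v 2 := by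
  rw [Wl, Submodule.mem_span_pair]
  constructor
  · rintro ⟨a, b, rfl⟩; simp [vβ, mα]; ring
  · intro h; refine ⟨v 2, v 1, ?_⟩
    ext i; fin_cases i <;> simp [vβ, mα, h]; ring
theorem li_vm (α β : ℝ) : LinearIndependent ℝ ![vβ β, mα α] := by
  rw [LinearIndependent.pair_iff]
  intro s t h
  have h1 := congrFun h 1; have h2 := congrFun h 2
  simp [vβ, mα] at h1 h2; exact ⟨h2, h1⟩
theorem bit_of (hf : f.IsHomogeneous 4) {v m : ℛ} {a b : ℝ} (hm : eval m f ≠ 0) (h : ∀ t : ℝ, eval (v + t • m) f = eval m f * (a + b * t + t ^ 2) ^ 2) :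
    Bit f v m := by
  refine ⟨a, b, 1, eval m f, by simp, hm, fun s t => ?_⟩
  by_cases hs : s = 0
  · simp [hs, eval_smul4 hf]; ring
  · rw [show s • v + t • m = s • (v + (t / s) • m) by rw [smul_add, smul_smul, mul_div_cancel₀ _ hs], eval_smul4 hf, h]
    field_simp
theorem RP.bit (hf : f.IsHomogeneous 4) {α β : ℝ} {z1 z2 : ℂ} (h : RP f α β z1 z2) (hm : 0 < eval (mα α) f) (hz : z1 = z2 ∨ (z1.im = 0 ∧ z2.im = 0)) :
    IsRealBitangent f (Wl α β) := by
  rw [Wl, bit_iff (li_vm α β)]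
  have key : ∀ t : ℝ, ((eval (vβ β + t • mα α) f)) = eval (mα α) f * (((t) - z1) * (t - star z1) * ((t - z2) * (t - star z2))) := by
    intro t
    rw [← pt_eq, ← ev_pt, h.2.2, ev_rl, Fin.prod_univ_four]; simp; left; ring
  rcases hz with rfl | ⟨i1, i2⟩
  · refine bit_of hf hm.ne' (a := z1.re ^ 2 + z1.im ^ 2) (b := -2 * z1.re) fun t => ?_
    apply Complex.ofReal_injective
    rw [key t]
    have e : ((t) - z1) * (t - star z1) = ((z1.re ^ 2 + z1.im ^ 2 + -2 * z1.re * t + t ^ 2 : ℝ)) := by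
      apply Complex.ext <;> simp [pow_two] <;> ring
    rw [e]; push_cast; ring
  · have e1 : z1 = (z1.re) := by apply Complex.ext <;> simp [i1]
    have e2 : z2 = (z2.re) := by apply Complex.ext <;> simp [i2]
    refine bit_of hf hm.ne' (a := z1.re * z2.re) (b := -(z1.re + z2.re)) fun t => ?_
    apply Complex.ofReal_injective
    rw [key t, e1, e2]
    simp; left; ring
theorem NB (hf : f.IsHomogeneous 4) (h : NN0 f) : ∃ α β : ℛ, Function.Injective α ∧ ∀ i, IsRealBitangent f (Wl (α i) (β i)) ∧
    (∀ c : ℝ, 0 < c → eval ![-c, 0, 1] f < 0 → -c < β i) ∧ ∀ c : ℝ, 0 < c → eval ![c, 0, 1] f < 0 → β i < c := by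
  obtain ⟨b1, b2, am, ap, hR⟩ := reg_exists hf h
  have m0 := hR.m0
  have p0 := hR.p0
  have bd : ∀ α β, am ≤ α → α ≤ ap → b1 α ≤ β → β ≤ b2 α → (∀ c : ℝ, 0 < c → eval ![-c, 0, 1] f < 0 → -c < β) ∧ ∀ c : ℝ, 0 < c → eval ![c, 0, 1] f < 0 → β < c := by
    intro α β h1 h2 h3 h4
    have n := hR.nn α h1 h2 β h3 h4 0
    constructor
    · intro c hc hF
      have := hR.l1 α (-c) 0 (by simpa [pt] using hF.le) (by simpa using hc)
      refine lt_of_le_of_ne (this.trans h3) ?_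
      rintro rfl
      simp [pt] at n; linarith
    · intro c hc hF
      have := hR.l2 α c 0 (by simpa [pt] using hF.le) (by simpa using hc)
      refine lt_of_le_of_ne (h4.trans this) ?_
      rintro rfl
      simp [pt] at n; linarith
  have en : ∀ x, x = am ∨ x = ap → IsRealBitangent f (Wl x (b1 x)) := by
    intro x hx
    have hi : am ≤ x ∧ x ≤ ap := by grind
    have hb : b1 x = b2 x := by rcases hx with rfl | rfl; exacts [hR.em, hR.ep]
    obtain ⟨t1, q1, r1⟩ := hR.k1 x hi.1 hi.2
    obtain ⟨t2, q2, r2⟩ := hR.k2 x hi.1 hi.2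
    rw [← hb] at q2 r2
    obtain ⟨z1, z2, hz⟩ := FR hf (hR.mp x) (fun t => by rw [← pt_eq]; exact hR.nn x hi.1 hi.2 (b1 x) le_rfl hb.le t)
    replace hz : RP f x (b1 x) z1 z2 := hz
    have hne : (t1 : ℂ) ≠ t2 := by intro e; rw [Complex.ofReal_inj] at e; rw [e] at q1; linarith
    refine hz.bit hf (hR.mp x) (Or.inr ?_)
    rcases hz.root (hR.mp x) r1 with h | h <;> rcases hz.root (hR.mp x) r2 with h' | h'
    · exact absurd (h.symm.trans h') hne
    · simp [h, h']
    · simp [h, h']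
    · exact absurd (h.symm.trans h') hne
  obtain ⟨α, β, h1, h2, h3, h4, z1, z2, hz, hh⟩ := core hf hR
  refine ⟨![am, α, ap], ![b1 am, β, b1 ap], ?_, ?_⟩
  · intro i j; fin_cases i <;> fin_cases j <;> simp <;> intro e <;> linarith
  · intro i; fin_cases i
    · exact ⟨en am (Or.inl rfl), bd _ _ le_rfl (by linarith) le_rfl hR.em.le⟩
    · exact ⟨hz.bit hf (hR.mp α) hh, bd _ _ h1.le h2.le h3 h4⟩
    · exact ⟨en ap (Or.inr rfl), bd _ _ (by linarith) le_rfl le_rfl hR.ep.le⟩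
def Ms : Matrix (Fin 3) (Fin 3) ℝ := !![0, 0, 1; 0, 1, 0; 1, 0, 0]
theorem Ms_inv : Ms * Ms = 1 := by
  ext i j; fin_cases i <;> fin_cases j <;> simp [Ms]
theorem Ms_mul (v : ℛ) : Ms.mulVec v = ![v 2, v 1, v 0] := by
  ext i; fin_cases i <;> simp [Ms, dotProduct, Fin.sum_univ_three]
theorem sw_eval (v : ℛ) : eval v (cg f Ms 1) = eval ![v 2, v 1, v 0] f := by rw [eval_cg, Ms_mul, one_mul]
theorem sw_c (hf : f.IsHomogeneous 4) {c : ℝ} (hc : c ≠ 0) (h : eval ![c, 0, 1] f < 0) : eval ![c⁻¹, 0, 1] (cg f Ms 1) < 0 := by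
  rw [sw_eval]
  have : (![c, 0, 1] : ℛ) = c • ![1, 0, c⁻¹] := by simp [hc]
  rw [this, eval_smul4 hf] at h
  have h2 := neg_of_mul_neg_right h (by positivity)
  simpa using h2
theorem NN0_sw (hf : f.IsHomogeneous 4) (h : NN0 f) : NN0 (cg f Ms 1) := by
  obtain ⟨h0, ⟨c, hc, Fc⟩, c', hc', Fc'⟩ := h
  refine ⟨fun v hv e => ?_, ⟨c⁻¹, inv_pos.2 hc, ?_⟩, c'⁻¹, inv_pos.2 hc', sw_c hf hc'.ne' Fc'⟩
  · rw [sw_eval]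
    refine h0 _ (fun h => hv ?_) (by simpa [mul_comm] using e)
    ext i; fin_cases i; exacts [congrFun h 2, congrFun h 1, congrFun h 0]
  · have := sw_c hf (neg_ne_zero.2 hc.ne') Fc
    rwa [inv_neg] at this
theorem NN0_P1 (hf : IsSmoothQuartic f) (h : NN0 f) : ¬ P1 f := by
  intro h4
  obtain ⟨α, β, hi, hb⟩ := NB hf.1 h
  obtain ⟨α', β', hi', hb'⟩ := NB (cg_smooth Ms_inv one_ne_zero hf).1 (NN0_sw hf.1 h)
  obtain ⟨h0, ⟨c, hc, Fc⟩, c', hc', Fc'⟩ := h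
  have hfin := Nat.finite_of_card_ne_zero (by rw [show Nat.card _ = 4 from h4]; norm_num)
  let g : Fin 3 ⊕ Fin 3 → {W : Submodule ℝ ℛ // IsRealBitangent f W} :=
    Sum.elim (fun i => ⟨_, (hb i).1⟩) (fun i => ⟨_, cg_bit1 Ms_inv one_ne_zero (hb' i).1⟩)
  have inj1 : ∀ {a b a' b'}, Wl a b = Wl a' b' → a = a' := by
    intro a b a' b' e
    have : mα a ∈ Wl a' b' := by rw [← e, mem_Wl]; simp [mα]
    rw [mem_Wl] at this; simpa [mα] using this
  have hne : ∀ i j, Wl (α i) (β i) ≠ (Wl (α' j) (β' j)).map Ms.mulVecLin := by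
    intro i j e
    have : ![β i, 0, 1] ∈ (Wl (α' j) (β' j)).map Ms.mulVecLin := by rw [← e, mem_Wl]; simp
    obtain ⟨v, hv, e2⟩ := this
    have hv' := (mem_Wl _ _ _).1 hv
    rw [Matrix.mulVecLin_apply, Ms_mul] at e2
    have q0 := congrFun e2 0; have q1 := congrFun e2 1; have q2 := congrFun e2 2
    simp at q0 q1 q2
    rw [q0, q1, q2] at hv'
    have r1 := (hb i).2.1 c hc Fc
    have r2 := (hb i).2.2 c' hc' Fc'
    have s1 := (hb' j).2.1 c⁻¹ (inv_pos.2 hc) (by have := sw_c hf.1 (neg_ne_zero.2 hc.ne') Fc; rwa [inv_neg] at this)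
    have s2 := (hb' j).2.2 c'⁻¹ (inv_pos.2 hc') (sw_c hf.1 hc'.ne' Fc')
    have t1 : 0 < 1 + β' j * c := by have := mul_lt_mul_of_pos_right s1 hc; rw [neg_mul, inv_mul_cancel₀ hc.ne'] at this; linarith
    have t2 : 0 < 1 - β' j * c' := by have := mul_lt_mul_of_pos_right s2 hc'; rw [inv_mul_cancel₀ hc'.ne'] at this; linarith
    nlinarith
  have gi : Function.Injective g := by
    rintro (i | i) (j | j) e <;> have e' := congrArg Subtype.val e <;> simp  [g] at e'
    · rw [hi (inj1 e')]
    · exact absurd e' (hne i j)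
    · exact absurd e'.symm (hne j i)
    · have := congrArg (Submodule.map Ms.mulVecLin) e'
      rw [← Submodule.map_comp, ← Submodule.map_comp, ← Matrix.mulVecLin_mul, Ms_inv, Matrix.mulVecLin_one, Submodule.map_id, Submodule.map_id] at this
      rw [hi' (inj1 this)]
  have := Nat.card_le_card_of_injective g gi
  rw [show Nat.card {W : Submodule ℝ ℛ // IsRealBitangent f W} = 4 from h4] at this
  simp at this
def ballP : ↥(Metric.ball (0:EuclideanSpace ℝ (Fin 2)) 1) ≃ₜ ℝ × ℝ :=
  (Homeomorph.unitBall.symm.trans (EuclideanSpace.equiv (Fin 2) ℝ).toHomeomorph).trans Homeomorph.finTwoArrow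
theorem lv_ne (θ : ℝ) : (![0, Real.cos θ, Real.sin θ] : ℛ) ≠ 0 := by
  intro h
  have h1 := congrFun h 1; have h2 := congrFun h 2
  simp at h1 h2
  have := Real.sin_sq_add_cos_sq θ
  rw [h1, h2] at this; norm_num at this
theorem disk_line {D : Set RP2} (e : ↥D ≃ₜ ↥(Metric.ball (0:EuclideanSpace ℝ (Fin 2)) 1)) {q : ℛ} (hq0 : q 0 ≠ 0) (hq : q ≠ 0)
    (hqD : prj ⟨q, hq⟩ ∉ D) (hL : ∀ θ : ℝ, prj ⟨_, lv_ne θ⟩ ∈ D) : False := by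
  let g : ℛ → ℂ := fun w => ((w 1 * q 0 - w 0 * q 1 : ℝ)) + ((w 2 * q 0 - w 0 * q 2 : ℝ)) * Complex.I
  let H := fun w => g w ^ 2 / ((‖g w‖)) ^ 2
  have gs : ∀ (t : ℝ) w, g (t • w) = t * g w := by
    intro t w; simp only [g, Pi.smul_apply, smul_eq_mul]; push_cast; ring
  have g0 : ∀ w, (hw : w ≠ 0) → prj ⟨w, hw⟩ ∈ D → g w ≠ 0 := by
    intro w hw hD h
    have h1 := congrArg Complex.re h; have h2 := congrArg Complex.im h
    simp [g] at h1 h2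
    have hwq : w = (w 0 / q 0) • q := by
      ext i; fin_cases i <;> simp <;> field_simp <;> linarith
    have h0 : w 0 / q 0 ≠ 0 := fun h => hw (by rw [hwq, h, zero_smul])
    apply hqD
    rw [← prj_smul h0 (smul_ne_zero h0 hq) hq]
    convert hD using 3
    exact hwq.symm
  have Hs : ∀ (t : ℝ), t ≠ 0 → ∀ w, H (t • w) = H w := by
    intro t ht w
    simp only [H, gs, norm_mul, Complex.norm_real]
    push_cast
    rw [mul_pow, mul_pow, ← Complex.ofReal_pow ‖t‖, Real.norm_eq_abs, sq_abs, Complex.ofReal_pow, mul_div_mul_left]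
    simp_all
  have hrep : ∀ v, (hv : v ≠ 0) → H v = H (prj ⟨v, hv⟩).rep := by
    intro v hv
    obtain ⟨t, ht⟩ := Projectivization.exists_smul_eq_mk_rep ℝ v hv
    rw [show (prj ⟨v, hv⟩).rep = (t:ℝ) • v from ht.symm, Hs _ t.ne_zero]
  have hc : ContinuousOn (fun x : RP2 => H x.rep) D := by
    rw [contOn_prj qR D _ H (fun v hv _ => hrep v hv)]
    rintro w ⟨hw, hD⟩
    refine ContinuousAt.continuousWithinAt ?_
    refine ContinuousAt.div (by fun_prop) (by fun_prop) ?_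
    simpa using g0 w hw hD
  rw [continuousOn_iff_continuous_domRestrict] at hc
  let E := e.trans ballP
  obtain ⟨l, lc, hl⟩ := exp_lift (h := fun x => H (E.symm x).1.rep) (hc.comp E.symm.continuous) (by
    intro x
    obtain ⟨⟨v, hv⟩, hx⟩ := (qR).surjective (E.symm x).1
    rw [← hx, ← hrep]
    have := g0 v hv (hx ▸ (E.symm x).2)
    simp [H, this])
  let θl := fun θ => (l (E ⟨_, hL θ⟩)).im - 2 * θ
  have hcl : Continuous θl := by
    have : Continuous fun θ : ℝ => (⟨![0, Real.cos θ, Real.sin θ], lv_ne θ⟩ : {v : ℛ // v ≠ 0}) := by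
      fun_prop
    have h2 : Continuous fun θ : ℝ => (⟨_, hL θ⟩ : D) := Continuous.subtype_mk ((qR).continuous.comp this) _
    fun_prop
  have hex : ∀ θ : ℝ, Complex.exp (l (E ⟨_, hL θ⟩)) = Complex.exp (2 * θ * Complex.I) := by
    intro θ
    rw [hl, E.symm_apply_apply, ← hrep]
    have : g ![0, Real.cos θ, Real.sin θ] = q 0 * Complex.exp (θ * Complex.I) := by
      simp [g, Complex.exp_mul_I]; ring
    simp only [H, this, norm_mul, Complex.norm_exp_ofReal_mul_I, Complex.norm_real, mul_one, mul_pow]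
    rw [← Complex.ofReal_pow ‖q 0‖, Real.norm_eq_abs, sq_abs, Complex.ofReal_pow, mul_div_cancel_left₀ _ (by simpa using hq0), ← Complex.exp_nat_mul]
    ring_nf
  have hs : ∀ θ, Real.sin (θl θ) = 0 := by
    intro θ
    have h1 : Complex.exp (l (E ⟨_, hL θ⟩) - 2 * θ * Complex.I) = 1 := by
      rw [Complex.exp_sub, hex, div_self (Complex.exp_ne_zero _)]
    have h2 := congrArg Complex.im h1
    rw [Complex.exp_im] at h2
    simpa using h2
  have := sin0const hcl hs 0 Real.pi
  have hE : (⟨_, hL 0⟩ : D) = ⟨_, hL Real.pi⟩ := by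
    refine Subtype.ext ?_
    change prj _ = prj _
    rw [← prj_smul (t := (-1:ℝ)) (by norm_num) (smul_ne_zero (by norm_num) (lv_ne 0)) (lv_ne 0)]
    congr 2; ext i; fin_cases i <;> simp
  simp only [θl, hE] at this
  linarith [Real.pi_pos]
theorem two_same {S : Type*} [TopologicalSpace S] (h2 : Nat.card (ConnectedComponents S) = 2) {s : S → Bool} (hs : Continuous s) (hsu : Function.Surjective s)
    {x y : S} (h : s x = s y) : connectedComponent x = connectedComponent y := by
  have : Finite (ConnectedComponents S) := Nat.finite_of_card_ne_zero (by omega)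
  have hb : Function.Bijective hs.connectedComponentsLift := by
    rw [Nat.bijective_iff_surjective_and_card]
    refine ⟨fun b => ?_, by simp [h2]⟩
    obtain ⟨x, rfl⟩ := hsu b
    exact ⟨x, by simp⟩
  exact ConnectedComponents.coe_eq_coe.1 (hb.1 (by simpa using h))
theorem NN0_root (hf : f.IsHomogeneous 4) (h : NN0 f) : (∃ s : ℝ, s < 0 ∧ eval ![s, 0, 1] f = 0) ∧ ∃ s : ℝ, 0 < s ∧ eval ![s, 0, 1] f = 0 := by
  obtain ⟨h0, ⟨c, hc, hcn⟩, d, hd, hdn⟩ := h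
  have hp : 0 < eval ![(0), 0, 1] f := h0 _ (fun h => by simpa using congrFun h 2) (by simp)
  have hcont : Continuous fun s : ℝ => eval ![s, 0, 1] f := eval_cont.comp (by fun_prop)
  constructor
  · obtain ⟨s, hs, e⟩ := intermediate_value_Icc (by linarith) hcont.continuousOn ⟨hcn.le, hp.le⟩
    refine ⟨s, lt_of_le_of_ne hs.2 ?_, e⟩
    rintro rfl; linarith
  · obtain ⟨s, hs, e⟩ := intermediate_value_Icc' (by linarith) hcont.continuousOn ⟨hdn.le, hp.le⟩
    refine ⟨s, lt_of_le_of_ne hs.1 ?_, e⟩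
    rintro rfl; linarith
theorem NN0_P3 (hf : IsSmoothQuartic f) (h2 : Nat.card (ConnectedComponents ↥(realLocus f)) = 2) (h : NN0 f) : ¬ P3 f := by
  rintro ⟨x1, hx1, x2, hx2, hne, D, ⟨⟨y, hy, hD⟩, ⟨e⟩⟩, hs⟩
  let σ : RP2 → Bool := fun x => decide (0 < x.rep 0 * x.rep 2)
  have hσ : ∀ v, (hv : v ≠ 0) → σ (prj ⟨v, hv⟩) = decide (0 < v 0 * v 2) := by
    intro v hv
    obtain ⟨t, ht⟩ := Projectivization.exists_smul_eq_mk_rep ℝ v hv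
    simp only [σ]
    rw [show (prj ⟨v, hv⟩).rep = (t:ℝ) • v from ht.symm]
    simp only [Pi.smul_apply, smul_eq_mul]
    have : 0 < (t:ℝ)^2 := by have := t.ne_zero; positivity
    rw [decide_eq_decide, show (t) * v 0 * (t * v 2) = t^2 * (v 0 * v 2) by ring, mul_pos_iff_of_pos_left this]
  have hnz : ∀ v, (hv : v ≠ 0) → prj ⟨v, hv⟩ ∈ realLocus f → v 0 * v 2 ≠ 0 := by
    intro v hv h0 h1
    have := h.1 v hv h1
    rw [(rl_iff hf.1 ⟨v, hv⟩).1 h0] at this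
    exact lt_irrefl _ this
  have hcσ : ContinuousOn σ (realLocus f) := by
    rw [contOn_prj qR _ σ (fun v => decide (0 < v 0 * v 2)) (fun v hv _ => (hσ v hv).symm)]
    exact dec_cont (by fun_prop) (fun v hv => hnz v hv.1 hv.2)
  have hsu : Function.Surjective ((realLocus f).domRestrict σ) := by
    obtain ⟨⟨s, hs, e1⟩, t, ht, e2⟩ := NN0_root hf.1 h
    have n1 : ∀ s : ℝ, (![s, 0, 1] : ℛ) ≠ 0 := fun s h => by simpa using congrFun h 2
    intro b; cases b
    · refine ⟨⟨prj ⟨_, n1 s⟩, (rl_iff hf.1 ⟨_, n1 s⟩).2 e1⟩, ?_⟩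
      change σ _ = _; rw [hσ]; simp [hs.le]
    · refine ⟨⟨prj ⟨_, n1 t⟩, (rl_iff hf.1 ⟨_, n1 t⟩).2 e2⟩, ?_⟩
      change σ _ = _; rw [hσ]; simp [ht]
  have hne' : σ x1 ≠ σ x2 := by
    intro h
    apply hne
    have := two_same h2 (continuousOn_iff_continuous_domRestrict.1 hcσ) hsu (x := ⟨x1, hx1⟩) (y := ⟨x2, hx2⟩) h
    rw [ovalThrough, ovalThrough, connectedComponentIn_eq_image hx1, connectedComponentIn_eq_image hx2, this]
  have hO2 : ∀ x ∈ ovalThrough f x2, x ∈ realLocus f ∧ σ x = σ x2 := by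
    intro x hx
    have hsub : ovalThrough f x2 ⊆ realLocus f := connectedComponentIn_subset _ _
    exact ⟨hsub hx, isPreconnected_connectedComponentIn.constant (hcσ.mono hsub) hx (mem_connectedComponentIn hx2)⟩
  let ε : ℝ := if σ x2 then -1 else 1
  have hε : ε ≠ 0 := by simp only [ε]; split_ifs <;> norm_num
  let R : Set ℛ := {v | 0 ≤ v 0 ∧ 0 ≤ ε * v 2 ∧ v ≠ 0}
  have hRc : IsPreconnected R := by
    have h0 : (![1, 0, ε] : ℛ) ∈ R := by simp [R, mul_self_nonneg]
    have hst : StarConvex ℝ ![1, 0, ε] R := by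
      rw [starConvex_iff_forall_pos h0]
      rintro v ⟨h1, h2, h3⟩ a b ha hb hab
      refine ⟨by simp; positivity, ?_, fun h => ?_⟩
      · simp
        nlinarith [mul_nonneg ha.le (mul_self_nonneg ε)]
      · have := congrFun h 0
        simp at this; nlinarith []
    exact (hst.isPathConnected h0).isConnected.isPreconnected
  let Rp : Set RP2 := (fun v : {v : ℛ // v ≠ 0} => (prj v)) '' (Subtype.val ⁻¹' R)
  have hRp : IsPreconnected Rp := by
    refine IsPreconnected.image ?_ _ (qR).continuous.continuousOn
    refine (IsInducing.subtypeVal ).isPreconnected_image.1 ?_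
    convert hRc
    ext v
    exact ⟨fun ⟨w, h, e⟩ => e ▸ h, fun h => ⟨⟨v, h.2.2⟩, h, rfl⟩⟩
  have hRO : Rp ⊆ (ovalThrough f x2)ᶜ := by
    rintro _ ⟨⟨v, hv⟩, ⟨h1, h2', -⟩, rfl⟩ hx
    obtain ⟨h3, h4⟩ := hO2 _ hx
    have h5 := hnz v hv h3
    rw [hσ] at h4
    simp only [ε] at h2'
    cases hc : σ x2
    · simp only [hc] at h4 h2'
      simp at h4 h2'
      exact h5 (le_antisymm h4 (mul_nonneg h1 h2'))
    · simp only [hc] at h4 h2'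
      simp at h4 h2'
      nlinarith
  have hmem : ∀ v, (hv : v ≠ 0) → 0 ≤ ε * (v 0 * v 2) → prj ⟨v, hv⟩ ∈ Rp := by
    intro v hv h0
    have : ∃ t : ℝ, t ≠ 0 ∧ 0 ≤ t * v 0 ∧ 0 ≤ ε * (t * v 2) := by
      rcases lt_trichotomy (v 0) 0 with h | h | h
      · exact ⟨-1, by norm_num, by linarith, by nlinarith⟩
      · rcases le_total 0 (ε * v 2) with h' | h'
        · exact ⟨1, by norm_num, by linarith, by linarith⟩
        · exact ⟨-1, by norm_num, by linarith, by linarith⟩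
      · exact ⟨1, by norm_num, by linarith, by nlinarith⟩
    obtain ⟨t, ht, h1, h2⟩ := this
    exact ⟨⟨t • v, smul_ne_zero ht hv⟩, ⟨h1, h2, smul_ne_zero ht hv⟩, prj_smul ht _ hv⟩
  have hx1R : x1 ∈ Rp := by
    obtain ⟨⟨v, hv⟩, rfl⟩ := (qR).surjective x1
    apply hmem
    rw [hσ] at hne'
    simp only [ε]
    cases hc : σ x2
    · simp [hc] at hne' ⊢; exact hne'.le
    · simp [hc] at hne' ⊢; exact hne'
  have hx1D := hs (mem_connectedComponentIn hx1)
  have hRD : Rp ⊆ D := by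
    rw [hD] at hx1D ⊢
    rw [connectedComponentIn_eq hx1D]
    exact hRp.subset_connectedComponentIn hx1R hRO
  obtain ⟨⟨q, hq⟩, hqe⟩ := (qR).surjective x2
  refine disk_line e  (fun h => hnz q hq (hqe ▸ hx2) (by rw [h, zero_mul])) hq ?_ (fun θ => hRD (hmem _ _ (by simp)))
  rw [hqe, hD]
  intro hh
  exact connectedComponentIn_subset _ _ hh (mem_connectedComponentIn hx2)
def th (f : 𝒫) (x : ℛ) (z : 𝒞) : ℝ := nn z 0 * gr f x 0 + nn z 1 * gr f x 1 + nn z 2 * gr f x 2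
def crs (x g : ℛ) : ℛ := ![x 1 * g 2 - x 2 * g 1, x 2 * g 0 - x 0 * g 2, x 0 * g 1 - x 1 * g 0]
def dt {K : Type*} [CommRing K] (x z : Fin 3 → K) : K := x 0 * z 0 + x 1 * z 1 + x 2 * z 2
theorem dt_pos {x : ℛ} (hx : x ≠ 0) : 0 < dt x x := by
  rcases (by positivity : 0 ≤ x 0 ^ 2 + x 1 ^ 2 + x 2 ^ 2).lt_or_eq with h | h
  · simp  [dt]; linarith
  · exfalso; apply hx
    ext i; fin_cases i <;> simp <;> nlinarith
theorem orth0 {x g u : ℛ} (hx : x ≠ 0) (hg : g ≠ 0) (h : dt x g = 0) (h1 : dt x u = 0) (h2 : dt g u = 0) (h3 : dt (crs x g) u = 0) : u = 0 := by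
  have e : dt x x * dt g g * dt u u = dt g g * (dt x u) ^ 2 + dt x x * dt g u ^ 2 + dt (crs x g) u ^ 2 + dt x g * (dt x g * dt u u - 2 * dt x u * dt g u) := by
    simp [dt, crs]; ring
  rw [h, h1, h2, h3] at e
  by_contra hu
  have := mul_pos (mul_pos (dt_pos hx) (dt_pos hg)) (dt_pos hu)
  nlinarith
theorem dt_re (x : ℛ) (z : 𝒞) : (dt (rl x) z).re = dt x (fun i => (z i).re) ∧ (dt (rl x) z).im = dt x (fun i => (z i).im) := by
  simp [dt, rl]
theorem orth0c {x g : ℛ} {u : 𝒞} (hx : x ≠ 0) (hg : g ≠ 0) (h : dt x g = 0) (h1 : dt (rl x) u = 0) (h2 : dt (rl g) u = 0) (h3 : dt (rl (crs x g)) u = 0) : u = 0 := by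
  have a := orth0 hx hg h  (by rw [← (dt_re _ _).1, h1]; rfl) (by rw [← (dt_re _ _).1, h2]; rfl) (by rw [← (dt_re _ _).1, h3]; rfl)
  have b := orth0 hx hg h  (by rw [← (dt_re _ _).2, h1]; rfl) (by rw [← (dt_re _ _).2, h2]; rfl) (by rw [← (dt_re _ _).2, h3]; rfl)
  ext i; exact Complex.ext (congrFun a i) (congrFun b i)
theorem th_smul (x : ℛ) (t : ℂ) (z) : th f x (t • z) = Complex.normSq t * th f x z := by
  simp  [th, nn_smul]; ring
theorem th_im {x : ℛ} (h : dt x (gr f x) = 0) {z : 𝒞} (hz : dt (rl x) z = (dt x x : ℝ)) (hx : x ≠ 0) :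
    th f x z = - (dt (rl (crs x (gr f x))) z).im := by
  have h1 := congrArg Complex.re hz; have h2 := congrArg Complex.im hz
  rw [(dt_re _ _).1, Complex.ofReal_re] at h1
  rw [(dt_re _ _).2, Complex.ofReal_im] at h2
  rw [(dt_re _ _).2]
  have hp := dt_pos hx
  refine mul_left_cancel₀ hp.ne' ?_
  have key : dt x x * th f x z = dt x (gr f x) * dt x (nn z) - (dt x (fun i => (z i).re) * dt (crs x (gr f x)) (fun i => (z i).im) - dt x (fun i => (z i).im) * dt (crs x (gr f x)) (fun i => (z i).re)) := by
    simp [th, nn, dt, crs]; ring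
  rw [key, h, h1, h2]; ring
theorem loc_inv (hf : IsSmoothQuartic f) {x : ℛ} (hx : x ∈ KK f) : ∃ e : OpenPartialHomeomorph 𝒞 𝒞, rl x ∈ e.source ∧
    ∀ z, e z = ![dt (rl x) z, dt (rl (crs x (gr f x))) z, ev f z] := by
  let L : 𝒞 → (𝒞 →L[ℂ] ℂ) := fun a => ∑ i, a i • ContinuousLinearMap.proj (R := ℂ) (φ := fun _ : Fin 3 => ℂ) i
  have hL : ∀ a z, L a z = dt a z := by simp [L, dt, Fin.sum_univ_three]
  let A : 𝒞 →L[ℂ] 𝒞 := ContinuousLinearMap.pi ![L (rl x), L (rl (crs x (gr f x))), L (rl (gr f x))]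
  have hinj : Function.Injective A.toLinearMap := by
    rw [← LinearMap.ker_eq_bot, LinearMap.ker_eq_bot']
    intro z hz
    have h0 := congrFun hz 0; have h1 := congrFun hz 1; have h2 := congrFun hz 2
    simp [A, hL] at h0 h1 h2
    exact orth0c hx.1 (gr_ne hf hx.1 hx.2) (gr_dot hf.1 hx.2) h0 h2 h1
  let E : 𝒞 ≃L[ℂ] 𝒞 := (LinearEquiv.ofInjectiveEndo A.toLinearMap hinj).toContinuousLinearEquiv
  have hE : (E) = A := by rfl
  have hLi := fun a => by
    have := (L a).hasStrictFDerivAt (x := rl x)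
    rwa [show (⇑(L a)) = fun z => dt a z from _root_.funext (hL a)] at this
  have hev : HasStrictFDerivAt (fun z : 𝒞 => ev f z) (L (rl (gr f x))) (rl x) := by
    have := hasDeriv (f.map (algebraMap ℝ ℂ)) (rl x)
    rw [← grc_rl]; exact this
  have hd : HasStrictFDerivAt (fun z : 𝒞 => (![dt (rl x) z, dt (rl (crs x (gr f x))) z, ev f z] : 𝒞)) (E : 𝒞 →L[ℂ] 𝒞) (rl x) := by
    rw [hE, hasStrictFDerivAt_pi']
    intro i
    fin_cases i
    · exact hLi (rl x)
    · exact hLi (rl (crs x (gr f x)))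
    · exact hev
  exact ⟨hd.toOpenPartialHomeomorph _, hd.mem_toOpenPartialHomeomorph_source, fun z => rfl⟩
theorem LS (hf : IsSmoothQuartic f) {x : ℛ} (hx : x ∈ KK f) : (∃ᶠ z in 𝓝 (rl x), z ∈ XX f) ∧ ∃ V ∈ 𝓝 (rl x), ∀ χ, InvOn (XX f) χ →
    ∀ z ∈ V, ∀ z' ∈ V, z ∈ XX f → z' ∈ XX f → 0 < th f x z * th f x z' → χ z = χ z' := by
  obtain ⟨e, hes, he⟩ := loc_inv hf hx
  have hg := gr_dot hf.1 hx.2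
  have hp := dt_pos hx.1
  set r := dt x x with hr
  have hk : dt (rl x) (rl x) = (r) := by simp [dt, rl, hr]
  have hl : dt (rl (crs x (gr f x))) (rl x) = 0 := by simp [dt, rl, crs]; ring
  have he0 : e (rl x) = ![(r:ℂ), 0, 0] := by rw [he, hk, hl, ev_rl, hx.2]; simp
  have hmem : ∀ {s : ℂ}, ![(r:ℂ), s, 0] ∈ e.target → s.im ≠ 0 → e.symm ![(r), s, 0] ∈ XX f ∧ th f x (e.symm ![(r), s, 0]) = - s.im := by
    intro s hs h0
    have := e.right_inv hs
    rw [he] at this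
    have a0 := congrFun this 0; have a1 := congrFun this 1; have a2 := congrFun this 2
    simp only [Matrix.cons_val] at a0 a1 a2
    have ht := th_im hg a0 hx.1
    rw [a1] at ht
    refine ⟨⟨a2, fun hn => h0 ?_⟩, ht⟩
    simp only [th, hn] at ht
    simp at ht; exact ht
  obtain ⟨ε, ε0, hε⟩ := Metric.isOpen_iff.1 e.open_target _ (he0 ▸ e.map_source hes)
  have hb : ∀ {s : ℂ}, ‖s‖ < ε → ![(r:ℂ), s, 0] ∈ Metric.ball ![(r:ℂ), 0, 0] ε := by
    intro s hs
    rw [Metric.mem_ball, dist_pi_lt_iff ε0]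
    intro i; fin_cases i <;> simp [hs, ε0]
  have hsymc : ContinuousOn (fun s : ℂ => e.symm ![(r), s, 0]) (Metric.ball 0 ε) :=
    e.continuousOn_symm.comp (by fun_prop) (fun s hs => hε (hb (by simpa using hs)))
  constructor
  · have h1 : Tendsto (fun t : ℝ => e.symm ![(r), (t) * Complex.I, 0]) (𝓝[>] 0) (𝓝 (rl x)) := by
      have h2 := (hsymc.continuousAt (Metric.ball_mem_nhds 0 ε0)).tendsto
      rw [← he0, e.left_inv hes] at h2
      refine h2.comp (Tendsto.mono_left ?_ nhdsWithin_le_nhds)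
      have : Continuous fun t : ℝ => (t) * Complex.I := by fun_prop
      simpa using this.tendsto 0
    refine h1.frequently (Eventually.frequently ?_)
    filter_upwards [self_mem_nhdsWithin, nhdsWithin_le_nhds (Metric.ball_mem_nhds (0) ε0)] with t ht ht'
    refine (hmem (hε (hb ?_)) ?_).1
    · simpa using ht'
    · simpa using (ne_of_gt ht)
  · have hkc : Continuous (dt (rl x)) := by unfold dt; fun_prop
    let V0 := e.source ∩ e ⁻¹' Metric.ball ![(r), 0, 0] ε
    have hV0 : V0 ∈ 𝓝 (rl x) := (e.isOpen_inter_preimage Metric.isOpen_ball).mem_nhds ⟨hes, by simp_all⟩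
    have hr0 : (r:ℂ) ≠ 0 := by exact_mod_cast hp.ne'
    refine ⟨{z | dt (rl x) z ≠ 0 ∧ ((r) / dt (rl x) z) • z ∈ V0}, ?_, ?_⟩
    · have h1 : ContinuousAt (fun z => ((r) / dt (rl x) z) • z) (rl x) :=
        (continuousAt_const.div hkc.continuousAt (by rw [hk]; exact hr0)).smul continuousAt_id
      refine inter_mem (hkc.continuousAt.eventually_ne (by rw [hk]; exact hr0)) (h1 ?_)
      beta_reduce; rw [hk, div_self hr0, one_smul]; exact hV0
    · intro χ hχ
      have key : ∀ z, dt (rl x) z ≠ 0 → ((r) / dt (rl x) z) • z ∈ V0 → z ∈ XX f → ∃ s : ℂ, ‖s‖ < ε ∧ (∃ c : ℝ, 0 < c ∧ c * th f x z = - s.im) ∧ χ z = χ (e.symm ![(r), s, 0]) := by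
        intro z h1 h2 h3
        set z' := ((r) / dt (rl x) z) • z with hz'
        have ht : (r) / dt (rl x) z ≠ 0 := div_ne_zero hr0 h1
        have hkz : dt (rl x) z' = r := by
          have : dt (rl x) z' = ((r) / dt (rl x) z) * dt (rl x) z := by simp [hz', dt]; ring
          rw [this, div_mul_cancel₀ _ h1]
        have hev : ev f z' = 0 := by rw [ev_smul hf.1, h3.1, mul_zero]
        have hz2 : e z' = ![(r:ℂ), dt (rl (crs x (gr f x))) z', 0] := by rw [he, hkz, hev]
        refine ⟨dt (rl (crs x (gr f x))) z', ?_, ?_, ?_⟩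
        · have := h2.2
          rw [Set.mem_preimage, hz2, Metric.mem_ball, dist_pi_lt_iff ε0] at this
          simpa using this 1
        · have := th_im hg hkz hx.1
          rw [hz', th_smul, ← hz'] at this
          exact ⟨_, Complex.normSq_pos.2 ht, this⟩
        · rw [← hz2, e.left_inv h2.1, hχ.2 _ ht]
      rintro z ⟨a1, a2⟩ z' ⟨b1, b2⟩ hz hz' hpos
      obtain ⟨s, hs, ⟨c, hc, hs1⟩, hs2⟩ := key z a1 a2 hz
      obtain ⟨s', hs', ⟨c', hc', hs1'⟩, hs2'⟩ := key z' b1 b2 hz'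
      have hss : 0 < s.im * s'.im := by
        have := mul_pos (mul_pos hc hc') hpos
        rw [show s.im * s'.im = (-s.im) * (-s'.im) by ring, ← hs1, ← hs1']; linarith
      have hs0 : s'.im ≠ 0 := fun h => by simp_all
      have hcv : IsPreconnected (Metric.ball (0:ℂ) ε ∩ {u | 0 < u.im * s'.im}) :=
        ((convex_ball _ _).inter ((convex_Ioi (0:ℝ)).is_linear_preimage
          ⟨fun a b => by simp; ring, fun a b => by simp; ring⟩)).isPreconnected
      rw [hs2, hs2']
      refine hcv.constant  (hχ.1.comp (hsymc.mono Set.inter_subset_left) ?_) ⟨by simpa using hs, hss⟩ ⟨by simpa using hs', mul_self_pos.2 hs0⟩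
      rintro u ⟨hu, hu'⟩
      refine (hmem (hε (hb (by simpa using hu))) (fun h => ?_)).1
      simp at hu'
      rw [h, zero_mul] at hu'; exact lt_irrefl _ hu'
theorem LS2 (hf : IsSmoothQuartic f) {x : ℛ} (hx : x ∈ KK f) :
    ∀ᶠ p : ℛ × 𝒞 in 𝓝 (x, rl x), p.2 ∈ XX f → 0 < th f x p.2 * th f p.1 p.2 := by
  by_contra hcon
  rw [not_eventually] at hcon
  obtain ⟨U, hUle, hU⟩ : ∃ U : Ultrafilter (ℛ × 𝒞), (U) ≤ 𝓝 (x, rl x) ∧ ∀ᶠ p : ℛ × 𝒞 in U, ¬ (p.2 ∈ XX f → 0 < th f x p.2 * th f p.1 p.2) := by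
    have := frequently_iff_neBot.1 hcon
    obtain ⟨U, hU⟩ := Ultrafilter.exists_le (𝓝 (x, rl x) ⊓ 𝓟 {p | ¬ (p.2 ∈ XX f → 0 < th f x p.2 * th f p.1 p.2)})
    exact ⟨U, hU.trans inf_le_left, le_principal_iff.1 (hU.trans inf_le_right)⟩
  have hg := gr_dot hf.1 hx.2
  have hp := dt_pos hx.1
  set r := dt x x with hr
  have hr0 : (r:ℂ) ≠ 0 := by exact_mod_cast hp.ne'
  have hk : dt (rl x) (rl x) = (r) := by simp [dt, rl, hr]
  have hkc : Continuous (dt (rl x)) := by unfold dt; fun_prop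
  have t1 : Tendsto (fun p : ℛ × 𝒞 => p.1) U (𝓝 x) := (continuous_fst.tendsto _).mono_left hUle
  have t2 : Tendsto (fun p : ℛ × 𝒞 => p.2) U (𝓝 (rl x)) := (continuous_snd.tendsto (x, rl x)).mono_left hUle
  let Z : ℛ × 𝒞 → 𝒞 := fun p => ((r) / dt (rl x) p.2) • p.2
  have tk : Tendsto (fun p : ℛ × 𝒞 => dt (rl x) p.2) U (𝓝 r) := by
    have := (hkc.tendsto (rl x)).comp t2; rwa [hk] at this
  have tZ : Tendsto Z U (𝓝 (rl x)) := by
    have := (tendsto_const_nhds (x := (r:ℂ))).div tk hr0 |>.smul t2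
    rwa [div_self hr0, one_smul] at this
  have hkne := tk.eventually_ne hr0
  let η := fun p i => (Z p i).im
  let ξ := fun p i => (Z p i).re
  have tξ : Tendsto ξ U (𝓝 x) := by
    have hc : Continuous fun z : 𝒞 => fun i => (z i).re := by fun_prop
    exact (hc.tendsto (rl x)).comp tZ
  let u := fun p => ‖η p‖⁻¹ • η p
  have hul : ∃ u0, Tendsto u U (𝓝 u0) := by
    have hcp : IsCompact (Metric.closedBall (0 : ℛ) 1) := isCompact_closedBall _ _
    obtain ⟨u0, -, h⟩ := hcp.ultrafilter_le_nhds (U.map u) (by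
      rw [le_principal_iff]
      refine Ultrafilter.mem_map.2 (univ_mem' fun p => ?_)
      simp only [Set.mem_preimage, mem_closedBall_zero_iff, u, norm_smul, norm_inv, norm_norm]
      exact inv_mul_le_one)
    exact ⟨u0, h⟩
  obtain ⟨u0, tu⟩ := hul
  have hXX := hU.mono fun p hp => by by_contra h; exact hp fun h' => (h h').elim
  have hη0 : ∀ᶠ p : ℛ × 𝒞 in U, ‖η p‖ ≠ 0 := by
    filter_upwards [hXX, hkne] with p h1 h2 h3
    have ht : (r) / dt (rl x) p.2 ≠ 0 := div_ne_zero hr0 h2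
    have hη : η p = 0 := norm_eq_zero.1 h3
    have hz : Z p = rl (ξ p) := by
      ext i; exact Complex.ext rfl (congrFun hη i)
    have := nn_smul ((r) / dt (rl x) p.2) p.2
    rw [show ((r) / dt (rl x) p.2) • p.2 = Z p from rfl, hz, nn_rl] at this
    rcases smul_eq_zero.1 this.symm with h | h
    · exact ht (Complex.normSq_eq_zero.1 h)
    · exact h1.2 h
  have hu1 : ‖u0‖ = 1 := by
    refine tendsto_nhds_unique tu.norm (tendsto_const_nhds.congr' ?_)
    filter_upwards [hη0] with p hp
    simp [u, norm_smul, hp]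
  have hdc : ∀ a : ℛ, Continuous (dt a) := fun a => by unfold dt; fun_prop
  have hdu : ∀ a p, dt a (u p) = ‖η p‖⁻¹ * dt a (η p) := by intro a p; simp [dt, u]; ring
  have hxu : dt x u0 = 0 := by
    refine tendsto_nhds_unique (((hdc x).tendsto u0).comp tu) (tendsto_const_nhds.congr' ?_)
    filter_upwards [hkne] with p hp
    have : dt (rl x) (Z p) = r := by
      have : dt (rl x) (Z p) = ((r) / dt (rl x) p.2) * dt (rl x) p.2 := by simp [Z, dt]; ring
      rw [this, div_mul_cancel₀ _ hp]
    have h2 := congrArg Complex.im this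
    rw [(dt_re _ _).2, Complex.ofReal_im] at h2
    simp only [Function.comp, hdu]
    grind
  have hgu : dt (gr f x) u0 = 0 := by
    have hst := (hasDeriv (f.map (algebraMap ℝ ℂ)) (rl x)).isLittleO
    have tZZ : Tendsto (fun p => (Z p, star (Z p))) U (𝓝 (rl x, rl x)) := by
      refine tZ.prodMk_nhds ?_
      have : star (rl x) = rl x := by ext i; simp [rl]
      have h2 := (continuous_star.tendsto (rl x)).comp tZ
      rwa [this] at h2
    have hst2 := hst.comp_tendsto tZZ
    by_contra hne
    have hpos : 0 < |dt (gr f x) u0| := abs_pos.2 hne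
    have hb := hst2.bound (half_pos hpos)
    have hle : |dt (gr f x) u0| ≤ |dt (gr f x) u0| / 2 := by
      refine le_of_tendsto (((hdc (gr f x)).tendsto u0).comp tu).abs ?_
      filter_upwards [hb, hXX, hη0] with p h1 h2 h3
      have e1 : ev f (Z p) = 0 := by rw [ev_smul hf.1, h2.1, mul_zero]
      have e2 : ev f (star (Z p)) = 0 := by rw [ev_star, e1, star_zero]
      have e3 : Z p - star (Z p) = (2 * Complex.I) • rl (η p) := by
        ext i; apply Complex.ext <;> simp [rl, η]; ring
      simp only [Function.comp] at h1
      rw [show eval (Z p) (f.map (algebraMap ℝ ℂ)) = 0 from e1, show eval (star (Z p)) (f.map (algebraMap ℝ ℂ)) = 0 from e2, e3] at h1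
      have e4 : ‖rl (η p)‖ = ‖η p‖ := by simp [Pi.norm_def, rl]
      have e5 : ∑ i, grc f (rl x) i * ((2 * Complex.I) * rl (η p) i) = 2 * Complex.I * (dt (gr f x) (η p)) := by
        rw [grc_rl]; simp [Fin.sum_univ_three, dt, rl]; ring
      simp only [ContinuousLinearMap.sum_apply, ContinuousLinearMap.smul_apply, ContinuousLinearMap.proj_apply, Pi.smul_apply, smul_eq_mul] at h1
      rw [show ∑ i, eval (rl x) (pderiv i (f.map (algebraMap ℝ ℂ))) * ((2 * Complex.I) * rl (η p) i) = _ from e5, norm_smul, e4] at h1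
      simp at h1
      have h3' : 0 < ‖η p‖ := lt_of_le_of_ne (norm_nonneg _) (Ne.symm h3)
      simp only [Function.comp, hdu, abs_mul, abs_inv, abs_norm]
      rw [inv_mul_le_iff₀ h3']
      linarith
    linarith
  have hn : dt (crs x (gr f x)) u0 ≠ 0 := by
    intro h
    have := orth0 hx.1 (gr_ne hf hx.1 hx.2) hg hxu hgu h
    rw [this] at hu1; simp at hu1
  have hgc : Continuous (gr f) := by
    exact continuous_pi fun i => MvPolynomial.continuous_eval _
  have hth : ∀ y p, th f y (Z p) = - dt (crs (ξ p) (gr f y)) (η p) := by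
    intro y p; simp [th, nn, dt, crs, ξ, η]; ring
  have hlim : ∀ Y : ℛ × 𝒞 → ℛ, Tendsto Y U (𝓝 x) → Tendsto (fun p => ‖η p‖⁻¹ * th f (Y p) (Z p)) U (𝓝 (- dt (crs x (gr f x)) u0)) := by
    intro Y hY
    have hc : Continuous fun q : ℛ × ℛ × ℛ => - dt (crs q.1 (gr f q.2.1)) q.2.2 := by
      simp only [dt, crs]
      fun_prop
    refine ((hc.tendsto (x, x, u0)).comp (tξ.prodMk_nhds (hY.prodMk_nhds tu))).congr fun p => ?_
    simp only [Function.comp, hth, hdu]; ring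
  have L1 := (hlim _ tendsto_const_nhds).mul (hlim _ t1)
  have hpos : ∀ᶠ p : ℛ × 𝒞 in U, 0 < (‖η p‖⁻¹ * th f x (Z p)) * (‖η p‖⁻¹ * th f p.1 (Z p)) :=
    L1.eventually (lt_mem_nhds (by have := mul_self_pos.2 hn; nlinarith))
  obtain ⟨p, h1, h2, h3⟩ := (hpos.and (hU.and hXX)).exists
  refine h2 fun _ => ?_
  simp only [Z, th_smul] at h1
  by_contra hh; push Not at hh
  have : (‖η p‖⁻¹ * (Complex.normSq ((r) / dt (rl x) p.2) * th f x p.2)) * (‖η p‖⁻¹ * (Complex.normSq ((r) / dt (rl x) p.2) * th f p.1 p.2)) =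
    (‖η p‖⁻¹ * Complex.normSq ((r) / dt (rl x) p.2)) ^ 2 * (th f x p.2 * th f p.1 p.2) := by ring
  nlinarith
def CT (f : 𝒫) : Set 𝒞 := {z | z ≠ 0 ∧ ev f z = 0}
theorem XX_smul (hf : f.IsHomogeneous 4) {t : ℂ} (ht : t ≠ 0) {z} (h : z ∈ XX f) : t • z ∈ XX f := by
  refine ⟨by rw [ev_smul hf, h.1, mul_zero], ?_⟩
  rw [nn_smul]; exact smul_ne_zero (fun h => ht (Complex.normSq_eq_zero.1 h)) h.2
theorem XX_star {z} (h : z ∈ XX f) : star z ∈ XX f :=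
  ⟨by rw [ev_star, h.1, star_zero], by rw [nn_star]; exact neg_ne_zero.2 h.2⟩
theorem nn_ne0 {z : 𝒞} (h : nn z ≠ 0) : z ≠ 0 := by
  rintro rfl; apply h; ext i; fin_cases i <;> simp [nn]
theorem th_star (x : ℛ) (z) : th f x (star z) = - th f x z := by
  simp only [th, nn_star, Pi.neg_apply]; ring
theorem star_rl (x : ℛ) : star (rl x) = rl x := by ext i; simp [rl]
theorem ext_inv (hf : IsSmoothQuartic f) {χ} (hχ : InvOn (XX f) χ) (hc : ∀ z ∈ XX f, χ (star z) = χ z) :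
    ∃ χ', InvOn (CT f) χ' ∧ (∀ z ∈ XX f, χ' z = χ z) ∧ ∀ z ∈ CT f, χ' (star z) = χ' z := by
  have LCs : ∀ {z : 𝒞} {b} {t : ℂ}, t ≠ 0 → (∀ᶠ w in 𝓝 z, w ∈ XX f → χ w = b) → ∀ᶠ w in 𝓝 (t • z), w ∈ XX f → χ w = b := by
    intro z b t ht h
    have h1 : Tendsto (fun w : 𝒞 => t⁻¹ • w) (𝓝 (t • z)) (𝓝 z) := by
      have := (continuous_const_smul  t⁻¹).tendsto (t • z); rwa [inv_smul_smul₀ ht] at this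
    filter_upwards [h1.eventually h] with w hw hX
    rw [← hw (XX_smul hf.1 (inv_ne_zero ht) hX), hχ.2 _ (inv_ne_zero ht)]
  have hLC : ∀ z ∈ CT f, (∃ᶠ w in 𝓝 z, w ∈ XX f) ∧ ∃ b, ∀ᶠ w in 𝓝 z, w ∈ XX f → χ w = b := by
    intro z hz
    by_cases hn : nn z = 0
    · obtain ⟨x, t, hx, ht, rfl⟩ := nn_eq_zero hz.1 hn
      have hx' : x ∈ KK f := by
        refine ⟨hx, ?_⟩
        have := hz.2
        rw [ev_smul hf.1, ev_rl] at this
        simpa [ht] using this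
      obtain ⟨h1, V, hV, h2⟩ := LS hf hx'
      have h3 : ∀ᶠ w in 𝓝 (rl x), w ∈ V ∧ star w ∈ V ∧ (w ∈ XX f → 0 < th f x w * th f x w) := by
        have a := (continuous_star.tendsto (rl x)).eventually (star_rl x ▸ hV)
        have b : Tendsto (fun w : 𝒞 => (x, w)) (𝓝 (rl x)) (𝓝 (x, rl x)) := Continuous.tendsto (by fun_prop) _
        filter_upwards [hV, a, b.eventually (LS2 hf hx')] with w p q r using ⟨p, q, r⟩
      have hb : ∃ b, ∀ᶠ w in 𝓝 (rl x), w ∈ XX f → χ w = b := by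
        obtain ⟨w0, hw0, k1, k2, k3⟩ := (h1.and_eventually h3).exists
        refine ⟨χ w0, h3.mono fun w ⟨l1, l2, l3⟩ hw => ?_⟩
        have e1 := k3 hw0; have e2 := l3 hw
        rcases lt_trichotomy (th f x w * th f x w0) 0 with h | h | h
        · rw [← hc w hw]
          exact h2 χ hχ _ l2 _ k1 (XX_star hw) hw0 (by rw [th_star]; linarith)
        · nlinarith
        · exact h2 χ hχ _ l1 _ k1 hw hw0 h
      obtain ⟨b, hb⟩ := hb
      refine ⟨?_, b, LCs ht hb⟩
      have := ((continuous_const_smul (T := 𝒞) t).tendsto (rl x)).frequently (h1.mono fun w hw => XX_smul hf.1 ht hw)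
      exact this
    · have hX : z ∈ XX f := ⟨hz.2, hn⟩
      refine ⟨fun h => h.self_of_nhds hX, χ z, ?_⟩
      have := (hχ.1 z hX).eventually (show ∀ᶠ b in 𝓝 (χ z), b = χ z by simp)
      exact eventually_nhdsWithin_iff.1 this
  classical
  let χ' := fun z => decide (∃ᶠ w in 𝓝 z, w ∈ XX f ∧ χ w = true)
  have hval : ∀ z ∈ CT f, ∀ b, (∀ᶠ w in 𝓝 z, w ∈ XX f → χ w = b) → χ' z = b := by
    intro z hz b hb
    have h1 := (hLC z hz).1
    cases b
    · simp only [χ', decide_eq_false_iff_not]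
      simp_all
    · simp  [χ']
      exact (h1.and_eventually hb).mono fun w ⟨a, b⟩ => ⟨a, b a⟩
  have hsm : ∀ t : ℂ, t ≠ 0 → ∀ z, χ' (t • z) = true → χ' z = true := by
    intro t ht z h
    simp  [χ'] at h ⊢
    have := ((continuous_const_smul (T := 𝒞) t⁻¹).tendsto (t • z)).frequently (p := fun w => w ∈ XX f ∧ χ w = true) (h.mono fun w ⟨h1, h2⟩ => ⟨XX_smul hf.1 (inv_ne_zero ht) h1, by rw [hχ.2 _ (inv_ne_zero ht), h2]⟩)
    rwa [inv_smul_smul₀ ht] at this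
  refine ⟨χ', ⟨fun z hz => ?_, fun t ht z => ?_⟩, fun z hz => ?_, fun z hz => ?_⟩
  · obtain ⟨b, hb⟩ := (hLC z hz).2
    have : ∀ᶠ w in 𝓝[CT f] z, χ' w = χ' z := by
      filter_upwards [self_mem_nhdsWithin, nhdsWithin_le_nhds (eventually_eventually_nhds.2 hb)] with w h1 h2
      rw [hval z hz b hb, hval w h1 b h2]
    exact (continuousWithinAt_const ).congr_of_eventuallyEq this rfl
  · rw [Bool.eq_iff_iff]
    exact ⟨hsm t ht z, fun h => hsm t⁻¹ (inv_ne_zero ht) _ (by rwa [inv_smul_smul₀ ht])⟩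
  · refine hval z ⟨nn_ne0 hz.2, hz.1⟩ _ ?_
    have := (hχ.1 z hz).eventually (show ∀ᶠ b in 𝓝 (χ z), b = χ z by simp)
    exact eventually_nhdsWithin_iff.1 this
  · obtain ⟨b, hb⟩ := (hLC z hz).2
    rw [hval z hz b hb]
    refine hval _ ⟨star_ne_zero.2 hz.1, by rw [ev_star, hz.2, star_zero]⟩ _ ?_
    have h1 : Tendsto (fun w : 𝒞 => star w) (𝓝 (star z)) (𝓝 z) := by
      have := continuous_star.tendsto (star z); rwa [star_star] at this
    filter_upwards [h1.eventually hb] with w hw hX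
    rw [← hc w hX, hw (XX_star hX)]
theorem CC (hf : f.IsHomogeneous 4) {χ} (hχ : InvOn (CT f) χ) {v m : 𝒞} {w} (hw : IsRV f v m w) (hm : ev f m ≠ 0)
    (hv : ∀ s : ℂ, v + s • m ≠ 0) (h : ∀ i j, χ (v + w i • m) = χ (v + w j • m)) : ∀ z ∈ CT f, χ z = χ (v + w 0 • m) := by
  let E := Submodule.span ℝ {m, Complex.I • m}
  have hE : ∀ u ∉ E, ∀ s : ℂ, u + s • m ≠ 0 := by
    intro u hu s h0
    refine hu (Submodule.mem_span_pair.2 ⟨-s.re, -s.im, ?_⟩)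
    rw [eq_neg_of_add_eq_zero_left h0]
    ext i; have := Complex.re_add_im s
    simp; linear_combination (-m i) * this
  have hE' : ∀ u, (∀ s : ℂ, u + s • m ≠ 0) → u ∉ E := by
    intro u hu h0
    obtain ⟨a, b, h⟩ := Submodule.mem_span_pair.1 h0
    refine hu (-(a + b * Complex.I)) ?_
    rw [← h]; ext i; simp; ring
  have hc : 1 < Module.rank ℝ (𝒞 ⧸ E) := by
    have h1 := E.finrank_quotient_add_finrank
    have h2 : Module.finrank ℝ E ≤ 2 := (finrank_span_le_card  ({m, Complex.I • m})).trans (by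
      rw [Set.toFinset_card, ← Nat.card_eq_fintype_card, Nat.card_coe_set_eq]; exact (Set.ncard_insert_le _ _).trans (by simp))
    have h3 : Module.finrank ℝ 𝒞 = 6 := by simp [Module.finrank_pi_fintype]
    have : 1 < Module.finrank ℝ (𝒞 ⧸ E) := by omega
    rw [← Module.finrank_eq_rank]; exact_mod_cast this
  haveI : PreconnectedSpace ↥((E : Set 𝒞)ᶜ) := isPreconnected_iff_preconnectedSpace.1 (isConnected_compl_of_one_lt_codim hc).isPreconnected
  intro z hz
  have hzE : ∀ s : ℂ, z + s • m ≠ 0 := by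
    intro s h0
    rw [eq_neg_of_add_eq_zero_left h0] at hz
    have h1 := hz.2; have h2 := hz.1
    rw [← neg_smul, ev_smul hf] at h1
    rcases mul_eq_zero.1 h1 with h | h
    · simp at h; simp [h] at h2
    · exact hm h
  choose W hW using fun u : ↥((E : Set 𝒞)ᶜ) => exists_rv hf (u) hm
  have key := cnt_const hf  continuous_subtype_val (continuous_const ) (fun _ => hm) hχ.1 (fun u s hs => ⟨hE _ u.2 s, hs⟩) hW
    ⟨v, hE' v hv⟩ ⟨z, hE' z hzE⟩
  rw [← cnt_eq hm hw (hW ⟨v, _⟩)] at key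
  obtain ⟨i, hi⟩ : ∃ i, W ⟨z, hE' z hzE⟩ i = 0 := by
    have := hW ⟨z, hE' z hzE⟩ 0
    rw [zero_smul, add_zero, hz.2] at this
    obtain ⟨i, -, hi⟩ := Finset.prod_eq_zero_iff.1 ((mul_eq_zero.1 this.symm).resolve_left hm)
    exact ⟨i, by simpa using hi⟩
  have hzi : χ (z + W ⟨z, hE' z hzE⟩ i • m) = χ z := by rw [hi, zero_smul, add_zero]
  rw [← hzi]
  cases hb : χ (v + w 0 • m)
  · have : cnt χ v m w = 0 := by
      rw [cnt, Finset.card_eq_zero, Finset.filter_eq_empty_iff]; intro j _; rw [h j 0, hb]; simp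
    rw [this] at key
    have := Finset.filter_eq_empty_iff.1 (Finset.card_eq_zero.1 key.symm) (Finset.mem_univ i)
    simpa using this
  · have : cnt χ v m w = 4 := by
      rw [cnt, Finset.filter_true_of_mem]; rfl
      intro j _; rw [h j 0, hb]
    rw [this] at key
    have := Finset.filter_card_eq (key.symm.trans (by rfl)) i (Finset.mem_univ i)
    simpa using this
def NMB (f : 𝒫) : Prop := ∃ v m w, IsRV f v m w ∧ ev f m ≠ 0 ∧ (∀ s : ℂ, v + s • m ≠ 0) ∧
  ∀ χ, InvOn (CT f) χ → (∀ z ∈ CT f, χ (star z) = χ z) → ∀ i j, χ (v + w i • m) = χ (v + w j • m)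
theorem cinv_const (hf : IsSmoothQuartic f) (hN : NMB f) {χ} (hχ : InvOn (XX f) χ) (hc : ∀ z ∈ XX f, χ (star z) = χ z) :
    ∀ z ∈ XX f, ∀ z' ∈ XX f, χ z = χ z' := by
  obtain ⟨χ', h1, h2, h3⟩ := ext_inv hf hχ hc
  obtain ⟨v, m, w, a, b, c, d⟩ := hN
  intro z hz z' hz'
  have := CC hf.1 h1 a b c (d χ' h1 h3)
  rw [← h2 z hz, ← h2 z' hz', this z ⟨nn_ne0 hz.2, hz.1⟩, this z' ⟨nn_ne0 hz'.2, hz'.1⟩]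
theorem dich (hf : IsSmoothQuartic f) (hN : NMB f) {χ} (hχ : InvOn (XX f) χ) :
    (∀ z ∈ XX f, ∀ z' ∈ XX f, χ z = χ z') ∨ ∀ z ∈ XX f, χ (star z) = !χ z := by
  have hs : InvOn (XX f) (fun z => χ (star z)) := by
    refine ⟨hχ.1.comp continuous_star.continuousOn fun z hz => XX_star hz, fun t ht z => ?_⟩
    beta_reduce; rw [star_smul, hχ.2 _ (star_ne_zero.2 ht)]
  have hop : ∀ o : Bool → Bool → Bool, (∀ a b, o a b = o b a) → ∀ z ∈ XX f, ∀ z' ∈ XX f, o (χ z) (χ (star z)) = o (χ z') (χ (star z')) := by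
    intro o ho
    refine cinv_const hf hN  ⟨?_, fun t ht z => ?_⟩ fun z hz => ?_
    · exact (continuous_of_discreteTopology (f := fun p : Bool × Bool => o p.1 p.2)).comp_continuousOn (hχ.1.prodMk hs.1)
    · have := hs.2 t ht z; beta_reduce at this ⊢
      rw [this, hχ.2 _ ht]
    · rw [star_star]; exact ho _ _
  by_contra hcon; push Not at hcon
  obtain ⟨⟨z, hz, z', hz', h1⟩, y, hy, h2⟩ := hcon
  have a := hop (· && ·) Bool.and_comm; have b := hop (· || ·) Bool.or_comm
  have a1 := a z hz y hy; have a2 := a z' hz' y hy; have b1 := b z hz y hy; have b2 := b z' hz' y hy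
  revert h1 h2 a1 a2 b1 b2
  cases χ z <;> cases χ z' <;> cases χ y <;> cases χ (star z) <;> cases χ (star z') <;> cases χ (star y) <;> simp
theorem KKsep (hf : f.IsHomogeneous 4) (h : NN0 f) (h2 : TwoC (KK f)) {φ} (hφ : InvOn (KK f) φ) {x y} (hx : x ∈ KK f) (hy : y ∈ KK f)
    (hxy : 0 < x 0 * x 2 ↔ 0 < y 0 * y 2) : φ x = φ y := by
  obtain ⟨χ, -, -, hu⟩ := h2
  let s : ℛ → Bool := fun v => decide (0 < v 0 * v 2)
  have hs : InvOn (KK f) s := by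
    refine ⟨dec_cont  (by fun_prop) fun v hv h0 => ?_, fun t ht v => ?_⟩
    · have := h.1 v hv.1 h0; rw [hv.2] at this; exact lt_irrefl _ this
    · simp  [s]
      rw [show t * v 0 * (t * v 2) = t ^ 2 * (v 0 * v 2) by ring]
      exact mul_pos_iff_of_pos_left (by positivity)
  obtain ⟨⟨a, ha, Fa⟩, b, hb, Fb⟩ := NN0_root hf h
  have ka : ![a, 0, 1] ∈ KK f := ⟨fun h => by simpa using congrFun h 2, Fa⟩
  have kb : ![b, 0, 1] ∈ KK f := ⟨fun h => by simpa using congrFun h 2, Fb⟩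
  have sa : s ![a, 0, 1] = false := by simp [s, ha.le]
  have sb : s ![b, 0, 1] = true := by simp [s, hb]
  apply hu φ hφ _ hx _ hy
  have hsxy : s x = s y := by grind
  by_contra hne
  have e1 := hu s hs _ ka _ hx; have e2 := hu s hs _ ka _ hy; have e3 := hu s hs _ kb _ hx; have e4 := hu s hs _ kb _ hy
  rw [sa] at e1 e2; rw [sb] at e3 e4; rw [hsxy] at e1 e3
  revert hne e1 e2 e3 e4
  cases χ ![a, 0, 1] <;> cases χ ![b, 0, 1] <;> cases χ x <;> cases χ y <;> cases s y <;> simp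
theorem rl_pt (α β t : ℝ) : rl (vβ β) + (t : ℂ) • rl (mα α) = rl (pt α β t) := by
  rw [pt_eq]; ext i; simp [rl]
theorem im0 {z : ℂ} (h : z.im = 0) : z = ((z.re : ℝ) : ℂ) := by apply Complex.ext <;> simp [h]
theorem pt_ne (α β t : ℝ) : pt α β t ≠ 0 := fun h => by simpa [pt] using congrFun h 2
theorem vm_ne (α β : ℝ) (s : ℂ) : rl (vβ β) + s • rl (mα α) ≠ 0 := fun h => by simpa [rl, vβ, mα] using congrFun h 2
theorem Reg.side {b1 b2 : ℝ → ℝ} {am ap : ℝ} (hR : Reg f b1 b2 am ap) {α β t t' : ℝ} (h1 : am < α) (h2 : α < ap)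
    (ht : eval (pt α β t) f = 0) (ht' : eval (pt α β t') f = 0) : 0 < α * t + β ↔ 0 < α * t' + β := by
  have := hR.lt α h1 h2
  rcases lt_or_gt_of_ne (hR.ne α β t ht.le) with a | a <;> rcases lt_or_gt_of_ne (hR.ne α β t' ht'.le) with b | b
  · grind
  · linarith [hR.l1 _ _ _ ht.le a, hR.l2 _ _ _ ht'.le b]
  · linarith [hR.l1 _ _ _ ht'.le b, hR.l2 _ _ _ ht.le a]
  · exact iff_of_true a b
theorem NN0_NMB (hf : f.IsHomogeneous 4) (h : NN0 f) (h2 : TwoC (KK f)) : NMB f := by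
  obtain ⟨b1, b2, am, ap, hR⟩ := reg_exists hf h
  obtain ⟨α, β, a1, a2, a3, a4, z1, z2, hz, hc⟩ := core hf hR
  have hm : ev f (rl (mα α)) ≠ 0 := by rw [ev_rl]; exact_mod_cast (hR.mp α).ne'
  refine ⟨_, _, _, hz.2.2, hm, vm_ne α β, fun χ hχ hs => ?_⟩
  have hst : ∀ z : ℂ, rl (vβ β) + z • rl (mα α) ∈ CT f → χ (rl (vβ β) + star z • rl (mα α)) = χ (rl (vβ β) + z • rl (mα α)) := by
    intro z hz
    rw [← hs _ hz, star_add, star_smul, star_rl, star_rl]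
  have m1 := hst z1 ⟨vm_ne _ _ _, rv_zero hz.2.2 0⟩
  have m2 := hst z2 ⟨vm_ne _ _ _, rv_zero hz.2.2 2⟩
  have h12 : χ (rl (vβ β) + z1 • rl (mα α)) = χ (rl (vβ β) + z2 • rl (mα α)) := by
    rcases hc with rfl | ⟨i1, i2⟩
    · rfl
    · have r1 := hz.real i1; have r2 := hz.symm.real i2
      rw [im0 i1, im0 i2, rl_pt, rl_pt]
      have hφ : InvOn (KK f) (fun x => χ (rl x)) := by
        refine ⟨hχ.1.comp (by unfold rl; fun_prop) fun x hx => ⟨fun h => hx.1 ?_, by rw [ev_rl, hx.2]; simp⟩, fun t ht v => ?_⟩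
        · ext i; simpa [rl] using congrFun h i
        · beta_reduce; rw [show rl (t • v) = (t : ℂ) • rl v by ext i; simp [rl], hχ.2 _ (by exact_mod_cast ht)]
      refine KKsep hf h h2 hφ ⟨pt_ne _ _ _, r1⟩ ⟨pt_ne _ _ _, r2⟩ ?_
      simpa [pt] using hR.side a1 a2 r1 r2
  have : ∀ i, χ (rl (vβ β) + (![z1, star z1, z2, star z2] : Fin 4 → ℂ) i • rl (mα α)) = χ (rl (vβ β) + z2 • rl (mα α)) := by
    intro i; fin_cases i
    · exact h12
    · exact m1.trans h12
    · rfl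
    · exact m2
  grind
def Sd (f : 𝒫) (χ : 𝒞 → Bool) (x : ℛ) (b : Bool) : Prop :=
  ∀ᶠ z in 𝓝 (rl x), z ∈ XX f → (χ z = b ↔ 0 < th f x z)
theorem Sd_ex (hf : IsSmoothQuartic f) {χ} (hχ : InvOn (XX f) χ) (ho : ∀ z ∈ XX f, χ (star z) = !χ z) {x} (hx : x ∈ KK f) : ∃ b, Sd f χ x b := by
  obtain ⟨h1, V, hV, h2⟩ := LS hf hx
  have h3 : ∀ᶠ w in 𝓝 (rl x), w ∈ V ∧ star w ∈ V ∧ (w ∈ XX f → 0 < th f x w * th f x w) := by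
    have a := (continuous_star.tendsto (rl x)).eventually (star_rl x ▸ hV)
    have b : Tendsto (fun w : 𝒞 => (x, w)) (𝓝 (rl x)) (𝓝 (x, rl x)) := Continuous.tendsto (by fun_prop) _
    filter_upwards [hV, a, b.eventually (LS2 hf hx)] with w p q r using ⟨p, q, r⟩
  obtain ⟨w0, hw0, k1, k2, k3⟩ := (h1.and_eventually h3).exists
  have e1 := k3 hw0
  have key : ∀ᶠ w in 𝓝 (rl x), w ∈ XX f → (χ w = χ w0 ↔ 0 < th f x w * th f x w0) := by
    refine h3.mono fun w ⟨l1, l2, l3⟩ hw => ?_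
    have e2 := l3 hw
    rcases lt_trichotomy (th f x w * th f x w0) 0 with h | h | h
    · have := h2 χ hχ _ l2 _ k1 (XX_star hw) hw0 (by rw [th_star]; linarith)
      grind
    · simp_all
    grind
  rcases lt_trichotomy (th f x w0) 0 with h | h | h
  · refine ⟨!χ w0, (key.and h3).mono fun w ⟨hw, hw'⟩ hX => ?_⟩
    have e2 := hw'.2.2 hX
    have := hw hX
    rw [show 0 < th f x w * th f x w0 ↔ th f x w < 0 from ⟨fun k => by by_contra k'; nlinarith, fun k => mul_pos_of_neg_of_neg k h⟩] at this
    rw [show (χ w = !χ w0) ↔ ¬ (χ w = χ w0) by cases χ w <;> cases χ w0 <;> simp, this, not_lt]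
    exact ⟨fun h => lt_of_le_of_ne h fun h' => by simp [← h'] at e2, le_of_lt⟩
  · simp [h] at e1
  · refine ⟨χ w0, key.mono fun w hw hX => ?_⟩
    rw [hw hX, mul_pos_iff_of_pos_right h]
theorem Sd_uniq (hf : IsSmoothQuartic f) {χ} {x} (hx : x ∈ KK f) {b b'} (h : Sd f χ x b) (h' : Sd f χ x b') : b = b' := by
  obtain ⟨w, hw, h1, h2⟩ := ((LS hf hx).1.and_eventually (h.and h')).exists
  have := (h1 hw).trans (h2 hw).symm
  revert this; cases χ w <;> cases b <;> cases b' <;> simp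
theorem Sd_near (hf : IsSmoothQuartic f) {χ} {x} (hx : x ∈ KK f) {b} (h : Sd f χ x b) : ∀ᶠ y in 𝓝 x, Sd f χ y b := by
  have rc : Continuous rl := by unfold rl; fun_prop
  have h1 := (rc.tendsto x).eventually (eventually_eventually_nhds.2 h)
  have h2 := ((Continuous.prodMk continuous_id rc).tendsto x).eventually (eventually_eventually_nhds.2 (LS2 hf hx))
  filter_upwards [h1, h2] with y h3 h4
  have h5 := ((Continuous.prodMk (continuous_const (y := y)) continuous_id).tendsto (rl y)).eventually h4
  filter_upwards [h3, h5] with z h6 h7 hz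
  rw [h6 hz]
  have := h7 hz
  exact ⟨fun h => (mul_pos_iff_of_pos_left h).1 this, fun h => (mul_pos_iff_of_pos_right h).1 this⟩
theorem Sd_side (hf : IsSmoothQuartic f) (h : NN0 f) (h2 : TwoC (KK f)) {χ} (hχ : InvOn (XX f) χ) (ho : ∀ z ∈ XX f, χ (star z) = !χ z)
    {x y} (hx : x ∈ KK f) (hy : y ∈ KK f) (x2 : x 2 = 1) (y2 : y 2 = 1) (hxy : 0 < x 0 ↔ 0 < y 0) {b} (hb : Sd f χ x b) : Sd f χ y b := by
  classical
  let σ := fun v => decide (Sd f χ ((v 2)⁻¹ • v) true)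
  have hn : ∀ v ∈ KK f, v 2 ≠ 0 := fun v hv h0 => by
    have := h.1 v hv.1 (by rw [h0, mul_zero]); rw [hv.2] at this; exact lt_irrefl _ this
  have hk : ∀ v ∈ KK f, (v 2)⁻¹ • v ∈ KK f := fun v hv =>
    ⟨smul_ne_zero (inv_ne_zero (hn v hv)) hv.1, by rw [eval_smul4 hf.1, hv.2, mul_zero]⟩
  have hval : ∀ v ∈ KK f, ∀ b, Sd f χ v b → decide (Sd f χ v true) = b := by
    intro v hv b hb
    cases b
    · rw [decide_eq_false_iff_not]; intro h; exact absurd (Sd_uniq hf hv h hb) (by simp)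
    · simpa using hb
  have hσ : InvOn (KK f) σ := by
    refine ⟨fun v hv => ?_, fun t ht v => ?_⟩
    · obtain ⟨b, hb⟩ := Sd_ex hf hχ ho (hk v hv)
      have c : ContinuousAt (fun u : ℛ => (u 2)⁻¹ • u) v :=
        ((continuous_apply 2).continuousAt.inv₀ (hn v hv)).smul continuousAt_id
      have : ∀ᶠ w in 𝓝[KK f] v, σ w = σ v := by
        filter_upwards [self_mem_nhdsWithin, nhdsWithin_le_nhds (c.eventually (Sd_near hf (hk v hv) hb))] with w h1 h2
        exact (hval _ (hk w h1) b h2).trans (hval _ (hk v hv) b hb).symm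
      exact (continuousWithinAt_const ).congr_of_eventuallyEq this rfl
    · simp only [σ]
      rw [show ((t • v) 2)⁻¹ • t • v = (v 2)⁻¹ • v by
        rw [smul_smul]; simp_all]
  have e := KKsep hf.1 h h2 hσ hx hy (by simp_all)
  simp only [σ, x2, y2, inv_one, one_smul] at e
  rw [hval x hx b hb] at e
  obtain ⟨b', hb'⟩ := Sd_ex hf hχ ho hy
  rw [hval y hy b' hb'] at e
  rwa [e]
theorem dneg {φ : ℝ → ℝ} {d : ℝ} (h : HasDerivAt φ d 0) (h0 : φ 0 = 0) (hd : d < 0) : ∀ᶠ s in 𝓝[>] (0:ℝ), φ s < 0 := by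
  have h1 := (hasDerivAt_iff_tendsto_slope.1 h).eventually (gt_mem_nhds hd)
  filter_upwards [nhdsWithin_mono 0 (fun s (hs) => hs.ne') h1, self_mem_nhdsWithin] with s h2 h3
  rw [slope_def_field, h0, sub_zero, sub_zero, div_neg_iff] at h2
  grind
theorem half (hf : IsSmoothQuartic f) (h : NN0 f) (h2 : TwoC (KK f)) {χ} (hχ : InvOn (XX f) χ) (ho : ∀ z ∈ XX f, χ (star z) = !χ z)
    {x y} (hx : x ∈ KK f) (hy : y ∈ KK f) (x2 : x 2 = 1) (y2 : y 2 = 1) (x0 : x 0 < 0) (y0 : 0 < y 0) {b c} (hb : Sd f χ x b) (hc : Sd f χ y c) : c = !b := by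
  obtain ⟨b1, b2, am, ap, hR⟩ := reg_exists hf.1 h
  have hmp : am < ap := hR.m0.trans hR.p0
  let val : ℝ → Bool := fun r => if 0 < r then c else !b
  let B : ℝ × ℝ → ℝ := fun p => b1 p.1 + p.2 * (b2 p.1 - b1 p.1)
  have hc1 := hR.c1; have hc2 := hR.c2
  have Bc : Continuous B := by fun_prop
  let P := Set.Ioo am ap ×ˢ Set.Ioo (0:ℝ) 1
  have hB : ∀ p : P, b1 p.1.1 < B p ∧ B p < b2 p.1.1 := by
    rintro ⟨⟨α, u⟩, ⟨a1, a2⟩, u1, u2⟩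
    have := hR.lt α a1 a2
    constructor <;> simp only [B] <;> nlinarith
  have nr : ∀ α β t, b1 α < β → β < b2 α → eval (pt α β t) f ≠ 0 := by
    intro α β t h1 h2 h3
    rcases lt_or_gt_of_ne (hR.ne α β t h3.le) with k | k
    · linarith [hR.l1 _ _ _ h3.le k]
    · linarith [hR.l2 _ _ _ h3.le k]
  have hRP : ∀ p : P, ∃ z : ℂ × ℂ, RP f p.1.1 (B p) z.1 z.2 := by
    intro p
    obtain ⟨z1, z2, hz⟩ := FR hf.1  (hR.mp p.1.1) (fun t => by
      rw [← pt_eq]; exact hR.nn _ p.2.1.1.le p.2.1.2.le _ (hB p).1.le (hB p).2.le t)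
    exact ⟨(z1, z2), hz⟩
  choose Z hZ using hRP
  have hi1 : ∀ p, 0 < (Z p).1.im := fun p => lt_of_le_of_ne (hZ p).1 fun h => nr _ _ _ (hB p).1 (hB p).2 ((hZ p).real h.symm)
  have hi2 : ∀ p, 0 < (Z p).2.im := fun p => lt_of_le_of_ne (hZ p).2.1 fun h => nr _ _ _ (hB p).1 (hB p).2 ((hZ p).symm.real h.symm)
  let Y : P → ℂ → 𝒞 := fun p s => rl (vβ (B p)) + s • rl (mα p.1.1)
  have Y1 : ∀ p s, Y p s 1 = s := by simp [Y, rl, vβ, mα]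
  have Y2 : ∀ p s, Y p s 2 = 1 := by simp [Y, rl, vβ, mα]
  have hmne : ∀ α, ev f (rl (mα α)) ≠ 0 := fun α => by rw [ev_rl]; exact_mod_cast (hR.mp α).ne'
  haveI : PreconnectedSpace P := isPreconnected_iff_preconnectedSpace.1 ((convex_Ioo _ _).prod (convex_Ioo _ _)).isPreconnected
  have vc : Continuous fun b : ℝ => rl (vβ b) := by
    refine continuous_pi fun i => ?_
    fin_cases i <;> simp [rl, vβ] <;> fun_prop
  have mc' : Continuous fun b : ℝ => rl (mα b) := by
    refine continuous_pi fun i => ?_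
    fin_cases i <;> simp [rl, mα] <;> fun_prop
  have Bv : Continuous fun p : P => B p := Bc.comp continuous_subtype_val
  have n0 : ∀ z : 𝒞, nn z 0 = - (z 1 * star (z 2)).im := by intro z; simp [nn]; ring
  have hconst : ∀ p q : P, (χ (Y p (Z p).1)).toNat + (χ (Y p (Z p).2)).toNat = (χ (Y q (Z q).1)).toNat + (χ (Y q (Z q).2)).toNat := by
    have key := cnt_const hf.1 (T := P) (v := fun p => rl (vβ (B p))) (m := fun p => rl (mα p.1.1)) (vc.comp Bv) (mc'.comp (by fun_prop)) (fun p => hmne _)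
      (S := {z | ev f z = 0 ∧ (z 1 * star (z 2)).im ≠ 0}) (χ := fun z => χ z && decide (0 < (z 1 * star (z 2)).im)) ?_ ?_ (fun p => (hZ p).2.2)
    · have e : ∀ p : P, cnt (fun z => χ z && decide (0 < (z 1 * star (z 2)).im)) (rl (vβ (B p))) (rl (mα p.1.1)) ![(Z p).1, star (Z p).1, (Z p).2, star (Z p).2] = (χ (Y p (Z p).1)).toNat + (χ (Y p (Z p).2)).toNat := by
        intro p
        have h0 : ∀ s, ((Y p s 1) * star (Y p s 2)).im = s.im := by intro s; rw [Y1, Y2]; simp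
        have e1 : ∀ s : ℂ, (χ (Y p s) && decide (0 < ((Y p s 1) * star (Y p s 2)).im)) = (χ (Y p s) && decide (0 < s.im)) := fun s => by rw [h0]
        have e' : cnt (fun z => χ z && decide (0 < (z 1 * star (z 2)).im)) (rl (vβ (B p))) (rl (mα p.1.1)) ![(Z p).1, star (Z p).1, (Z p).2, star (Z p).2] = (Finset.univ.filter fun i : Fin 4 => (χ (Y p (![(Z p).1, star (Z p).1, (Z p).2, star (Z p).2] i)) && decide (0 < (![(Z p).1, star (Z p).1, (Z p).2, star (Z p).2] i).im)) = true).card := by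
          unfold cnt; congr 1; exact Finset.filter_congr fun i _ => by rw [← e1]
        rw [e', Finset.card_filter, Fin.sum_univ_four]
        simp [hi1 p, hi2 p, (hi1 p).not_gt, (hi2 p).not_gt, Bool.toNat, Bool.cond_eq_ite]
      intro p q; rw [← e p, ← e q]; exact key p q
    · refine (continuous_of_discreteTopology (f := fun p : Bool × Bool => p.1 && p.2)).comp_continuousOn ((hχ.1.mono fun z hz => ⟨hz.1, fun h => hz.2 ?_⟩).prodMk (dec_cont (by fun_prop) fun z hz => hz.2))
      rw [← neg_eq_zero, ← n0, h]; rfl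
    · intro p s hs
      refine ⟨hs, fun h0 => ?_⟩
      have : s.im = 0 := by
        simp only [Y] at *
        simp_all
      rw [im0 this, ev_pt] at hs
      exact nr _ _ _ (hB p).1 (hB p).2 (by exact_mod_cast hs)
  obtain ⟨p0⟩ : Nonempty P := ⟨⟨((am + ap) / 2, 1 / 2), ⟨by linarith, by linarith⟩, by norm_num⟩⟩
  set n := (χ (Y p0 (Z p0).1)).toNat + (χ (Y p0 (Z p0).2)).toNat with hn
  have edge : ∀ α u : ℝ, am ≤ α → α ≤ ap → 0 ≤ u → u ≤ 1 → ∀ z1 z2, RP f α (B (α, u)) z1 z2 → z1.im = 0 → z2.im = 0 →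
      n = (val (α * z1.re + B (α, u))).toNat + (val (α * z2.re + B (α, u))).toNat := by
    intro α u a1 a2 u1 u2 z1 z2 hz i1 i2
    have hcl : (α, u) ∈ closure P := by
      rw [closure_prod_eq, closure_Ioo hmp.ne, closure_Ioo zero_ne_one]; exact ⟨⟨a1, a2⟩, u1, u2⟩
    haveI := mem_closure_iff_comap_neBot.1 hcl
    let U : Ultrafilter P := Ultrafilter.of (comap Subtype.val (𝓝 (α, u)))
    have tv : Tendsto (fun p : P => p.1) U (𝓝 (α, u)) := tendsto_comap.mono_left (Ultrafilter.of_le _)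
    have tα : Tendsto (fun p : P => p.1.1) U (𝓝 α) := (continuous_fst.tendsto (α, u)).comp tv
    have tB : Tendsto (fun p : P => B p) U (𝓝 (B (α, u))) := (Bc.tendsto (α, u)).comp tv
    set β := B (α, u) with hβ
    have bb : b1 α ≤ β ∧ β ≤ b2 α := by
      have := hR.le a1 a2
      constructor <;> simp only [hβ, B] <;> nlinarith
    have tv' := (vc.tendsto β).comp tB
    have tm' := (mc'.tendsto α).comp tα
    obtain ⟨w0, hw0, hrv⟩ := rv_lim hf.1 U tv' tm' (hmne α) (fun p => (hZ p).2.2)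
    have l0 := (continuous_apply 0).tendsto w0 |>.comp hw0
    have l1 := (continuous_apply 1).tendsto w0 |>.comp hw0
    have l2 := (continuous_apply 2).tendsto w0 |>.comp hw0
    have l3 := (continuous_apply 3).tendsto w0 |>.comp hw0
    have s1 := tendsto_nhds_unique l1 ((continuous_star.tendsto _).comp l0)
    have s3 := tendsto_nhds_unique l3 ((continuous_star.tendsto _).comp l2)
    have j0 : 0 ≤ (w0 0).im := ge_of_tendsto' ((Complex.continuous_im.tendsto _).comp l0) fun p => (hi1 p).le
    have j2 : 0 ≤ (w0 2).im := ge_of_tendsto' ((Complex.continuous_im.tendsto _).comp l2) fun p => (hi2 p).le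
    have hrv' : IsRV f (rl (vβ β)) (rl (mα α)) ![w0 0, star (w0 0), w0 2, star (w0 2)] := by
      have : w0 = ![w0 0, star (w0 0), w0 2, star (w0 2)] := by
        ext i; fin_cases i
        · rfl
        · exact s1
        · rfl
        · exact s3
      rw [← this]; exact hrv
    have lcl : ∀ (ζ : P → ℂ) (t : ℝ), Tendsto ζ U (𝓝 (t)) → (∀ p, 0 < (ζ p).im) → (∀ p, ev f (Y p (ζ p)) = 0) → eval (pt α β t) f = 0 →
        ∀ᶠ p in U, χ (Y p (ζ p)) = val (α * t + β) := by
      intro ζ t hζ him hev ht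
      have k : pt α β t ∈ KK f := ⟨pt_ne _ _ _, ht⟩
      set g := gr f (pt α β t) with hg
      have g1 : g 1 = - α * g 0 := by
        have hd := der_line f (pt α β t) (mα α)
        have hmin : IsLocalMin (fun s : ℝ => eval (pt α β t + s • mα α) f) 0 := Eventually.of_forall fun s => by
          simp
          rw [ht, show pt α β t + s • mα α = pt α β (t + s) by rw [pt_eq, pt_eq, add_smul, add_assoc]]
          exact hR.nn α a1 a2 β bb.1 bb.2 _
        have := hmin.hasDerivAt_eq_zero hd
        rw [Fin.sum_univ_three] at this
        simp [mα] at this; linarith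
      have g2 : g 2 = - β * g 0 := by
        have : (α * t + β) * g 0 + t * g 1 + 1 * g 2 = 0 := gr_dot hf.1 ht
        rw [g1] at this; linarith
      have g0 : g 0 ≠ 0 := by
        intro h0
        refine gr_ne hf k.1 k.2 ?_
        ext i; fin_cases i
        · exact h0
        · show g 1 = 0; rw [g1, h0, mul_zero]
        · show g 2 = 0; rw [g2, h0, mul_zero]
      have mv : ∀ s : ℝ, pt α β t + s • ![1, 0, 0] = pt α (β + s) t := by
        intro s; ext i; fin_cases i <;> simp [pt]; ring
      have sg : 0 < α * t + β ↔ g 0 < 0 := by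
        rcases lt_or_gt_of_ne (hR.ne α β t ht.le) with a | a
        · refine iff_of_false (not_lt.2 a.le) fun hneg => ?_
          have hd := der_line f (pt α β t) ![1, 0, 0]
          have := dneg hd (by simp [ht]) (by rw [Fin.sum_univ_three]; simpa using hneg)
          obtain ⟨s, h1, h2, h3⟩ := (this.and (Ioo_mem_nhdsGT (show 0 < -(α * t + β) by linarith))).exists
          rw [mv] at h1
          linarith [hR.l1 _ _ _ h1.le (by linarith)]
        · refine iff_of_true a ?_
          by_contra hneg
          have hneg : 0 < g 0 := lt_of_le_of_ne (not_lt.1 hneg) (Ne.symm g0)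
          have hd := der_line f (pt α β t) (-![1, 0, 0])
          have := dneg hd (by simp [ht]) (by rw [Fin.sum_univ_three]; simpa using hneg)
          obtain ⟨s, h1, h2, h3⟩ := (this.and (Ioo_mem_nhdsGT a)).exists
          rw [smul_neg, ← neg_smul, mv] at h1
          linarith [hR.l2 _ _ _ h1.le (by linarith)]
      have hS : Sd f χ (pt α β t) (if 0 < α * t + β then c else b) := by
        split_ifs with hp
        · exact Sd_side hf h h2 hχ ho hy k y2 (by simp [pt]) (by simp [pt, y0, hp]) hc
        · exact Sd_side hf h h2 hχ ho hx k x2 (by simp [pt]) (iff_of_false x0.not_gt hp) hb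
      have tY : Tendsto (fun p => Y p (ζ p)) U (𝓝 (rl (pt α β t))) := by
        rw [← rl_pt]; exact tv'.add (hζ.smul tm')
      have e1 := tY.eventually hS
      have e2 : ∀ᶠ p : P in U, 0 < 1 + p.1.1 * α + B p * β := by
        have :=
          ((tα.mul_const α).const_add 1).add (tB.mul_const β)
        exact this.eventually (lt_mem_nhds (by nlinarith []))
      filter_upwards [e1, e2] with p h1 h2
      have hth : th f (pt α β t) (Y p (ζ p)) = (ζ p).im * (1 + p.1.1 * α + B p * β) * (- g 0) := by
        have : th f (pt α β t) (Y p (ζ p)) = nn (Y p (ζ p)) 0 * g 0 + nn (Y p (ζ p)) 1 * g 1 + nn (Y p (ζ p)) 2 * g 2 := rfl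
        rw [this, g1, g2]
        simp [nn, Y, rl, vβ, mα]; ring
      have hX : Y p (ζ p) ∈ XX f := ⟨hev p, fun h0 => (him p).ne' (by
        have := n0 (Y p (ζ p)); rw [h0, Y1, Y2] at this; simpa using this)⟩
      have h3 := h1 hX
      rw [hth, mul_pos_iff_of_pos_left (mul_pos (him p) h2), neg_pos, ← sg] at h3
      simp  [val]
      split_ifs at h3 ⊢ with hp
      · exact h3.2 hp
      · have : ¬ χ (Y p (ζ p)) = b := fun h => hp (h3.1 h)
        revert this; cases χ (Y p (ζ p)) <;> cases b <;> simp
    have r1 := hz.real i1; have r2 := hz.symm.real i2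
    have ha : ∀ p, ev f (Y p (Z p).1) = 0 := fun p => rv_zero (hZ p).2.2 0
    have hb' : ∀ p, ev f (Y p (Z p).2) = 0 := fun p => rv_zero (hZ p).2.2 2
    rcases FR_uniq j0 j2 hz.1 hz.2.1 (rv_perm (hmne α) hrv' hz.2.2) with ⟨e1, e2⟩ | ⟨e1, e2⟩
    · obtain ⟨p, q1, q2⟩ := ((lcl _ z1.re (by rw [← im0 i1, ← e1]; exact l0) hi1 ha r1).and (lcl _ z2.re (by rw [← im0 i2, ← e2]; exact l2) hi2 hb' r2)).exists
      rw [hn, hconst p0 p, q1, q2]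
    · obtain ⟨p, q1, q2⟩ := ((lcl _ z2.re (by rw [← im0 i2, ← e1]; exact l0) hi1 ha r2).and (lcl _ z1.re (by rw [← im0 i1, ← e2]; exact l2) hi2 hb' r1)).exists
      rw [hn, hconst p0 p, q1, q2, add_comm]
  have even : ∃ d : Bool, n = d.toNat + d.toNat := by
    obtain ⟨α, β, a1, a2, a3, a4, z1, z2, hz, hcc⟩ := core hf.1 hR
    have hlt := hR.lt α a1 a2
    obtain ⟨u, u1, u2, hu⟩ : ∃ u, 0 ≤ u ∧ u ≤ 1 ∧ B (α, u) = β := by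
      refine ⟨(β - b1 α) / (b2 α - b1 α), div_nonneg (by linarith) (by linarith), (div_le_one (by linarith)).2 (by linarith), ?_⟩
      grind
    by_cases hi : z1.im = 0 ∧ z2.im = 0
    · have e := edge α u a1.le a2.le u1 u2 z1 z2 (by rw [hu]; exact hz) hi.1 hi.2
      have r1 := hz.real hi.1; have r2 := hz.symm.real hi.2
      refine ⟨_, e.trans (congrArg _ ?_)⟩
      simp  [val, hu, hR.side a1 a2 r1 r2]
    · obtain rfl := hcc.resolve_right hi
      have hne : z1.im ≠ 0 := fun h => hi ⟨h, h⟩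
      have hu1 : u ≠ 0 := by
        rintro rfl
        have hb1 : β = b1 α := by rw [← hu]; simp [B]
        obtain ⟨t, -, ht⟩ := hR.k1 α a1.le a2.le
        rw [← hb1] at ht
        rcases hz.root (hR.mp α) ht with h | h <;> exact hne (by rw [h]; simp)
      have hu2 : u ≠ 1 := by
        rintro rfl
        have hb1 : β = b2 α := by rw [← hu]; simp [B]
        obtain ⟨t, -, ht⟩ := hR.k2 α a1.le a2.le
        rw [← hb1] at ht
        rcases hz.root (hR.mp α) ht with h | h <;> exact hne (by rw [h]; simp)
      let p : P := ⟨(α, u), ⟨a1, a2⟩, lt_of_le_of_ne u1 (Ne.symm hu1), lt_of_le_of_ne u2 hu2⟩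
      have hzp : RP f p.1.1 (B p) z1 z1 := by grind
      have : (Z p).1 = z1 ∧ (Z p).2 = z1 := by
        rcases FR_uniq (hZ p).1 (hZ p).2.1 hzp.1 hzp.2.1 (rv_perm (hmne _) (hZ p).2.2 hzp.2.2) with h | h
        · exact h
        · exact h
      exact ⟨_, by rw [hn, hconst p0 p, this.1, this.2]⟩
  have corner : n = (!b).toNat + c.toNat := by
    have hBa : B (ap, 0) = b1 ap := by simp [B]
    obtain ⟨t1, s1, q1⟩ := hR.k1 ap hmp.le le_rfl
    obtain ⟨t2, s2, q2⟩ := hR.k2 ap hmp.le le_rfl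
    rw [← hR.ep] at q2 s2
    obtain ⟨z1, z2, hz⟩ := FR hf.1  (hR.mp ap) (fun t => by
      rw [← pt_eq]; exact hR.nn _ hmp.le le_rfl _ le_rfl (hR.ep.le) t)
    have hz : RP f ap (b1 ap) z1 z2 := hz
    have hne : t1 ≠ t2 := by rintro rfl; linarith
    have v1 : val (ap * t1 + b1 ap) = !b := by simp only [val]; rw [if_neg (by linarith)]
    have v2 : val (ap * t2 + b1 ap) = c := by grind
    have main : ∀ z1 z2 : ℂ, RP f ap (b1 ap) z1 z2 → z1 = t1 → z2 = t2 → n = (!b).toNat + c.toNat := by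
      rintro z1 z2 hz rfl rfl
      have := edge ap 0 hmp.le le_rfl le_rfl zero_le_one _ _ (by rw [hBa]; exact hz) (by simp) (by simp)
      rw [hBa] at this; simpa  [Complex.ofReal_re, v1, v2] using this
    rcases hz.root (hR.mp ap) q1 with e1 | e1 <;> rcases hz.root (hR.mp ap) q2 with e2 | e2
    · exact absurd (e1.symm.trans e2) (by exact_mod_cast hne)
    · exact main _ _ hz e1 e2
    · exact main _ _ hz.symm e1 e2
    · exact absurd (e1.symm.trans e2) (by exact_mod_cast hne)
  obtain ⟨d, hd⟩ := even
  rw [corner] at hd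
  revert hd; cases b <;> cases c <;> cases d <;> simp
def sc (z : 𝒞) : 𝒞 := ![z 2, z 1, z 0]
theorem sc_cont : Continuous sc := by
  refine continuous_pi fun i => ?_
  fin_cases i <;> simp [sc] <;> fun_prop
theorem ev_sc (z) : ev (cg f Ms 1) z = ev f (sc z) := by
  rw [ev_cg, Complex.ofReal_one, one_mul]
  congr 1; ext i; fin_cases i <;> simp [Ms, sc, Matrix.mulVec, dotProduct, Fin.sum_univ_three]
theorem XX_sc {z} (h : z ∈ XX (cg f Ms 1)) : sc z ∈ XX f := by
  refine ⟨by rw [← ev_sc]; exact h.1, fun h0 => h.2 ?_⟩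
  have a := congrFun h0 0; have b := congrFun h0 1; have c := congrFun h0 2
  simp [nn, sc] at a b c
  ext i; fin_cases i <;> simp [nn] <;> linarith
theorem gr_sw (x : ℛ) : gr (cg f Ms 1) x = ![gr f ![x 2, x 1, x 0] 2, gr f ![x 2, x 1, x 0] 1, gr f ![x 2, x 1, x 0] 0] := by
  have k : ∀ n : ℛ, ∑ i, gr (cg f Ms 1) x i * n i = ∑ i, gr f ![x 2, x 1, x 0] i * ![n 2, n 1, n 0] i := by
    intro n
    refine (der_line (cg f Ms 1) x n).unique ?_
    refine (der_line f ![x 2, x 1, x 0] ![n 2, n 1, n 0]).congr_of_eventuallyEq (Eventually.of_forall fun t => ?_)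
    beta_reduce; rw [sw_eval]; simp
  have a := k ![1, 0, 0]; have b := k ![0, 1, 0]; have c := k ![0, 0, 1]
  simp [Fin.sum_univ_three] at a b c
  ext i; fin_cases i
  · exact a
  · exact b
  · exact c
theorem gr_smul (hf : f.IsHomogeneous 4) (t : ℝ) (x) (i) : gr f (t • x) i = t ^ 3 * gr f x i :=
  hom_smul (hf.pderiv (i := i)) t x
theorem Sd_sw (hf : IsSmoothQuartic f) {χ} (hχ : InvOn (XX f) χ) {s : ℝ} (hs : s ≠ 0) (hx : ![s, 0, 1] ∈ KK f) {b} (h : Sd f χ ![s, 0, 1] b) :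
    Sd (cg f Ms 1) (fun z => χ (sc z)) ![s⁻¹, 0, 1] (if 0 < s then !b else b) := by
  have T : Tendsto (fun z => (s : ℂ) • sc z) (𝓝 (rl ![s⁻¹, 0, 1])) (𝓝 (rl ![s, 0, 1])) := by
    have : rl ![s, 0, 1] = (s : ℂ) • sc (rl ![s⁻¹, 0, 1]) := by
      have : (s : ℂ) ≠ 0 := by exact_mod_cast hs
      ext i; fin_cases i <;> simp [rl, sc, this]
    rw [this]; exact (sc_cont.const_smul (s)).tendsto _
  have T2 : Tendsto (fun z => (![s, 0, 1], (s : ℂ) • sc z)) (𝓝 (rl ![s⁻¹, 0, 1])) (𝓝 ((![s, 0, 1], rl ![s, 0, 1]) : ℛ × 𝒞)) :=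
    tendsto_const_nhds.prodMk_nhds T
  filter_upwards [T.eventually h, T2.eventually (LS2 hf hx)] with z h1 h2 hz
  have hs' : (s : ℂ) ≠ 0 := by exact_mod_cast hs
  have hX := XX_smul hf.1 hs' (XX_sc hz)
  replace h1 := h1 hX; replace h2 := h2 hX
  simp only [hχ.2 _ hs', th_smul, Complex.normSq_ofReal] at h1 h2
  have hss := mul_self_pos.2 hs
  rw [mul_pos_iff_of_pos_left hss] at h1
  have hn : th f ![s, 0, 1] (sc z) ≠ 0 := by intro h0; simp [h0] at h2
  have e : th (cg f Ms 1) ![s⁻¹, 0, 1] z = - (s⁻¹) ^ 3 * th f ![s, 0, 1] (sc z) := by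
    have : (![1, 0, s⁻¹] : ℛ) = s⁻¹ • ![s, 0, 1] := by ext i; fin_cases i <;> simp [hs]
    simp only [th, gr_sw, Matrix.cons_val]
    rw [this]
    simp only [gr_smul hf.1]
    simp [nn, sc]; ring
  rw [e]
  split_ifs with hp
  · have : 0 < (s⁻¹) ^ 3 := by positivity
    have k : 0 < -(s⁻¹) ^ 3 * th f ![s, 0, 1] (sc z) ↔ ¬ 0 < th f ![s, 0, 1] (sc z) := by
      rw [not_lt]
      exact ⟨fun h => by nlinarith, fun h => by have := lt_of_le_of_ne h hn; nlinarith⟩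
    rw [k, ← h1]; cases χ (sc z) <;> cases b <;> simp
  · have : 0 < -(s⁻¹) ^ 3 := by
      have : 0 < - s⁻¹ := by rw [neg_pos, inv_lt_zero]; exact lt_of_le_of_ne (not_lt.1 hp) hs
      have := pow_pos this 3
      nlinarith
    rw [mul_pos_iff_of_pos_left this]; exact h1
theorem NN0_P2 (hf : IsSmoothQuartic f) (h : NN0 f) (h2 : TwoC (KK f)) : ¬ TwoC (XX f) := by
  rintro ⟨χ, hχ, hs, -⟩
  have ho : ∀ z ∈ XX f, χ (star z) = !χ z := by
    refine (dich hf (NN0_NMB hf.1 h h2) hχ).resolve_left fun hc => ?_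
    obtain ⟨a, ha, a'⟩ := hs true; obtain ⟨b, hb, b'⟩ := hs false
    grind
  obtain ⟨⟨s, s0, hsf⟩, t, t0, htf⟩ := NN0_root hf.1 h
  have k : ∀ s, eval ![s, 0, 1] f = 0 → ![s, 0, 1] ∈ KK f := fun s hs => ⟨fun h => by simpa using congrFun h 2, hs⟩
  have k' : ∀ s : ℝ, s ≠ 0 → eval ![s, 0, 1] f = 0 → ![s⁻¹, 0, 1] ∈ KK (cg f Ms 1) := fun s h0 hs => ⟨fun h => by simpa using congrFun h 2, by
    rw [sw_eval]
    have : (![1, 0, s⁻¹] : ℛ) = s⁻¹ • ![s, 0, 1] := by ext i; fin_cases i <;> simp [h0]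
    simp
    rw [this, eval_smul4 hf.1, hs, mul_zero]⟩
  obtain ⟨b, hb⟩ := Sd_ex hf hχ ho (k s hsf)
  obtain ⟨c, hc⟩ := Sd_ex hf hχ ho (k t htf)
  have e1 := half hf h h2 hχ ho (k s hsf) (k t htf) (by simp) (by simp) (by simpa) (by simpa) hb hc
  have hb' := Sd_sw hf hχ s0.ne (k s hsf) hb
  have hc' := Sd_sw hf hχ t0.ne' (k t htf) hc
  rw [if_neg s0.not_gt] at hb'
  rw [if_pos t0] at hc'
  have hχ' : InvOn (XX (cg f Ms 1)) (fun z => χ (sc z)) := by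
    refine ⟨hχ.1.comp sc_cont.continuousOn fun z hz => XX_sc hz, fun u hu z => ?_⟩
    beta_reduce
    rw [show sc (u • z) = u • sc z by simp [sc], hχ.2 u hu]
  have ho' : ∀ z ∈ XX (cg f Ms 1), χ (sc (star z)) = !χ (sc z) := fun z hz => by
    rw [← ho _ (XX_sc hz)]; congr 1; ext i; fin_cases i <;> simp [sc]
  have e2 := half (cg_smooth Ms_inv one_ne_zero hf) (NN0_sw hf.1 h) (cg_KK Ms_inv one_ne_zero h2) hχ' ho' (k' s s0.ne hsf) (k' t t0.ne' htf)
    (by simp) (by simp) (by simpa) (by simpa) hb' hc'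
  subst e1
  revert e2; cases b <;> simp
abbrev e3 : ℛ := ![0, 0, 1]
abbrev U3 (u : ℝ × ℝ) (t : ℝ) : ℛ := ![u.1, u.2, t]
def HE (f : 𝒫) : Prop := eval e3 f = 1 ∧ ∀ u : ℝ × ℝ, u ≠ 0 → ∃ r : Fin 4 → ℝ, StrictMono r ∧ ∀ i, eval (U3 u (r i)) f = 0
theorem HY_norm {p} (h : HY f p) (hf : f.IsHomogeneous 4) : ∃ (M N : Matrix (Fin 3) (Fin 3) ℝ) (c : ℝ), c ≠ 0 ∧ N * M = 1 ∧ HE (cg f M c) := by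
  have hp : p ≠ 0 := by
    rintro rfl
    have := eval_smul4 hf 0 0
    exact h.1 (by simpa using this)
  obtain ⟨q, r, hd⟩ : ∃ q r : ℛ, (Matrix.of fun i j => ![q i, r i, p i] j).det ≠ 0 := by
    by_cases h0 : p 0 = 0
    · by_cases h1 : p 1 = 0
      · refine ⟨![1, 0, 0], ![0, 1, 0], fun h2 => hp ?_⟩
        simp [Matrix.det_fin_three] at h2
        ext i; fin_cases i
        · exact h0
        · exact h1
        · exact h2
      · exact ⟨![1, 0, 0], ![0, 0, 1], by simpa [Matrix.det_fin_three] using h1⟩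
    · exact ⟨![0, 1, 0], ![0, 0, 1], by simpa [Matrix.det_fin_three] using h0⟩
  set M : Matrix (Fin 3) (Fin 3) ℝ := Matrix.of fun i j => ![q i, r i, p i] j with hM
  have hN := Matrix.nonsing_inv_mul M (isUnit_iff_ne_zero.2 hd)
  have hm : ∀ v, M.mulVec v = v 0 • q + v 1 • r + v 2 • p := by
    intro v; ext i; simp [hM, Matrix.mulVec, dotProduct, Fin.sum_univ_three]; ring
  refine ⟨M, M⁻¹, (eval p f)⁻¹, inv_ne_zero h.1, hN, ?_, fun u hu => ?_⟩
  · rw [eval_cg, hm]; simp [h.1]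
  · obtain ⟨r1, r2, r3, r4, a, b, c, k1, k2, k3, k4⟩ := h.2 (M.mulVec (U3 u 0)) (by
      rw [LinearIndependent.pair_iff]
      intro s t e
      have e2 : M.mulVec (s • U3 u 0 + t • e3) = 0 := by
        rw [Matrix.mulVec_add, Matrix.mulVec_smul, Matrix.mulVec_smul, hm e3]; simpa using e
      have e4 : s • U3 u 0 + t • e3 = 0 := by
        by_contra h0; exact mul_ne hN h0 e2
      have a0 := congrFun e4 0; have a1 := congrFun e4 1; have a2 := congrFun e4 2
      simp at a0 a1 a2
      refine ⟨?_, a2⟩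
      by_contra hs
      exact hu (Prod.ext (a0.resolve_left hs) (a1.resolve_left hs)))
    have key : ∀ t, eval (M.mulVec (U3 u 0) + t • p) f = 0 → eval (U3 u t) (cg f M (eval p f)⁻¹) = 0 := by
      intro t ht
      rw [eval_cg, show M.mulVec (U3 u t) = M.mulVec (U3 u 0) + t • p by rw [hm, hm]; simp, ht, mul_zero]
    refine ⟨![r1, r2, r3, r4], ?_, fun i => ?_⟩
    · simp_all
    · fin_cases i <;> simp <;> apply key <;> assumption
theorem HE_prod (hf : f.IsHomogeneous 4) (h1 : eval e3 f = 1) {u : ℝ × ℝ} {r : Fin 4 → ℝ} (hr : Function.Injective r) (h : ∀ i, eval (U3 u (r i)) f = 0) (t : ℂ) :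
    ev f ![u.1, u.2, t] = ∏ i, (t - r i) := by
  have hm : ev f (rl e3) = 1 := by rw [ev_rl, h1, Complex.ofReal_one]
  obtain ⟨w, hw⟩ := exists_rv hf (rl (U3 u 0))  (by rw [hm]; exact one_ne_zero)
  have e : ∀ t : ℂ, ev f ![u.1, u.2, t] = ∏ i, (t - w i) := by
    intro t
    rw [← one_mul (∏ i, (t - w i)), ← hm, ← hw]; congr 1; ext i; fin_cases i <;> simp [rl]
  have : ∀ i, ∃ j, (r i) = w j := by
    intro i
    have h2 : ev f ![u.1, u.2, r i] = 0 := by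
      have := ev_rl (f := f) (U3 u (r i))
      rw [h, Complex.ofReal_zero] at this
      rw [← this]; congr 1; ext i; fin_cases i <;> simp [rl]
    rw [e, Finset.prod_eq_zero_iff] at h2
    grind
  choose σ hσ using this
  have hi : Function.Injective σ := fun i j hij => hr (by
    have := hσ i; rw [hij, ← hσ j] at this; exact_mod_cast this)
  rw [e, ← (Equiv.ofBijective σ (Finite.injective_iff_bijective.1 hi)).prod_comp]
  grind
theorem HE_prodR (hf : f.IsHomogeneous 4) (h1 : eval e3 f = 1) {u : ℝ × ℝ} {r : Fin 4 → ℝ} (hr : Function.Injective r) (h : ∀ i, eval (U3 u (r i)) f = 0) (t : ℝ) :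
    eval (U3 u t) f = ∏ i, (t - r i) := by
  have := HE_prod hf h1 hr h t
  rw [show (![(u.1 : ℂ), u.2, t]) = rl (U3 u t) by ext i; fin_cases i <;> simp [rl], ev_rl] at this
  exact_mod_cast this
theorem sm_uniq {r r' : Fin 4 → ℝ} (hr : StrictMono r) (hr' : StrictMono r') (h : ∀ i, ∏ j, (r i - r' j) = 0) : r = r' := by
  have : ∀ i, ∃ j, r i = r' j := fun i => by
    obtain ⟨j, -, hj⟩ := Finset.prod_eq_zero_iff.1 (h i); exact ⟨j, sub_eq_zero.1 hj⟩
  choose σ hσ using this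
  have hi : Function.Injective σ := fun i j hij => hr.injective (by rw [hσ i, hσ j, hij])
  refine (hr.range_inj hr').1 (Set.Subset.antisymm ?_ ?_)
  · grind
  · rintro _ ⟨i, rfl⟩
    obtain ⟨j, rfl⟩ := (Finite.injective_iff_surjective.1 hi) i
    exact ⟨j, hσ j⟩
theorem sep {T : Type*} [TopologicalSpace T] {φ : T → ℝ → ℝ} {p0 : T} (h1 : ∀ t, ContinuousAt (fun p => φ p t) p0) (h2 : ∀ p, Continuous (φ p))
    {r : Fin 4 → ℝ} (hr : StrictMono r) (h : ∀ t, φ p0 t = ∏ i, (t - r i)) {ε : ℝ} (hε : 0 < ε) :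
    ∀ᶠ p in 𝓝 p0, ∃ r' : Fin 4 → ℝ, StrictMono r' ∧ ∀ i, φ p (r' i) = 0 ∧ |r' i - r i| < ε := by
  have g1 := hr (show (0) < 1 by decide); have g2 := hr (show (1) < 2 by decide); have g3 := hr (show (2) < 3 by decide)
  obtain ⟨δ, d0, d1, d2, d3, d4⟩ : ∃ δ, 0 < δ ∧ δ < ε ∧ 2 * δ < r 1 - r 0 ∧ 2 * δ < r 2 - r 1 ∧ 2 * δ < r 3 - r 2 := by
    obtain ⟨m, hm, k⟩ := exists_between (lt_min (lt_min hε (sub_pos.2 g1)) (lt_min (sub_pos.2 g2) (sub_pos.2 g3)))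
    simp at k
    exact ⟨m / 2, by linarith, by linarith, by linarith, by linarith, by linarith⟩
  have neg : ∀ i, φ p0 (r i - δ) * φ p0 (r i + δ) < 0 := by
    intro i
    rw [h, h, ← Finset.prod_mul_distrib, Fin.prod_univ_four]
    have e : ∀ j, (r i - δ - r j) * (r i + δ - r j) = (r i - r j) ^ 2 - δ ^ 2 := fun j => by ring
    simp only [e]
    have pos : ∀ x : ℝ, δ < x ∨ δ < -x → 0 < x ^ 2 - δ ^ 2 := fun x hx => by rcases hx with hx | hx <;> nlinarith
    have ng : (0) ^ 2 - δ ^ 2 < 0 := by nlinarith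
    fin_cases i <;> simp only [Fin.zero_eta, Fin.mk_one, Fin.reduceFinMk, sub_self]
    · exact mul_neg_of_neg_of_pos (mul_neg_of_neg_of_pos (mul_neg_of_neg_of_pos ng (pos _ (by right; linarith))) (pos _ (by right; linarith))) (pos _ (by right; linarith))
    · exact mul_neg_of_neg_of_pos (mul_neg_of_neg_of_pos (mul_neg_of_pos_of_neg (pos _ (by left; linarith)) ng) (pos _ (by right; linarith))) (pos _ (by right; linarith))
    · exact mul_neg_of_neg_of_pos (mul_neg_of_pos_of_neg (mul_pos (pos _ (by left; linarith)) (pos _ (by left; linarith))) ng) (pos _ (by right; linarith))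
    · exact mul_neg_of_pos_of_neg (mul_pos (mul_pos (pos _ (by left; linarith)) (pos _ (by left; linarith))) (pos _ (by left; linarith))) ng
  have ev := fun i => ((h1 (r i - δ)).mul (h1 (r i + δ))).eventually (gt_mem_nhds (neg i))
  filter_upwards [eventually_all.2 ev] with p hp
  have : ∀ i, ∃ x, r i - δ < x ∧ x < r i + δ ∧ φ p x = 0 := by
    intro i
    have := hp i
    rcases mul_neg_iff.1 this with ⟨a, b⟩ | ⟨a, b⟩
    · obtain ⟨x, hx, h0⟩ := intermediate_value_Ioo' (by linarith) (h2 p).continuousOn ⟨b, a⟩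
      exact ⟨x, hx.1, hx.2, h0⟩
    · obtain ⟨x, hx, h0⟩ := intermediate_value_Ioo (by linarith) (h2 p).continuousOn ⟨a, b⟩
      exact ⟨x, hx.1, hx.2, h0⟩
  choose r' a b c using this
  refine ⟨r', ?_, fun i => ⟨c i, abs_lt.2 ⟨by linarith [a i], by linarith [b i]⟩⟩⟩
  rw [Fin.strictMono_iff_lt_succ]; intro i
  fin_cases i <;> simp
  · linarith [b 0, a 1]
  · linarith [b 1, a 2]
  · linarith [b 2, a 3]
structure ZZ (f : 𝒫) (z : ℝ × ℝ → Fin 4 → ℝ) : Prop where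
  c : ∀ i, ContinuousOn (fun u => z u i) {0}ᶜ
  m : ∀ u, u ≠ 0 → StrictMono (z u)
  pc : ∀ u, u ≠ 0 → ∀ t : ℂ, ev f ![u.1, u.2, t] = ∏ i, (t - z u i)
  p : ∀ u, u ≠ 0 → ∀ t, eval (U3 u t) f = ∏ i, (t - z u i)
  h : ∀ u, u ≠ 0 → ∀ s : ℝ, 0 < s → ∀ i, z (s • u) i = s * z u i
  n : ∀ u, u ≠ 0 → ∀ i, z (-u) i = - z u i.rev
theorem HE_z (hf : f.IsHomogeneous 4) (h : HE f) : ∃ z, ZZ f z := by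
  have : ∀ u : ℝ × ℝ, ∃ r : Fin 4 → ℝ, u ≠ 0 → StrictMono r ∧ ∀ i, eval (U3 u (r i)) f = 0 := fun u => by
    by_cases hu : u = 0
    · exact ⟨0, fun h => absurd hu h⟩
    · obtain ⟨r, hr⟩ := h.2 u hu; exact ⟨r, fun _ => hr⟩
  choose z hz using this
  have pr := fun u hu t => HE_prodR hf h.1 (hz u hu).1.injective (hz u hu).2 t
  have un : ∀ u, u ≠ 0 → ∀ r : Fin 4 → ℝ, StrictMono r → (∀ i, eval (U3 u (r i)) f = 0) → z u = r := fun u hu r hr h0 =>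
    (sm_uniq hr (hz u hu).1 fun i => by rw [← pr u hu, h0]).symm
  refine ⟨z, fun i u hu => ContinuousAt.continuousWithinAt ?_, fun u hu => (hz u hu).1, fun u hu t => HE_prod hf h.1 (hz u hu).1.injective (hz u hu).2 t, pr, fun u hu s hs i => ?_, fun u hu i => ?_⟩
  · refine Metric.tendsto_nhds.2 fun ε hε => ?_
    have c1 : ∀ t, Continuous fun u : ℝ × ℝ => eval (U3 u t) f := fun t => eval_cont.comp (continuous_pi fun i => by
      fin_cases i <;> simp <;> fun_prop)
    have c2 : ∀ u, Continuous fun t : ℝ => eval (U3 u t) f := fun u => eval_cont.comp (continuous_pi fun i => by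
      fin_cases i <;> simp <;> fun_prop)
    filter_upwards [sep  (fun t => (c1 t).continuousAt) c2 (hz u hu).1 (pr u hu) hε, isOpen_compl_singleton.mem_nhds hu] with v hv hv0
    obtain ⟨r', a, b⟩ := hv
    rw [un v hv0 r' a fun i => (b i).1]; exact (b i).2
  · refine congrFun (un (s • u) (smul_ne_zero hs.ne' hu) (fun i => s * z u i) (fun i j hij => mul_lt_mul_of_pos_left ((hz u hu).1 hij) hs) fun i => ?_) i
    rw [show U3 (s • u) (s * z u i) = s • U3 u (z u i) by simp, eval_smul4 hf, (hz u hu).2, mul_zero]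
  · refine congrFun (un (-u) (neg_ne_zero.2 hu) (fun i => - z u i.rev) (fun i j hij => neg_lt_neg ((hz u hu).1 (Fin.rev_lt_rev.2 hij))) fun i => ?_) i
    rw [show U3 (-u) (-z u i.rev) = (-1:ℝ) • U3 u (z u i.rev) by simp, eval_smul4 hf, (hz u hu).2, mul_zero]
def z0 (φ : ℝ × ℝ → ℝ) (u : ℝ × ℝ) : ℝ := if u = 0 then 0 else φ u
theorem z0_ne {φ : ℝ × ℝ → ℝ} {u} (hu : u ≠ 0) : z0 φ u = φ u := if_neg hu
theorem hom_bd {φ : ℝ × ℝ → ℝ} (hc : ContinuousOn φ {0}ᶜ) (hh : ∀ u, u ≠ 0 → ∀ s : ℝ, 0 < s → φ (s • u) = s * φ u) :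
    ∃ K, 0 ≤ K ∧ ∀ u, u ≠ 0 → |φ u| ≤ K * ‖u‖ := by
  obtain ⟨K, hK⟩ := (isCompact_sphere (0) 1).exists_bound_of_continuousOn (hc.mono fun u hu h => by
    rw [h] at hu; simp at hu)
  refine ⟨|K|, abs_nonneg _, fun u hu => ?_⟩
  have h0 := norm_pos_iff.2 hu
  have h1 := hK (‖u‖⁻¹ • u) (by simp [norm_smul, h0.ne'])
  rw [hh u hu _ (inv_pos.2 h0), Real.norm_eq_abs, abs_mul, abs_of_pos (inv_pos.2 h0), inv_mul_le_iff₀ h0] at h1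
  nlinarith [le_abs_self K]
theorem z0_cont {φ : ℝ × ℝ → ℝ} (hc : ContinuousOn φ {0}ᶜ) (hh : ∀ u, u ≠ 0 → ∀ s : ℝ, 0 < s → φ (s • u) = s * φ u) : Continuous (z0 φ) := by
  obtain ⟨K, -, hK⟩ := hom_bd hc hh
  refine continuous_iff_continuousAt.2 fun u => ?_
  by_cases hu : u = 0
  · subst hu
    rw [ContinuousAt, z0, if_pos rfl]
    refine squeeze_zero_norm (a := fun u => K * ‖u‖) (fun u => ?_) ?_
    · by_cases h : u = 0
      · simp [z0, h]
      · rw [z0_ne h]; exact hK u h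
    · have : Continuous fun u : ℝ × ℝ => K * ‖u‖ := by fun_prop
      simpa using this.tendsto 0
  · exact (hc.continuousAt (isOpen_compl_singleton.mem_nhds hu)).congr (by filter_upwards [isOpen_compl_singleton.mem_nhds hu] with v hv using (z0_ne hv).symm)
theorem cc_eq {X : Type*} [TopologicalSpace X] {A S U V : Set X} {x : X} (hA : IsPreconnected A) (h1 : A ⊆ S) (hx : x ∈ A) (hU : IsOpen U) (hV : IsOpen V)
    (hUV : Disjoint U V) (hAU : A ⊆ U) (h : ∀ y ∈ S, y ∈ A ∨ y ∈ V) : connectedComponentIn S x = A := by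
  refine Set.Subset.antisymm (fun y hy => ?_) (hA.subset_connectedComponentIn hx h1)
  have hS := connectedComponentIn_subset S x
  have := isPreconnected_connectedComponentIn.subset_left_of_subset_union hU hV hUV (fun y hy => (h y (hS hy)).imp (fun k => hAU k) id)
    ⟨x, mem_connectedComponentIn (h1 hx), hAU hx⟩
  grind
theorem disk (m : ℝ × ℝ → ℝ) (hm : Continuous m) (hh : ∀ u, ∀ s : ℝ, 0 < s → m (s • u) = s * m u) (hp : ∀ u, 0 ≤ m u + m (-u)) :
    ∃ D V : Set RP2, IsOpen D ∧ IsOpen V ∧ Disjoint D V ∧ IsPreconnected D ∧ Nonempty (↥D ≃ₜ ↥(Metric.ball (0:EuclideanSpace ℝ (Fin 2)) 1)) ∧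
      (∀ v, prj v ∈ D ↔ (m (v.1 0, v.1 1) < v.1 2 ∨ m (-(v.1 0), -(v.1 1)) < - v.1 2)) ∧
      ∀ v, prj v ∈ V ↔ (v.1 2 < m (v.1 0, v.1 1) ∧ - v.1 2 < m (-(v.1 0), -(v.1 1))) := by
  have hop := prj_open qR
  have h00 : m 0 = 0 := by have := hh 0 2 two_pos; simp at this; linarith
  let A : Set {v : ℛ // v ≠ 0} := {v | m (v.1 0, v.1 1) < v.1 2}
  let B : Set {v : ℛ // v ≠ 0} := {v | v.1 2 < m (v.1 0, v.1 1) ∧ - v.1 2 < m (-(v.1 0), -(v.1 1))}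
  have c0 : ∀ i, Continuous fun v : {v : ℛ // v ≠ 0} => v.1 i := fun i => (continuous_apply i).comp continuous_subtype_val
  have c1 : Continuous fun v : {v : ℛ // v ≠ 0} => m (v.1 0, v.1 1) := hm.comp ((c0 0).prodMk (c0 1))
  have c2 : Continuous fun v : {v : ℛ // v ≠ 0} => m (-(v.1 0), -(v.1 1)) := hm.comp ((c0 0).neg.prodMk (c0 1).neg)
  have oA : IsOpen A := isOpen_lt c1 (c0 2)
  have oB : IsOpen B := (isOpen_lt (c0 2) c1).inter (isOpen_lt (c0 2).neg c2)
  have key : ∀ v w : {v : ℛ // v ≠ 0}, prj v = prj w → ∃ t : ℝ, t ≠ 0 ∧ ∀ i, v.1 i = t * w.1 i := by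
    intro v w h
    obtain ⟨t, ht⟩ := (Projectivization.mk_eq_mk_iff' _ _ _ v.2 w.2).1 h
    refine ⟨t, fun h0 => v.2 (by rw [← ht, h0, zero_smul]), fun i => by rw [← ht]; rfl⟩
  have hs : ∀ x y : ℝ, ∀ t : ℝ, 0 < t → m (t * x, t * y) = t * m (x, y) := fun x y t ht => hh (x, y) t ht
  have mD : ∀ v, prj v ∈ prj '' A ↔ (m (v.1 0, v.1 1) < v.1 2 ∨ m (-(v.1 0), -(v.1 1)) < - v.1 2) := by
    intro v; constructor
    · rintro ⟨w, hw, e⟩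
      obtain ⟨t, t0, ht⟩ := key v w e.symm
      rw [ht, ht, ht]
      rcases lt_or_gt_of_ne t0 with h | h
      · right; rw [← neg_mul, ← neg_mul, ← neg_mul, hs _ _ _ (neg_pos.2 h)]; exact mul_lt_mul_of_pos_left hw (neg_pos.2 h)
      · left; rw [hs _ _ _ h]; exact mul_lt_mul_of_pos_left hw h
    · rintro (h | h)
      · exact ⟨v, h, rfl⟩
      · refine ⟨⟨(-1:ℝ) • v.1, smul_ne_zero (by norm_num) v.2⟩, ?_, prj_smul (by norm_num) _ _⟩
        simp only [A]; simpa using h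
  have mV : ∀ v, prj v ∈ prj '' B ↔ (v.1 2 < m (v.1 0, v.1 1) ∧ - v.1 2 < m (-(v.1 0), -(v.1 1))) := by
    intro v; constructor
    · rintro ⟨w, ⟨hw, hw'⟩, e⟩
      obtain ⟨t, t0, ht⟩ := key v w e.symm
      rw [ht, ht, ht]
      rcases lt_or_gt_of_ne t0 with h | h
      · have h' := neg_pos.2 h
        have e1 := hs (w.1 0) (w.1 1) (-t) h'; have e2 := hs (-(w.1 0)) (-(w.1 1)) (-t) h'
        simp at e1 e2
        constructor <;> nlinarith
      · have e2 := hs (-(w.1 0)) (-(w.1 1)) t h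
        simp at e2
        rw [hs _ _ _ h, e2]; constructor <;> nlinarith
    · exact fun h => ⟨v, h, rfl⟩
  have un : ∀ u : ℝ × ℝ, U3 u (1 + m u) ≠ 0 := fun u h => by
    have a0 := congrFun h 0; have a1 := congrFun h 1; have a2 := congrFun h 2
    simp at a0 a1 a2
    rw [show u = 0 from Prod.ext a0 a1, h00] at a2; norm_num at a2
  let ψ : ℝ × ℝ → RP2 := fun u => prj ⟨U3 u (1 + m u), un u⟩
  have cψ : Continuous ψ := hop.continuous.comp (Continuous.subtype_mk (continuous_pi fun i => by fin_cases i <;> simp <;> fun_prop) _)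
  have rψ : ∀ V : Set (ℝ × ℝ), ψ '' V = prj '' {v | v ∈ A ∧ (v.1 2 - m (v.1 0, v.1 1))⁻¹ • (v.1 0, v.1 1) ∈ V} := by
    intro V; ext y; constructor
    · rintro ⟨u, hu, rfl⟩
      refine ⟨_, ⟨?_, ?_⟩, rfl⟩
      · simp [A]
      · simpa using hu
    · rintro ⟨v, ⟨hv, hV⟩, rfl⟩
      have hv : 0 < v.1 2 - m (v.1 0, v.1 1) := sub_pos.2 hv
      refine ⟨_, hV, ?_⟩
      refine Eq.trans ?_ (prj_smul (inv_ne_zero hv.ne') (smul_ne_zero (inv_ne_zero hv.ne') v.2) v.2)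
      simp only [ψ]; congr 2
      rw [hh _ _ (inv_pos.2 hv)]
      ext i; fin_cases i <;> simp; field_simp; ring
  have oψ : IsOpenMap ψ := fun V hV => by
    rw [rψ]
    refine hop.isOpenMap _ ?_
    have : ContinuousOn (fun v : {v : ℛ // v ≠ 0} => (v.1 2 - m (v.1 0, v.1 1))⁻¹ • (v.1 0, v.1 1)) A :=
      ContinuousOn.smul (((c0 2).sub c1).continuousOn.inv₀ fun v (hv : v ∈ A) => (sub_pos.2 hv).ne') ((c0 0).prodMk (c0 1)).continuousOn
    exact this.isOpen_inter_preimage oA hV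
  have iψ : Function.Injective ψ := fun u u' h => by
    obtain ⟨t, t0, ht⟩ := key _ _ h
    have a0 := ht 0; have a1 := ht 1; have a2 := ht 2
    simp at a0 a1 a2
    have eu : u = t • u' := Prod.ext a0 a1
    rcases lt_or_gt_of_ne t0 with h | h
    · have e1 : m u = -t * m (-u') := by rw [eu, ← hh _ _ (neg_pos.2 h)]; simp
      have := hp u'
      nlinarith
    · rw [eu, hh _ _ h] at a2
      have : t = 1 := by linarith
      rw [eu, this, one_smul]
  have rg : Set.range ψ = prj '' A := by rw [← Set.image_univ, rψ]; simp
  refine ⟨prj '' A, prj '' B, hop.isOpenMap _ oA, hop.isOpenMap _ oB, ?_, ?_, ?_, mD, mV⟩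
  · refine Set.disjoint_left.2 ?_
    rintro _ ⟨v, hv, rfl⟩ h
    exact lt_asymm ((mV v).1 h).1 hv
  · rw [← rg]; exact isPreconnected_range cψ
  · rw [← rg]
    exact ⟨((Topology.IsOpenEmbedding.of_continuous_injective_isOpenMap cψ iψ oψ).isEmbedding.toHomeomorph).symm.trans ballP.symm⟩
theorem HE_P3 (hf : f.IsHomogeneous 4) (h : HE f) : P3 f := by
  obtain ⟨z, Z⟩ := HE_z hf h
  have hne : ∀ u : ℝ × ℝ, u ≠ 0 → ∀ t, U3 u t ≠ 0 := fun u hu t h => hu (Prod.ext (by simpa using congrFun h 0) (by simpa using congrFun h 1))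
  have cz := fun i => z0_cont (Z.c i) fun u hu s hs => Z.h u hu s hs i
  have hz : ∀ i u, ∀ s : ℝ, 0 < s → z0 (fun u => z u i) (s • u) = s * z0 (fun u => z u i) u := fun i u s hs => by
    by_cases hu : u = 0
    · simp [hu, z0]
    · rw [z0_ne hu, z0_ne (smul_ne_zero hs.ne' hu), Z.h u hu s hs]
  have hn : ∀ x y : ℝ, (-x, -y) = -(x, y) := fun x y => rfl
  have n2 : ∀ u, u ≠ 0 → z (-u) 2 = - z u 1 := fun u hu => Z.n u hu 2
  have n3 : ∀ u, u ≠ 0 → z (-u) 3 = - z u 0 := fun u hu => Z.n u hu 3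
  have lt : ∀ u, u ≠ 0 → z u 0 < z u 1 ∧ z u 1 < z u 2 ∧ z u 2 < z u 3 := fun u hu => ⟨Z.m u hu (by decide), Z.m u hu (by decide), Z.m u hu (by decide)⟩
  have pos : ∀ u, 0 ≤ z0 (fun u => z u 2) u + z0 (fun u => z u 2) (-u) := fun u => by
    by_cases hu : u = 0
    · simp [hu, z0]
    · rw [z0_ne hu, z0_ne (neg_ne_zero.2 hu), n2 u hu]; linarith [lt u hu]
  have pos3 : ∀ u, 0 ≤ z0 (fun u => z u 3) u + z0 (fun u => z u 3) (-u) := fun u => by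
    by_cases hu : u = 0
    · simp [hu, z0]
    · rw [z0_ne hu, z0_ne (neg_ne_zero.2 hu), n3 u hu]; linarith [lt u hu]
  let O : Fin 4 → Set RP2 := fun i => Set.range fun u : ({0}ᶜ : Set (ℝ × ℝ)) => prj ⟨U3 u.1 (z u.1 i), hne u.1 u.2 _⟩
  have pO : ∀ i, IsPreconnected (O i) := fun i => by
    have : IsConnected ({0}ᶜ : Set (ℝ × ℝ)) := isConnected_compl_singleton_of_one_lt_rank (by norm_num) 0
    haveI := isPreconnected_iff_preconnectedSpace.1 this.isPreconnected
    refine isPreconnected_range ((prj_open qR).continuous.comp (Continuous.subtype_mk (continuous_pi fun j => ?_) _))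
    have := continuousOn_iff_continuous_domRestrict.1 (Z.c i)
    fin_cases j
    · exact continuous_fst.comp continuous_subtype_val
    · exact continuous_snd.comp continuous_subtype_val
    · exact this
  have sO : ∀ i, O i ⊆ realLocus f := by
    rintro i _ ⟨u, rfl⟩
    refine (rl_iff hf _).2 ?_
    rw [Z.p u.1 u.2]; exact Finset.prod_eq_zero (Finset.mem_univ i) (sub_self _)
  have mO : ∀ i v, ∀ u : ℝ × ℝ, (v.1 0, v.1 1) = u → u ≠ 0 → (v.1 2 = z u i ∨ v.1 2 = z u i.rev) → prj v ∈ O i := by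
    rintro i v u rfl hu (e | e)
    · exact ⟨⟨_, hu⟩, congrArg prj (Subtype.ext (by ext j; fin_cases j <;> simp [e]))⟩
    · refine ⟨⟨_, neg_ne_zero.2 hu⟩, Eq.trans ?_ (prj_smul (show (-1:ℝ) ≠ 0 by norm_num) (smul_ne_zero (by norm_num) v.2) v.2)⟩
      refine congrArg prj (Subtype.ext ?_)
      have := Z.n _ hu i
      ext j; fin_cases j <;> simp [e] <;> simpa using this
  have cov : ∀ y ∈ realLocus f, y ∈ O 2 ∨ y ∈ O 3 := by
    intro y hy
    obtain ⟨v, rfl⟩ := (prj_open qR).surjective y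
    rw [rl_iff hf] at hy
    by_cases hu : ((v.1 0, v.1 1)) = 0
    · have a : v.1 = v.1 2 • e3 := by
        ext j; fin_cases j <;> simp_all
      rw [a, eval_smul4 hf, h.1, mul_one] at hy
      exact absurd (a.trans (by rw [pow_eq_zero_iff (by norm_num)] at hy; rw [hy, zero_smul])) v.2
    · rw [show v.1 = U3 (v.1 0, v.1 1) (v.1 2) by ext j; fin_cases j <;> simp, Z.p _ hu, Fin.prod_univ_four] at hy
      simp only [mul_eq_zero, sub_eq_zero] at hy
      rcases hy with ((e | e) | e) | e
      · exact Or.inr (mO 3 v _ rfl hu (Or.inr e))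
      · exact Or.inl (mO 2 v _ rfl hu (Or.inr e))
      · exact Or.inl (mO 2 v _ rfl hu (Or.inl e))
      · exact Or.inr (mO 3 v _ rfl hu (Or.inl e))
  let m := fun u => (z0 (fun u => z u 2) u + z0 (fun u => z u 3) u) / 2
  obtain ⟨D, V, oD, oV, dj, -, -, mD, mV⟩ := disk m (((cz 2).add (cz 3)).div_const 2) (fun u s hs => by simp  [m]; rw [hz 2 u s hs, hz 3 u s hs]; ring)
    (fun u => by simp  [m]; linarith [pos u, pos3 u])
  obtain ⟨D', V', oD', oV', dj', cD', bD', mD', mV'⟩ := disk _ (cz 2) (hz 2) pos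
  have e1 : ((1, 0) : ℝ × ℝ) ≠ 0 := by simp
  have O3D : O 3 ⊆ D := by
    rintro _ ⟨u, rfl⟩
    refine (mD _).2 (Or.inl ?_)
    have hu : ((u.1.1, u.1.2)) ≠ 0 := u.2
    simp [m, z0_ne hu]; linarith [lt u.1 u.2]
  have O2V : O 2 ⊆ V := by
    rintro _ ⟨u, rfl⟩
    have hu : ((u.1.1, u.1.2)) ≠ 0 := u.2
    refine (mV _).2 ?_
    simp only [hn, m]
    have a := n2 _ hu; have b := n3 _ hu
    simp [z0_ne hu, z0_ne (neg_ne_zero.2 hu)] at a b ⊢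
    constructor <;> linarith [lt u.1 u.2]
  have O3D' : O 3 ⊆ D' := by
    rintro _ ⟨u, rfl⟩
    refine (mD' _).2 (Or.inl ?_)
    have hu : ((u.1.1, u.1.2)) ≠ 0 := u.2
    simp [z0_ne hu]; linarith [lt u.1 u.2]
  have x3 : prj ⟨U3 (1,0) (z (1,0) 3), hne _ e1 _⟩ ∈ O 3 := ⟨⟨_, e1⟩, rfl⟩
  have x2 : prj ⟨U3 (1,0) (z (1,0) 2), hne _ e1 _⟩ ∈ O 2 := ⟨⟨_, e1⟩, rfl⟩
  have k3 := cc_eq (pO 3) (sO 3) x3 oD oV dj O3D fun y hy => (cov y hy).symm.imp id fun k => O2V k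
  have k2 := cc_eq (pO 2) (sO 2) x2 oV oD dj.symm O2V fun y hy => (cov y hy).imp id fun k => O3D k
  have D'O : ∀ v, v ∈ O 2 → v ∉ D' := by
    rintro _ ⟨u, rfl⟩ h
    have hu : ((u.1.1, u.1.2)) ≠ 0 := u.2
    have := (mD' _).1 h
    simp only [hn] at this
    have a := n2 _ hu
    simp [z0_ne hu, z0_ne (neg_ne_zero.2 hu)] at a this
    linarith [lt u.1 u.2]
  refine ⟨_, sO 3 x3, _, sO 2 x2, ?_, D', ⟨⟨prj ⟨U3 (1,0) (z (1,0) 3), hne _ e1 _⟩, ?_, ?_⟩, bD'⟩, ?_⟩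
  · rw [ovalThrough, ovalThrough, k3, k2]
    intro e
    exact Set.disjoint_left.1 dj (O3D x3) (O2V (e ▸ x3))
  · rw [ovalThrough, k2]; exact fun h => D'O _ h (O3D' x3)
  · rw [ovalThrough, k2]
    refine (cc_eq cD' (fun y hy h => D'O y h hy) (O3D' x3) oD' oV' dj' le_rfl fun y hy => ?_).symm
    obtain ⟨v, rfl⟩ := (prj_open qR).surjective y
    rw [mD', mV']
    by_contra hc
    push Not at hc
    obtain ⟨⟨c1, c2⟩, c3⟩ := hc
    by_cases hu : ((v.1 0, v.1 1)) = 0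
    · simp only [hn, hu, neg_zero, z0, if_true] at c1 c2 c3
      have := le_antisymm c1 (by linarith)
      apply v.2
      ext j; fin_cases j <;> simp_all
    · simp only [hn, z0_ne hu, z0_ne (neg_ne_zero.2 hu), n2 _ hu] at c1 c2 c3
      rcases lt_or_eq_of_le c1 with c | c
      · exact hy (mO 2 v _ rfl hu (Or.inr (le_antisymm (by have := c3 c; linarith!) (by linarith!))))
      · exact hy (mO 2 v _ rfl hu (Or.inl c))
  · rw [ovalThrough, k3]; exact O3D'
theorem ivt0 {g : ℝ × ℝ → ℝ} (hg : ContinuousOn g {0}ᶜ) {u v : ℝ × ℝ} (hu : u ≠ 0) (hv : v ≠ 0) (h1 : g u ≤ 0) (h2 : 0 ≤ g v) : ∃ w, w ≠ 0 ∧ g w = 0 := by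
  have : IsConnected ({0}ᶜ : Set (ℝ × ℝ)) := isConnected_compl_singleton_of_one_lt_rank (by norm_num) 0
  obtain ⟨w, a, b⟩ := this.isPreconnected.intermediate_value hu hv hg ⟨h1, h2⟩
  exact ⟨w, a, b⟩
abbrev Ln (a b : ℝ) (u : ℝ × ℝ) : ℝ := a * u.1 + b * u.2
theorem Ln_cont (a b : ℝ) : Continuous (Ln a b) := by fun_prop
theorem Ln_mid {z} (Z : ZZ f z) (a b : ℝ) : ∃ u, u ≠ 0 ∧ z u 1 < Ln a b u ∧ Ln a b u < z u 2 := by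
  let g := fun u => Ln a b u - (z u 1 + z u 2) / 2
  have hg : ContinuousOn g {0}ᶜ := (Ln_cont a b).continuousOn.sub (((Z.c 1).add (Z.c 2)).div_const 2)
  have hn : ∀ u, u ≠ 0 → g (-u) = - g u := fun u hu => by
    have h1 : z (-u) 1 = - z u 2 := Z.n u hu 1
    have h2 : z (-u) 2 = - z u 1 := Z.n u hu 2
    simp [g, h1, h2, Ln]; ring
  have e1 : ((1, 0) : ℝ × ℝ) ≠ 0 := by simp
  obtain ⟨w, w0, hw⟩ : ∃ w, w ≠ 0 ∧ g w = 0 := by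
    rcases le_total (g (1,0)) 0 with h | h
    · exact ivt0 hg e1 (neg_ne_zero.2 e1) h (by rw [hn _ e1]; linarith)
    · exact ivt0 hg (neg_ne_zero.2 e1) e1 (by rw [hn _ e1]; linarith) h
  have := Z.m w w0 (show (1) < 2 by decide)
  exact ⟨w, w0, by simp  [g] at hw; linarith, by simp  [g] at hw; linarith⟩
theorem mid_pos {z} (Z : ZZ f z) (a b : ℝ) : ∃ u, u ≠ 0 ∧ 0 < eval (U3 u (Ln a b u)) f := by
  obtain ⟨u, u0, h1, h2⟩ := Ln_mid Z a b
  refine ⟨u, u0, ?_⟩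
  rw [Z.p u u0, Fin.prod_univ_four]
  have l1 := Z.m u u0 (show (0) < 1 by decide); have l2 := Z.m u u0 (show (2) < 3 by decide)
  have := mul_pos (mul_pos (mul_pos (show 0 < Ln a b u - z u 0 by linarith) (show 0 < Ln a b u - z u 1 by linarith)) (show 0 < z u 2 - Ln a b u by linarith)) (show 0 < z u 3 - Ln a b u by linarith)
  nlinarith
theorem Ln_bd {z} (Z : ZZ f z) {a b : ℝ} (h : ∀ u, u ≠ 0 → 0 ≤ eval (U3 u (Ln a b u)) f) : ∀ u, u ≠ 0 → z u 1 ≤ Ln a b u ∧ Ln a b u ≤ z u 2 := by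
  obtain ⟨w, w0, h1, h2⟩ := Ln_mid Z a b
  have lt : ∀ u, u ≠ 0 → z u 0 < z u 1 ∧ z u 1 < z u 2 ∧ z u 2 < z u 3 := fun u hu => ⟨Z.m u hu (by decide), Z.m u hu (by decide), Z.m u hu (by decide)⟩
  have cl := (Ln_cont a b).continuousOn (s := ({0}ᶜ))
  refine fun u hu => ⟨?_, ?_⟩ <;> by_contra hc <;> push Not at hc
  · obtain ⟨v, v0, hv⟩ := ivt0 (g := fun u => Ln a b u - (z u 0 + z u 1) / 2) (cl.sub (((Z.c 0).add (Z.c 1)).div_const 2)) hu w0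
      (by
        have := h u hu
        rw [Z.p u hu, Fin.prod_univ_four] at this
        by_contra k
        obtain ⟨l1, l2, l3⟩ := lt u hu
        have := mul_pos (mul_pos (mul_pos (show 0 < Ln a b u - z u 0 by linarith) (show 0 < z u 1 - Ln a b u by linarith)) (show 0 < z u 2 - Ln a b u by linarith)) (show 0 < z u 3 - Ln a b u by linarith)
        nlinarith) (by linarith [lt w w0])
    have := h v v0
    rw [Z.p v v0, Fin.prod_univ_four] at this
    obtain ⟨l1, l2, l3⟩ := lt v v0
    have := mul_pos (mul_pos (mul_pos (show 0 < Ln a b v - z v 0 by linarith) (show 0 < z v 1 - Ln a b v by linarith)) (show 0 < z v 2 - Ln a b v by linarith)) (show 0 < z v 3 - Ln a b v by linarith)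
    nlinarith
  · obtain ⟨v, v0, hv⟩ := ivt0 (g := fun u => Ln a b u - (z u 2 + z u 3) / 2) (cl.sub (((Z.c 2).add (Z.c 3)).div_const 2)) w0 hu (by linarith [lt w w0])
      (by
        have := h u hu
        rw [Z.p u hu, Fin.prod_univ_four] at this
        by_contra k
        obtain ⟨l1, l2, l3⟩ := lt u hu
        have := mul_pos (mul_pos (mul_pos (show 0 < Ln a b u - z u 0 by linarith) (show 0 < Ln a b u - z u 1 by linarith)) (show 0 < Ln a b u - z u 2 by linarith)) (show 0 < z u 3 - Ln a b u by linarith)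
        nlinarith)
    have := h v v0
    rw [Z.p v v0, Fin.prod_univ_four] at this
    obtain ⟨l1, l2, l3⟩ := lt v v0
    have := mul_pos (mul_pos (mul_pos (show 0 < Ln a b v - z v 0 by linarith) (show 0 < Ln a b v - z v 1 by linarith)) (show 0 < Ln a b v - z v 2 by linarith)) (show 0 < z v 3 - Ln a b v by linarith)
    nlinarith
def Sq (f : 𝒫) : Set (Fin 5 → ℝ) := {x | ∀ t : ℝ, eval ![t, 1, x 0 * t + x 1] f = (x 2 + x 3 * t + x 4 * t ^ 2) ^ 2}
theorem Sq_hom (hf : f.IsHomogeneous 4) {x} (hx : x ∈ Sq f) (s t : ℝ) : eval ![s, t, x 0 * s + x 1 * t] f = (x 2 * t ^ 2 + x 3 * s * t + x 4 * s ^ 2) ^ 2 := by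
  have : (fun t => eval ![s, t, x 0 * s + x 1 * t] f) = fun t => (x 2 * t ^ 2 + x 3 * s * t + x 4 * s ^ 2) ^ 2 := by
    refine Continuous.ext_on (dense_compl_singleton 0) (eval_cont.comp (continuous_pi fun i => by
      fin_cases i <;> simp <;> fun_prop)) (by fun_prop) fun t ht => ?_
    have ht : t ≠ 0 := ht
    rw [show ![s, t, x 0 * s + x 1 * t] = t • ![s / t, 1, x 0 * (s / t) + x 1] by ext i; fin_cases i <;> simp <;> field_simp, eval_smul4 hf, hx]
    field_simp
  exact congrFun this t
theorem sq_sq {a b c a' b' c' : ℝ} (h : ∀ t : ℝ, (a + b * t + c * t ^ 2) ^ 2 = (a' + b' * t + c' * t ^ 2) ^ 2) :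
    (a = a' ∧ b = b' ∧ c = c') ∨ (a = -a' ∧ b = -b' ∧ c = -c') := by
  have cf : ∀ a b c : ℝ, (Polynomial.C a + Polynomial.C b * Polynomial.X + Polynomial.C c * Polynomial.X ^ 2) = 0 → a = 0 ∧ b = 0 ∧ c = 0 := by
    intro a b c h
    have h0 := congrArg (Polynomial.coeff · 0) h; have h1 := congrArg (Polynomial.coeff · 1) h; have h2 := congrArg (Polynomial.coeff · 2) h
    simp at h0 h1 h2
    exact ⟨h0, h1, h2⟩
  have : (Polynomial.C (a - a') + Polynomial.C (b - b') * Polynomial.X + Polynomial.C (c - c') * Polynomial.X ^ 2) *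
    (Polynomial.C (a + a') + Polynomial.C (b + b') * Polynomial.X + Polynomial.C (c + c') * Polynomial.X ^ 2) = 0 := by
    refine Polynomial.funext fun t => ?_
    simp only [Polynomial.eval_mul, Polynomial.eval_add, Polynomial.eval_C, Polynomial.eval_X, Polynomial.eval_pow, Polynomial.eval_zero]; linear_combination h t
  rcases mul_eq_zero.1 this with h | h
  · obtain ⟨h1, h2, h3⟩ := cf _ _ _ h
    grind
  · obtain ⟨h1, h2, h3⟩ := cf _ _ _ h
    grind
abbrev Wx (x : Fin 5 → ℝ) : Submodule ℝ ℛ := Submodule.span ℝ {![1, 0, x 0], ![0, 1, x 1]}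
theorem Wx_li (x : Fin 5 → ℝ) : LinearIndependent ℝ ![![1, 0, x 0], ![0, 1, x 1]] := by
  rw [LinearIndependent.pair_iff]
  simp
theorem Wx_mem {x : Fin 5 → ℝ} {v} : v ∈ Wx x ↔ v 2 = x 0 * v 0 + x 1 * v 1 := by
  rw [Submodule.mem_span_pair]; constructor
  · rintro ⟨a, b, rfl⟩; simp; ring
  · intro h; refine ⟨v 0, v 1, ?_⟩
    ext i; fin_cases i <;> simp [h]; ring
theorem Sq_ne (hf : f.IsHomogeneous 4) (h : HE f) {x} (hx : x ∈ Sq f) : ¬ (x 2 = 0 ∧ x 3 = 0 ∧ x 4 = 0) := by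
  obtain ⟨z, Z⟩ := HE_z hf h
  rintro ⟨a, b, c⟩
  obtain ⟨u, u0, h1⟩ := mid_pos Z (x 0) (x 1)
  have := Sq_hom hf hx u.1 u.2
  simp_all
theorem Sq_bit (hf : f.IsHomogeneous 4) (h : HE f) {x} (hx : x ∈ Sq f) : IsRealBitangent f (Wx x) := by
  rw [bit_iff (Wx_li x)]
  refine ⟨x 4, x 3, x 2, 1, ?_, one_ne_zero, fun s t => ?_⟩
  · have := Sq_ne hf h hx; tauto
  · rw [show s • ![1, 0, x 0] + t • ![0, 1, x 1] = ![s, t, x 0 * s + x 1 * t] by ext i; fin_cases i <;> simp; ring, Sq_hom hf hx]; ring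
theorem bit_Sq (hf : f.IsHomogeneous 4) (h : HE f) {W} (hW : IsRealBitangent f W) : ∃ x ∈ Sq f, Wx x = W := by
  obtain ⟨z, Z⟩ := HE_z hf h
  have fr := hW.1
  have sp : ∀ p m, LinearIndependent ℝ ![p, m] → p ∈ W → m ∈ W → W = Submodule.span ℝ {p, m} := fun p m hl hp hm => by
    refine (Submodule.eq_of_le_of_finrank_eq (Submodule.span_le.2 ?_) ?_).symm
    · rintro v (rfl | rfl) <;> assumption
    · have := finrank_span_eq_card hl
      rw [show Set.range ![p, m] = {p, m} by simp [Set.pair_comm]] at this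
      rw [fr, this]; rfl
  have ne3 : e3 ∉ W := by
    intro he
    obtain ⟨w, hw, hl⟩ : ∃ w ∈ W, LinearIndependent ℝ ![e3, w] := by
      by_contra hc
      push Not at hc
      have : W ≤ Submodule.span ℝ {e3} := fun w hw => by
        have := hc w hw
        rw [LinearIndependent.pair_iff' (by simpa using congrFun h 2)] at this
        push Not at this
        exact Submodule.mem_span_singleton.2 this
      have := (Submodule.finrank_mono this).trans (finrank_span_singleton   (by simpa using congrFun h 2)).le
      omega
    obtain ⟨a, b, d, e, -, e0, hq⟩ := (bit_iff hl).1 (sp e3 w hl he hw ▸ hW)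
    have hu : ((w 0, w 1)) ≠ 0 := fun hu => by
      have := (LinearIndependent.pair_iff.1 hl (w 2) (-1) (by ext i; fin_cases i <;> simp_all)).2
      norm_num at this
    have rt : ∀ i, a * (z (w 0, w 1) i - w 2) ^ 2 + b * (z (w 0, w 1) i - w 2) + d = 0 := fun i => by
      have := hq (z (w 0, w 1) i - w 2) 1
      rw [show (z (w 0, w 1) i - w 2) • e3 + (1:ℝ) • w = U3 (w 0, w 1) (z (w 0, w 1) i) by ext i; fin_cases i <;> simp, Z.p _ hu,
        Finset.prod_eq_zero (Finset.mem_univ i) (sub_self _)] at this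
      have := pow_eq_zero_iff (two_ne_zero) |>.1 ((mul_eq_zero.1 this.symm).resolve_left e0)
      linarith
    have l1 := Z.m _ hu (show (0) < 1 by decide); have l2 := Z.m _ hu (show (1) < 2 by decide)
    have a0 : a = 0 := by
      have h1 : a * (z (w 0, w 1) 0 + z (w 0, w 1) 1 - 2 * w 2) + b = 0 := mul_left_cancel₀ (sub_pos.2 l1).ne' (by linear_combination rt 1 - rt 0)
      have h2 : a * (z (w 0, w 1) 1 + z (w 0, w 1) 2 - 2 * w 2) + b = 0 := mul_left_cancel₀ (sub_pos.2 l2).ne' (by linear_combination rt 2 - rt 1)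
      nlinarith
    have := hq 1 0
    rw [one_smul, zero_smul, add_zero, h.1, a0] at this
    norm_num at this
  let P := ((LinearMap.proj 0).prod (LinearMap.proj 1)).comp W.subtype
  have iP : Function.Injective P := by
    rw [← LinearMap.ker_eq_bot, LinearMap.ker_eq_bot']
    intro v hv
    have h0 : v.1 0 = 0 := congrArg Prod.fst hv
    have h1 : v.1 1 = 0 := congrArg Prod.snd hv
    by_contra hc
    have h2 : v.1 2 ≠ 0 := fun h2 => hc (Subtype.ext (by ext i; fin_cases i <;> simp [h0, h1, h2]))
    apply ne3
    have := W.smul_mem (v.1 2)⁻¹ v.2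
    convert this using 1
    ext i; fin_cases i <;> simp [h0, h1, h2]
  have sP : Function.Surjective P := (LinearMap.injective_iff_surjective_of_finrank_eq_finrank (by rw [fr]; simp)).1 iP
  obtain ⟨p, hp⟩ := sP (1, 0)
  obtain ⟨m, hm⟩ := sP (0, 1)
  have p0 : p.1 0 = 1 := congrArg Prod.fst hp
  have p1 : p.1 1 = 0 := congrArg Prod.snd hp
  have m0 : m.1 0 = 0 := congrArg Prod.fst hm
  have m1 : m.1 1 = 1 := congrArg Prod.snd hm
  have key : ∀ x : Fin 5 → ℝ, x 0 = p.1 2 → x 1 = m.1 2 → W = Wx x := fun x h0 h1 =>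
    sp _ _ (Wx_li x) (by convert p.2 using 1; ext i; fin_cases i <;> simp [p0, p1, h0]) (by convert m.2 using 1; ext i; fin_cases i <;> simp [m0, m1, h1])
  have hW' := hW
  rw [key ![p.1 2, m.1 2, 0, 0, 0] rfl rfl, bit_iff (Wx_li _)] at hW'
  obtain ⟨a, b, d, e, -, e0, hq⟩ := hW'
  have hq' : ∀ s t : ℝ, eval ![s, t, p.1 2 * s + m.1 2 * t] f = e * (a * s ^ 2 + b * s * t + d * t ^ 2) ^ 2 := fun s t => by
    rw [← hq]; congr 2; ext i; fin_cases i <;> simp; ring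
  have ep : 0 < e := by
    obtain ⟨u, u0, h1⟩ := mid_pos Z (p.1 2) (m.1 2)
    have := hq' u.1 u.2
    nlinarith
  refine ⟨![p.1 2, m.1 2, √e * d, √e * b, √e * a], fun t => ?_, (key _ rfl rfl).symm⟩
  have := hq' t 1
  simp
  grind
theorem Sq_P1 (hf : f.IsHomogeneous 4) (h : HE f) (h8 : Nat.card (Sq f) = 8) : P1 f := by
  choose s hs hW using fun W : {W // IsRealBitangent f W} => bit_Sq hf h W.2
  let ng : (Fin 5 → ℝ) → Bool → (Fin 5 → ℝ) := fun x b => if b then x else ![x 0, x 1, - x 2, - x 3, - x 4]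
  have ngS : ∀ x ∈ Sq f, ∀ b, ng x b ∈ Sq f := fun x hx b => by
    cases b
    · intro t; have := hx t; simp [ng] at this ⊢; rw [this]; ring
    · exact hx
  have ngW : ∀ x b, Wx (ng x b) = Wx x := fun x b => by cases b <;> rfl
  let F : {W // IsRealBitangent f W} × Bool → Sq f := fun y => ⟨ng (s y.1) y.2, ngS _ (hs _) _⟩
  have bF : Function.Bijective F := by
    constructor
    · rintro ⟨W, b⟩ ⟨W', b'⟩ e
      have e := congrArg Subtype.val e
      have e1 : W = W' := Subtype.ext (by rw [← hW W, ← hW W', ← ngW (s W) b, ← ngW (s W') b']; exact congrArg Wx e)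
      subst e1
      have n := Sq_ne hf h (hs W)
      have := congrFun e 2; have := congrFun e 3; have := congrFun e 4
      cases b <;> cases b' <;> first | rfl | (simp [F, ng] at *; apply n <;> linarith)
    · rintro ⟨x, hx⟩
      let W : {W // IsRealBitangent f W} := ⟨Wx x, Sq_bit hf h hx⟩
      have e : Wx (s W) = Wx x := hW W
      have m0 : (![1, 0, x 0] : ℛ) ∈ Wx (s W) := by rw [e, Wx_mem]; simp
      have m1 : (![0, 1, x 1] : ℛ) ∈ Wx (s W) := by rw [e, Wx_mem]; simp
      rw [Wx_mem] at m0 m1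
      simp at m0 m1
      have k := sq_sq fun t => (by rw [← hx t, ← hs W t, m0, m1] : (x 2 + x 3 * t + x 4 * t ^ 2) ^ 2 = (s W 2 + s W 3 * t + s W 4 * t ^ 2) ^ 2)
      rcases k with ⟨k2, k3, k4⟩ | ⟨k2, k3, k4⟩
      · exact ⟨(W, true), Subtype.ext (by ext i; fin_cases i <;> simp [F, ng, *])⟩
      · exact ⟨(W, false), Subtype.ext (by ext i; fin_cases i <;> simp [F, ng, *])⟩
  have := Nat.card_congr (Equiv.ofBijective F bF)
  rw [Nat.card_prod, h8, Nat.card_eq_fintype_card (α := Bool), Fintype.card_bool] at this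
  rw [P1]; omega
theorem card_const {E : Type*} [NormedAddCommGroup E] [NormedSpace ℝ E] [FiniteDimensional ℝ E] {G : ℝ × E → E} (hG : ContDiff ℝ 1 G)
    (hZ : IsCompact {p : ℝ × E | p.1 ∈ Set.Icc (0:ℝ) 1 ∧ G p = 0})
    (hi : ∀ p, p.1 ∈ Set.Icc (0:ℝ) 1 → G p = 0 → ∀ v, fderiv ℝ G p (0, v) = 0 → v = 0) :
    Nat.card {x | G (0, x) = 0} = Nat.card {x | G (1, x) = 0} := by
  set Z := {p : ℝ × E | p.1 ∈ Set.Icc (0) 1 ∧ G p = 0} with hZd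
  haveI := isCompact_iff_compactSpace.1 hZ
  let π : Z → Set.Icc (0:ℝ) 1 := fun p => ⟨p.1.1, p.2.1⟩
  have cπ : Continuous π := Continuous.subtype_mk (continuous_fst.comp continuous_subtype_val) _
  let Ψ := fun p => (p.1, G p)
  have loc : ∀ p ∈ Z, (∃ U ∈ 𝓝 p, Set.InjOn Ψ U) ∧ map Ψ (𝓝 p) = 𝓝 (Ψ p) := by
    intro p hp
    have h1 : HasStrictFDerivAt Ψ ((ContinuousLinearMap.fst ℝ ℝ E).prod (fderiv ℝ G p)) p :=
      (ContinuousLinearMap.fst ℝ ℝ E).hasStrictFDerivAt.prodMk (hG.contDiffAt.hasStrictFDerivAt one_ne_zero)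
    have inj : Function.Injective ((ContinuousLinearMap.fst ℝ ℝ E).prod (fderiv ℝ G p)).toLinearMap := by
      rw [← LinearMap.ker_eq_bot, LinearMap.ker_eq_bot']
      rintro ⟨a, v⟩ h
      have ha : a = 0 := congrArg Prod.fst h
      have hv : fderiv ℝ G p (a, v) = 0 := congrArg Prod.snd h
      rw [ha] at hv
      rw [ha, hi p hp.1 hp.2 v hv]; rfl
    let L := (LinearEquiv.ofInjectiveEndo _ inj).toContinuousLinearEquiv
    have h2 : HasStrictFDerivAt Ψ (L : ℝ × E →L[ℝ] ℝ × E) p := by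
      fun_prop
    exact ⟨⟨_, (h2.toOpenPartialHomeomorph Ψ).open_source.mem_nhds h2.mem_toOpenPartialHomeomorph_source, (h2.toOpenPartialHomeomorph Ψ).injOn⟩, h2.map_nhds_eq_of_equiv⟩
  have oπ : IsOpenMap π := by
    refine isOpenMap_iff_nhds_le.2 fun p s hs => ?_
    rw [mem_map, mem_nhds_subtype] at hs
    obtain ⟨W, hW, hs⟩ := hs
    have := image_mem_map (m := Ψ) hW
    rw [(loc p.1 p.2).2] at this
    have c : Continuous fun t : Set.Icc (0:ℝ) 1 => ((t : ℝ), (0 : E)) := by fun_prop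
    have e : Ψ p.1 = ((π p : ℝ), (0)) := Prod.ext rfl p.2.2
    rw [e] at this
    filter_upwards [c.continuousAt.preimage_mem_nhds this] with t ht
    obtain ⟨q, hq, e⟩ := ht
    have e1 : q.1 = t := congrArg Prod.fst e
    have e2 : G q = 0 := congrArg Prod.snd e
    have : (⟨q, ⟨e1 ▸ t.2, e2⟩⟩ : Z) ∈ π ⁻¹' s := hs hq
    grind
  have lh : IsCoveringMap π := by
    rw [← isLocalHomeomorph_iff_isCoveringMap, isLocalHomeomorph_iff_isOpenEmbedding_restrict]
    intro p
    obtain ⟨U, hU, hj⟩ := (loc p.1 p.2).1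
    obtain ⟨V, hV, oV, pV⟩ := mem_nhds_iff.1 hU
    refine ⟨Subtype.val ⁻¹' V, (oV.preimage continuous_subtype_val).mem_nhds pV, .of_continuous_injective_isOpenMap (cπ.comp continuous_subtype_val) ?_
      (oπ.comp (oV.preimage continuous_subtype_val).isOpenMap_subtype_val)⟩
    intro a b h
    exact Subtype.ext (Subtype.ext (hj (hV a.2) (hV b.2) (Prod.ext (congrArg Subtype.val h) (a.1.2.2.trans b.1.2.2.symm))))
  have lc : IsLocallyConstant fun t : Set.Icc (0) 1 => Nat.card (π ⁻¹' {t}) := by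
    refine (IsLocallyConstant.iff_eventually_eq _).2 fun t => ?_
    obtain ⟨d, U, tU, oU, oU', H⟩ := lh t
    filter_upwards [oU.mem_nhds tU] with y hy
    exact (Nat.card_congr (IsEvenlyCovered.fiberHomeomorph ⟨d, U, hy, oU, oU', H⟩).toEquiv).symm
  have fb : ∀ t : Set.Icc (0) 1, Nat.card (π ⁻¹' {t}) = Nat.card {x | G (t, x) = 0} := fun t =>
    Nat.card_congr
      { toFun := fun p => ⟨p.1.1.2, by
          grind⟩
        invFun := fun x => ⟨⟨(t, x), t.2, x.2⟩, rfl⟩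
        left_inv := fun p => by
          grind
        right_inv := fun x => rfl }
  have := lc.apply_eq_of_preconnectedSpace ⟨0, by simp⟩ ⟨1, by simp⟩
  rw [fb, fb] at this
  exact this
theorem five (hf : f.IsHomogeneous 4) {a b : ℝ} (h : ∀ k : Fin 5, eval ![(k : ℝ), 1, a * k + b] f = 0) (s t : ℂ) : ev f ![s, t, a * s + b * t] = 0 := by
  have hd := lpo_deg hf (rl ![0, 1, b]) (rl ![1, 0, a])
  have h0 : lpo f (rl ![0, 1, b]) (rl ![1, 0, a]) = 0 := by
    refine Polynomial.eq_zero_of_natDegree_lt_card_of_eval_eq_zero _ (f := fun k : Fin 5 => ((k))) (fun i j h => ?_) (fun k => ?_) (by rw [Fintype.card_fin]; omega)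
    · have := Complex.ofReal_injective h
      exact Fin.ext (by exact_mod_cast this)
    · have := ev_rl (f := f) ![(k), 1, a * k + b]
      rw [h k, Complex.ofReal_zero] at this
      rw [lpo_eval, ← this]; congr 1
      ext i; fin_cases i <;> simp [rl]; ring
  have h1 : ∀ t : ℂ, ev f (rl ![0, 1, b] + t • rl ![1, 0, a]) = 0 := fun t => by rw [← lpo_eval, h0, Polynomial.eval_zero]
  have h2 : ev f (rl ![1, 0, a]) = 0 := by simp_all
  by_cases ht : t = 0
  · rw [show (![s, t, a * s + b * t]) = s • rl ![1, 0, a] by ext i; fin_cases i <;> simp [rl, ht]; ring, ev_smul hf, h2, mul_zero]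
  · rw [show (![s, t, a * s + b * t]) = t • (rl ![0, 1, b] + (s / t) • rl ![1, 0, a]) by ext i; fin_cases i <;> simp [rl] <;> field_simp; ring, ev_smul hf, h1, mul_zero]
abbrev Qp (a b c : ℝ) : 𝒫 := C a * X 1 ^ 2 + C b * (X 0 * X 1) + C c * X 0 ^ 2
theorem Qp_hom (a b c : ℝ) : (Qp a b c).IsHomogeneous 2 := by
  have h := fun r i j => by
    simpa using (isHomogeneous_C (Fin 3) r).mul ((isHomogeneous_X ℝ i).mul (isHomogeneous_X ℝ j))
  unfold Qp
  rw [pow_two, pow_two]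
  exact ((h a 1 1).add (h b 0 1)).add (h c 0 0)
theorem Sq_iff (hf : f.IsHomogeneous 4) {x : Fin 5 → ℝ} : x ∈ Sq f ↔ ∀ k : Fin 5, eval ![(k : ℝ), 1, x 0 * k + x 1] f - (x 2 + x 3 * k + x 4 * k ^ 2) ^ 2 = 0 := by
  refine ⟨fun h k => by rw [h k, sub_self], fun h t => ?_⟩
  have := five (f := f - Qp (x 2) (x 3) (x 4) * Qp (x 2) (x 3) (x 4)) (hf.sub ((Qp_hom _ _ _).mul (Qp_hom _ _ _)))   (fun k => by
    have := h k
    simp at this ⊢; linear_combination this) t 1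
  have e := ev_rl (f := f - Qp (x 2) (x 3) (x 4) * Qp (x 2) (x 3) (x 4)) ![t, 1, x 0 * t + x 1]
  rw [show rl ![t, 1, x 0 * t + x 1] = ![(t : ℂ), 1, x 0 * t + x 1 * 1] by ext i; fin_cases i <;> simp [rl], this] at e
  have e := Complex.ofReal_injective (Complex.ofReal_zero.trans e)
  simp at e; linear_combination -e
theorem Sq_ev (hf : f.IsHomogeneous 4) {x} (hx : x ∈ Sq f) (s t : ℂ) : ev f ![s, t, x 0 * s + x 1 * t] = (x 2 * t ^ 2 + x 3 * s * t + x 4 * s ^ 2) ^ 2 := by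
  have := five (f := f - Qp (x 2) (x 3) (x 4) * Qp (x 2) (x 3) (x 4)) (hf.sub ((Qp_hom _ _ _).mul (Qp_hom _ _ _))) (a := x 0) (b := x 1) (fun k => by
    have := hx k
    simp at this ⊢; linear_combination this) s t
  simp at this ⊢
  linear_combination this
theorem gz_ne (hf : IsSmoothQuartic f) {x} (hx : x ∈ Sq f) {s t : ℂ} (h0 : s ≠ 0 ∨ t ≠ 0) (hq : x 2 * t ^ 2 + x 3 * s * t + x 4 * s ^ 2 = 0) :
    grc f ![s, t, x 0 * s + x 1 * t] 2 ≠ 0 := by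
  intro hz
  have key : ∀ a b : ℂ, grc f ![s, t, x 0 * s + x 1 * t] 0 * a + grc f ![s, t, x 0 * s + x 1 * t] 1 * b = 0 := fun a b => by
    set P : 𝒞 := ![s, t, x 0 * s + x 1 * t]
    set n : 𝒞 := ![a, b, x 0 * a + x 1 * b] with hn
    have h := (hasDeriv (f.map (algebraMap ℝ ℂ)) (P + (0:ℂ) • n)).hasFDerivAt.comp_hasDerivAt (0) (((hasDerivAt_id (0:ℂ)).smul_const n).const_add P)
    have h' : HasDerivAt (fun r : ℂ => (x 2 * (t + r * b) ^ 2 + x 3 * (s + r * a) * (t + r * b) + x 4 * (s + r * a) ^ 2) ^ 2) 0 0 := by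
      have d : DifferentiableAt ℂ (fun r : ℂ => x 2 * (t + r * b) ^ 2 + x 3 * (s + r * a) * (t + r * b) + x 4 * (s + r * a) ^ 2) 0 := by fun_prop
      have := d.hasDerivAt.pow 2
      refine this.congr_deriv ?_
      simp [hq]
    have e := (h.congr_of_eventuallyEq (Eventually.of_forall fun r => ?_)).unique h'
    · simp [Fin.sum_univ_three] at e
      simp  [grc] at hz ⊢
      rw [hz] at e
      simpa [hn] using e
    · rw [← Sq_ev hf.1 hx]
      congr 2
      ext i; fin_cases i <;> simp [P, n]; ring
  obtain ⟨i, hi⟩ := hf.2 ![s, t, x 0 * s + x 1 * t] (fun h => by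
    simp_all) (by
    have := Sq_ev hf.1 hx s t
    rw [hq] at this; simpa using this)
  apply hi
  have k0 := key 1 0; have k1 := key 0 1
  simp at k0 k1
  fin_cases i
  exacts [k0, k1, hz]
theorem Sq_inj (hf : IsSmoothQuartic f) (he : HE f) {x} (hx : x ∈ Sq f) {v : Fin 5 → ℝ}
    (hv : ∀ k : Fin 5, gr f ![(k : ℝ), 1, x 0 * k + x 1] 2 * (v 0 * k + v 1) - 2 * (x 2 + x 3 * k + x 4 * k ^ 2) * (v 2 + v 3 * k + v 4 * k ^ 2) = 0) : v = 0 := by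
  have hid : ∀ s t : ℂ, grc f ![s, t, x 0 * s + x 1 * t] 2 * (v 0 * s + v 1 * t) = 2 * (x 2 * t ^ 2 + x 3 * s * t + x 4 * s ^ 2) * (v 2 * t ^ 2 + v 3 * s * t + v 4 * s ^ 2) := by
    intro s t
    have hl : (C (v 0) * X 0 + C (v 1) * X 1 : 𝒫).IsHomogeneous 1 := by
      have h := fun r i => by
        simpa using (isHomogeneous_C (Fin 3) r).mul (isHomogeneous_X ℝ i)
      exact (h _ _).add (h _ _)
    have hp : (pderiv 2 f).IsHomogeneous 3 := hf.1.pderiv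
    have := five (f := pderiv 2 f * (C (v 0) * X 0 + C (v 1) * X 1) - Qp (2 * x 2) (2 * x 3) (2 * x 4) * Qp (v 2) (v 3) (v 4)) ((hp.mul hl).sub ((Qp_hom _ _ _).mul (Qp_hom _ _ _)))   (fun k => by
      have := hv k
      simp [gr] at this ⊢; linear_combination this) s t
    simp only [ev, grc, pderiv_map, map_sub, map_mul, map_add, map_pow, map_C, map_X, eval_C, eval_X] at this ⊢
    push_cast at this
    linear_combination this
  have hidR : ∀ s t : ℝ, gr f ![s, t, x 0 * s + x 1 * t] 2 * (v 0 * s + v 1 * t) = 2 * (x 2 * t ^ 2 + x 3 * s * t + x 4 * s ^ 2) * (v 2 * t ^ 2 + v 3 * s * t + v 4 * s ^ 2) := fun s t => by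
    have := hid s t
    rw [show (![(s:ℂ), t, x 0 * s + x 1 * t]) = rl ![s, t, x 0 * s + x 1 * t] by ext i; fin_cases i <;> simp [rl], grc_rl] at this
    simp  [rl] at this
    exact_mod_cast this
  have zr : ∀ s t : ℂ, (s ≠ 0 ∨ t ≠ 0) → x 2 * t ^ 2 + x 3 * s * t + x 4 * s ^ 2 = 0 → v 0 * s + v 1 * t = 0 := fun s t h0 hq => by
    have := hid s t
    rw [hq, mul_zero, zero_mul] at this
    exact (mul_eq_zero.1 this).resolve_left (gz_ne hf hx h0 hq)
  have zrR : ∀ s t : ℝ, (s ≠ 0 ∨ t ≠ 0) → x 2 * t ^ 2 + x 3 * s * t + x 4 * s ^ 2 = 0 → v 0 * s + v 1 * t = 0 := fun s t h0 hq => by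
    have := zr s t (by simpa using h0) (by exact_mod_cast congrArg (fun r : ℝ => (r)) hq)
    exact_mod_cast this
  have v01 : v 0 = 0 ∧ v 1 = 0 := by
    by_contra hc
    have hn : 0 < v 0 ^ 2 + v 1 ^ 2 := by
      rcases not_and_or.1 hc with h | h <;> positivity
    have hp : v 1 ≠ 0 ∨ -v 0 ≠ 0 := by
      rw [neg_ne_zero]; tauto
    have q0 : x 2 * (-v 0) ^ 2 + x 3 * v 1 * (-v 0) + x 4 * v 1 ^ 2 = 0 := by
      obtain ⟨s, t, h0, hq⟩ : ∃ s t : ℂ, (s ≠ 0 ∨ t ≠ 0) ∧ x 2 * t ^ 2 + x 3 * s * t + x 4 * s ^ 2 = 0 := by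
        by_cases h4 : x 4 = 0
        · exact ⟨1, 0, by simp, by simp [h4]⟩
        · obtain ⟨r, hr⟩ := IsAlgClosed.exists_pow_nat_eq ((x 3 : ℂ) ^ 2 - 4 * x 4 * x 2) (n := 2) (by norm_num)
          have h4' : (x 4 : ℂ) ≠ 0 := by exact_mod_cast h4
          refine ⟨(-x 3 + r) / (2 * x 4), 1, by simp, ?_⟩
          grind
      have hl := zr s t h0 hq
      have hn' : (v 0) ^ 2 + (v 1 : ℂ) ^ 2 ≠ 0 := by exact_mod_cast hn.ne'
      obtain ⟨c, hs, ht⟩ : ∃ c : ℂ, s = c * v 1 ∧ t = c * (-v 0) := by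
        refine ⟨(s * v 1 - t * v 0) / (v 0 ^ 2 + v 1 ^ 2), ?_, ?_⟩ <;> field_simp
        · linear_combination v 0 * hl
        · linear_combination v 1 * hl
      have c0 : c ≠ 0 := fun h => by simp [h] at hs ht; tauto
      rw [hs, ht] at hq
      have : (c ^ 2) * ((x 2) * (-v 0) ^ 2 + x 3 * v 1 * (-v 0) + x 4 * v 1 ^ 2) = 0 := by linear_combination hq
      exact_mod_cast (mul_eq_zero.1 this).resolve_left (pow_ne_zero 2 c0)
    set B := -2 * x 2 * v 0 * v 1 + x 3 * (v 1 ^ 2 - v 0 ^ 2) + 2 * x 4 * v 0 * v 1 with hB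
    set N := x 2 * v 1 ^ 2 + x 3 * v 0 * v 1 + x 4 * v 0 ^ 2 with hN
    have ex : ∀ ε : ℝ, x 2 * (-v 0 + ε * v 1) ^ 2 + x 3 * (v 1 + ε * v 0) * (-v 0 + ε * v 1) + x 4 * (v 1 + ε * v 0) ^ 2 = ε * (B + ε * N) := fun ε => by
      linear_combination q0
    have N0 : N ≠ 0 := fun h => by
      grind
    have B0 : B = 0 := by
      have := zrR (v 1 + (-B / N) * v 0) (-v 0 + (-B / N) * v 1) (by
        grind) (by rw [ex]; field_simp; ring)
      grind
    let P : ℝ → ℛ := fun ε => ![v 1 + ε * v 0, -v 0 + ε * v 1, x 0 * (v 1 + ε * v 0) + x 1 * (-v 0 + ε * v 1)]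
    have cP : Continuous P := continuous_pi fun i => by fin_cases i <;> simp [P] <;> fun_prop
    have e : (fun ε : ℝ => gr f (P ε) 2 * (v 0 ^ 2 + v 1 ^ 2)) = fun ε : ℝ => 2 * ε * N * (v 2 * (-v 0 + ε * v 1) ^ 2 + v 3 * (v 1 + ε * v 0) * (-v 0 + ε * v 1) + v 4 * (v 1 + ε * v 0) ^ 2) := by
      refine Continuous.ext_on (dense_compl_singleton 0) ((eval_cont.comp cP).mul continuous_const) (by fun_prop) fun ε hε => ?_
      have := hidR (v 1 + ε * v 0) (-v 0 + ε * v 1)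
      grind
    have := congrFun e 0
    simp  [mul_zero, hn.ne'] at this
    have k := gz_ne hf hx (s := v 1) (t := (-v 0 : ℝ)) (by exact_mod_cast hp) (by exact_mod_cast q0)
    rw [show (![((v 1) : ℂ), ((-v 0 : ℝ)), x 0 * v 1 + x 1 * ((-v 0 : ℝ))]) = rl (P 0) by ext i; fin_cases i <;> simp [rl, P], grc_rl] at k
    exact k (by simp [rl, this])
  have := sq_sq (a := x 2 + v 2) (b := x 3 + v 3) (c := x 4 + v 4) (a' := x 2 - v 2) (b' := x 3 - v 3) (c' := x 4 - v 4) fun t => by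
    have := hidR t 1
    grind
  have ne := Sq_ne hf.1 he hx
  obtain ⟨h2, h3, h4⟩ : v 2 = 0 ∧ v 3 = 0 ∧ v 4 = 0 := by
    grind
  ext i; fin_cases i <;> simp [v01, h2, h3, h4]
set_option maxHeartbeats 1000000 in
theorem Sq_const {g : ℝ → 𝒫} (hg : ∀ τ ∈ Set.Icc (0:ℝ) 1, IsSmoothQuartic (g τ) ∧ HE (g τ))
    (hc : ContDiff ℝ 1 (fun p : ℝ × ℛ => eval p.2 (g p.1))) : Nat.card (Sq (g 0)) = Nat.card (Sq (g 1)) := by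
  let G : ℝ × (Fin 5 → ℝ) → Fin 5 → ℝ := fun p k => eval ![(k : ℝ), 1, p.2 0 * k + p.2 1] (g p.1) - (p.2 2 + p.2 3 * k + p.2 4 * k ^ 2) ^ 2
  have hG : ContDiff ℝ 1 G := by
    rw [contDiff_pi]; intro k
    have h : ContDiff ℝ 1 (fun p : ℝ × (Fin 5 → ℝ) => (p.1, ![(k : ℝ), 1, p.2 0 * k + p.2 1])) :=
      contDiff_fst.prodMk (contDiff_pi.2 fun i => by fin_cases i <;> simp <;> fun_prop)
    exact (hc.comp h).sub (by fun_prop)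
  have hmem : ∀ τ ∈ Set.Icc (0) 1, ∀ x, x ∈ Sq (g τ) ↔ G (τ, x) = 0 := fun τ h x => by
    rw [Sq_iff (hg τ h).1.1]; exact _root_.funext_iff.symm
  have he : ∀ τ ∈ Set.Icc (0) 1, Sq (g τ) = {x | G (τ, x) = 0} := fun τ h => Set.ext (hmem τ h)
  rw [he 0 (by simp), he 1 (by simp)]
  refine card_const hG ?_ ?_
  · obtain ⟨ε, hε, hpos⟩ : ∃ ε > 0, ∀ w : ℝ × ℝ, ‖w‖ < ε → ∀ τ ∈ Set.Icc (0:ℝ) 1, 0 < eval (U3 w 1) (g τ) := by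
      have := IsCompact.eventually_forall_of_forall_eventually (x₀ := (0 : ℝ × ℝ)) (isCompact_Icc (a := (0:ℝ)) (b := 1)) (P := fun w τ => 0 < eval (U3 w 1) (g τ)) (fun τ hτ => by
        have hct : Continuous fun p : (ℝ × ℝ) × ℝ => eval (U3 p.1 1) (g p.2) :=
          hc.continuous.comp (continuous_snd.prodMk (show Continuous fun p : (ℝ × ℝ) × ℝ => ![p.1.1, p.1.2, (1:ℝ)] from continuous_pi fun i => by fin_cases i <;> simp <;> fun_prop))
        have h0 : (0:ℝ) < eval (U3 (((0 : ℝ × ℝ), τ) : (ℝ × ℝ) × ℝ).1 1) (g (((0 : ℝ × ℝ), τ) : (ℝ × ℝ) × ℝ).2) := by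
          show 0 < eval (U3 0 1) (g τ)
          rw [show U3 0 1 = e3 by simp [U3, e3], (hg τ hτ).2.1]; exact one_pos
        exact continuousAt_const.eventually_lt hct.continuousAt h0)
      obtain ⟨ε, h1, h2⟩ := Metric.eventually_nhds_iff.1 this
      exact ⟨ε, h1, fun w hw => h2 (by simpa using hw)⟩
    have rb : ∀ τ ∈ Set.Icc (0:ℝ) 1, ∀ (u : ℝ × ℝ) (z : ℝ), eval (U3 u z) (g τ) = 0 → |z| * ε ≤ ‖u‖ := fun τ hτ u z h => by
      by_contra hl; push Not at hl
      have hz : z ≠ 0 := by rintro rfl; simp at hl; linarith [norm_nonneg u]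
      have := hpos (z⁻¹ • u) (by rw [norm_smul, norm_inv, Real.norm_eq_abs, inv_mul_lt_iff₀ (abs_pos.2 hz)]; exact hl) τ hτ
      have e := eval_smul4 (hg τ hτ).1.1 z (U3 (z⁻¹ • u) 1)
      rw [show z • U3 (z⁻¹ • u) 1 = U3 u z by ext i; fin_cases i <;> simp [hz], h] at e
      have : 0 < z ^ 4 := by positivity
      nlinarith [mul_pos this ‹0 < eval (U3 (z⁻¹ • u) 1) (g τ)›]
    have b1 : ∀ τ ∈ Set.Icc (0:ℝ) 1, ∀ x ∈ Sq (g τ), |x 0| ≤ ε⁻¹ ∧ |x 1| ≤ ε⁻¹ := fun τ hτ x hx => by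
      obtain ⟨z, Z⟩ := HE_z (hg τ hτ).1.1 (hg τ hτ).2
      have hb := Ln_bd Z (a := x 0) (b := x 1) (fun u hu => by
        have := Sq_hom (hg τ hτ).1.1 hx u.1 u.2
        show 0 ≤ eval ![u.1, u.2, x 0 * u.1 + x 1 * u.2] (g τ)
        rw [this]; positivity)
      have key : ∀ u : ℝ × ℝ, u ≠ 0 → ‖u‖ = 1 → |Ln (x 0) (x 1) u| ≤ ε⁻¹ := fun u hu hn => by
        have h1 := rb τ hτ u (z u 1) (by rw [Z.p u hu]; exact Finset.prod_eq_zero (Finset.mem_univ 1) (sub_self _))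
        have h2 := rb τ hτ u (z u 2) (by rw [Z.p u hu]; exact Finset.prod_eq_zero (Finset.mem_univ 2) (sub_self _))
        rw [hn, ← le_div_iff₀ hε, one_div] at h1 h2
        rw [abs_le] at *
        exact ⟨by linarith [(hb u hu).1], by linarith [(hb u hu).2]⟩
      exact ⟨by simpa [Ln] using key (1, 0) (by simp) (by simp), by simpa [Ln] using key (0, 1) (by simp) (by simp)⟩
    obtain ⟨M, hM⟩ := ((isCompact_Icc (a := (0:ℝ)) (b := 1)).prod (isCompact_closedBall (0 : ℛ) (1 + 2 * ε⁻¹))).exists_bound_of_continuousOn hc.continuous.continuousOn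
    have hi : 0 < ε⁻¹ := by positivity
    refine ((isCompact_Icc (a := (0:ℝ)) (b := 1)).prod (isCompact_closedBall (0 : Fin 5 → ℝ) (ε⁻¹ + 3 * (M + 1)))).of_isClosed_subset
      ((isClosed_Icc.preimage continuous_fst).inter (isClosed_eq hG.continuous continuous_const)) ?_
    rintro ⟨τ, x⟩ ⟨hτ, hx⟩
    refine ⟨hτ, ?_⟩
    have hx := (hmem τ hτ x).2 hx
    obtain ⟨h0, h1⟩ := b1 τ hτ x hx
    have bb : ∀ a b : ℝ, |a| ≤ 1 → |b| ≤ 1 → |x 2 * b ^ 2 + x 3 * a * b + x 4 * a ^ 2| ≤ M + 1 := fun a b ha hb => by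
      have := hM (τ, ![a, b, x 0 * a + x 1 * b]) ⟨hτ, by
        rw [mem_closedBall_zero_iff, pi_norm_le_iff_of_nonneg (by positivity)]
        have h3 : |x 0 * a + x 1 * b| ≤ 2 * ε⁻¹ := by
          refine (abs_add_le _ _).trans ?_
          rw [abs_mul, abs_mul]
          nlinarith [abs_nonneg (x 0), abs_nonneg (x 1), abs_nonneg a, abs_nonneg b]
        intro i; fin_cases i <;> simp [Real.norm_eq_abs] <;> linarith⟩
      simp only at this
      rw [Sq_hom (hg τ hτ).1.1 hx, Real.norm_eq_abs, abs_of_nonneg (sq_nonneg _), ← sq_abs] at this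
      nlinarith [sq_nonneg (|x 2 * b ^ 2 + x 3 * a * b + x 4 * a ^ 2| - 1), abs_nonneg (x 2 * b ^ 2 + x 3 * a * b + x 4 * a ^ 2)]
    have q1 := bb 0 1 (by simp) (by simp)
    have q2 := bb 1 0 (by simp) (by simp)
    have q3 := bb 1 1 (by simp) (by simp)
    norm_num at q1 q2 q3
    have hM0 := (abs_nonneg _).trans q1
    rw [mem_closedBall_zero_iff, pi_norm_le_iff_of_nonneg (by positivity)]
    rw [abs_le] at *
    intro i; rw [Real.norm_eq_abs, abs_le]
    fin_cases i <;> simp only [Fin.reduceFinMk, Fin.zero_eta, Fin.mk_one, Fin.isValue] <;> constructor <;> linarith [h0.1, h0.2, h1.1, h1.2, q1.1, q1.2, q2.1, q2.2, q3.1, q3.2]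
  · rintro ⟨τ, x⟩ hτ hx v hv
    refine Sq_inj (hg τ hτ).1 (hg τ hτ).2 ((hmem τ hτ x).2 hx) (fun k => ?_)
    have h1 : HasDerivAt (fun s : ℝ => ((τ, x) : ℝ × (Fin 5 → ℝ)) + s • ((0 : ℝ), v)) (0, v) 0 := by
      simpa using ((hasDerivAt_id (0:ℝ)).smul_const ((0 : ℝ), v)).const_add (τ, x)
    have h2 := ((hG.differentiable one_ne_zero) ((τ, x) + (0:ℝ) • ((0 : ℝ), v))).hasFDerivAt.comp_hasDerivAt (0:ℝ) h1
    rw [show ((τ, x) + (0:ℝ) • ((0 : ℝ), v)) = (τ, x) by simp, hv] at h2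
    have h3 := hasDerivAt_pi.1 h2 k
    have h4 := der_line (g τ) ![(k : ℝ), 1, x 0 * k + x 1] ![0, 0, v 0 * k + v 1]
    have h5 : HasDerivAt (fun s : ℝ => (x 2 + x 3 * k + x 4 * k ^ 2) + s * (v 2 + v 3 * k + v 4 * k ^ 2)) (v 2 + v 3 * k + v 4 * k ^ 2) 0 := by
      simpa using ((hasDerivAt_id (0:ℝ)).mul_const (v 2 + v 3 * k + v 4 * k ^ 2)).const_add (x 2 + x 3 * k + x 4 * k ^ 2)
    have h6 := (h4.sub (h5.pow 2)).congr_of_eventuallyEq (f₁ := fun s => (G ∘ fun s : ℝ => ((τ, x) : ℝ × (Fin 5 → ℝ)) + s • ((0 : ℝ), v)) s k) (Eventually.of_forall fun s => by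
      simp only [G, Function.comp, Pi.sub_apply, Pi.pow_apply]
      congr 1
      · simp only [Prod.smul_mk, Prod.mk_add_mk, smul_zero, add_zero]
        congr 2; ext i; fin_cases i <;> simp; ring
      · simp; ring)
    have := h6.unique h3
    simp [Fin.sum_univ_three] at this
    linear_combination this
abbrev q4 (a b c d t : ℝ) : ℝ := t ^ 4 + a * t ^ 3 + b * t ^ 2 + c * t + d
def HR (a b c d : ℝ) : Prop := ∃ r : Fin 4 → ℝ, StrictMono r ∧ ∀ i, q4 a b c d (r i) = 0
theorem sm4 {p q r s : ℝ} (h : p < q) (h' : q < r) (h'' : r < s) : StrictMono ![p, q, r, s] := by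
  simp_all
theorem vie {a b c d p q r s : ℝ} (h : p < q) (h' : q < r) (h'' : r < s) (hp : q4 a b c d p = 0) (hq : q4 a b c d q = 0) (hr : q4 a b c d r = 0) (hs : q4 a b c d s = 0) :
    a = -(p + q + r + s) ∧ b = p * q + p * r + p * s + q * r + q * s + r * s ∧ c = -(p * q * r + p * q * s + p * r * s + q * r * s) ∧ d = p * q * r * s := by
  have n1 : q - p ≠ 0 := by linarith
  have n2 : r - q ≠ 0 := by linarith
  have n3 : s - r ≠ 0 := by linarith
  have n4 : r - p ≠ 0 := by linarith
  have n5 : s - q ≠ 0 := by linarith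
  have n6 : s - p ≠ 0 := by linarith
  have e : ∀ x y, y - x ≠ 0 → q4 a b c d x = 0 → q4 a b c d y = 0 → (x ^ 3 + x ^ 2 * y + x * y ^ 2 + y ^ 3) + a * (x ^ 2 + x * y + y ^ 2) + b * (x + y) + c = 0 := fun x y n hx hy =>
    mul_left_cancel₀ n (by linarith)
  have e1 := e p q n1 hp hq
  have e2 := e q r n2 hq hr
  have e3 := e r s n3 hr hs
  have g1 : p ^ 2 + q ^ 2 + r ^ 2 + p * q + p * r + q * r + a * (p + q + r) + b = 0 := mul_left_cancel₀ n4 (by linear_combination e2 - e1)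
  have g2 : q ^ 2 + r ^ 2 + s ^ 2 + q * r + q * s + r * s + a * (q + r + s) + b = 0 := mul_left_cancel₀ n5 (by linear_combination e3 - e2)
  have ha : a = -(p + q + r + s) := mul_left_cancel₀ n6 (by linear_combination g2 - g1)
  subst ha
  have hb : b = p * q + p * r + p * s + q * r + q * s + r * s := by linear_combination g1
  subst hb
  have hc : c = -(p * q * r + p * q * s + p * r * s + q * r * s) := by linear_combination e1
  grind
theorem q4_ivt {a b c d x y : ℝ} (h : x < y) (hP : q4 a b c d x * q4 a b c d y < 0) : ∃ z, x < z ∧ z < y ∧ q4 a b c d z = 0 := by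
  obtain ⟨z, h1, h2, h3⟩ := poly_ivt (Polynomial.X ^ 4 + Polynomial.C a * Polynomial.X ^ 3 + Polynomial.C b * Polynomial.X ^ 2 + Polynomial.C c * Polynomial.X + Polynomial.C d) h (by simpa using hP)
  exact ⟨z, h1, h2, by simpa using h3⟩
theorem q4_far (a b c d B : ℝ) : ∃ T > B, 0 < q4 a b c d T := by
  set S := |a| + |b| + |c| + |d|
  refine ⟨1 + S + |B|, by grind, ?_⟩
  set T := 1 + S + |B|
  have hS : 0 ≤ S := by positivity
  have hT : 1 ≤ T := by grind
  have h2 : T ^ 2 ≤ T ^ 3 := pow_le_pow_right₀ hT (by norm_num)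
  have h1 : T ≤ T ^ 3 := le_self_pow₀ hT (by norm_num)
  have h0 : 1 ≤ T ^ 3 := one_le_pow₀ hT
  have k : ∀ a x : ℝ, 0 ≤ x → x ≤ T ^ 3 → - (|a| * T ^ 3) ≤ a * x := fun a x h0 h => by
    have := neg_abs_le (a * x)
    rw [abs_mul, abs_of_nonneg h0] at this
    nlinarith [mul_le_mul_of_nonneg_left h (abs_nonneg a)]
  have := k a _ (by positivity) le_rfl
  have := k b _ (by positivity) h2
  have := k c _ (by positivity) h1
  have := k d 1 (by positivity) h0
  have : 0 < T ^ 3 * (T - S) := mul_pos (by positivity) (by have := abs_nonneg B; linarith)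
  linarith
theorem HR_neg {a b c d : ℝ} (h : HR a b c d) : HR (-a) b (-c) d := by
  obtain ⟨r, hr, h⟩ := h
  refine ⟨fun i => - r i.rev, fun i j hij => neg_lt_neg (hr (Fin.rev_lt_rev.2 hij)), fun i => ?_⟩
  grind
theorem HR_op {a b c d : ℝ} (h : HR a b c d) (s : ℝ) : HR (a - 4 * s) (b - 3 * s * a) (c - 2 * s * b) (d - s * c) := by
  have key : ∀ {a b c d : ℝ}, HR a b c d → ∀ s : ℝ, 0 < s → HR (a - 4 * s) (b - 3 * s * a) (c - 2 * s * b) (d - s * c) := by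
    rintro a b c d ⟨r, hr, h⟩ s hs
    have g1 := hr (show (0) < 1 by decide); have g2 := hr (show (1) < 2 by decide); have g3 := hr (show (2) < 3 by decide)
    obtain ⟨ha, hb, hc, hd⟩ := vie g1 g2 g3 (h 0) (h 1) (h 2) (h 3)
    generalize r 0 = x, r 1 = y, r 2 = z, r 3 = w at *
    have p4 : 0 < z - x := by linarith
    have p5 : 0 < w - y := by linarith
    have p6 : 0 < w - x := by linarith
    set Q := q4 (a - 4 * s) (b - 3 * s * a) (c - 2 * s * b) (d - s * c)
    have v0 : 0 < Q x := by
      have : Q x = s * ((y - x) * (z - x) * (w - x)) := by simp only [Q, q4, ha, hb, hc, hd]; ring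
      rw [this]; positivity
    have v1 : Q y < 0 := by
      have : Q y = - (s * ((y - x) * (z - y) * (w - y))) := by simp only [Q, q4, ha, hb, hc, hd]; ring
      simp_all
    have v2 : 0 < Q z := by
      have : Q z = s * ((z - x) * (z - y) * (w - z)) := by simp only [Q, q4, ha, hb, hc, hd]; ring
      rw [this]; positivity
    have v3 : Q w < 0 := by
      have : Q w = - (s * ((w - x) * (w - y) * (w - z))) := by simp only [Q, q4, ha, hb, hc, hd]; ring
      simp_all
    obtain ⟨T, hT, v4⟩ := q4_far (a - 4 * s) (b - 3 * s * a) (c - 2 * s * b) (d - s * c) w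
    obtain ⟨t0, i0, j0, k0⟩ := q4_ivt g1 (mul_neg_of_pos_of_neg v0 v1)
    obtain ⟨t1, i1, j1, k1⟩ := q4_ivt g2 (mul_neg_of_neg_of_pos v1 v2)
    obtain ⟨t2, i2, j2, k2⟩ := q4_ivt g3 (mul_neg_of_pos_of_neg v2 v3)
    obtain ⟨t3, i3, j3, k3⟩ := q4_ivt hT (mul_neg_of_neg_of_pos v3 v4)
    exact ⟨_, sm4 (j0.trans i1) (j1.trans i2) (j2.trans i3), fun i => by fin_cases i <;> assumption⟩
  rcases lt_trichotomy s 0 with hs | rfl | hs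
  · have := HR_neg (key (HR_neg h) (-s) (by linarith))
    ring_nf at this ⊢; exact this
  · simpa using h
  · exact key h s hs
theorem HR_T {a b c d : ℝ} (h : HR a b c d) {m : ℝ} (hm : 0 ≤ m) : HR a (b - 24 * m) (c - 12 * m * a) (d - 4 * m * b + 24 * m ^ 2) := by
  obtain ⟨s, rfl⟩ : ∃ s, m = s ^ 2 := ⟨√m, (Real.sq_sqrt hm).symm⟩
  have := HR_op (HR_op (HR_op (HR_op h s) (-s)) s) (-s)
  ring_nf at this ⊢; exact this
theorem biq {B D : ℝ} (hB : 0 < B) (hD : 0 < D) (h : 4 * D < B ^ 2) : HR 0 (-B) 0 D := by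
  set e := √(B ^ 2 - 4 * D)
  have he : e ^ 2 = B ^ 2 - 4 * D := Real.sq_sqrt (by linarith)
  have h0 : 0 < e := Real.sqrt_pos.2 (by linarith)
  have h1 : e < B := by nlinarith
  have s1 : √((B - e) / 2) ^ 2 = (B - e) / 2 := Real.sq_sqrt (by linarith)
  have s2 : √((B + e) / 2) ^ 2 = (B + e) / 2 := Real.sq_sqrt (by linarith)
  have p1 : 0 < √((B - e) / 2) := Real.sqrt_pos.2 (by linarith)
  have p2 : √((B - e) / 2) < √((B + e) / 2) := Real.sqrt_lt_sqrt (by linarith) (by linarith)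
  have k : ∀ x : ℝ, (x ^ 2 = (B - e) / 2 ∨ x ^ 2 = (B + e) / 2) → q4 0 (-B) 0 D x = 0 := fun x hx => by
    grind
  exact ⟨_, sm4 (neg_lt_neg p2) (by linarith) p2, fun i => by
    fin_cases i; exacts [k _ (.inr ((neg_sq _).trans s2)), k _ (.inl ((neg_sq _).trans s1)), k _ (.inl s1), k _ (.inr s2)]⟩
theorem dz (p : 𝒫) (u : ℝ × ℝ) (t : ℝ) : HasDerivAt (fun t => eval (U3 u t) p) (eval (U3 u t) (pderiv 2 p)) t := by
  have h1 : HasDerivAt (fun t => U3 u t) ![0, 0, 1] t := hasDerivAt_pi.2 fun i => by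
    fin_cases i
    · exact hasDerivAt_const t u.1
    · exact hasDerivAt_const t u.2
    · exact hasDerivAt_id t
  refine ((hasDeriv p (U3 u t)).hasFDerivAt.comp_hasDerivAt t h1).congr_deriv ?_
  simp [Fin.sum_univ_three]
theorem quart (hf : f.IsHomogeneous 4) (h : HE f) {u : ℝ × ℝ} (hu : u ≠ 0) : ∃ a b c d, HR a b c d ∧ (∀ t, eval (U3 u t) f = q4 a b c d t) ∧
    (∀ t, eval (U3 u t) (pderiv 2 f) = 4 * t ^ 3 + 3 * a * t ^ 2 + 2 * b * t + c) ∧ ∀ t, eval (U3 u t) (pderiv 2 (pderiv 2 f)) = 12 * t ^ 2 + 6 * a * t + 2 * b := by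
  obtain ⟨r, hr, h0⟩ := h.2 u hu
  obtain ⟨a, b, c, d, hq⟩ : ∃ a b c d, ∀ t, eval (U3 u t) f = q4 a b c d t :=
    ⟨-(r 0 + r 1 + r 2 + r 3), r 0 * r 1 + r 0 * r 2 + r 0 * r 3 + r 1 * r 2 + r 1 * r 3 + r 2 * r 3, -(r 0 * r 1 * r 2 + r 0 * r 1 * r 3 + r 0 * r 2 * r 3 + r 1 * r 2 * r 3), r 0 * r 1 * r 2 * r 3, fun t => by
      rw [HE_prodR hf h.1 hr.injective h0]; simp only [Fin.prod_univ_four, q4]; ring⟩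
  refine ⟨a, b, c, d, ⟨r, hr, fun i => by rw [← hq, h0]⟩, hq, ?_⟩
  have d1 : ∀ t, eval (U3 u t) (pderiv 2 f) = 4 * t ^ 3 + 3 * a * t ^ 2 + 2 * b * t + c := fun t => by
    have e := dz f u t
    rw [_root_.funext hq] at e
    refine e.unique ((((((hasDerivAt_pow 4 t).add ((hasDerivAt_pow 3 t).const_mul a)).add ((hasDerivAt_pow 2 t).const_mul b)).add ((hasDerivAt_id t).const_mul c)).add_const d).congr_deriv ?_)
    ring
  refine ⟨d1, fun t => ?_⟩
  have e := dz (pderiv 2 f) u t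
  rw [_root_.funext d1] at e
  refine e.unique ((((((hasDerivAt_pow 3 t).const_mul 4).add ((hasDerivAt_pow 2 t).const_mul (3 * a))).add ((hasDerivAt_id t).const_mul (2 * b))).add_const c).congr_deriv ?_)
  ring
def Hh (h : Fin 6 → ℝ) : 𝒫 :=
  X 1 * (C (h 0) * X 1 ^ 3 + C (h 1) * (X 0 * X 1 ^ 2) + C (h 2) * (X 0 ^ 2 * X 1) + C (h 3) * X 0 ^ 3) + X 2 * X 1 ^ 2 * (C (h 4) * X 0 + C (h 5) * X 1)
abbrev dg (τ : ℝ) : Matrix (Fin 3) (Fin 3) ℝ := Matrix.diagonal ![τ, τ, 1]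
def g0 (f : 𝒫) (τ : ℝ) : 𝒫 :=
  cg f (dg τ) 1 - C (2 * (1 - τ ^ 2)) * ((X 0 ^ 2 + X 1 ^ 2) * cg (pderiv 2 (pderiv 2 f)) (dg τ) 1) + C (24 * (1 - τ ^ 2) ^ 2) * (X 0 ^ 2 + X 1 ^ 2) ^ 2
def gm (f : 𝒫) (τ : ℝ) (h : Fin 6 → ℝ) : 𝒫 := g0 f τ + C (1 - τ) * Hh h
theorem cg_hom {n} (hf : f.IsHomogeneous n) (M c) : (cg f M c).IsHomogeneous n := by
  have := (hf.aeval (fun i => ∑ j, C (M i j) * X j) (fun i => IsHomogeneous.sum _ _ 1 fun j _ => isHomogeneous_C_mul_X _ j)).C_mul c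
  rwa [one_mul] at this
theorem gm_hom (hf : f.IsHomogeneous 4) (τ h) : (gm f τ h).IsHomogeneous 4 := by
  have x := fun i => isHomogeneous_X ℝ (i : Fin 3)
  have h2 : (X 0 ^ 2 + X 1 ^ 2 : 𝒫).IsHomogeneous 2 := ((x 0).pow 2).add ((x 1).pow 2)
  have hp : (pderiv 2 (pderiv 2 f)).IsHomogeneous 2 := IsHomogeneous.pderiv  (hf.pderiv)
  have hh : (Hh h).IsHomogeneous 4 := ((x 1).mul  (((((((x 1).pow 3).C_mul _).add (((x 0).mul ((x 1).pow 2)).C_mul _))).add ((((x 0).pow 2).mul (x 1)).C_mul _)).add (((x 0).pow 3).C_mul _))).add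
    (((x 2).mul ((x 1).pow 2)).mul (((x 0).C_mul _).add ((x 1).C_mul _)))
  exact (((cg_hom hf _ _).sub ((h2.mul (cg_hom hp _ _)).C_mul _)).add ((h2.pow 2).C_mul _)).add (hh.C_mul _)
abbrev Hv {K} [CommRing K] (h : Fin 6 → K) (v : Fin 3 → K) : K :=
  v 1 * (h 0 * v 1 ^ 3 + h 1 * (v 0 * v 1 ^ 2) + h 2 * (v 0 ^ 2 * v 1) + h 3 * v 0 ^ 3) + v 2 * v 1 ^ 2 * (h 4 * v 0 + h 5 * v 1)
theorem dg_mul (τ : ℝ) (v : ℛ) : Matrix.mulVec (dg τ) v = ![τ * v 0, τ * v 1, v 2] := by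
  ext i; fin_cases i <;> simp [Matrix.mulVec_diagonal]
theorem gm_eval (τ h) (v : ℛ) : eval v (gm f τ h) = eval ![τ * v 0, τ * v 1, v 2] f - 2 * (1 - τ ^ 2) * ((v 0 ^ 2 + v 1 ^ 2) * eval ![τ * v 0, τ * v 1, v 2] (pderiv 2 (pderiv 2 f)))
    + 24 * (1 - τ ^ 2) ^ 2 * (v 0 ^ 2 + v 1 ^ 2) ^ 2 + (1 - τ) * Hv h v := by
  simp [gm, g0, Hh, eval_cg, dg_mul]
theorem eval_u0 (hf : f.IsHomogeneous 4) (h : eval e3 f = 1) (t : ℝ) : eval (U3 0 t) f = t ^ 4 := by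
  have := eval_smul4 hf t e3
  rwa [h, mul_one, show t • e3 = U3 0 t by ext i; fin_cases i <;> simp] at this
theorem eval_d0 (hf : f.IsHomogeneous 4) (h : eval e3 f = 1) (t : ℝ) : eval (U3 0 t) (pderiv 2 (pderiv 2 f)) = 12 * t ^ 2 := by
  have d1 : ∀ t, eval (U3 0 t) (pderiv 2 f) = 4 * t ^ 3 := fun t => by
    have e := dz f 0 t
    rw [_root_.funext (eval_u0 hf h)] at e
    exact e.unique ((hasDerivAt_pow 4 t).congr_deriv (by simp))
  have e := dz (pderiv 2 f) 0 t
  rw [_root_.funext d1] at e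
  exact e.unique (((hasDerivAt_pow 3 t).const_mul 4).congr_deriv (by ring))
theorem gm0_HE (hf : f.IsHomogeneous 4) (h : HE f) {τ : ℝ} (hτ : τ ∈ Set.Icc (0:ℝ) 1) : HE (gm f τ 0) := by
  have hu0 := eval_u0 hf h.1
  have hd0 := eval_d0 hf h.1
  refine ⟨?_, fun u hu => ?_⟩
  · rw [gm_eval]
    have := h.1
    simp [e3, Hv] at this ⊢; exact this
  · have hp : 0 < u.1 ^ 2 + u.2 ^ 2 := by
      by_contra hn
      exact hu (Prod.ext (by simp; nlinarith) (by simp; nlinarith))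
    have ge : ∀ t, eval (U3 u t) (gm f τ 0) = eval (U3 (τ • u) t) f - 2 * (1 - τ ^ 2) * ((u.1 ^ 2 + u.2 ^ 2) * eval (U3 (τ • u) t) (pderiv 2 (pderiv 2 f))) + 24 * (1 - τ ^ 2) ^ 2 * (u.1 ^ 2 + u.2 ^ 2) ^ 2 := fun t => by
      rw [gm_eval]; simp [Hv, U3]
    obtain rfl | h0 := eq_or_ne τ 0
    · obtain ⟨r, hr, e⟩ := biq (B := 24 * (u.1 ^ 2 + u.2 ^ 2)) (D := 24 * (u.1 ^ 2 + u.2 ^ 2) ^ 2) (by positivity) (by positivity) (by nlinarith)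
      refine ⟨r, hr, fun i => ?_⟩
      have := e i; rw [ge, zero_smul, hu0, hd0]; linear_combination this
    · obtain ⟨a, b, c, d, k, e1, -, e2⟩ := quart hf h (smul_ne_zero h0 hu)
      obtain ⟨r, hr, e⟩ := HR_T k (m := (1 - τ ^ 2) * (u.1 ^ 2 + u.2 ^ 2)) (mul_nonneg (by nlinarith [hτ.1, hτ.2]) hp.le)
      refine ⟨r, hr, fun i => ?_⟩
      have := e i; rw [ge, e1, e2]; linear_combination this
theorem eval_smooth {K : Type*} [NormedField K] [NormedAlgebra ℝ K] (p : MvPolynomial (Fin 3) K) {n} : ContDiff ℝ n (fun z : Fin 3 → K => eval z p) := by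
  induction p using MvPolynomial.induction_on with
  | C a => simp; exact contDiff_const
  | add p q hp hq => simp; exact hp.add hq
  | mul_X p i hp => simp; exact hp.mul (contDiff_apply ℝ K i)
theorem gm_smooth : ContDiff ℝ 1 (fun p : (Fin 6 → ℝ) × ℝ × ℛ => eval p.2.2 (gm f p.2.1 p.1)) := by
  simp only [gm_eval]
  have h : ContDiff ℝ 1 (fun p : (Fin 6 → ℝ) × ℝ × ℛ => ![p.2.1 * p.2.2 0, p.2.1 * p.2.2 1, p.2.2 2]) :=
    contDiff_pi.2 fun i => by fin_cases i <;> simp <;> fun_prop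
  have h1 := (eval_smooth f).comp h
  have h2 := (eval_smooth (pderiv 2 (pderiv 2 f))).comp h
  fun_prop
theorem gm_HE (hf : f.IsHomogeneous 4) (h : HE f) : ∀ᶠ k : Fin 6 → ℝ in 𝓝 0, ∀ τ ∈ Set.Icc (0:ℝ) 1, HE (gm f τ k) := by
  have hc : ∀ {X : Type} [TopologicalSpace X] {φ : X → (Fin 6 → ℝ) × ℝ × (ℝ × ℝ)} {ψ : X → ℝ}, Continuous φ → Continuous ψ → Continuous fun x => eval (U3 (φ x).2.2 (ψ x)) (gm f (φ x).2.1 (φ x).1) := by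
    intro X _ φ ψ h1 h2
    have h4 : Continuous fun x => ((φ x).1, (φ x).2.1, U3 (φ x).2.2 (ψ x)) := by fun_prop
    have h5 := (gm_smooth (f := f)).continuous.comp h4
    fun_prop
  have := IsCompact.eventually_forall_of_forall_eventually  ((isCompact_Icc  ).prod (isCompact_sphere (0) 1)) (P := fun k y => ∃ r : Fin 4 → ℝ, StrictMono r ∧ ∀ i, eval (U3 y.2 (r i)) (gm f y.1 k) = 0) (by
    rintro ⟨τ, u⟩ ⟨hτ, hu⟩
    have hu : u ≠ 0 := by rintro rfl; simp at hu
    have h0 := gm0_HE hf h hτ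
    obtain ⟨r, hr, e⟩ := h0.2 u hu
    have := sep (φ := fun (p : (Fin 6 → ℝ) × ℝ × (ℝ × ℝ)) t => eval (U3 p.2.2 t) (gm f p.2.1 p.1)) (p0 := (0, τ, u)) (fun t => (hc  continuous_id (continuous_const )).continuousAt)
      (fun p => hc  continuous_const continuous_id) hr (HE_prodR (gm_hom hf τ 0) h0.1 hr.injective e) one_pos
    exact this.mono fun p ⟨r, h1, h2⟩ => ⟨r, h1, fun i => (h2 i).1⟩)
  filter_upwards [this] with k hk τ hτ
  refine ⟨?_, fun u hu => ?_⟩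
  · have := h.1
    rw [gm_eval]; simp [e3, Hv] at this ⊢; exact this
  · have hn := norm_pos_iff.2 hu
    obtain ⟨r, hr, e⟩ := hk (τ, ‖u‖⁻¹ • u) ⟨hτ, by simp [norm_smul, hn.ne']⟩
    refine ⟨fun i => ‖u‖ * r i, fun i j hij => mul_lt_mul_of_pos_left (hr hij) hn, fun i => ?_⟩
    have := eval_smul4 (gm_hom hf τ k) ‖u‖ (U3 (‖u‖⁻¹ • u) (r i))
    rw [e i, mul_zero, show ‖u‖ • U3 (‖u‖⁻¹ • u) (r i) = U3 u (‖u‖ * r i) by fin_cases i <;> simp [hn.ne']] at this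
    exact this
theorem HE_gz (hf : f.IsHomogeneous 4) (h : HE f) {u : ℝ × ℝ} (hu : u ≠ 0) {t : ℝ} (ht : eval (U3 u t) f = 0) : gr f (U3 u t) 2 ≠ 0 := by
  obtain ⟨a, b, c, d, ⟨r, hr, h0⟩, h1, h2, -⟩ := quart hf h hu
  have g1 := hr (show (0) < 1 by decide); have g2 := hr (show (1) < 2 by decide); have g3 := hr (show (2) < 3 by decide)
  obtain ⟨ha, hb, hc, hd⟩ := vie g1 g2 g3 (h0 0) (h0 1) (h0 2) (h0 3)
  rw [h1] at ht
  rw [gr, h2]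
  generalize r 0 = x, r 1 = y, r 2 = z, r 3 = w at *
  have : (t - x) * ((t - y) * ((t - z) * (t - w))) = 0 := by rw [← ht, q4, ha, hb, hc, hd]; ring
  have n1 : x - y ≠ 0 := by linarith
  have n2 : y - z ≠ 0 := by linarith
  have n3 : z - w ≠ 0 := by linarith
  have n4 : x - z ≠ 0 := by linarith
  have n5 : x - w ≠ 0 := by linarith
  have n6 : y - w ≠ 0 := by linarith
  simp  [mul_eq_zero, sub_eq_zero] at this
  rw [ha, hb, hc]
  rcases this with rfl | rfl | rfl | rfl
  · convert mul_ne_zero (mul_ne_zero n1 n4) n5 using 1; ring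
  · convert neg_ne_zero.2 (mul_ne_zero (mul_ne_zero n1 n2) n6) using 1; ring
  · convert mul_ne_zero (mul_ne_zero n4 n2) n3 using 1; ring
  · convert neg_ne_zero.2 (mul_ne_zero (mul_ne_zero n5 n6) n3) using 1; ring
theorem HE_cpx (hf : f.IsHomogeneous 4) (h : HE f) {z : 𝒞} (hz : z ≠ 0) (h0 : ev f z = 0) (him : (z 0 * star (z 1)).im = 0) :
    ∃ t : ℂ, t ≠ 0 ∧ ∃ u : ℝ × ℝ, u ≠ 0 ∧ ∃ r : ℝ, z = t • rl (U3 u r) ∧ eval (U3 u r) f = 0 := by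
  have key : ∀ (t : ℂ) (u : ℝ × ℝ) (w : ℂ), t ≠ 0 → u ≠ 0 → z = t • ![(u.1 : ℂ), u.2, w] → ∃ t : ℂ, t ≠ 0 ∧ ∃ u : ℝ × ℝ, u ≠ 0 ∧ ∃ r : ℝ, z = t • rl (U3 u r) ∧ eval (U3 u r) f = 0 := by
    intro t u w ht hu e
    obtain ⟨r, hr, hr0⟩ := h.2 u hu
    rw [e, ev_smul hf, HE_prod hf h.1 hr.injective hr0, mul_eq_zero, Finset.prod_eq_zero_iff] at h0
    obtain ⟨i, -, hi⟩ := h0.resolve_left (pow_ne_zero _ ht)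
    refine ⟨t, ht, u, hu, r i, ?_, hr0 i⟩
    rw [e, sub_eq_zero.1 hi]; ext i; fin_cases i <;> simp [rl]
  by_cases h1 : z 1 = 0
  · by_cases h2 : z 0 = 0
    · exfalso
      have e : z = z 2 • rl e3 := by ext i; fin_cases i <;> simp [h1, h2, rl]
      rw [e, ev_smul hf, ev_rl, h.1] at h0
      simp at h0
      rw [h0, zero_smul] at e; exact hz e
    · exact key (z 0) (1, 0) (z 2 / z 0) h2 (by simp) (by ext i; fin_cases i <;> simp [h1]; field_simp)
  · have hr : z 0 / z 1 = ((z 0 / z 1).re) := by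
      apply Complex.ext
      · simp
      · rw [Complex.ofReal_im, Complex.div_im, ← sub_div]
        simp at him
        grind
    exact key (z 1) ((z 0 / z 1).re, 1) (z 2 / z 1) h1 (by simp) (by
      ext i; fin_cases i
      · simp  [Pi.smul_apply, ← hr]; field_simp
      · simp
      · simp; field_simp)
theorem grc_smul (hf : f.IsHomogeneous 4) (t : ℂ) (z) (i) : grc f (t • z) i = t ^ 3 * grc f z i :=
  hom_smul (hf.map (algebraMap ℝ ℂ)).pderiv t z
theorem grc_ev (z i) : grc f z i = ev (pderiv i f) z := by
  rw [grc, ev, pderiv_map]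
theorem sing (hf : f.IsHomogeneous 4) (h : HE f) (hs : ¬ IsSmoothQuartic f) : ∃ u w : ℂ, 0 < u.im ∧ ev f ![u, 1, w] = 0 ∧ ∀ i, grc f ![u, 1, w] i = 0 := by
  simp only [IsSmoothQuartic, hf, true_and] at hs
  push Not at hs
  obtain ⟨z, hz, h0, h1⟩ := hs
  have h1 : ∀ i, grc f z i = 0 := h1
  have h0 : ev f z = 0 := h0
  have him : (z 0 * star (z 1)).im ≠ 0 := fun hi => by
    obtain ⟨t, ht, u, hu, r, rfl, hr⟩ := HE_cpx hf h hz h0 hi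
    have := h1 2
    rw [grc_smul hf, grc_rl, mul_eq_zero] at this
    exact HE_gz hf h hu hr (by simpa [rl] using this.resolve_left (pow_ne_zero _ ht))
  have hz1 : z 1 ≠ 0 := fun h => by simp [h] at him
  have e : z = z 1 • ![z 0 / z 1, 1, z 2 / z 1] := by ext i; fin_cases i <;> simp <;> field_simp
  rw [e] at h0 h1
  rw [ev_smul hf, mul_eq_zero] at h0
  replace h0 := h0.resolve_left (pow_ne_zero _ hz1)
  replace h1 : ∀ i, grc f ![z 0 / z 1, 1, z 2 / z 1] i = 0 := fun i => by
    have := h1 i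
    rw [grc_smul hf, mul_eq_zero] at this; grind
  have hi : (z 0 / z 1).im ≠ 0 := by
    have : (z 0 / z 1).im * Complex.normSq (z 1) = (z 0 * star (z 1)).im := by
      have := Complex.normSq_pos.2 hz1
      rw [Complex.div_im]; field_simp; simp; ring
    grind
  rcases hi.lt_or_gt with hl | hl
  · refine ⟨star (z 0 / z 1), star (z 2 / z 1), by simpa only [RCLike.star_def, Complex.conj_im, Left.neg_pos_iff] using hl, ?_⟩
    rw [show ![star (z 0 / z 1), 1, star (z 2 / z 1)] = star ![z 0 / z 1, 1, z 2 / z 1] by ext i; fin_cases i <;> simp, ev_star, h0, star_zero]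
    exact ⟨rfl, fun i => by rw [grc_ev, ev_star, ← grc_ev, h1, star_zero]⟩
  · exact ⟨_, _, hl, h0, h1⟩
def slvF (κ a y Y e1 e2 d1 d2 c1 c2 w1 w2 : ℝ) : Fin 6 → ℝ :=
  let A1 := -d1 * κ
  let A2 := -d2 * κ
  let p := A2 * y
  let B1 := -e1 * κ - (w1 * A1 - w2 * A2)
  let B2 := -e2 * κ - (w1 * A2 + w2 * A1)
  let l1 := B2 * y
  let l0 := B1 - l1 * a
  let s1 := -(-c1 * κ - w1 * p - l1) / 2 * y * y
  let s0 := (-c2 * κ - w2 * p) / 2 * y - s1 * a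
  ![l0 + s0 * (a ^ 2 + Y ^ 2), l1 + s1 * (a ^ 2 + Y ^ 2) - 2 * s0 * a, s0 - 2 * s1 * a, s1, p, A1 - p * a]
theorem slv {κ a y e1 e2 d1 d2 c1 c2 w1 w2 : ℝ} (hκ : κ ≠ 0) (hy : y ≠ 0) {k : Fin 6 → ℝ}
    (hE : (⟨e1, e2⟩ : ℂ) + κ * (k 0 + k 1 * ⟨a, y⟩ + k 2 * ⟨a, y⟩ ^ 2 + k 3 * ⟨a, y⟩ ^ 3 + ⟨w1, w2⟩ * (k 4 * ⟨a, y⟩ + k 5)) = 0)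
    (hD : (⟨d1, d2⟩ : ℂ) + κ * (k 4 * ⟨a, y⟩ + k 5) = 0)
    (hC : (⟨c1, c2⟩ : ℂ) + κ * (k 1 + 2 * k 2 * ⟨a, y⟩ + 3 * k 3 * ⟨a, y⟩ ^ 2 + ⟨w1, w2⟩ * k 4) = 0) :
    slvF κ⁻¹ a y⁻¹ y e1 e2 d1 d2 c1 c2 w1 w2 = k := by
  simp [Complex.ext_iff, pow_succ] at hE hD hC
  obtain ⟨E1, E2⟩ := hE
  obtain ⟨D1, D2⟩ := hD
  obtain ⟨C1, C2⟩ := hC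
  rw [add_eq_zero_iff_eq_neg] at E1 E2 D1 D2 C1 C2
  subst E1 E2 D1 D2 C1 C2
  ext i
  fin_cases i <;> simp [slvF] <;> field_simp <;> ring
theorem slv_cd {P : Type*} [NormedAddCommGroup P] [NormedSpace ℝ P] {κ a y Y e1 e2 d1 d2 c1 c2 w1 w2 : P → ℝ} (h1 : ContDiff ℝ 1 κ) (h2 : ContDiff ℝ 1 a) (h3 : ContDiff ℝ 1 y) (h4 : ContDiff ℝ 1 Y)
    (h5 : ContDiff ℝ 1 e1) (h6 : ContDiff ℝ 1 e2) (h7 : ContDiff ℝ 1 d1) (h8 : ContDiff ℝ 1 d2) (h9 : ContDiff ℝ 1 c1) (h10 : ContDiff ℝ 1 c2) (h11 : ContDiff ℝ 1 w1) (h12 : ContDiff ℝ 1 w2) :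
    ContDiff ℝ 1 fun p => slvF (κ p) (a p) (y p) (Y p) (e1 p) (e2 p) (d1 p) (d2 p) (c1 p) (c2 p) (w1 p) (w2 p) := by
  refine contDiff_pi.2 fun i => ?_
  fin_cases i <;> simp only [slvF, Fin.zero_eta, Fin.mk_one, Fin.reduceFinMk, Matrix.cons_val] <;> fun_prop
theorem g0_ev (τ : ℝ) (z : 𝒞) : ev (g0 f τ) z = ev f ![τ * z 0, τ * z 1, z 2] - 2 * (1 - (τ:ℂ) ^ 2) * ((z 0 ^ 2 + z 1 ^ 2) * ev (pderiv 2 (pderiv 2 f)) ![τ * z 0, τ * z 1, z 2])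
    + 24 * (1 - (τ:ℂ) ^ 2) ^ 2 * (z 0 ^ 2 + z 1 ^ 2) ^ 2 := by
  have h : ∀ p : 𝒫, ev (cg p (dg τ) 1) z = ev p ![τ * z 0, τ * z 1, z 2] := fun p => by
    rw [ev_cg, Complex.ofReal_one, one_mul]; congr 1
    ext i; fin_cases i <;> simp [Matrix.mulVec, dotProduct, Fin.sum_univ_three]
  rw [← h f, ← h (pderiv 2 (pderiv 2 f))]
  simp only [ev, g0]
  simp
theorem g0_smooth : ContDiff ℝ 2 (fun p : ℝ × 𝒞 => ev (g0 f p.1) p.2) := by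
  simp only [g0_ev]
  have k : ContDiff ℝ 2 (fun p : ℝ × 𝒞 => (p.1 : ℂ)) := Complex.ofRealCLM.contDiff.comp contDiff_fst
  have h : ContDiff ℝ 2 (fun p : ℝ × 𝒞 => ![(p.1) * p.2 0, p.1 * p.2 1, p.2 2]) :=
    contDiff_pi.2 fun i => by fin_cases i <;> simp <;> fun_prop
  have h1 := (eval_smooth  (f.map (algebraMap ℝ ℂ))).comp h
  have h2 := (eval_smooth  ((pderiv 2 (pderiv 2 f)).map (algebraMap ℝ ℂ))).comp h
  fun_prop
theorem g0_grc (i : Fin 3) : ContDiff ℝ 1 (fun p : ℝ × 𝒞 => grc (g0 f p.1) p.2 i) := by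
  have e : (fun p : ℝ × 𝒞 => grc (g0 f p.1) p.2 i) = fun p => fderiv ℝ (fun p : ℝ × 𝒞 => ev (g0 f p.1) p.2) p (0, Pi.single i 1) := by
    ext ⟨τ, z⟩
    have h1 := (hasDeriv ((g0 f τ).map (algebraMap ℝ ℂ)) z).hasFDerivAt.restrictScalars ℝ
    have h2 := ((g0_smooth (f := f)).differentiable two_ne_zero (τ, z)).hasFDerivAt.comp z (hasFDerivAt_prodMk_right τ z)
    have := congrArg (fun L => L (Pi.single i 1)) (h1.unique h2)
    simpa [grc, Pi.single_apply] using this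
  rw [e]
  exact (g0_smooth.fderiv_right  le_rfl).clm_apply contDiff_const
theorem gen : ∃ Ψ : ℝ × ℝ × ℝ × ℂ → Fin 6 → ℝ, ContDiff ℝ 1 Ψ ∧ ∀ τ < 1, ∀ k, ∀ u w : ℂ, 0 < u.im → ev (gm f τ k) ![u, 1, w] = 0 → (∀ i, grc (gm f τ k) ![u, 1, w] i = 0) → k ∈ Set.range Ψ := by
  let Z : ℝ × ℝ × ℝ × ℂ → ℝ × 𝒞 := fun p => (1 - Real.exp p.1, ![⟨p.2.1, Real.exp p.2.2.1⟩, 1, p.2.2.2])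
  have hZ : ContDiff ℝ 1 Z := by
    refine ContDiff.prodMk (by fun_prop) (contDiff_pi.2 fun i => ?_)
    fin_cases i
    · have : ContDiff ℝ 1 fun p : ℝ × ℝ × ℝ × ℂ => (Complex.ofRealCLM p.2.1 + Complex.ofRealCLM (Real.exp p.2.2.1) * Complex.I) := by fun_prop
      simp only [Complex.mk_eq_add_mul_I]; exact this
    · exact contDiff_const
    · exact contDiff_snd.comp (contDiff_snd.comp contDiff_snd)
  have re : ∀ {F : ℝ × ℝ × ℝ × ℂ → ℂ}, ContDiff ℝ 1 F → ContDiff ℝ 1 (fun p => (F p).re) := fun h => Complex.reCLM.contDiff.comp h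
  have im : ∀ {F : ℝ × ℝ × ℝ × ℂ → ℂ}, ContDiff ℝ 1 F → ContDiff ℝ 1 (fun p => (F p).im) := fun h => Complex.imCLM.contDiff.comp h
  have hE : ContDiff ℝ 1 (fun p => ev (g0 f (Z p).1) (Z p).2) := (g0_smooth.of_le (by norm_num)).comp hZ
  have hD : ContDiff ℝ 1 (fun p => grc (g0 f (Z p).1) (Z p).2 2) := (g0_grc 2).comp hZ
  have hC : ContDiff ℝ 1 (fun p => grc (g0 f (Z p).1) (Z p).2 0) := (g0_grc 0).comp hZ
  have hw : ContDiff ℝ 1 (fun p : ℝ × ℝ × ℝ × ℂ => p.2.2.2) := by fun_prop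
  refine ⟨fun p => slvF (Real.exp (-p.1)) p.2.1 (Real.exp (-p.2.2.1)) (Real.exp p.2.2.1) (ev (g0 f (Z p).1) (Z p).2).re (ev (g0 f (Z p).1) (Z p).2).im (grc (g0 f (Z p).1) (Z p).2 2).re (grc (g0 f (Z p).1) (Z p).2 2).im
    (grc (g0 f (Z p).1) (Z p).2 0).re (grc (g0 f (Z p).1) (Z p).2 0).im p.2.2.2.re p.2.2.2.im, ?_, ?_⟩
  · exact slv_cd (by fun_prop) (by fun_prop) (by fun_prop) (by fun_prop) (re hE) (im hE) (re hD) (im hD) (re hC) (im hC) (re hw) (im hw)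
  · intro τ hτ k u w hu h0 h1
    refine ⟨(Real.log (1 - τ), u.re, Real.log u.im, w), ?_⟩
    have e : Z (Real.log (1 - τ), u.re, Real.log u.im, w) = (τ, ![u, 1, w]) := by
      simp only [Z]; rw [Real.exp_log (by linarith), Real.exp_log hu]; simp
    simp only [e, Real.exp_neg]
    rw [Real.exp_log (by linarith), Real.exp_log hu]
    have hm : (gm f τ k).map (algebraMap ℝ ℂ) = (g0 f τ).map (algebraMap ℝ ℂ) + C ((1 - τ : ℝ) : ℂ) * (X 1 * (C (k 0 : ℂ) * X 1 ^ 3 + C (k 1 : ℂ) * (X 0 * X 1 ^ 2) + C (k 2 : ℂ) * (X 0 ^ 2 * X 1) + C (k 3 : ℂ) * X 0 ^ 3) + X 2 * X 1 ^ 2 * (C (k 4 : ℂ) * X 0 + C (k 5 : ℂ) * X 1)) := by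
      simp [gm, Hh]
    refine slv (by linarith) hu.ne' ?_ ?_ ?_
    · rw [ev, hm] at h0
      simp at h0 ⊢
      linear_combination h0
    · have := h1 2
      rw [grc, hm] at this
      simp [grc] at this ⊢
      linear_combination this
    · have := h1 0
      rw [grc, hm] at this
      simp [grc] at this ⊢
      linear_combination this
theorem count_eq {b : 𝒫} (hf : IsSmoothQuartic f) (h : HE f) (hb : IsSmoothQuartic b) (h' : HE b) : Nat.card (Sq f) = Nat.card (Sq b) := by
  obtain ⟨Ψ, hΨ, s1⟩ := gen
  obtain ⟨Ψ', hΨ', s2⟩ := gen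
  have hd : Dense (Set.range Ψ ∪ Set.range Ψ')ᶜ := by
    refine dense_compl_of_dimH_lt_finrank ?_
    rw [dimH_union]
    refine (max_le hΨ.dimH_range_le hΨ'.dimH_range_le).trans_lt (Nat.cast_lt.2 ?_)
    simp
  obtain ⟨k, k3, k1, k2⟩ := hd.inter_nhds_nonempty ((gm_HE hf.1 h).and (gm_HE hb.1 h'))
  simp only [Set.mem_compl_iff, Set.mem_union, not_or] at k3
  have key : ∀ {f : 𝒫} {Ψ : ℝ × ℝ × ℝ × ℂ → Fin 6 → ℝ}, IsSmoothQuartic f → (∀ τ ∈ Set.Icc (0) 1, HE (gm f τ k)) → k ∉ Set.range Ψ →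
      (∀ τ < 1, ∀ k, ∀ u w : ℂ, 0 < u.im → ev (gm f τ k) ![u, 1, w] = 0 → (∀ i, grc (gm f τ k) ![u, 1, w] i = 0) → k ∈ Set.range Ψ) → Nat.card (Sq (gm f 0 k)) = Nat.card (Sq f) := by
    intro f Ψ hf h hk s
    have e : gm f 1 k = f := MvPolynomial.funext fun v => by
      rw [gm_eval]; simp; congr 2; ext i; fin_cases i <;> simp
    have hs : ∀ τ ∈ Set.Icc (0) 1, IsSmoothQuartic (gm f τ k) ∧ HE (gm f τ k) := fun τ hτ => ⟨by
      by_contra hs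
      rcases hτ.2.lt_or_eq with ht | ht
      · obtain ⟨u, w, hu, h0, h1⟩ := sing (gm_hom hf.1 τ k) (h τ hτ) hs
        exact hk (s τ ht k u w hu h0 h1)
      · rw [ht, e] at hs; exact hs hf, h τ hτ⟩
    have hp : ContDiff ℝ 1 fun p : ℝ × ℛ => (k, p.1, p.2) := by fun_prop
    have hc := (gm_smooth (f := f)).comp hp
    have := Sq_const hs hc
    rw [e] at this; exact this
  rw [← key hf k1 k3.1 s1, ← key hb k2 k3.2 s2]
  congr 3
  refine MvPolynomial.funext fun v => ?_
  have e : (![0 * v 0, 0 * v 1, v 2] : ℛ) = U3 0 (v 2) := by simp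
  rw [gm_eval, gm_eval, e, eval_u0 hf.1 h.1, eval_d0 hf.1 h.1, eval_u0 hb.1 h'.1, eval_d0 hb.1 h'.1]
abbrev bs : 𝒫 := X 2 ^ 4 - C 4 * (X 2 ^ 2 * (X 0 ^ 2 + X 1 ^ 2)) + X 0 ^ 4 + C (1/2) * (X 0 ^ 2 * X 1 ^ 2) + X 1 ^ 4
theorem bs_hom : bs.IsHomogeneous 4 := by
  have h : ∀ i n, (X i ^ n : 𝒫).IsHomogeneous n := fun i n => isHomogeneous_X_pow i n
  exact ((((h 2 4).sub (((h 2 2).mul ((h 0 2).add (h 1 2))).C_mul _)).add (h 0 4)).add (((h 0 2).mul (h 1 2)).C_mul _)).add (h 1 4)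
theorem bs_HE : HE bs := by
  refine ⟨by simp, fun u hu => ?_⟩
  have h0 : 0 < u.1 ^ 2 + u.2 ^ 2 := by
    by_contra h
    exact hu (Prod.ext (by simp; nlinarith) (by simp; nlinarith))
  obtain ⟨r, hr, h⟩ := biq (B := 4 * (u.1 ^ 2 + u.2 ^ 2)) (D := u.1 ^ 4 + u.1 ^ 2 * u.2 ^ 2 / 2 + u.2 ^ 4) (by linarith) (by nlinarith) (by nlinarith)
  refine ⟨r, hr, fun i => ?_⟩
  have := h i
  simp [q4] at this ⊢
  linear_combination this
theorem bs_smooth : IsSmoothQuartic bs := by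
  refine ⟨bs_hom, fun z hz _ => ?_⟩
  by_contra! h
  have a := h 0
  have b := h 1
  have c := h 2
  simp at a b c
  have a : z 0 * (-8 * z 2 ^ 2 + 4 * z 0 ^ 2 + z 1 ^ 2) = 0 := by linear_combination a
  have b : z 1 * (-8 * z 2 ^ 2 + 4 * z 1 ^ 2 + z 0 ^ 2) = 0 := by linear_combination b
  have c : z 2 * (z 2 ^ 2 - 2 * (z 0 ^ 2 + z 1 ^ 2)) = 0 := by linear_combination c / 4
  apply hz
  suffices k : z 0 ^ 2 = 0 ∧ z 1 ^ 2 = 0 ∧ z 2 ^ 2 = 0 by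
    ext i; fin_cases i <;> simp_all
  all_goals refine ⟨?_, ?_, ?_⟩ <;> grind
def g8 (p : Bool × Bool × Bool) : Fin 5 → ℝ :=
  let s : Bool → ℝ := fun b => if b then 1 else -1
  if p.1 then ![s p.2.1 / 2, 0, s p.2.2, 0, - s p.2.2 / 4] else ![0, s p.2.1 / 2, - s p.2.2 / 4, 0, s p.2.2]
theorem g8_inj : Function.Injective g8 := by
  classical
  rintro ⟨a, b, c⟩
  cases a <;> cases b <;> cases c <;> simp [g8] <;> norm_num
theorem bs_alg {a b p q r : ℝ} (h4 : a ^ 4 - 4 * a ^ 2 + 1 = r ^ 2) (h3 : 4 * a ^ 3 * b - 8 * a * b = 2 * q * r)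
    (h2 : 6 * a ^ 2 * b ^ 2 - 4 * a ^ 2 - 4 * b ^ 2 + 1 / 2 = q ^ 2 + 2 * p * r) (h1 : 4 * a * b ^ 3 - 8 * a * b = 2 * p * q) (h0 : b ^ 4 - 4 * b ^ 2 + 1 = p ^ 2) : a = 0 ∨ b = 0 := by
  by_contra! h
  obtain ⟨ha, hb⟩ := h
  have ha' : 0 < a ^ 2 := by positivity
  have hb' : 0 < b ^ 2 := by positivity
  by_cases hq : q = 0
  · grind
  have e1 : a ^ 2 * b ^ 2 * (4 * r ^ 2 + 12) = q ^ 2 * r ^ 2 := by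
    rw [← h4]; linear_combination (2 * a ^ 3 * b - 4 * a * b + q * r) / 2 * h3 - q ^ 2 * h4
  have e2 : a ^ 2 * b ^ 2 * (4 * p ^ 2 + 12) = q ^ 2 * p ^ 2 := by
    linear_combination (2 * a * b ^ 3 - 4 * a * b + p * q) / 2 * h1 - 4 * a ^ 2 * b ^ 2 * h0
  have e3 : p ^ 2 = r ^ 2 := by
    grind
  have hr : 0 < r ^ 2 := by
    by_contra h
    simp_all
  rcases sq_eq_sq_iff_eq_or_eq_neg.1 e3 with e | e
  · subst e
    nlinarith []
  · subst e
    have k : a ^ 2 + b ^ 2 = 4 := mul_left_cancel₀ (mul_ne_zero ha hb) (by linear_combination (h3 + h1) / 4)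
    nlinarith []
theorem bs_alg0 {a p q r : ℝ} (h4 : a ^ 4 - 4 * a ^ 2 + 1 = r ^ 2) (h2 : - 4 * a ^ 2 + 1 / 2 = q ^ 2 + 2 * p * r) (h1 : 0 = 2 * p * q) (h0 : 1 = p ^ 2) :
    (a = 1 / 2 ∨ a = - 1 / 2) ∧ q = 0 ∧ (p = 1 ∧ r = - 1 / 4 ∨ p = -1 ∧ r = 1 / 4) := by
  have hp : p ≠ 0 := by rintro rfl; norm_num at h0
  have hq : q = 0 := mul_left_cancel₀ hp (by linear_combination -h1 / 2)
  subst hq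
  have h : (a ^ 2 + 5 / 4) * ((a - 1 / 2) * (a + 1 / 2)) = 0 := by
    grind
  have ha : a ^ 2 = 1 / 4 := by
    nlinarith
  grind
theorem bs_card : Nat.card (Sq bs) = 8 := by
  have : Sq bs = Set.range g8 := by
    ext x
    constructor
    · intro h
      have k := fun t => h t
      simp at k
      have k0 := k 0
      have k1 := k 1
      have k2 := k (-1)
      have k3 := k 2
      have k4 := k (-2)
      have h0 : x 1 ^ 4 - 4 * x 1 ^ 2 + 1 = x 2 ^ 2 := by linear_combination k0
      have h1 : 4 * x 0 * x 1 ^ 3 - 8 * x 0 * x 1 = 2 * x 2 * x 3 := by grind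
      have h2 : 6 * x 0 ^ 2 * x 1 ^ 2 - 4 * x 0 ^ 2 - 4 * x 1 ^ 2 + 1 / 2 = x 3 ^ 2 + 2 * x 2 * x 4 := by grind
      have h3 : 4 * x 0 ^ 3 * x 1 - 8 * x 0 * x 1 = 2 * x 3 * x 4 := by grind
      have h4 : x 0 ^ 4 - 4 * x 0 ^ 2 + 1 = x 4 ^ 2 := by grind
      rcases bs_alg h4 h3 h2 h1 h0 with h | h
      · rw [h] at h1 h2 h3 h4
        obtain ⟨ha, hq, hp⟩ := bs_alg0 h0 (p := x 4) (q := x 3) (by linear_combination h2) (by linear_combination h3) (by linear_combination h4)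
        rcases ha with ha | ha <;> rcases hp with ⟨hp, hr⟩ | ⟨hp, hr⟩
        · exact ⟨(false, true, true), by ext i; fin_cases i <;> simp [g8, *]⟩
        · exact ⟨(false, true, false), by ext i; fin_cases i <;> simp [g8, *]⟩
        · exact ⟨(false, false, true), by ext i; fin_cases i <;> simp [g8, *]⟩
        · exact ⟨(false, false, false), by ext i; fin_cases i <;> simp [g8, *]⟩
      · rw [h] at h1 h2 h3 h0
        obtain ⟨ha, hq, hp⟩ := bs_alg0 h4 (p := x 2) (q := x 3) (by linear_combination h2) (by linear_combination h1) (by linear_combination h0)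
        rcases ha with ha | ha <;> rcases hp with ⟨hp, hr⟩ | ⟨hp, hr⟩
        · exact ⟨(true, true, true), by ext i; fin_cases i <;> simp [g8, *]⟩
        · exact ⟨(true, true, false), by ext i; fin_cases i <;> simp [g8, *]⟩
        · exact ⟨(true, false, true), by ext i; fin_cases i <;> simp [g8, *]⟩
        · exact ⟨(true, false, false), by ext i; fin_cases i <;> simp [g8, *]⟩
    · rintro ⟨⟨a, b, c⟩, rfl⟩ t
      cases a <;> cases b <;> cases c <;> simp [g8] <;> ring
  rw [this, Nat.card_range_of_injective g8_inj]
  simp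
theorem HE_card (hf : IsSmoothQuartic f) (h : HE f) : Nat.card (Sq f) = 8 := (count_eq hf h bs_smooth bs_HE).trans bs_card
theorem HE_P1 (hf : IsSmoothQuartic f) (h : HE f) : P1 f := Sq_P1 hf.1 h (HE_card hf h)
theorem z2_const {z} (Z : ZZ f z) {χ} (hχ : InvOn (CT f) χ) {u u' : ℝ × ℝ} (hu : u ≠ 0) (hu' : u' ≠ 0) : χ (rl (U3 u (z u 2))) = χ (rl (U3 u' (z u' 2))) := by
  have hp : IsPreconnected ({0}ᶜ : Set (ℝ × ℝ)) := (isConnected_compl_singleton_of_one_lt_rank (by norm_num) 0).isPreconnected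
  have hc : ContinuousOn (fun u => χ (rl (U3 u (z u 2)))) {0}ᶜ := by
    refine hχ.1.comp (continuousOn_pi.2 fun i => ?_) fun u hu => ⟨fun h => hu ?_, ?_⟩
    · have := Complex.continuous_ofReal.comp_continuousOn (Z.c 2)
      fin_cases i
      · simp [rl]; fun_prop
      · simp [rl]; fun_prop
      · simpa [rl, Function.comp_def] using this
    · have h0 := congrFun h 0
      have h1 := congrFun h 1
      simp [rl] at h0 h1
      exact Prod.ext h0 h1
    · rw [ev_rl, Z.p u hu, Finset.prod_eq_zero (Finset.mem_univ 2) (sub_self _), Complex.ofReal_zero]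
  exact hp.constant hc hu hu'
theorem HE_NMB (hf : IsSmoothQuartic f) (h : HE f) : NMB f := by
  obtain ⟨z, Z⟩ := HE_z hf.1 h
  obtain ⟨x, hx⟩ := Nat.card_pos_iff.1 (by rw [HE_card hf h]; norm_num) |>.1
  obtain ⟨a, b, hq⟩ : ∃ a b : ℝ, x 2 * b ^ 2 + x 3 * a * b + x 4 * a ^ 2 ≠ 0 := by
    by_contra! k
    have h1 := k 0 1
    have h2 := k 1 0
    have h3 := k 1 1
    exact Sq_ne hf.1 h hx ⟨by linarith, by linarith, by linarith⟩
  let L : ℝ → ℝ → ℛ := fun s t => ![s, t, x 0 * s + x 1 * t]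
  have e : ∀ s : ℂ, rl (L (-b) a) + s • rl (L a b) = ![-b + s * a, a + s * b, x 0 * (-b + s * a) + x 1 * (a + s * b)] := fun s => by
    ext i; fin_cases i <;> simp [rl, L]; ring
  have n2 : ∀ s t : ℝ, rl (L s t) = ![(s:ℂ), t, x 0 * s + x 1 * t] := fun s t => by ext i; fin_cases i <;> simp [rl, L]
  have hab : a ^ 2 + b ^ 2 ≠ 0 := fun k => hq (by
    have h1 : a = 0 := by nlinarith
    grind)
  have hne : ∀ s : ℂ, rl (L (-b) a) + s • rl (L a b) ≠ 0 := fun s k => by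
    rw [e] at k
    have h0 := congrFun k 0
    have h1 := congrFun k 1
    simp at h0 h1
    have : ((a ^ 2 + b ^ 2 : ℝ) : ℂ) = 0 := by push_cast; grind
    exact hab (by exact_mod_cast this)
  set A := x 2 * b ^ 2 + x 3 * a * b + x 4 * a ^ 2 with hA
  set B := 2 * x 2 * a * b + x 3 * (a ^ 2 - b ^ 2) - 2 * x 4 * a * b with hB
  set G := x 2 * a ^ 2 - x 3 * a * b + x 4 * b ^ 2 with hG
  have eA : ev f (rl (L a b)) = (A) ^ 2 := by
    rw [n2, Sq_ev hf.1 hx, hA]; push_cast; ring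
  have hA0 : (A : ℂ) ≠ 0 := by exact_mod_cast hq
  have main : ∀ ξ η : ℂ, (A) * (ξ + η) = -B → A * (ξ * η) = G → (∀ χ, InvOn (CT f) χ → (∀ z ∈ CT f, χ (star z) = χ z) → ev f (rl (L (-b) a) + ξ • rl (L a b)) = 0 → ev f (rl (L (-b) a) + η • rl (L a b)) = 0 →
      χ (rl (L (-b) a) + ξ • rl (L a b)) = χ (rl (L (-b) a) + η • rl (L a b))) → NMB f := by
    intro ξ η h1 h2 h3
    have hr : IsRV f (rl (L (-b) a)) (rl (L a b)) ![ξ, ξ, η, η] := fun s => by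
      rw [e, Sq_ev hf.1 hx, eA]
      simp  [Fin.prod_univ_four]
      have : (x 2 * (a + s * b) ^ 2 + x 3 * (-b + s * a) * (a + s * b) + x 4 * (-b + s * a) ^ 2) = A * ((s - ξ) * (s - η)) := by
        have : (A) * ((s - ξ) * (s - η)) = A * s ^ 2 + B * s + G := by grind
        rw [this, hA, hB, hG]; push_cast; ring
      rw [this]; ring
    refine ⟨_, _, _, hr, by grind, hne, fun χ hχ hs => ?_⟩
    have h3 := h3 χ hχ hs (rv_zero hr 0) (rv_zero hr 2)
    intro i j
    fin_cases i <;> fin_cases j <;> first | rfl | exact h3 | exact h3.symm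
  by_cases hD : 0 ≤ B ^ 2 - 4 * A * G
  · set d := √(B ^ 2 - 4 * A * G)
    have hd : d ^ 2 = B ^ 2 - 4 * A * G := Real.sq_sqrt hD
    have hdc : (d : ℂ) ^ 2 = B ^ 2 - 4 * A * G := by exact_mod_cast hd
    refine main (((-B + d) / (2 * A) : ℝ)) (((-B - d) / (2 * A) : ℝ)) (by push_cast; field_simp; ring) (by push_cast; field_simp; linear_combination -hdc) fun χ hχ hs k1 k2 => ?_
    have key : ∀ r : ℝ, ev f (rl (L (-b) a) + (r : ℂ) • rl (L a b)) = 0 → ∃ u, u ≠ 0 ∧ χ (rl (L (-b) a) + (r : ℂ) • rl (L a b)) = χ (rl (U3 u (z u 2))) := by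
      intro r hr
      set u : ℝ × ℝ := (-b + r * a, a + r * b)
      have eu : rl (L (-b) a) + (r : ℂ) • rl (L a b) = rl (U3 u (Ln (x 0) (x 1) u)) := by
        rw [e]; ext i; fin_cases i <;> simp [rl, u]
      have hu : u ≠ 0 := fun k => hne r (by rw [eu, k]; ext i; fin_cases i <;> simp [rl])
      have hb := Ln_bd Z   (fun u _ => by
        have := Sq_hom hf.1 hx u.1 u.2
        nlinarith) u hu
      rw [eu] at hr ⊢
      rw [ev_rl, Z.p u hu, Complex.ofReal_eq_zero, Finset.prod_eq_zero_iff] at hr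
      obtain ⟨i, -, hi⟩ := hr
      have m := Z.m u hu
      have m0 := m (show (0) < 1 by decide)
      have m1 := m (show (2) < 3 by decide)
      fin_cases i
      · simp at hi; linarith
      · refine ⟨-u, neg_ne_zero.2 hu, ?_⟩
        rw [Z.n u hu 2, show Fin.rev (2) = 1 by decide, ← hχ.2 (-1) (by norm_num)]
        congr 1; ext i; simp  [Fin.mk_one, sub_eq_zero] at hi; fin_cases i <;> simp [rl, hi]
      · refine ⟨u, hu, ?_⟩
        simp  [Fin.reduceFinMk, sub_eq_zero] at hi; rw [hi]
      · simp at hi; linarith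
    obtain ⟨u, hu, e1⟩ := key _ k1
    obtain ⟨u', hu', e2⟩ := key _ k2
    rw [e1, e2, z2_const Z hχ hu hu']
  · set d := √(4 * A * G - B ^ 2)
    have hd : d ^ 2 = 4 * A * G - B ^ 2 := Real.sq_sqrt (by linarith)
    have hdc : (d : ℂ) ^ 2 = 4 * A * G - B ^ 2 := by exact_mod_cast hd
    have I2 := Complex.I_sq
    refine main ((-B + d * Complex.I) / (2 * A)) (star ((-B + d * Complex.I) / (2 * A))) ?_ ?_ fun χ hχ hs k1 k2 => ?_
    · simp; field_simp; ring
    · simp; field_simp; grind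
    · rw [← hs _ ⟨hne _, k1⟩, star_add, star_smul, star_rl, star_rl]
theorem HE_nn (hf : f.IsHomogeneous 4) (h : HE f) {z} (hz : z ∈ XX f) : nn z 2 ≠ 0 := fun k => by
  obtain ⟨t, -, u, -, r, e, -⟩ := HE_cpx hf h (nn_ne0 hz.2) hz.1 (by simp [nn] at k; simp; linarith)
  exact hz.2 (by rw [e, nn_smul, nn_rl, smul_zero])
theorem HE_P2 (hf : IsSmoothQuartic f) (h : HE f) : TwoC (XX f) := by
  have hn := HE_NMB hf h
  set χ : 𝒞 → Bool := fun z => decide (0 < nn z 2) with hχd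
  have hχ : InvOn (XX f) χ := by
    refine ⟨dec_cont ((continuous_apply 2).comp nn_cont).continuousOn fun z hz => HE_nn hf.1 h hz, fun t ht z => ?_⟩
    have := Complex.normSq_pos.2 ht
    simp  [hχd, nn_smul, mul_pos_iff_of_pos_left this]
  have hs : ∀ z ∈ XX f, χ (star z) = !χ z := fun z hz => by
    have := HE_nn hf.1 h hz
    rcases lt_or_gt_of_ne this with k | k
    · simp [hχd, nn_star, k, k.not_gt]
    · simp [hχd, nn_star, k, k.le]
  refine ⟨χ, hχ, ?_, fun φ hφ a ha b hb hab => ?_⟩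
  · obtain ⟨w, hw⟩ := exists_rv hf.1 ![Complex.I, 1, 0]  (by rw [ev_rl, h.1]; simp)
    have h0 := rv_zero hw 0
    have hz : (![Complex.I, 1, 0] + w 0 • rl e3) ∈ XX f := ⟨h0, fun k => by
      have := congrFun k 2
      simp [nn, rl] at this⟩
    intro b
    by_cases k : χ (![Complex.I, 1, 0] + w 0 • rl e3) = b
    · exact ⟨_, hz, k⟩
    · exact ⟨_, XX_star hz, by grind⟩
  · have hφs : InvOn (XX f) (fun z => φ (star z)) := by
      refine ⟨hφ.1.comp continuous_star.continuousOn fun z hz => XX_star hz, fun t ht z => ?_⟩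
      beta_reduce; rw [star_smul, hφ.2 _ (star_ne_zero.2 ht)]
    have := cinv_const hf hn (χ := fun z => if χ z = χ a then φ z else φ (star z)) ⟨?_, fun t ht z => ?_⟩ (fun z hz => ?_) a ha b hb
    · simpa [hab] using this
    · exact (continuous_of_discreteTopology (f := fun p : Bool × Bool × Bool => if p.1 = χ a then p.2.1 else p.2.2)).comp_continuousOn (hχ.1.prodMk (hφ.1.prodMk hφs.1))
    · have := hφs.2 t ht z; beta_reduce at this ⊢
      rw [this, hφ.2 _ ht, hχ.2 _ ht]
    · rw [star_star, hs z hz]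
      grind
theorem NN_all (hf : IsSmoothQuartic f) (h2 : TwoC (KK f)) (h : NN f) : ¬ P1 f ∧ ¬ TwoC (XX f) ∧ ¬ P3 f := by
  obtain ⟨M, N, e, k⟩ := NN_norm hf.1 h
  have hc := one_ne_zero (α := ℝ)
  have hg := cg_smooth e hc hf
  have hk := cg_KK e hc h2
  rw [← cg_P1 e hc, ← cg_P2 e hc, ← cg_P3 e hc hf]
  exact ⟨NN0_P1 hg k, NN0_P2 hg k hk, NN0_P3 hg ((twoR hg.1).2 hk) k⟩
theorem all_eq (hf : IsSmoothQuartic f) (h2 : TwoC (KK f)) : P1 f ∧ TwoC (XX f) ∧ P3 f ∨ ¬ P1 f ∧ ¬ TwoC (XX f) ∧ ¬ P3 f := by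
  rcases T1 hf h2 with ⟨p, h⟩ | h | h
  · obtain ⟨M, N, c, hc, e, k⟩ := HY_norm h hf.1
    have hg := cg_smooth e hc hf
    left
    rw [← cg_P1 e hc, ← cg_P2 e hc, ← cg_P3 e hc hf]
    exact ⟨HE_P1 hg k, HE_P2 hg k, HE_P3 hg.1 k⟩
  · exact .inr (NN_all hf h2 h)
  · have e : (1 : Matrix (Fin 3) (Fin 3) ℝ) * 1 = 1 := mul_one 1
    have hc : (-1 : ℝ) ≠ 0 := by norm_num
    right
    rw [← cg_P1 e hc, ← cg_P2 e hc, ← cg_P3 e hc hf]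
    exact NN_all (cg_smooth e hc hf) (cg_KK e hc h2) h
end
end

/-- **Proposition (Proposition 2.9 / `prop:dividing`).**  Let `C = V(f)` be a smooth plane
quartic over `ℝ` whose real point set `C(ℝ) ⊆ ℝP²` consists of exactly 2 connected
components (ovals).  Then the following are equivalent:
(1) `C` has exactly 4 real bitangent lines;
(2) `C` is dividing, i.e. `C(ℝ)` disconnects `C(ℂ)` into two connected components;
(3) the two ovals are nested, i.e. one oval is contained in the disk bounded by the
other. -/
theorem quartic_two_ovals_tfae (f : MvPolynomial (Fin 3) ℝ)
    (hf : IsSmoothQuartic f)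
    (h2 : Nat.card (ConnectedComponents ↥(realLocus f)) = 2) :
    ((Nat.card {W : Submodule ℝ (Fin 3 → ℝ) // IsRealBitangent f W} = 4) ↔
      (Nat.card (ConnectedComponents ↥(complexLocus f \ realPointsInCP2 f)) = 2)) ∧
    ((Nat.card (ConnectedComponents ↥(complexLocus f \ realPointsInCP2 f)) = 2) ↔
      (∃ x₁ ∈ realLocus f, ∃ x₂ ∈ realLocus f,
        ovalThrough f x₁ ≠ ovalThrough f x₂ ∧
        NestedOvals (ovalThrough f x₁) (ovalThrough f x₂))) := by
  have h := all_eq hf ((twoR hf.1).1 h2)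
  have e := twoX hf.1
  rw [e]
  rcases h with ⟨a, b, c⟩ | ⟨a, b, c⟩
  · exact ⟨iff_of_true a b, iff_of_true b c⟩
  · exact ⟨iff_of_false a b, iff_of_false b c⟩
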